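/- (Ten Martini Problem) For every λ > 0, every irrational α ∈ ℝ, and every ω ∈ ℝ, the spectrum of the almost Mathieu operator H^{λ,α}_ω is a Cantor set: it is closed, has no isolated points, and has empty interior in ℝ. -/

import Mathlib

namespace TenMartini

noncomputable section

open Set hiding range
open Filter Topology
open MeasureTheory hiding integral_const_mul integral_add integral_sub integral_div
open scoped Real ComplexConjugate
open Complex (I normSq norm_real ofReal_im sub_im add_im conj_ofReal normSq_eq_norm_sq
  continuous_im conj_conj ofReal_re abs_im_le_norm normSq_apply continuous_ofReal norm_I I_im I_re
  norm_conj mul_im mul_re continuous_re ofReal_sub div_ofReal_im continuous_conj conj_im add_re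
  cos sub_re normSq_pos norm_le_of_forall_mem_frontier_norm_le
  norm_deriv_le_of_forall_mem_sphere_norm_le)
open Real (exp log exp_pos exp_add exp_le_exp exp_nat_mul exp_log pi_pos norm_eq_abs
  norm_of_nonneg two_pi_pos log_pos)
open Metric (ball closedBall sphere mem_ball isOpen_ball sphere_subset_closedBall
  ball_subset_closedBall mem_sphere isBounded_ball)
open Finset (range prod_congr prod_range_succ mul_sum)
open Function (uncurry comp_apply)
open Matrix (mulVec)
open intervalIntegral (integral_const_mul integral_add integral_sub integral_div integral_congr
  integral_mono_on integral_add_adjacent_intervals norm_integral_le_of_norm_le_const)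

attribute [local instance] Matrix.linftyOpNormedRing

variable {lam α : ℝ} {E : ℂ}

/-! ### Transfer matrices and their growth -/

/-- The potential `2 λ cos (2 π x)`, for complex phases `x`. -/
def pot (lam : ℝ) (x : ℂ) : ℂ := 2 * lam * cos (2 * π * x)

/-- The one-step transfer matrix. -/
def tm (lam : ℝ) (E x : ℂ) : Matrix (Fin 2) (Fin 2) ℂ := !![E - pot lam x, -1; 1, 0]

/-- The `n`-step transfer matrix. -/
def An (lam α : ℝ) (E : ℂ) : ℕ → ℂ → Matrix (Fin 2) (Fin 2) ℂ
  | 0, _ => 1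
  | n + 1, x => tm lam E (x + n * α) * An lam α E n x

theorem norm_two (M : Matrix (Fin 2) (Fin 2) ℂ) :
    ‖M‖ = max (‖M 0 0‖ + ‖M 0 1‖) (‖M 1 0‖ + ‖M 1 1‖) := by
  rw [Matrix.linfty_opNorm_def, show (Finset.univ : Finset (Fin 2)) = {0, 1} from rfl]
  simp [Finset.sup_insert]

theorem norm_entry_le (M : Matrix (Fin 2) (Fin 2) ℂ) (i j : Fin 2) : ‖M i j‖ ≤ ‖M‖ := by
  rw [norm_two]
  fin_cases i <;> fin_cases j <;> simp

theorem norm_le_of_entry_le {M : Matrix (Fin 2) (Fin 2) ℂ} {c : ℝ} (h : ∀ i j, ‖M i j‖ ≤ c) :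
    ‖M‖ ≤ 2 * c := by
  rw [norm_two]
  apply max_le <;> linarith [h 0 0, h 0 1, h 1 0, h 1 1]

theorem norm_det_le (M : Matrix (Fin 2) (Fin 2) ℂ) : ‖M.det‖ ≤ ‖M‖ ^ 2 := by
  rw [Matrix.det_fin_two, norm_two]
  refine (norm_sub_le _ _).trans ?_
  rw [norm_mul, norm_mul]
  set a := ‖M 0 0‖ + ‖M 0 1‖
  set b := ‖M 1 0‖ + ‖M 1 1‖
  have h0 : 0 ≤ a := by positivity
  have h1 : 0 ≤ b := by positivity
  have h2 : ‖M 0 0‖ * ‖M 1 1‖ + ‖M 0 1‖ * ‖M 1 0‖ ≤ a * b := by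
    have := mul_nonneg (norm_nonneg (M 0 0)) (norm_nonneg (M 1 0))
    have := mul_nonneg (norm_nonneg (M 0 1)) (norm_nonneg (M 1 1))
    simp only [a, b]; nlinarith
  nlinarith [le_max_left a b, le_max_right a b, mul_le_mul (le_max_left a b) (le_max_right a b) h1
    (h0.trans (le_max_left a b))]

theorem det_tm (x : ℂ) : (tm lam E x).det = 1 := by simp [tm, Matrix.det_fin_two]

theorem pot_periodic (x : ℂ) : pot lam (x + 1) = pot lam x := by
  simp only [pot]
  rw [mul_add, mul_one, Complex.cos_add_two_pi]

theorem pot_neg (x : ℂ) : pot lam (-x) = pot lam x := by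
  simp [pot, Complex.cos_neg]

theorem norm_pot_le {x : ℂ} {ε : ℝ} (hx : |x.im| ≤ ε) :
    ‖pot lam x‖ ≤ 2 * |lam| * exp (2 * π * ε) := by
  have h1 : ‖cos (2 * π * x)‖ ≤ exp (2 * π * ε) := by
    rw [cos, norm_div, div_le_iff₀ (by simp)]
    refine (norm_add_le _ _).trans ?_
    rw [Complex.norm_exp, Complex.norm_exp]
    have e1 : (2 * (π : ℂ) * x * I).re ≤ 2 * π * ε := by
      have : (2 * (π : ℂ) * x * I).re = 2 * π * (-x.im) := by simp
      rw [this]; gcongr; exact (neg_le_abs _).trans hx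
    have e2 : (-(2 * (π : ℂ) * x) * I).re ≤ 2 * π * ε := by
      have : (-(2 * (π : ℂ) * x) * I).re = 2 * π * x.im := by simp
      rw [this]; gcongr; exact (le_abs_self _).trans hx
    have h1 := exp_le_exp.2 e1
    have h2 := exp_le_exp.2 e2
    rw [RCLike.norm_ofNat]; linarith
  calc ‖pot lam x‖ = 2 * |lam| * ‖cos (2 * π * x)‖ := by simp [pot]
    _ ≤ _ := by gcongr

theorem An_zero (x : ℂ) : An lam α E 0 x = 1 := rfl

theorem An_succ (n : ℕ) (x : ℂ) :
    An lam α E (n + 1) x = tm lam E (x + n * α) * An lam α E n x := rfl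

theorem An_add (m n : ℕ) (x : ℂ) :
    An lam α E (m + n) x = An lam α E m (x + n * α) * An lam α E n x := by
  induction m with
  | zero => simp [An_zero]
  | succ k ih =>
    rw [add_right_comm, An_succ, ih, An_succ, mul_assoc]
    congr 2; push_cast; ring

theorem An_one (x : ℂ) : An lam α E 1 x = tm lam E x := by
  rw [An_succ, An_zero]; simp

theorem An_succ' (n : ℕ) (x : ℂ) :
    An lam α E (n + 1) x = An lam α E n (x + α) * tm lam E x := by
  rw [An_add, An_one]; simp

theorem det_An (n : ℕ) (x : ℂ) : (An lam α E n x).det = 1 := by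
  induction n with
  | zero => simp [An_zero]
  | succ k ih => rw [An_succ, Matrix.det_mul, det_tm, ih, one_mul]

theorem one_le_norm_An (n : ℕ) (x : ℂ) : 1 ≤ ‖An lam α E n x‖ := by
  have := norm_det_le (An lam α E n x)
  rw [det_An, norm_one] at this
  nlinarith [norm_nonneg (An lam α E n x)]

/-- An a priori bound for the one-step transfer matrix on a strip. -/
def Kb (lam ε R : ℝ) : ℝ := R + 2 * |lam| * exp (2 * π * ε) + 1

theorem one_le_Kb {ε R : ℝ} (hR : 0 ≤ R) : 1 ≤ Kb lam ε R := by
  unfold Kb; have := mul_nonneg (mul_nonneg zero_le_two (abs_nonneg lam))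
    (exp_pos (2 * π * ε)).le; linarith

theorem norm_tm_le {x : ℂ} {ε R : ℝ} (hx : |x.im| ≤ ε) (hE : ‖E‖ ≤ R) :
    ‖tm lam E x‖ ≤ Kb lam ε R := by
  rw [norm_two]
  have h1 := norm_sub_le E (pot lam x)
  have h2 := norm_pot_le (lam := lam) hx
  have h3 := one_le_Kb (lam := lam) (ε := ε) ((norm_nonneg E).trans hE)
  apply max_le
  · simp only [tm, Kb]; simp; linarith
  · simpa [tm] using h3

theorem strip_shift {x : ℂ} {ε : ℝ} (hx : |x.im| ≤ ε) (n : ℕ) : |(x + n * α).im| ≤ ε := by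
  simpa using hx

theorem norm_An_le {x : ℂ} {ε R : ℝ} (hx : |x.im| ≤ ε) (hE : ‖E‖ ≤ R) (n : ℕ) :
    ‖An lam α E n x‖ ≤ Kb lam ε R ^ n := by
  induction n with
  | zero => simp [An_zero]
  | succ k ih =>
    rw [An_succ, pow_succ']
    have h3 := one_le_Kb (lam := lam) (ε := ε) ((norm_nonneg E).trans hE)
    exact (norm_mul_le _ _).trans (mul_le_mul (norm_tm_le (strip_shift hx k) hE) ih
      (norm_nonneg _) (by linarith))

theorem norm_An_sub_le {x E' : ℂ} {ε R : ℝ} (hx : |x.im| ≤ ε) (hE : ‖E‖ ≤ R) (hE' : ‖E'‖ ≤ R)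
    (n : ℕ) : ‖An lam α E n x - An lam α E' n x‖ ≤ n * Kb lam ε R ^ n * ‖E - E'‖ := by
  have hK := one_le_Kb (lam := lam) (ε := ε) ((norm_nonneg E).trans hE)
  induction n with
  | zero => simp [An_zero]
  | succ k ih =>
    have h1 : An lam α E (k + 1) x - An lam α E' (k + 1) x
        = tm lam E (x + k * α) * (An lam α E k x - An lam α E' k x)
          + (tm lam E (x + k * α) - tm lam E' (x + k * α)) * An lam α E' k x := by
      rw [An_succ, An_succ]; noncomm_ring
    have h2 : ‖tm lam E (x + k * α) - tm lam E' (x + k * α)‖ = ‖E - E'‖ := by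
      rw [norm_two]; simp [tm]
    rw [h1]
    refine (norm_add_le _ _).trans ?_
    have h3 : ‖tm lam E (x + k * α) * (An lam α E k x - An lam α E' k x)‖
        ≤ Kb lam ε R * (k * Kb lam ε R ^ k * ‖E - E'‖) :=
      (norm_mul_le _ _).trans (mul_le_mul (norm_tm_le (strip_shift hx k) hE) ih
        (norm_nonneg _) (by linarith))
    have h4 : ‖(tm lam E (x + k * α) - tm lam E' (x + k * α)) * An lam α E' k x‖
        ≤ ‖E - E'‖ * Kb lam ε R ^ k := by
      refine (norm_mul_le _ _).trans ?_
      rw [h2]; gcongr; exact norm_An_le hx hE' k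
    have h5 : Kb lam ε R ^ k ≤ Kb lam ε R ^ (k + 1) := pow_le_pow_right₀ hK (by omega)
    calc _ ≤ Kb lam ε R * (k * Kb lam ε R ^ k * ‖E - E'‖) + ‖E - E'‖ * Kb lam ε R ^ (k + 1) := by
          refine (add_le_add h3 h4).trans ?_; gcongr
      _ = _ := by push_cast; ring

theorem tm_periodic (x : ℂ) : tm lam E (x + 1) = tm lam E x := by
  simp [tm, pot_periodic]

theorem An_periodic (n : ℕ) (x : ℂ) : An lam α E n (x + 1) = An lam α E n x := by
  induction n with
  | zero => rfl
  | succ k ih => rw [An_succ, An_succ, ih, add_right_comm, tm_periodic]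

/-- Supremum over a strip of the norm of the `n`-step transfer matrix. -/
def sN (lam α : ℝ) (E : ℂ) (ε : ℝ) (n : ℕ) : ℝ := ⨆ x : {x : ℂ // |x.im| ≤ ε}, ‖An lam α E n x‖

theorem norm_An_le_sN {x : ℂ} {ε : ℝ} (hx : |x.im| ≤ ε) (n : ℕ) :
    ‖An lam α E n x‖ ≤ sN lam α E ε n :=
  le_ciSup (f := fun x : {x : ℂ // |x.im| ≤ ε} => ‖An lam α E n x‖)
    ⟨Kb lam ε ‖E‖ ^ n, by rintro _ ⟨y, rfl⟩; exact norm_An_le y.2 le_rfl n⟩ ⟨x, hx⟩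

theorem sN_le {ε c : ℝ} (hε : 0 ≤ ε) {n : ℕ} (h : ∀ x : ℂ, |x.im| ≤ ε → ‖An lam α E n x‖ ≤ c) :
    sN lam α E ε n ≤ c := by
  have : Nonempty {x : ℂ // |x.im| ≤ ε} := ⟨⟨0, by simpa using hε⟩⟩
  exact ciSup_le fun x => h x x.2

theorem one_le_sN {ε : ℝ} (hε : 0 ≤ ε) (n : ℕ) : 1 ≤ sN lam α E ε n :=
  (one_le_norm_An n 0).trans (norm_An_le_sN (by simpa using hε) n)

/-- The Lyapunov exponent, with a supremum over the strip of width `ε`. -/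
def Lyap (lam α : ℝ) (E : ℂ) (ε : ℝ) : ℝ :=
  sInf ((fun n : ℕ => log (sN lam α E ε n) / n) '' Ici 1)

theorem Lyap_nonneg {ε : ℝ} (hε : 0 ≤ ε) : 0 ≤ Lyap lam α E ε := by
  refine Real.sInf_nonneg ?_
  rintro _ ⟨n, -, rfl⟩
  exact div_nonneg (Real.log_nonneg (one_le_sN hε n)) (Nat.cast_nonneg n)

theorem exp_Lyap_le_sN (lam α : ℝ) {ε : ℝ} (hε : 0 ≤ ε) (n : ℕ) :
    exp (n * Lyap lam α E ε) ≤ sN lam α E ε n := by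
  rcases Nat.eq_zero_or_pos n with rfl | hn
  · simpa using one_le_sN hε 0
  have h1 : Lyap lam α E ε ≤ log (sN lam α E ε n) / n := by
    refine csInf_le ⟨0, ?_⟩ ⟨n, hn, rfl⟩
    rintro _ ⟨n, -, rfl⟩
    exact div_nonneg (Real.log_nonneg (one_le_sN hε n)) (Nat.cast_nonneg n)
  have hn' : (0 : ℝ) < n := by exact_mod_cast hn
  rw [le_div_iff₀ hn'] at h1
  rw [← Real.le_log_iff_exp_le (by linarith [one_le_sN (lam := lam) (α := α) (E := E) hε n])]
  linarith

/-- Uniform exponential upper bounds for energies close to a given one. -/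
theorem exists_growth {ε c : ℝ} (hε : 0 ≤ ε) (h : Lyap lam α E ε < c) :
    ∃ δ > 0, ∃ C > 0, ∀ E' : ℂ, ‖E' - E‖ < δ → ∀ (n : ℕ) (x : ℂ), |x.im| ≤ ε →
      ‖An lam α E' n x‖ ≤ C * exp (c * n) := by
  have hc : 0 < c := (Lyap_nonneg hε).trans_lt h
  obtain ⟨_, ⟨N, hN, rfl⟩, hlt⟩ := exists_lt_of_csInf_lt (Set.Nonempty.image _ ⟨1, le_rfl⟩) h
  have hN1 : 1 ≤ N := hN
  have hN0 : (0 : ℝ) < N := by exact_mod_cast hN1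
  simp only at hlt
  have hs1 := one_le_sN (lam := lam) (α := α) (E := E) hε N
  rw [div_lt_iff₀ hN0, Real.log_lt_iff_lt_exp (by linarith)] at hlt
  set K := Kb lam ε (‖E‖ + 1) with hKdef
  have hK1 : 1 ≤ K := one_le_Kb (by positivity)
  set g := exp (c * N) - sN lam α E ε N with hg
  have hgpos : 0 < g := by simp only [hg]; linarith
  have hKN : 0 < N * K ^ N := by positivity
  refine ⟨min 1 (g / (N * K ^ N)), by positivity, K ^ N, by positivity, ?_⟩
  intro E' hE'
  have hE'1 : ‖E'‖ ≤ ‖E‖ + 1 := by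
    have := norm_le_norm_add_norm_sub E E'
    rw [norm_sub_rev] at this
    have := hE'.le.trans (min_le_left _ _)
    linarith
  have key : ∀ x : ℂ, |x.im| ≤ ε → ‖An lam α E' N x‖ ≤ exp (c * N) := by
    intro x hx
    have h1 := norm_An_sub_le (lam := lam) (α := α) (E := E') (E' := E) hx hE'1 (by linarith) N
    have h2 : N * K ^ N * ‖E' - E‖ ≤ g := by
      have := hE'.le.trans (min_le_right _ _)
      rw [le_div_iff₀ hKN] at this
      linarith
    have h3 := norm_le_norm_add_norm_sub (An lam α E N x) (An lam α E' N x)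
    rw [norm_sub_rev] at h3
    have h4 := norm_An_le_sN (lam := lam) (α := α) (E := E) hx N
    linarith
  have mult : ∀ (k : ℕ) (x : ℂ), |x.im| ≤ ε → ‖An lam α E' (N * k) x‖ ≤ exp (c * (N * k)) := by
    intro k
    induction k with
    | zero => intro x _; simp [An_zero]
    | succ k ih =>
      intro x hx
      rw [Nat.mul_succ, add_comm, An_add]
      refine (norm_mul_le _ _).trans ?_
      calc _ ≤ exp (c * N) * exp (c * (N * k)) := by
            gcongr
            · exact key _ (by simpa using hx)
            · exact ih x hx
        _ = _ := by rw [← exp_add]; push_cast; ring_nf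
  intro n x hx
  have hdm := Nat.mod_add_div n N
  rw [← hdm, An_add]
  refine (norm_mul_le _ _).trans ?_
  have e1 : ‖An lam α E' (n % N) (x + (N * (n / N) : ℕ) * α)‖ ≤ K ^ N :=
    (norm_An_le (strip_shift hx _) hE'1 _).trans
      (pow_le_pow_right₀ hK1 (Nat.mod_lt _ (by omega)).le)
  have e2 := mult (n / N) x hx
  calc _ ≤ K ^ N * exp (c * (N * (n / N : ℕ))) := by gcongr
    _ ≤ _ := by
        gcongr
        push_cast
        have : (0 : ℝ) ≤ ((n % N : ℕ) : ℝ) := Nat.cast_nonneg _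
        linarith

theorem Lyap_le_of_growth {ε c C : ℝ} (hε : 0 ≤ ε)
    (h : ∀ (n : ℕ) (x : ℂ), |x.im| ≤ ε → ‖An lam α E n x‖ ≤ C * exp (c * n)) :
    Lyap lam α E ε ≤ c := by
  by_contra! hlt
  have hC : 0 < C := by
    have := (one_le_norm_An (lam := lam) (α := α) (E := E) 0 0).trans (h 0 0 (by simpa using hε))
    simp at this; linarith
  obtain ⟨n, hn⟩ := exists_nat_gt (log C / (Lyap lam α E ε - c))
  rw [div_lt_iff₀ (by linarith)] at hn
  have h1 := (exp_Lyap_le_sN lam α (E := E) hε n).trans (sN_le hε (h n))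
  rw [← exp_log hC, ← exp_add, exp_le_exp] at h1
  linarith

theorem Lyap_usc {ε c : ℝ} (hε : 0 ≤ ε) (h : Lyap lam α E ε < c) :
    ∃ δ > 0, ∀ E' : ℂ, ‖E' - E‖ < δ → Lyap lam α E' ε ≤ c := by
  obtain ⟨δ, hδ, C, -, hC⟩ := exists_growth hε h
  exact ⟨δ, hδ, fun E' hE' => Lyap_le_of_growth hε (hC _ hE')⟩

/-! ### Continuous periodic functions and their Fourier coefficients -/

/-- The character `exp (2 π i z)`. -/
def ee (z : ℂ) : ℂ := Complex.exp (2 * π * I * z)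

theorem ee_add (z w : ℂ) : ee (z + w) = ee z * ee w := by
  simp only [ee]; rw [← Complex.exp_add]; ring_nf

theorem ee_zero : ee 0 = 1 := by simp [ee]

theorem ee_neg (z : ℂ) : ee (-z) = (ee z)⁻¹ := by
  simp only [ee]; rw [← Complex.exp_neg]; ring_nf

theorem ee_int (k : ℤ) : ee k = 1 := by
  simp only [ee]; rw [mul_comm]; exact Complex.exp_int_mul_two_pi_mul_I k

theorem norm_ee (z : ℂ) : ‖ee z‖ = exp (-(2 * π * z.im)) := by
  simp [ee, Complex.norm_exp]

theorem norm_ee_real (x : ℝ) : ‖ee x‖ = 1 := by simp [norm_ee]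

theorem norm_ee_int_mul (k : ℤ) (x : ℝ) : ‖ee (k * x)‖ = 1 := by
  have := norm_ee_real (k * x); push_cast at this; exact this

theorem continuous_ee : Continuous ee := by unfold ee; fun_prop

theorem ee_nat_mul (n : ℕ) (z : ℂ) : ee (n * z) = ee z ^ n := by
  simp only [ee]; rw [← Complex.exp_nat_mul]; ring_nf

theorem ee_conj (z : ℂ) : conj (ee z) = ee (-(starRingEnd ℂ z)) := by
  simp only [ee, ← Complex.exp_conj]; congr 1
  simp only [map_mul, Complex.conj_I, conj_ofReal, Complex.conj_ofNat]; ring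

theorem ee_conj_real (x : ℝ) : conj (ee x) = ee (-x) := by
  rw [ee_conj, conj_ofReal]

theorem ee_eq_one_iff (z : ℂ) : ee z = 1 ↔ ∃ n : ℤ, z = n := by
  have h : (2 * (π : ℂ) * I) ≠ 0 := by simp
  rw [ee, Complex.exp_eq_one_iff]
  constructor
  · rintro ⟨n, hn⟩
    exact ⟨n, mul_left_cancel₀ h (by rw [hn]; ring)⟩
  · rintro ⟨n, rfl⟩; exact ⟨n, by ring⟩

theorem ee_ne_one {α : ℝ} (hα : Irrational α) {k : ℤ} (hk : k ≠ 0) : ee (k * α) ≠ 1 := by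
  intro h
  rw [ee_eq_one_iff] at h
  obtain ⟨n, hn⟩ := h
  have : (k : ℝ) * α = n := by exact_mod_cast hn
  exact (hα.intCast_mul hk).ne_int n this

/-- Continuous functions of period one. -/
structure CP (f : ℝ → ℂ) : Prop where
  cont : Continuous f
  per : ∀ x, f (x + 1) = f x

theorem CP.periodic {f : ℝ → ℂ} (hf : CP f) : Function.Periodic f 1 := hf.per

/-- Fourier coefficients. -/
def fc (f : ℝ → ℂ) (k : ℤ) : ℂ := ∫ x in (0 : ℝ)..1, ee (-(k * x)) * f x

/-- The function on the circle. -/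
def CP.lift {f : ℝ → ℂ} (hf : CP f) : C(AddCircle (1 : ℝ), ℂ) :=
  ⟨hf.periodic.lift, continuous_coinduced_dom.mpr hf.cont⟩

theorem CP.lift_coe {f : ℝ → ℂ} (hf : CP f) (x : ℝ) : hf.lift (x : AddCircle (1 : ℝ)) = f x := rfl

theorem fourier_ee (k : ℤ) (x : ℝ) : fourier k (x : AddCircle (1 : ℝ)) = ee (k * x) := by
  rw [fourier_coe_apply, ee]; congr 1; push_cast; ring

theorem CP.fourierCoeff_lift {f : ℝ → ℂ} (hf : CP f) (k : ℤ) : fourierCoeff hf.lift k = fc f k := by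
  rw [fourierCoeff_eq_intervalIntegral _ _ 0, fc]
  simp only [fourier_ee, hf.lift_coe]
  simp

theorem CP.hasSum {f : ℝ → ℂ} (hf : CP f) (h : Summable (fc f)) (x : ℝ) :
    HasSum (fun k : ℤ => fc f k * ee (k * x)) (f x) := by
  have h' : Summable (fourierCoeff hf.lift) := by
    convert h using 1; ext k; exact hf.fourierCoeff_lift k
  have := has_pointwise_sum_fourier_series_of_summable h' (x : AddCircle (1 : ℝ))
  simpa only [hf.fourierCoeff_lift, fourier_ee, hf.lift_coe, smul_eq_mul] using this

theorem CP.eq_zero {f : ℝ → ℂ} (hf : CP f) (h : ∀ k, fc f k = 0) (x : ℝ) : f x = 0 := by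
  have h1 := hf.hasSum (by rw [show fc f = 0 from funext h]; exact summable_zero) x
  simp only [h, zero_mul] at h1
  exact h1.unique hasSum_zero

theorem CP.norm_bdd {f : ℝ → ℂ} (hf : CP f) : ∃ C, 0 < C ∧ ∀ x, ‖f x‖ ≤ C := by
  refine ⟨‖hf.lift‖ + 1, by positivity, fun x => ?_⟩
  rw [← hf.lift_coe x]; linarith [hf.lift.norm_coe_le_norm (x : AddCircle (1 : ℝ))]

theorem CP.add {f g : ℝ → ℂ} (hf : CP f) (hg : CP g) : CP (fun x => f x + g x) :=
  ⟨hf.cont.add hg.cont, fun x => by simp only [hf.per, hg.per]⟩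

theorem CP.sub {f g : ℝ → ℂ} (hf : CP f) (hg : CP g) : CP (fun x => f x - g x) :=
  ⟨hf.cont.sub hg.cont, fun x => by simp only [hf.per, hg.per]⟩

theorem CP.mul {f g : ℝ → ℂ} (hf : CP f) (hg : CP g) : CP (fun x => f x * g x) :=
  ⟨hf.cont.mul hg.cont, fun x => by simp only [hf.per, hg.per]⟩

theorem CP.const (c : ℂ) : CP (fun _ => c) := ⟨continuous_const, fun _ => rfl⟩

theorem CP.shift {f : ℝ → ℂ} (hf : CP f) (a : ℝ) : CP (fun x => f (x + a)) :=
  ⟨hf.cont.comp (continuous_add_const a), fun x => by rw [add_right_comm, hf.per]⟩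

theorem CP.char (k : ℤ) : CP (fun x => ee (k * x)) :=
  ⟨continuous_ee.comp (by fun_prop), fun x => by
    push_cast; rw [mul_add, mul_one, ee_add, ee_int, mul_one]⟩

theorem CP.sub_int {f : ℝ → ℂ} (hf : CP f) (x : ℝ) (n : ℤ) : f (x - n) = f x := by
  have := hf.periodic.sub_int_mul_eq (x := x) n
  simpa using this

theorem fc_norm_le {f : ℝ → ℂ} {C : ℝ} (h : ∀ x, ‖f x‖ ≤ C) (k : ℤ) : ‖fc f k‖ ≤ C := by
  have := norm_integral_le_of_norm_le_const (a := (0 : ℝ)) (b := 1) (C := C)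
    (f := fun x => ee (-(k * x)) * f x) (by
      intro x _
      rw [norm_mul, ee_neg, norm_inv, norm_ee_int_mul]; simpa using h x)
  simpa [fc] using this

theorem CP.fc_shift {f : ℝ → ℂ} (hf : CP f) (a : ℝ) (k : ℤ) :
    fc (fun x => f (x + a)) k = ee (k * a) * fc f k := by
  have hp : Function.Periodic (fun x : ℝ => ee (-(k * x)) * f x) 1 := by
    intro x
    have := (CP.char (-k)).per x
    push_cast at this ⊢
    simp only [neg_mul] at this
    simp only [this, hf.per]
  have h1 : ∀ x : ℝ, ee (-(k * x)) * f (x + a) =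
      ee (k * a) * (ee (-(k * ((x + a : ℝ) : ℂ))) * f (x + a)) := by
    intro x
    rw [← mul_assoc, ← ee_add]; congr 2; push_cast; ring
  simp only [fc]
  rw [integral_congr (fun x _ => h1 x), integral_const_mul]
  congr 1
  rw [intervalIntegral.integral_comp_add_right
    (fun x : ℝ => ee (-(k * x)) * f x) a, zero_add, add_comm 1 a]
  simpa using hp.intervalIntegral_add_eq a 0

theorem CP.integrable_fc {f : ℝ → ℂ} (hf : CP f) (k : ℤ) (a b : ℝ) :
    IntervalIntegrable (fun x : ℝ => ee (-(k * x)) * f x) volume a b := by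
  apply Continuous.intervalIntegrable
  have := hf.cont
  have := continuous_ee.comp (f := fun x : ℝ => -((k : ℂ) * x)) (by fun_prop)
  exact this.mul hf.cont

theorem CP.fc_add {f g : ℝ → ℂ} (hf : CP f) (hg : CP g) (k : ℤ) :
    fc (fun x => f x + g x) k = fc f k + fc g k := by
  simp only [fc, mul_add]
  exact integral_add (hf.integrable_fc k 0 1) (hg.integrable_fc k 0 1)

theorem CP.fc_sub {f g : ℝ → ℂ} (hf : CP f) (hg : CP g) (k : ℤ) :
    fc (fun x => f x - g x) k = fc f k - fc g k := by
  simp only [fc, mul_sub]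
  exact integral_sub (hf.integrable_fc k 0 1) (hg.integrable_fc k 0 1)

theorem fc_const_mul (f : ℝ → ℂ) (c : ℂ) (k : ℤ) : fc (fun x => c * f x) k = c * fc f k := by
  simp only [fc]
  rw [← integral_const_mul]
  congr 1; ext x; ring

theorem fc_ee_mul (f : ℝ → ℂ) (j k : ℤ) : fc (fun x => ee (j * x) * f x) k = fc f (k - j) := by
  simp only [fc]
  congr 1; ext x
  rw [← mul_assoc, ← ee_add]; congr 2; push_cast; ring

theorem CP.parseval {f : ℝ → ℂ} (hf : CP f) :
    HasSum (fun k => ‖fc f k‖ ^ 2) (∫ x in (0 : ℝ)..1, ‖f x‖ ^ 2) := by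
  have h1 : MemLp f 2 (volume.restrict (Ioc (0 : ℝ) 1)) := by
    obtain ⟨C, -, hC⟩ := hf.norm_bdd
    exact MemLp.of_bound hf.cont.aestronglyMeasurable C (Eventually.of_forall hC)
  have h2 := hasSum_sq_fourierCoeffOn zero_lt_one h1
  convert h2 using 1
  · ext k
    rw [fourierCoeffOn_eq_integral, fc]
    simp only [sub_zero, div_one, one_smul, smul_eq_mul]
    congr 2
    refine integral_congr fun x _ => ?_
    congr 1
    have := fourier_ee (-k) x
    push_cast at this
    rw [neg_mul] at this
    rw [← this]
    simp
  · simp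

theorem CP.exists_approx {f : ℝ → ℂ} (hf : CP f) {κ : ℝ} (hκ : 0 < κ) :
    ∃ (s : Finset ℤ) (c : ℤ → ℂ), ∀ x : ℝ, ‖f x - ∑ k ∈ s, c k * ee (k * x)‖ ≤ κ := by
  have h : hf.lift ∈ (Submodule.span ℂ (Set.range <| @fourier (1 : ℝ))).topologicalClosure := by
    rw [span_fourier_closure_eq_top]; trivial
  obtain ⟨p, hp, hd⟩ := Metric.mem_closure_iff.1 h κ hκ
  obtain ⟨c, rfl⟩ := (Finsupp.mem_span_range_iff_exists_finsupp).1 hp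
  refine ⟨c.support, c, fun x => ?_⟩
  rw [dist_eq_norm] at hd
  have := (hf.lift - c.sum fun i a => a • fourier i).norm_coe_le_norm (x : AddCircle (1 : ℝ))
  refine le_trans (le_of_eq ?_) (this.trans hd.le)
  congr 1
  simp [Finsupp.sum, hf.lift_coe, ← fourier_ee]

theorem fc_zero (f : ℝ → ℂ) : fc f 0 = ∫ x in (0 : ℝ)..1, f x := by
  simp [fc, ee_zero]

theorem integral_ee {k : ℤ} (hk : k ≠ 0) : ∫ x in (0 : ℝ)..1, ee (k * x) = 0 := by
  have hc : (2 * π * I * k : ℂ) ≠ 0 := by simp [hk]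
  have := integral_exp_mul_complex (a := 0) (b := 1) hc
  have h2 : ∀ x : ℝ, ee (k * x) = Complex.exp (2 * π * I * k * x) := by
    intro x; rw [ee]; ring_nf
  simp only [h2, this]
  have := ee_int k
  rw [ee] at this
  simp [this]

/-- Weyl's theorem with uniformity in the initial point. -/
theorem CP.ergodic {α : ℝ} (hα : Irrational α) {f : ℝ → ℂ} (hf : CP f) {κ : ℝ} (hκ : 0 < κ) :
    ∃ C, 0 < C ∧ ∀ (n : ℕ) (x : ℝ),
      ‖∑ j ∈ range n, f (x + j * α) - n * ∫ x in (0 : ℝ)..1, f x‖ ≤ C + κ * n := by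
  obtain ⟨s, c, hsc⟩ := hf.exists_approx (half_pos hκ)
  set p : ℝ → ℂ := fun x => ∑ k ∈ s, c k * ee (k * x) with hp
  have hpc : Continuous p := by
    refine continuous_finsetSum _ fun k _ => continuous_const.mul (CP.char k).cont
  have hint : ∫ x in (0 : ℝ)..1, p x = if 0 ∈ s then c 0 else 0 := by
    simp only [hp]
    rw [intervalIntegral.integral_finsetSum]
    · rw [← Finset.sum_ite_eq' s (0 : ℤ) c]
      refine Finset.sum_congr rfl fun k _ => ?_
      rw [integral_const_mul]
      split_ifs with h
      · subst h; simp [ee_zero]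
      · rw [integral_ee h, mul_zero]
    · intro k _; exact (continuous_const.mul (CP.char k).cont).intervalIntegrable _ _
  have hdiff : ‖(∫ x in (0 : ℝ)..1, f x) - ∫ x in (0 : ℝ)..1, p x‖ ≤ κ / 2 := by
    rw [← integral_sub (hf.cont.intervalIntegrable _ _)
      (hpc.intervalIntegrable _ _)]
    have := norm_integral_le_of_norm_le_const (a := (0 : ℝ)) (b := 1)
      (C := κ / 2) (f := fun x => f x - p x) (fun x _ => hsc x)
    simpa using this
  set D : ℝ := ∑ k ∈ s, ‖c k‖ * (2 / ‖ee (k * α) - 1‖) with hD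
  have hD0 : 0 ≤ D := Finset.sum_nonneg fun k _ => by positivity
  have hpn : ∀ (n : ℕ) (x : ℝ),
      ‖∑ j ∈ range n, p (x + j * α) - n * ∫ x in (0 : ℝ)..1, p x‖ ≤ D := by
    intro n x
    have e1 : ∑ j ∈ range n, p (x + j * α) - n * ∫ x in (0 : ℝ)..1, p x
        = ∑ k ∈ s, c k * (∑ j ∈ range n, ee (k * (x + j * α : ℝ))
            - if k = 0 then (n : ℂ) else 0) := by
      rw [hint]
      simp only [hp, mul_sub, Finset.sum_sub_distrib]
      congr 1
      · rw [Finset.sum_comm]; simp only [mul_sum]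
      · simp only [mul_ite, mul_zero, Finset.sum_ite_eq']; split_ifs <;> ring
    rw [e1]
    refine (norm_sum_le _ _).trans (Finset.sum_le_sum fun k _ => ?_)
    rw [norm_mul]
    gcongr
    split_ifs with h
    · subst h; simp [ee_zero]
    · have hne := ee_ne_one hα h
      have e2 : ∀ j : ℕ, ee (k * (x + j * α : ℝ))
          = ee (k * x) * ee (k * α) ^ j := by
        intro j; rw [← ee_nat_mul, ← ee_add]; congr 1; push_cast; ring
      simp only [e2, ← mul_sum, sub_zero]
      rw [geom_sum_eq hne, norm_mul, norm_ee_int_mul, one_mul, norm_div]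
      gcongr
      refine (norm_sub_le _ _).trans ?_
      rw [norm_pow, norm_ee_int_mul]; norm_num
  refine ⟨D + 1, by positivity, fun n x => ?_⟩
  have e : ∑ j ∈ range n, f (x + j * α) - n * ∫ x in (0 : ℝ)..1, f x
      = ∑ j ∈ range n, (f (x + j * α) - p (x + j * α))
        + (∑ j ∈ range n, p (x + j * α) - n * ∫ x in (0 : ℝ)..1, p x)
        - n * ((∫ x in (0 : ℝ)..1, f x) - ∫ x in (0 : ℝ)..1, p x) := by
    rw [Finset.sum_sub_distrib]; ring
  rw [e]
  have h1 : ‖∑ j ∈ range n, (f (x + j * α) - p (x + j * α))‖ ≤ n * (κ / 2) := by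
    refine (norm_sum_le _ _).trans ((Finset.sum_le_sum fun j _ => hsc _).trans ?_)
    simp
  have h2 : ‖(n : ℂ) * ((∫ x in (0 : ℝ)..1, f x) - ∫ x in (0 : ℝ)..1, p x)‖ ≤ n * (κ / 2) := by
    rw [norm_mul, Complex.norm_natCast]; gcongr
  have h3 := norm_sub_le (∑ j ∈ range n, (f (x + j * α) - p (x + j * α))
        + (∑ j ∈ range n, p (x + j * α) - n * ∫ x in (0 : ℝ)..1, p x))
        (n * ((∫ x in (0 : ℝ)..1, f x) - ∫ x in (0 : ℝ)..1, p x))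
  have h4 := norm_add_le (∑ j ∈ range n, (f (x + j * α) - p (x + j * α)))
    (∑ j ∈ range n, p (x + j * α) - n * ∫ x in (0 : ℝ)..1, p x)
  have h5 := hpn n x
  linarith

section Param

variable {U : Set ℂ} {F : ℂ → ℝ → ℂ} {a b : ℝ}

theorem continuousOn_deriv_param (hU : IsOpen U)
    (hc : ContinuousOn (uncurry F) (U ×ˢ Icc a b))
    (hd : ∀ x ∈ Icc a b, DifferentiableOn ℂ (F · x) U) {E : ℂ} (hE : E ∈ U) :
    ContinuousOn (fun x => deriv (F · x) E) (Icc a b) := by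
  obtain ⟨r, hr, hrU⟩ := Metric.nhds_basis_closedBall.mem_iff.1 (hU.mem_nhds hE)
  have huc : UniformContinuousOn (uncurry F) (closedBall E r ×ˢ Icc a b) :=
    ((isCompact_closedBall E r).prod isCompact_Icc).uniformContinuousOn_of_continuous
      (hc.mono (prod_mono hrU subset_rfl))
  rw [Metric.continuousOn_iff]
  intro x hx ε hε
  obtain ⟨δ, hδ, h⟩ := Metric.uniformContinuousOn_iff.1 huc (r * (ε / 2)) (by positivity)
  refine ⟨δ, hδ, fun y hy hxy => ?_⟩
  have hdx := (hd x hx).mono (ball_subset_closedBall.trans hrU)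
  have hdy := (hd y hy).mono (ball_subset_closedBall.trans hrU)
  have hEb : ball E r ∈ 𝓝 E := Metric.ball_mem_nhds E hr
  have key := norm_deriv_le_of_forall_mem_sphere_norm_le (c := E) (R := r)
    (f := fun z => F z y - F z x) (C := r * (ε / 2)) hr ?_ ?_
  · rw [deriv_fun_sub (hdy.differentiableAt hEb) (hdx.differentiableAt hEb)] at key
    rw [dist_eq_norm]
    refine key.trans_lt ?_
    rw [mul_div_cancel_left₀ _ hr.ne']
    linarith
  · refine DifferentiableOn.diffContOnCl ?_
    rw [closure_ball E hr.ne']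
    exact ((hd y hy).mono hrU).sub ((hd x hx).mono hrU)
  · intro z hz
    have hz' := sphere_subset_closedBall hz
    have := h (z, y) ⟨hz', hy⟩ (z, x) ⟨hz', hx⟩ (by
      rw [Prod.dist_eq, dist_self]; exact max_lt hδ hxy)
    rw [dist_eq_norm] at this
    exact this.le

theorem hasDerivAt_integral_param (hU : IsOpen U) (hab : a ≤ b)
    (hc : ContinuousOn (uncurry F) (U ×ˢ Icc a b))
    (hd : ∀ x ∈ Icc a b, DifferentiableOn ℂ (F · x) U) {E : ℂ} (hE : E ∈ U) :
    HasDerivAt (fun E => ∫ x in a..b, F E x) (∫ x in a..b, deriv (F · x) E) E := by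
  obtain ⟨r, hr, hrU⟩ := Metric.nhds_basis_closedBall.mem_iff.1 (hU.mem_nhds hE)
  obtain ⟨M, hM⟩ := ((isCompact_closedBall E r).prod
    (isCompact_Icc (a := a) (b := b))).exists_bound_of_continuousOn
      (hc.mono (prod_mono hrU subset_rfl))
  have hIoc : uIoc a b ⊆ Icc a b := by rw [uIoc_of_le hab]; exact Ioc_subset_Icc_self
  have hcx : ∀ z ∈ U, ContinuousOn (F z) (Icc a b) := fun z hz =>
    hc.comp (by fun_prop : ContinuousOn (fun x : ℝ => (z, x)) (Icc a b))
      fun x hx => ⟨hz, hx⟩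
  refine (intervalIntegral.hasDerivAt_integral_of_dominated_loc_of_deriv_le (𝕜 := ℂ)
    (μ := volume) (a := a) (b := b) (F := F) (F' := fun E x => deriv (F · x) E) (x₀ := E)
    (bound := fun _ => M / (r / 2)) (Metric.ball_mem_nhds E (half_pos hr)) ?_ ?_ ?_ ?_ ?_ ?_).2
  · filter_upwards [hU.mem_nhds hE] with z hz
    exact ((hcx z hz).mono hIoc).aestronglyMeasurable measurableSet_uIoc
  · exact ContinuousOn.intervalIntegrable (by rw [uIcc_of_le hab]; exact hcx E hE)
  · exact ((continuousOn_deriv_param hU hc hd hE).mono hIoc).aestronglyMeasurable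
      measurableSet_uIoc
  · refine .of_forall fun x hx z hz => ?_
    refine norm_deriv_le_of_forall_mem_sphere_norm_le (half_pos hr) ?_ ?_
    · refine DifferentiableOn.diffContOnCl ?_
      rw [closure_ball z (half_pos hr).ne']
      refine (hd x (hIoc hx)).mono ((Metric.closedBall_subset_closedBall' ?_).trans hrU)
      rw [mem_ball] at hz; linarith
    · intro w hw
      refine hM (w, x) ⟨?_, hIoc hx⟩
      rw [mem_ball] at hz; rw [mem_sphere] at hw; rw [Metric.mem_closedBall]
      linarith [dist_triangle w z E]
  · exact intervalIntegrable_const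
  · refine .of_forall fun x hx z hz => ?_
    refine DifferentiableAt.hasDerivAt ((hd x (hIoc hx)).differentiableAt (hU.mem_nhds (hrU ?_)))
    exact (ball_subset_closedBall.trans
      (Metric.closedBall_subset_closedBall (by linarith))) hz

end Param

/-- A two-constants estimate: a bounded function on a disc which is small on the part of the
boundary away from the horizontal diameter is small at the centre. -/
theorem two_constants {f : ℂ → ℂ} {E : ℂ} {ρ M m σ : ℝ} (hρ : 0 < ρ) (hσ : 0 ≤ σ)
    (hf : DiffContOnCl ℂ f (ball E ρ))
    (hM : ∀ z ∈ sphere E ρ, ‖f z‖ ≤ M)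
    (hm : ∀ z ∈ sphere E ρ, ρ * σ ≤ |(z - E).im| → ‖f z‖ ≤ m) (s : ℕ) :
    ‖f E‖ ≤ 2 ^ s * max m (M * σ ^ s) := by
  have hnorm : ∀ z ∈ sphere E ρ, ‖1 - ((z - E) / ρ) ^ 2‖ = 2 * (|(z - E).im| / ρ) := by
    intro z hz
    set u : ℂ := (z - E) / ρ with hu
    have hu1 : ‖u‖ = 1 := by
      rw [hu, norm_div, ← dist_eq_norm, mem_sphere.1 hz, norm_real,
        norm_of_nonneg hρ.le, div_self hρ.ne']
    have h1 : u * (starRingEnd ℂ u) = 1 := by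
      rw [Complex.mul_conj, normSq_eq_norm_sq, hu1]; simp
    have h2 : 1 - u ^ 2 = u * (starRingEnd ℂ u - u) := by rw [mul_sub, h1]; ring
    have h3 : starRingEnd ℂ u - u = -(2 * u.im * I) := by
      apply Complex.ext <;> simp; ring
    have h4 : |u.im| = |(z - E).im| / ρ := by
      rw [hu, div_ofReal_im, abs_div, abs_of_pos hρ]
    rw [h2, norm_mul, hu1, h3, one_mul, norm_neg, ← h4]
    simp
  have hle : ∀ z ∈ sphere E ρ, |(z - E).im| / ρ ≤ 1 := by
    intro z hz
    rw [div_le_one hρ]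
    exact (abs_im_le_norm _).trans (by rw [← dist_eq_norm]; exact (mem_sphere.1 hz).le)
  have key := norm_le_of_forall_mem_frontier_norm_le (U := ball E ρ)
    (f := fun z => (1 - ((z - E) / ρ) ^ 2) ^ s • f z) (C := 2 ^ s * max m (M * σ ^ s))
    isBounded_ball ?_ ?_ (z := E) (subset_closure (Metric.mem_ball_self hρ))
  · simpa using key
  · refine DiffContOnCl.smul (Differentiable.diffContOnCl ?_) hf
    fun_prop
  · intro z hz
    rw [frontier_ball E hρ.ne'] at hz
    rw [norm_smul, norm_pow, hnorm z hz, mul_pow, mul_assoc]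
    gcongr
    by_cases h : ρ * σ ≤ |(z - E).im|
    · calc (|(z - E).im| / ρ) ^ s * ‖f z‖ ≤ 1 * m := by
            gcongr
            · exact pow_le_one₀ (by positivity) (hle z hz)
            · exact hm z hz h
        _ ≤ _ := by rw [one_mul]; exact le_max_left _ _
    · calc (|(z - E).im| / ρ) ^ s * ‖f z‖ ≤ σ ^ s * M := by
            gcongr
            · rw [div_le_iff₀ hρ]; push Not at h; linarith
            · exact hM z hz
        _ ≤ _ := by rw [mul_comm]; exact le_max_right _ _

theorem differentiableOn_of_off_real {g : ℂ → ℂ} {U : Set ℂ} (hU : IsOpen U)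
    (hc : ContinuousOn g U) (hd : ∀ z ∈ U, z.im ≠ 0 → DifferentiableAt ℂ g z) :
    DifferentiableOn ℂ g U := by
  rw [← Complex.isConservativeOn_and_continuousOn_iff_isDifferentiableOn hU]
  refine ⟨fun z w hzw => ?_, hc⟩
  rw [← add_eq_zero_iff_eq_neg, Complex.wedgeIntegral_add_wedgeIntegral_eq]
  have base : ∀ a b c d : ℝ, 0 ∉ Ioo (min c d) (max c d) → uIcc c d ⊆ uIcc z.im w.im →
      uIcc a b ⊆ uIcc z.re w.re →
      (∫ x : ℝ in a..b, g (x + c * I)) - (∫ x : ℝ in a..b, g (x + d * I)) +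
      I • (∫ y : ℝ in c..d, g (b + y * I)) -
      I • (∫ y : ℝ in c..d, g (a + y * I)) = 0 := by
    intro a b c d h0 hcd hab
    have hsub : uIcc a b ×ℂ uIcc c d ⊆ U := fun x hx => hzw ⟨hab hx.1, hcd hx.2⟩
    have := Complex.integral_boundary_rect_eq_zero_of_continuousOn_of_differentiableOn g
      (a + c * I) (b + d * I) (hc.mono (by simpa using hsub)) ?_
    · simpa using this
    · intro x hx
      simp only [add_re, ofReal_re, mul_re, I_re, mul_zero,
        ofReal_im, I_im, mul_one, sub_self, add_zero, add_im,
        mul_im, zero_add] at hx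
      refine (hd x (hsub ⟨Ioo_subset_Icc_self hx.1, Ioo_subset_Icc_self hx.2⟩)
        ?_).differentiableWithinAt
      intro h
      exact h0 (h ▸ hx.2)
  by_cases h0 : (0 : ℝ) ∈ Ioo (min z.im w.im) (max z.im w.im)
  · have h0' : (0 : ℝ) ∈ uIcc z.im w.im := Ioo_subset_Icc_self h0
    have h1 := base z.re w.re z.im 0 (by
      intro h; rcases le_total z.im 0 with h' | h' <;> simp [h'] at h)
      (uIcc_subset_uIcc left_mem_uIcc h0') subset_rfl
    have h2 := base z.re w.re 0 w.im (by
      intro h; rcases le_total w.im 0 with h' | h' <;> simp [h'] at h)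
      (uIcc_subset_uIcc h0' right_mem_uIcc) subset_rfl
    have hint : ∀ a ∈ uIcc z.re w.re, ∀ c ∈ uIcc z.im w.im, ∀ d ∈ uIcc z.im w.im,
        IntervalIntegrable (fun y : ℝ => g (a + y * I)) volume c d := by
      intro a ha c hc' d hd'
      refine ContinuousOn.intervalIntegrable (hc.comp (by fun_prop) ?_)
      intro y hy
      refine hzw ⟨by simpa using ha, ?_⟩
      simpa using uIcc_subset_uIcc hc' hd' hy
    have h3 := integral_add_adjacent_intervals
      (hint w.re right_mem_uIcc _ left_mem_uIcc _ h0')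
      (hint w.re right_mem_uIcc _ h0' _ right_mem_uIcc)
    have h4 := integral_add_adjacent_intervals
      (hint z.re left_mem_uIcc _ left_mem_uIcc _ h0')
      (hint z.re left_mem_uIcc _ h0' _ right_mem_uIcc)
    rw [← h3, ← h4, smul_add, smul_add]
    linear_combination h1 + h2
  · exact base z.re w.re z.im w.im h0 subset_rfl subset_rfl

theorem exists_lipschitz_extension {h : ℂ → ℂ} {V : Set ℂ} (hV : IsOpen V) (hVc : Convex ℝ V)
    {K : NNReal} (h1 : LipschitzOnWith K h (V ∩ {z | 0 < z.im}))
    (h2 : LipschitzOnWith K h (V ∩ {z | z.im < 0}))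
    (h3 : ∀ x : ℝ, (x : ℂ) ∈ V →
      Tendsto (fun η : ℝ => h (x + η * I) - h (x - η * I)) (𝓝[>] 0) (𝓝 0)) :
    ∃ g : ℂ → ℂ, Continuous g ∧ ∀ z ∈ V, z.im ≠ 0 → g z = h z := by
  have key : ∀ z ∈ V, ∀ w ∈ V, 0 < z.im → w.im < 0 → ‖h z - h w‖ ≤ K * ‖z - w‖ := by
    intro z hz w hw hzi hwi
    set t : ℝ := z.im / (z.im - w.im) with ht
    have hd : 0 < z.im - w.im := by linarith
    have ht0 : 0 ≤ t := by positivity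
    have ht1 : t ≤ 1 := by rw [ht, div_le_one hd]; linarith
    set p : ℂ := z + t * (w - z) with hp
    have hpV : p ∈ V := by
      have := hVc.add_smul_sub_mem hz hw ⟨ht0, ht1⟩
      simpa [hp] using this
    have hpim : p.im = 0 := by
      simp only [hp, add_im, mul_im, ofReal_re, sub_im,
        ofReal_im, zero_mul, add_zero, ht]
      field_simp; ring
    obtain ⟨x, hx⟩ : ∃ x : ℝ, (x : ℂ) = p := ⟨p.re, Complex.ext rfl (by simp [hpim])⟩
    rw [← hx] at hpV
    have hcont1 : Tendsto (fun η : ℝ => (x : ℂ) + η * I) (𝓝[>] 0) (𝓝 x) := by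
      refine tendsto_nhdsWithin_of_tendsto_nhds ?_
      have : Continuous fun η : ℝ => (x : ℂ) + η * I := by fun_prop
      simpa using this.tendsto 0
    have hcont2 : Tendsto (fun η : ℝ => (x : ℂ) - η * I) (𝓝[>] 0) (𝓝 x) := by
      refine tendsto_nhdsWithin_of_tendsto_nhds ?_
      have : Continuous fun η : ℝ => (x : ℂ) - η * I := by fun_prop
      simpa using this.tendsto 0
    have hlim : Tendsto (fun η : ℝ => K * ‖z - (x + η * I)‖ +
        ‖h (x + η * I) - h (x - η * I)‖ + K * ‖(x - η * I) - w‖)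
        (𝓝[>] 0) (𝓝 (K * ‖z - x‖ + ‖(0 : ℂ)‖ + K * ‖x - w‖)) :=
      (((hcont1.const_sub z).norm.const_mul _).add (h3 x hpV).norm).add
        ((hcont2.sub_const w).norm.const_mul _)
    have hseg : ‖z - x‖ + ‖x - w‖ = ‖z - w‖ := by
      have e1 : z - x = (t : ℂ) * (z - w) := by rw [hx, hp]; ring
      have e2 : x - w = ((1 - t : ℝ) : ℂ) * (z - w) := by rw [hx, hp]; push_cast; ring
      rw [e1, e2, norm_mul, norm_mul, norm_real, norm_real,
        norm_of_nonneg ht0, norm_of_nonneg (by linarith)]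
      ring
    have : K * ‖z - w‖ = K * ‖z - x‖ + ‖(0 : ℂ)‖ + K * ‖x - w‖ := by
      rw [← hseg, norm_zero]; ring
    rw [this]
    refine ge_of_tendsto hlim ?_
    filter_upwards [hcont1 (hV.mem_nhds hpV), hcont2 (hV.mem_nhds hpV), self_mem_nhdsWithin]
      with η hη1 hη2 hη
    have hη' : (0 : ℝ) < η := hη
    have b1 := h1.dist_le_mul z ⟨hz, hzi⟩ _ ⟨hη1, by simpa using hη'⟩
    have b2 := h2.dist_le_mul _ ⟨hη2, by simpa using hη'⟩ w ⟨hw, hwi⟩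
    rw [dist_eq_norm, dist_eq_norm] at b1 b2
    calc ‖h z - h w‖ = ‖(h z - h (x + η * I)) +
        (h (x + η * I) - h (x - η * I)) + (h (x - η * I) - h w)‖ := by
          congr 1; ring
      _ ≤ _ := norm_add₃_le
      _ ≤ _ := by linarith
  have hlip : LipschitzOnWith K h (V ∩ {z | z.im ≠ 0}) := by
    refine LipschitzOnWith.of_dist_le_mul fun z hz w hw => ?_
    rcases lt_or_gt_of_ne hz.2 with hz' | hz' <;> rcases lt_or_gt_of_ne hw.2 with hw' | hw'
    · exact h2.dist_le_mul z ⟨hz.1, hz'⟩ w ⟨hw.1, hw'⟩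
    · rw [dist_comm, dist_comm z, dist_eq_norm, dist_eq_norm]
      exact key w hw.1 z hz.1 hw' hz'
    · rw [dist_eq_norm, dist_eq_norm]; exact key z hz.1 w hw.1 hz' hw'
    · exact h1.dist_le_mul z ⟨hz.1, hz'⟩ w ⟨hw.1, hw'⟩
  obtain ⟨g, hg, hgh⟩ := hlip.extend_finite_dimension
  exact ⟨g, hg.continuous, fun z hz hz' => (hgh ⟨hz, hz'⟩).symm⟩

theorem glue_average {f : ℂ → ℂ} {c R s : ℝ} (hs : 0 < s) (hsR : s < R / 4)
    (hf : ∀ z : ℂ, |z.re - c| < R → |z.im| < R → z.im ≠ 0 → DifferentiableAt ℂ f z)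
    (hb : ∀ z : ℂ, |z.re - c| < R → |z.im| < R → z.im ≠ 0 → ‖f z‖ ≤ 1)
    (hD : ∀ t₁ t₂ : ℝ, |t₁ - c| < R → |t₂ - c| < R →
      Tendsto (fun η : ℝ => ∫ t in t₁..t₂, (f (t + η * I) - f (t - η * I)))
        (𝓝[>] 0) (𝓝 0)) :
    ∃ g : ℂ → ℂ, Continuous g ∧
      DifferentiableOn ℂ g {z : ℂ | |z.re - c| < 3 * R / 4 ∧ |z.im| < R} ∧
      ∀ z : ℂ, |z.re - c| < 3 * R / 4 → |z.im| < R → z.im ≠ 0 →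
        g z = (1 / s : ℝ) * ∫ t in (0 : ℝ)..s, f (z + t) := by
  set V := {z : ℂ | |z.re - c| < 3 * R / 4 ∧ |z.im| < R} with hVdef
  have hV : IsOpen V := by
    rw [hVdef, ofPred_and]
    exact (isOpen_lt (by fun_prop) continuous_const).inter
      (isOpen_lt (by fun_prop) continuous_const)
  have hVc : Convex ℝ V := by
    intro z hz w hw a b ha hb hab
    have e1 : (a • z + b • w).re - c = a * (z.re - c) + b * (w.re - c) := by
      simp; linear_combination c * (hab)
    have e2 : (a • z + b • w).im = a * z.im + b * w.im := by simp
    obtain ⟨hz1, hz2⟩ := hz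
    obtain ⟨hw1, hw2⟩ := hw
    rw [abs_lt] at *
    refine ⟨?_, ?_⟩
    · rw [e1, abs_lt]; exact convex_Ioo _ _ hz1 hw1 ha hb hab
    · rw [e2, abs_lt]; exact convex_Ioo _ _ hz2 hw2 ha hb hab
  set h : ℂ → ℂ := fun z => (1 / s : ℝ) * ∫ t in (0 : ℝ)..s, f (z + t) with hh
  set B : Set ℂ := {z : ℂ | |z.re - c| < R ∧ |z.im| < R ∧ z.im ≠ 0} with hBdef
  have hfB : ∀ z ∈ B, DifferentiableAt ℂ f z := fun z hz => hf z hz.1 hz.2.1 hz.2.2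
  have hmem : ∀ z ∈ V, z.im ≠ 0 → ∀ t ∈ Icc (0 : ℝ) s, z + t ∈ B := by
    intro z hz hzi t ht
    have := hz.1
    have h2 := hz.2
    rw [abs_lt] at this
    refine ⟨?_, ?_, ?_⟩
    · rw [abs_lt]; simp; constructor <;> linarith [ht.1, ht.2]
    · simpa using h2
    · simpa using hzi
  have hfc : ContinuousOn f B := fun z hz => (hfB z hz).continuousAt.continuousWithinAt
  have hder : ∀ z ∈ V, z.im ≠ 0 → HasDerivAt h ((1 / s : ℝ) * (f (z + s) - f z)) z := by
    intro z hz hzi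
    have hU : IsOpen (V ∩ {z : ℂ | z.im ≠ 0}) :=
      hV.inter (isOpen_ne_fun (by fun_prop) continuous_const)
    have hc : ContinuousOn (uncurry fun (z : ℂ) (t : ℝ) => f (z + t))
        ((V ∩ {z : ℂ | z.im ≠ 0}) ×ˢ Icc 0 s) :=
      hfc.comp (by fun_prop) fun p hp => hmem p.1 hp.1.1 hp.1.2 p.2 hp.2
    have hd : ∀ x ∈ Icc 0 s, DifferentiableOn ℂ (fun z => f (z + x)) (V ∩ {z : ℂ | z.im ≠ 0}) :=
      fun x hx y hy => ((hfB _ (hmem y hy.1 hy.2 x hx)).comp y (by fun_prop)).differentiableWithinAt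
    have := hasDerivAt_integral_param (F := fun z t => f (z + t)) hU hs.le hc hd ⟨hz, hzi⟩
    have h2 : ∫ x in (0 : ℝ)..s, deriv (fun y : ℂ => f (y + x)) z = f (z + s) - f z := by
      rw [intervalIntegral.integral_eq_sub_of_hasDerivAt (f := fun x : ℝ => f (z + x))]
      · simp
      · intro x hx
        rw [uIcc_of_le hs.le] at hx
        have hd := (hfB _ (hmem z hz hzi x hx)).hasDerivAt
        rw [deriv_comp_add_const]
        have h1 : HasDerivAt (fun x : ℝ => z + (x : ℂ)) 1 x := by
          have := Complex.ofRealCLM.hasDerivAt (x := x)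
          simp only [Complex.ofRealCLM_apply, Complex.ofReal_one] at this
          exact this.const_add z
        have h2 := hd.scomp x h1
        rw [one_smul] at h2
        exact h2
      · refine ContinuousOn.intervalIntegrable ?_
        rw [uIcc_of_le hs.le]
        exact continuousOn_deriv_param (F := fun z t => f (z + t)) hU hc hd ⟨hz, hzi⟩
    rw [h2] at this
    exact this.const_mul _
  have hderb : ∀ z ∈ V, z.im ≠ 0 → ‖deriv h z‖₊ ≤ (2 / s).toNNReal := by
    intro z hz hzi
    refine NNReal.coe_le_coe.1 ?_
    rw [coe_nnnorm, Real.coe_toNNReal _ (by positivity), (hder z hz hzi).deriv, norm_mul, norm_real]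
    have b1 := hmem z hz hzi s ⟨hs.le, le_rfl⟩
    have b2 := hmem z hz hzi 0 ⟨le_rfl, hs.le⟩
    rw [Complex.ofReal_zero, add_zero] at b2
    have b3 := hb _ b1.1 b1.2.1 b1.2.2
    have b4 := hb _ b2.1 b2.2.1 b2.2.2
    have := norm_sub_le (f (z + s)) (f z)
    rw [norm_of_nonneg (by positivity)]
    calc 1 / s * ‖f (z + s) - f z‖ ≤ 1 / s * 2 := by gcongr; linarith
      _ = 2 / s := by ring
  have hup : Convex ℝ (V ∩ {z : ℂ | 0 < z.im}) := hVc.inter (convex_halfSpace_im_gt 0)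
  have hlo : Convex ℝ (V ∩ {z : ℂ | z.im < 0}) := hVc.inter (convex_halfSpace_im_lt 0)
  obtain ⟨g, hg, hgh⟩ := exists_lipschitz_extension (h := h) hV hVc
    (hup.lipschitzOnWith_of_nnnorm_deriv_le (𝕜 := ℂ)
      (fun z hz => (hder z hz.1 hz.2.ne').differentiableAt) fun z hz => hderb z hz.1 hz.2.ne')
    (hlo.lipschitzOnWith_of_nnnorm_deriv_le (𝕜 := ℂ)
      (fun z hz => (hder z hz.1 hz.2.ne).differentiableAt) fun z hz => hderb z hz.1 hz.2.ne) (by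
    intro x hx
    have hx1 : |x - c| < 3 * R / 4 := by simpa using hx.1
    have hR : 0 < R := by linarith
    have := (hD x (x + s) (by linarith) (by rw [abs_lt] at *; constructor <;> linarith)).const_mul
      ((1 / s : ℝ) : ℂ)
    rw [mul_zero] at this
    refine this.congr' ?_
    have hR' : ∀ᶠ η in 𝓝[>] (0 : ℝ), η < R := nhdsWithin_le_nhds (gt_mem_nhds hR)
    filter_upwards [hR', self_mem_nhdsWithin] with η hη hη0
    have hη0' : (0 : ℝ) < η := hη0
    have hm : ∀ η' : ℝ, |η'| < R → η' ≠ 0 → (x + η' * I : ℂ) ∈ V ∧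
        (x + η' * I : ℂ).im ≠ 0 := by
      intro η' h1 h2
      exact ⟨⟨by simpa using hx1, by simpa using h1⟩, by simpa using h2⟩
    have hi : ∀ η' : ℝ, |η'| < R → η' ≠ 0 →
        IntervalIntegrable (fun t : ℝ => f (x + η' * I + t)) volume 0 s := by
      intro η' h1 h2
      refine ContinuousOn.intervalIntegrable ?_
      rw [uIcc_of_le hs.le]
      exact hfc.comp (by fun_prop) fun t ht => hmem _ (hm η' h1 h2).1 (hm η' h1 h2).2 t ht
    have i1 := hi η (by rwa [abs_of_pos hη0']) hη0'.ne'
    have i2 := hi (-η) (by rwa [abs_neg, abs_of_pos hη0']) (neg_ne_zero.2 hη0'.ne')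
    have e2 : ((-η : ℝ) : ℂ) = -(η : ℂ) := by simp
    rw [e2, neg_mul, ← sub_eq_add_neg] at i2
    simp only [hh]
    rw [← mul_sub, ← integral_sub i1 i2]
    congr 1
    have := intervalIntegral.integral_comp_add_left (a := 0) (b := s)
      (fun t : ℝ => f (t + η * I) - f (t - η * I)) x
    rw [add_zero] at this
    rw [← this]
    refine integral_congr fun t _ => ?_
    push_cast
    ring_nf)
  refine ⟨g, hg, ?_, fun z h1 h2 h3 => hgh z ⟨h1, h2⟩ h3⟩
  refine differentiableOn_of_off_real hV hg.continuousOn fun z hz hzi => ?_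
  refine (hder z hz hzi).differentiableAt.congr_of_eventuallyEq ?_
  have : IsOpen (V ∩ {z : ℂ | z.im ≠ 0}) := hV.inter (isOpen_ne_fun (by fun_prop) continuous_const)
  filter_upwards [this.mem_nhds ⟨hz, hzi⟩] with w hw
  exact hgh w hw.1 hw.2

/-- A bounded function, holomorphic off the real axis, whose boundary values from above and from
below agree in the sense of distributions extends holomorphically, as a Cauchy integral. -/
theorem glue {f : ℂ → ℂ} {c R : ℝ} (hR : 0 < R)
    (hf : ∀ z : ℂ, |z.re - c| < R → |z.im| < R → z.im ≠ 0 → DifferentiableAt ℂ f z)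
    (hb : ∀ z : ℂ, |z.re - c| < R → |z.im| < R → z.im ≠ 0 → ‖f z‖ ≤ 1)
    (hD : ∀ t₁ t₂ : ℝ, |t₁ - c| < R → |t₂ - c| < R →
      Tendsto (fun η : ℝ => ∫ t in t₁..t₂, (f (t + η * I) - f (t - η * I)))
        (𝓝[>] 0) (𝓝 0)) :
    DifferentiableOn ℂ
      (fun w => (2 * π * I : ℂ)⁻¹ • ∮ ζ in C(c, R / 2), (ζ - w)⁻¹ • f ζ)
      (ball c (R / 2)) ∧
    (∀ w ∈ ball (c : ℂ) (R / 2), w.im ≠ 0 →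
      (2 * π * I : ℂ)⁻¹ • (∮ ζ in C(c, R / 2), (ζ - w)⁻¹ • f ζ) = f w) := by
  have hs : ∀ n : ℕ, 0 < R / 8 / (n + 1) ∧ R / 8 / ((n : ℝ) + 1) < R / 4 := fun n => by
    refine ⟨by positivity, ?_⟩
    rw [div_lt_iff₀ (by positivity)]
    nlinarith [(Nat.cast_nonneg n : (0 : ℝ) ≤ n)]
  choose g hgc hgd hg using fun n : ℕ => glue_average (hs n).1 (hs n).2 hf hb hD
  have hlim0 : Tendsto (fun n : ℕ => R / 8 / ((n : ℝ) + 1)) atTop (𝓝[>] 0) := by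
    rw [tendsto_nhdsWithin_iff]
    refine ⟨?_, .of_forall fun n => (hs n).1⟩
    exact tendsto_const_nhds.div_atTop (tendsto_atTop_add_const_right _ _
      tendsto_natCast_atTop_atTop)
  set B : Set ℂ := {z : ℂ | |z.re - c| < R ∧ |z.im| < R ∧ z.im ≠ 0} with hBdef
  have hBo : IsOpen B := by
    rw [hBdef, ofPred_and, ofPred_and]
    exact (isOpen_lt (by fun_prop) continuous_const).inter
      ((isOpen_lt (by fun_prop) continuous_const).inter
        (isOpen_ne_fun (by fun_prop) continuous_const))
  have hfB : ContinuousOn f B := fun z hz =>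
    (hf z hz.1 hz.2.1 hz.2.2).continuousAt.continuousWithinAt
  have hballs : ∀ w ∈ closedBall (c : ℂ) (R / 2), |w.re - c| ≤ R / 2 ∧ |w.im| ≤ R / 2 := by
    intro w hw
    rw [Metric.mem_closedBall, dist_eq_norm] at hw
    exact ⟨by simpa using (Complex.abs_re_le_norm _).trans hw,
      by simpa using (abs_im_le_norm _).trans hw⟩
  have hlim : ∀ w ∈ closedBall (c : ℂ) (R / 2), w.im ≠ 0 →
      Tendsto (fun n => g n w) atTop (𝓝 (f w)) := by
    intro w hw hwi
    obtain ⟨h1, h2⟩ := hballs w hw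
    have hwB : ∀ t ∈ Icc 0 (R / 4), w + (t : ℝ) ∈ B := by
      intro t ht
      rw [abs_le] at h1 h2
      refine ⟨?_, ?_, by simpa using hwi⟩
      · rw [abs_lt]; simp; constructor <;> linarith [ht.1, ht.2]
      · rw [abs_lt]; simp; constructor <;> linarith
    have hder : HasDerivWithinAt (fun u : ℝ => ∫ t in (0 : ℝ)..u, f (w + t)) (f (w + (0 : ℝ)))
        (Ioi 0) 0 := by
      have hcon : ContinuousOn (fun t : ℝ => f (w + t)) (Icc 0 (R / 4)) :=
        hfB.comp (by fun_prop) hwB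
      have hnh : Icc 0 (R / 4) ∈ 𝓝[≥] (0 : ℝ) := Icc_mem_nhdsGE_of_mem ⟨le_rfl, by positivity⟩
      refine (intervalIntegral.integral_hasDerivWithinAt_right (s := Ici 0) (t := Ioi 0)
        (by simp) ?_ ?_).mono Ioi_subset_Ici_self
      · exact ⟨Icc 0 (R / 4), nhdsWithin_mono _ Ioi_subset_Ici_self hnh,
          hcon.aestronglyMeasurable measurableSet_Icc⟩
      · exact (hcon 0 ⟨le_rfl, by positivity⟩).mono_of_mem_nhdsWithin
          (nhdsWithin_mono _ Ioi_subset_Ici_self hnh)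
    have hsl := (hasDerivWithinAt_iff_tendsto_slope' (by simp)).1 hder
    rw [Complex.ofReal_zero, add_zero] at hsl
    refine (hsl.comp hlim0).congr fun n => ?_
    rw [hg n w (by linarith) (by linarith) hwi]
    simp [slope_def_module]
  have hae : ∀ᵐ θ ∂(volume.restrict (uIoc 0 (2 * π))), (circleMap (c : ℂ) (R / 2) θ).im ≠ 0 := by
    refine ae_restrict_of_ae ?_
    have : Set.Countable {θ : ℝ | (circleMap (c : ℂ) (R / 2) θ).im = 0} := by
      refine (countable_range fun n : ℤ => (n : ℝ) * π).mono fun θ hθ => ?_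
      have h0 : R / 2 * Real.sin θ = 0 := by
        have := hθ
        simpa [circleMap, Complex.exp_im, ← Complex.ofReal_ofNat] using this
      obtain ⟨n, hn⟩ := Real.sin_eq_zero_iff.1 ((mul_eq_zero.1 h0).resolve_left (by positivity))
      exact ⟨n, hn⟩
    exact (this.ae_notMem volume).mono fun θ hθ => hθ
  have hcm : ∀ θ, circleMap (c : ℂ) (R / 2) θ ∈ sphere (c : ℂ) (R / 2) := fun θ =>
    circleMap_mem_sphere _ (by positivity) θ
  have hcm' : ∀ θ, circleMap (c : ℂ) (R / 2) θ ∈ closedBall (c : ℂ) (R / 2) := fun θ =>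
    sphere_subset_closedBall (hcm θ)
  have hgb : ∀ n, ∀ w ∈ closedBall (c : ℂ) (R / 2), w.im ≠ 0 → ‖g n w‖ ≤ 1 := by
    intro n w hw hwi
    obtain ⟨h1, h2⟩ := hballs w hw
    have hn := hs n
    rw [hg n w (by linarith) (by linarith) hwi, norm_mul, norm_real,
      norm_of_nonneg (by positivity)]
    have := norm_integral_le_of_norm_le_const (a := 0) (b := R / 8 / ((n : ℝ) + 1))
      (f := fun t : ℝ => f (w + t)) (C := 1) (fun t ht => ?_)
    · rw [sub_zero, abs_of_pos hn.1, one_mul] at this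
      calc _ ≤ 1 / (R / 8 / ((n : ℝ) + 1)) * (R / 8 / ((n : ℝ) + 1)) := by
            gcongr
        _ = 1 := by rw [one_div, inv_mul_cancel₀ hn.1.ne']
    · rw [uIoc_of_le hn.1.le] at ht
      rw [abs_le] at h1 h2
      refine hb _ ?_ ?_ (by simpa using hwi)
      · rw [abs_lt]; simp; constructor <;> linarith [ht.1, ht.2]
      · rw [abs_lt]; simp; constructor <;> linarith
  have hfm : AEStronglyMeasurable (fun θ => f (circleMap (c : ℂ) (R / 2) θ))
      (volume.restrict (uIoc 0 (2 * π))) := by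
    refine aestronglyMeasurable_of_tendsto_ae atTop
      (f := fun n θ => g n (circleMap (c : ℂ) (R / 2) θ)) (fun n => ?_) ?_
    · exact ((hgc n).comp (continuous_circleMap _ _)).aestronglyMeasurable
    · filter_upwards [hae] with θ hθ
      exact hlim _ (hcm' θ) hθ
  have hci : CircleIntegrable f c (R / 2) := by
    refine (intervalIntegrable_const (c := (1 : ℝ))).mono_fun hfm ?_
    filter_upwards [hae] with θ hθ
    obtain ⟨h1, h2⟩ := hballs _ (hcm' θ)
    simpa using hb _ (by linarith) (by linarith) hθ
  constructor
  · intro w hw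
    have hR2 : (0 : NNReal) < (R / 2).toNNReal := by simpa using hR
    have hci' : CircleIntegrable f c ((R / 2).toNNReal : ℝ) := by
      rwa [Real.coe_toNNReal _ (by positivity)]
    have := (hasFPowerSeriesOn_cauchy_integral hci' hR2).differentiableOn
    rw [Metric.eball_coe, Real.coe_toNNReal _ (by positivity)] at this
    exact this w hw
  · intro w hw hwi
    have hdisc : ∀ n, (∮ ζ in C(c, R / 2), (ζ - w)⁻¹ • g n ζ) = (2 * π * I : ℂ) • g n w := by
      intro n
      refine DifferentiableOn.circleIntegral_sub_inv_smul ((hgd n).mono fun z hz => ?_) hw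
      obtain ⟨h1, h2⟩ := hballs z hz
      exact ⟨by linarith, by linarith⟩
    have hd : 0 < R / 2 - ‖w - c‖ := by
      rw [mem_ball, dist_eq_norm] at hw; linarith
    have hlimI : Tendsto (fun n => ∮ ζ in C(c, R / 2), (ζ - w)⁻¹ • g n ζ) atTop
        (𝓝 (∮ ζ in C(c, R / 2), (ζ - w)⁻¹ • f ζ)) := by
      have hcw : ∀ θ, R / 2 - ‖w - c‖ ≤ ‖circleMap (c : ℂ) (R / 2) θ - w‖ := by
        intro θ
        have h1 := hcm θ
        rw [mem_sphere, dist_eq_norm] at h1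
        have := norm_sub_norm_le (circleMap (c : ℂ) (R / 2) θ - c) (w - c)
        rw [h1, sub_sub_sub_cancel_right] at this
        exact this
      refine intervalIntegral.tendsto_integral_filter_of_dominated_convergence
        (fun _ => R / 2 * ((R / 2 - ‖w - c‖)⁻¹ * 1)) (.of_forall fun n => ?_)
        (.of_forall fun n => ?_) intervalIntegrable_const ?_
      · refine Continuous.aestronglyMeasurable ?_
        refine Continuous.fun_smul ?_ (Continuous.fun_smul (Continuous.inv₀ ?_ ?_) ?_)
        · rw [show deriv (circleMap (c : ℂ) (R / 2)) = fun θ => circleMap 0 (R / 2) θ * I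
            from funext fun θ => deriv_circleMap _ _ θ]
          fun_prop
        · fun_prop
        · intro θ h0; have := hcw θ; rw [h0, norm_zero] at this; linarith
        · exact (hgc n).comp (continuous_circleMap _ _)
      · rw [← ae_restrict_iff' measurableSet_uIoc]
        filter_upwards [hae] with θ hθ
        rw [norm_smul, norm_smul, norm_inv, deriv_circleMap]
        gcongr
        · simp [abs_of_pos (half_pos hR)]
        · exact hcw θ
        · exact hgb n _ (hcm' θ) hθ
      · rw [← ae_restrict_iff' measurableSet_uIoc]
        filter_upwards [hae] with θ hθ
        exact ((hlim _ (hcm' θ) hθ).const_smul _).const_smul _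
    have h2 : Tendsto (fun n => (2 * π * I : ℂ) • g n w) atTop
        (𝓝 ((2 * π * I : ℂ) • f w)) :=
      (hlim w (ball_subset_closedBall hw) hwi).const_smul _
    simp only [← hdisc] at h2
    rw [tendsto_nhds_unique hlimI h2, inv_smul_smul₀]
    simp [Real.pi_ne_zero]

/-- Finite continued fractions approximating the `m`-function. -/
def mN (lam α : ℝ) : ℕ → ℂ → ℝ → ℂ
  | 0, E, x => E - pot lam (x - α : ℝ)
  | n + 1, E, x => E - pot lam (x - α : ℝ) - (mN lam α n E (x - α))⁻¹

/-- The `m`-function of the half line, for energies in the upper half plane. -/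
def mf (lam α : ℝ) (E : ℂ) (x : ℝ) : ℂ := limUnder atTop fun n => mN lam α n E x

theorem pot_ofReal (x : ℝ) : pot lam x = ((2 * lam * Real.cos (2 * π * x) : ℝ) : ℂ) := by
  simp [pot]

theorem pot_ofReal_im (x : ℝ) : (pot lam x).im = 0 := by
  rw [pot_ofReal]; exact ofReal_im _

theorem norm_pot_ofReal_le (x : ℝ) : ‖pot lam x‖ ≤ 2 * |lam| := by
  simpa using norm_pot_le (lam := lam) (x := x) (ε := 0) (by simp)

theorem im_neg_inv (z : ℂ) : (-z⁻¹).im = z.im / normSq z := by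
  rw [Complex.neg_im, Complex.inv_im]; ring

theorem im_neg_inv_nonneg {z : ℂ} (hz : 0 ≤ z.im) : 0 ≤ (-z⁻¹).im := by
  rw [im_neg_inv]; exact div_nonneg hz (Complex.normSq_nonneg _)

theorem norm_inv_le_of_im {z : ℂ} {η : ℝ} (hη : 0 < η) (hz : η ≤ z.im) : ‖z⁻¹‖ ≤ η⁻¹ := by
  rw [norm_inv]
  exact inv_anti₀ hη (hz.trans ((le_abs_self _).trans (abs_im_le_norm z)))

theorem mN_im (hE : 0 < E.im) (n : ℕ) (x : ℝ) : E.im ≤ (mN lam α n E x).im := by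
  induction n generalizing x with
  | zero => rw [mN, sub_im, pot_ofReal_im, sub_zero]
  | succ n ih =>
    rw [mN, sub_eq_add_neg, add_im, sub_im, pot_ofReal_im, sub_zero]
    linarith [im_neg_inv_nonneg (hE.le.trans (ih (x - α)))]

theorem mN_norm_le (hE : 0 < E.im) (n : ℕ) (x : ℝ) :
    ‖mN lam α n E x‖ ≤ ‖E‖ + 2 * |lam| + E.im⁻¹ := by
  have h0 : ‖E - pot lam (x - α : ℝ)‖ ≤ ‖E‖ + 2 * |lam| :=
    (norm_sub_le _ _).trans (by gcongr; exact norm_pot_ofReal_le _)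
  cases n with
  | zero => rw [mN]; have := inv_pos.2 hE; linarith
  | succ n =>
    rw [mN]
    exact (norm_sub_le _ _).trans (add_le_add h0 (norm_inv_le_of_im hE (mN_im hE n _)))

theorem mN_ne_zero (hE : 0 < E.im) (n : ℕ) (x : ℝ) : mN lam α n E x ≠ 0 := by
  intro h
  have := mN_im (lam := lam) (α := α) hE n x
  rw [h, Complex.zero_im] at this
  linarith

/-- Contraction for the hyperbolic distance under `z ↦ c - 1 / z`. -/
theorem contraction {z w c : ℂ} {η : ℝ} (hη : 0 < η) (hz : η ≤ z.im) (hw : η ≤ w.im)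
    (hc : η ≤ c.im) {d : ℝ} (h : ‖z - w‖ ^ 2 ≤ d * (z.im * w.im)) :
    ‖(c - z⁻¹) - (c - w⁻¹)‖ ^ 2 ≤ d / (1 + η ^ 2) ^ 2 * ((c - z⁻¹).im * (c - w⁻¹).im) := by
  have hz0 : z ≠ 0 := by rintro rfl; simp at hz; linarith
  have hw0 : w ≠ 0 := by rintro rfl; simp at hw; linarith
  have key : ∀ u : ℂ, η ≤ u.im → (1 + η ^ 2) * (u.im / normSq u) ≤ (c - u⁻¹).im := by
    intro u hu
    have hn : η * u.im ≤ normSq u := by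
      rw [normSq_apply]; nlinarith [mul_self_nonneg u.re]
    have hpos : 0 < normSq u := by nlinarith
    have : η * (η * u.im / normSq u) ≤ η * 1 := by
      gcongr; rwa [div_le_one hpos]
    rw [sub_eq_add_neg, add_im, im_neg_inv]
    calc (1 + η ^ 2) * (u.im / normSq u) =
        u.im / normSq u + η * (η * u.im / normSq u) := by ring
      _ ≤ _ := by linarith
  have e : (c - z⁻¹) - (c - w⁻¹) = (z - w) / (z * w) := by field_simp; ring
  have hnz := normSq_pos.2 hz0
  have hnw := normSq_pos.2 hw0
  have hzi : 0 < z.im := hη.trans_le hz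
  have hwi : 0 < w.im := hη.trans_le hw
  have hd : 0 ≤ d := by
    by_contra! hd
    nlinarith [mul_pos hzi hwi, sq_nonneg ‖z - w‖]
  rw [e, norm_div, div_pow, norm_mul, mul_pow, ← normSq_eq_norm_sq z,
    ← normSq_eq_norm_sq w]
  calc ‖z - w‖ ^ 2 / (normSq z * normSq w)
      ≤ d * (z.im * w.im) / (normSq z * normSq w) := by gcongr
    _ = d / (1 + η ^ 2) ^ 2 * (((1 + η ^ 2) * (z.im / normSq z)) *
        ((1 + η ^ 2) * (w.im / normSq w))) := by field_simp
    _ ≤ _ := by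
        gcongr
        · exact (by positivity : (0 : ℝ) ≤ _).trans (key z hz)
        · exact key z hz
        · exact key w hw

theorem mN_succ_sub (hE : 0 < E.im) {η R : ℝ} (hη : 0 < η) (hηE : η ≤ E.im) (hR : ‖E‖ ≤ R)
    (n : ℕ) (x : ℝ) : ‖mN lam α (n + 1) E x - mN lam α n E x‖ ≤
      (1 + η ^ 2)⁻¹ ^ n * (η⁻¹ ^ 2 * (R + 2 * |lam| + η⁻¹)) := by
  have hB : ∀ n x, (mN lam α n E x).im ≤ R + 2 * |lam| + η⁻¹ := fun n x =>
    (le_abs_self _).trans ((abs_im_le_norm _).trans ((mN_norm_le hE n x).trans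
      (by gcongr)))
  have hi : ∀ n x, η ≤ (mN lam α n E x).im := fun n x => hηE.trans (mN_im hE n x)
  have key : ∀ n x, ‖mN lam α (n + 1) E x - mN lam α n E x‖ ^ 2 ≤
      (η⁻¹ ^ 4 / ((1 + η ^ 2) ^ 2) ^ n) *
        ((mN lam α (n + 1) E x).im * (mN lam α n E x).im) := by
    intro n
    induction n with
    | zero =>
      intro x
      have : mN lam α 1 E x - mN lam α 0 E x = -(mN lam α 0 E (x - α))⁻¹ := by
        simp only [mN]; ring
      rw [zero_add, this, norm_neg, pow_zero, div_one]
      calc _ ≤ η⁻¹ ^ 2 := by gcongr; exact norm_inv_le_of_im hη (hi 0 _)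
        _ = η⁻¹ ^ 4 * (η * η) := by field_simp
        _ ≤ _ := by gcongr; exacts [hη.le.trans (hi 1 x), hi 1 x, hi 0 x]
    | succ n ih =>
      intro x
      have := contraction (c := E - pot lam (x - α : ℝ)) hη (hi (n + 1) (x - α)) (hi n (x - α))
        (by rw [sub_im, pot_ofReal_im, sub_zero]; exact hηE) (ih (x - α))
      rw [div_div, ← pow_succ] at this
      exact this
  refine abs_le_of_sq_le_sq' ?_ ?_ |>.2
  · refine (key n x).trans ?_
    have h1 : (mN lam α (n + 1) E x).im * (mN lam α n E x).im ≤
        (R + 2 * |lam| + η⁻¹) * (R + 2 * |lam| + η⁻¹) := by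
      gcongr
      · exact hη.le.trans (hi n x)
      · exact (hη.le.trans (hi n x)).trans (hB n x)
      · exact hB _ _
      · exact hB _ _
    calc _ ≤ (η⁻¹ ^ 4 / ((1 + η ^ 2) ^ 2) ^ n) *
        ((R + 2 * |lam| + η⁻¹) * (R + 2 * |lam| + η⁻¹)) := by gcongr
      _ = _ := by simp only [div_eq_mul_inv, ← inv_pow]; ring
  · have := (norm_nonneg E).trans hR
    positivity

theorem tendsto_mN_aux {η R : ℝ} (hη : 0 < η) : UniformCauchySeqOn
    (fun n (p : ℂ × ℝ) => mN lam α n p.1 p.2) atTop {p | η ≤ p.1.im ∧ ‖p.1‖ ≤ R} := by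
  rw [Metric.uniformCauchySeqOn_iff]
  intro ε hε
  set r := (1 + η ^ 2)⁻¹ with hr
  have hr1 : r < 1 := inv_lt_one_of_one_lt₀ (by nlinarith)
  have hr0 : 0 < r := by positivity
  set K := η⁻¹ ^ 2 * (|R| + 2 * |lam| + η⁻¹)
  have hK : 0 < K := by positivity
  have : Tendsto (fun n : ℕ => K * r ^ n / (1 - r)) atTop (𝓝 0) := by
    have := ((tendsto_pow_atTop_nhds_zero_of_lt_one hr0.le hr1).const_mul K).div_const (1 - r)
    simpa using this
  obtain ⟨N, hN⟩ := (this.eventually (gt_mem_nhds (half_pos hε))).exists_forall_of_atTop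
  have h2 : ∀ n ≥ N, ∀ p ∈ {p : ℂ × ℝ | η ≤ p.1.im ∧ ‖p.1‖ ≤ R},
      dist (mN lam α N p.1 p.2) (mN lam α n p.1 p.2) < ε / 2 := by
    intro n hn p hp
    have hd : ∀ k, dist (mN lam α k p.1 p.2) (mN lam α (k + 1) p.1 p.2) ≤ K * r ^ k := by
      intro k
      rw [dist_comm, dist_eq_norm, mul_comm]
      exact mN_succ_sub (hη.trans_le hp.1) hη hp.1 (hp.2.trans (le_abs_self R)) k p.2
    refine (dist_le_Ico_sum_of_dist_le hn (d := fun k => K * r ^ k) fun {k} _ _ => hd k).trans_lt ?_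
    rw [← mul_sum]
    refine lt_of_le_of_lt ?_ (hN N le_rfl)
    rw [mul_div_assoc]
    gcongr
    rw [geom_sum_Ico hr1.ne hn, ← neg_div_neg_eq, neg_sub, neg_sub]
    have : 0 < 1 - r := by linarith
    gcongr
    have := pow_pos hr0 n
    linarith
  refine ⟨N, fun m hm n hn p hp => ?_⟩
  have := dist_triangle_left (mN lam α m p.1 p.2) (mN lam α n p.1 p.2) (mN lam α N p.1 p.2)
  linarith [h2 m hm p hp, h2 n hn p hp]

theorem tendsto_mN (hE : 0 < E.im) (x : ℝ) :
    Tendsto (fun n => mN lam α n E x) atTop (𝓝 (mf lam α E x)) := by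
  obtain ⟨l, hl⟩ := cauchySeq_tendsto_of_complete
    ((tendsto_mN_aux (lam := lam) (α := α) (R := ‖E‖) hE).cauchySeq (x := (E, x)) ⟨le_rfl, le_rfl⟩)
  have hl' : Tendsto (fun n => mN lam α n E x) atTop (𝓝 l) := hl
  rw [mf, hl'.limUnder_eq]
  exact hl'

theorem tendstoUniformlyOn_mN (lam α : ℝ) {η R : ℝ} (hη : 0 < η) : TendstoUniformlyOn
    (fun n (p : ℂ × ℝ) => mN lam α n p.1 p.2) (fun p => mf lam α p.1 p.2) atTop
    {p | η ≤ p.1.im ∧ ‖p.1‖ ≤ R} :=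
  (tendsto_mN_aux hη).tendstoUniformlyOn_of_tendsto fun p hp => tendsto_mN (hη.trans_le hp.1) p.2

theorem mf_im (lam α : ℝ) (hE : 0 < E.im) (x : ℝ) : E.im ≤ (mf lam α E x).im :=
  ge_of_tendsto ((continuous_im.tendsto _).comp (tendsto_mN hE x))
    (.of_forall fun n => mN_im hE n x)

theorem mf_ne_zero (lam α : ℝ) (hE : 0 < E.im) (x : ℝ) : mf lam α E x ≠ 0 := by
  intro h
  have := mf_im lam α hE x
  rw [h, Complex.zero_im] at this
  linarith

theorem mf_riccati' (lam α : ℝ) (hE : 0 < E.im) (x : ℝ) :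
    mf lam α E x = E - pot lam (x - α : ℝ) - (mf lam α E (x - α))⁻¹ :=
  tendsto_nhds_unique ((tendsto_mN hE x).comp (tendsto_add_atTop_nat 1))
    (((tendsto_mN hE (x - α)).inv₀ (mf_ne_zero _ _ hE _)).const_sub _)

theorem mf_riccati (hE : 0 < E.im) (x : ℝ) :
    mf lam α E (x + α) = E - pot lam x - (mf lam α E x)⁻¹ := by
  simpa using mf_riccati' lam α hE (x + α)

theorem mN_periodic (n : ℕ) (x : ℝ) : mN lam α n E (x + 1) = mN lam α n E x := by
  have hp : ∀ x : ℝ, pot lam (x + 1 - α : ℝ) = pot lam (x - α : ℝ) := fun x => by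
    rw [← pot_periodic ((x - α : ℝ) : ℂ)]; congr 1; push_cast; ring
  induction n generalizing x with
  | zero => simp only [mN, hp]
  | succ n ih =>
    rw [mN, mN, hp, ← ih (x - α)]
    congr 3; ring

theorem mf_periodic (x : ℝ) : mf lam α E (x + 1) = mf lam α E x := by
  simp only [mf, mN_periodic]

theorem continuous_pot : Continuous (pot lam) := by unfold pot; fun_prop

theorem continuousOn_mN (n : ℕ) : ContinuousOn (fun p : ℂ × ℝ => mN lam α n p.1 p.2)
    {p | 0 < p.1.im} := by
  induction n with
  | zero => 
    have := continuous_pot (lam := lam)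
    simp only [mN]; fun_prop
  | succ n ih =>
    have := continuous_pot (lam := lam)
    simp only [mN]
    refine ContinuousOn.sub (by fun_prop) (ContinuousOn.inv₀ ?_ fun p hp => mN_ne_zero hp _ _)
    exact ih.comp (f := fun p : ℂ × ℝ => (p.1, p.2 - α)) (by fun_prop) fun p hp => hp

theorem isOpen_uhp : IsOpen {z : ℂ | 0 < z.im} := isOpen_lt continuous_const continuous_im

theorem differentiableOn_mN (n : ℕ) (x : ℝ) :
    DifferentiableOn ℂ (fun E => mN lam α n E x) {z | 0 < z.im} := by
  induction n generalizing x with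
  | zero => simp only [mN]; fun_prop
  | succ n ih =>
    simp only [mN]
    exact DifferentiableOn.sub (by fun_prop) ((ih (x - α)).inv fun p hp => mN_ne_zero hp _ _)

theorem continuousOn_mf : ContinuousOn (fun p : ℂ × ℝ => mf lam α p.1 p.2) {p | 0 < p.1.im} := by
  intro p hp
  have hp' : 0 < p.1.im := hp
  have hnhd : {q : ℂ × ℝ | p.1.im / 2 ≤ q.1.im ∧ ‖q.1‖ ≤ ‖p.1‖ + 1} ∈ 𝓝 p := by
    have h1 : IsOpen {q : ℂ × ℝ | p.1.im / 2 < q.1.im} := isOpen_lt (by fun_prop) (by fun_prop)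
    have h2 : IsOpen {q : ℂ × ℝ | ‖q.1‖ < ‖p.1‖ + 1} := isOpen_lt (by fun_prop) (by fun_prop)
    filter_upwards [h1.mem_nhds (by simp only [mem_ofPred_eq]; linarith),
      h2.mem_nhds (by simp only [mem_ofPred_eq]; linarith)] with q hq1 hq2
    exact ⟨le_of_lt hq1, le_of_lt hq2⟩
  have := (tendstoUniformlyOn_mN lam α (R := ‖p.1‖ + 1)
    (half_pos hp')).continuousOn (Frequently.of_forall fun n => (continuousOn_mN n).mono
      fun q hq => (half_pos hp').trans_le hq.1)
  exact (this.continuousAt hnhd).continuousWithinAt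

theorem differentiableOn_mf (lam α : ℝ) (x : ℝ) :
    DifferentiableOn ℂ (fun E => mf lam α E x) {z | 0 < z.im} := by
  refine TendstoLocallyUniformlyOn.differentiableOn (F := fun n E => mN lam α n E x) (φ := atTop)
    ?_ (.of_forall fun n => differentiableOn_mN n x) isOpen_uhp
  rw [tendstoLocallyUniformlyOn_iff_forall_isCompact isOpen_uhp]
  intro K hK hKc
  rcases K.eq_empty_or_nonempty with rfl | hne
  · exact tendstoUniformlyOn_empty
  obtain ⟨z₀, hz₀, hmin⟩ := hKc.exists_isMinOn hne continuous_im.continuousOn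
  obtain ⟨R, hR⟩ := hKc.exists_bound_of_continuousOn (f := id) continuousOn_id
  have := (tendstoUniformlyOn_mN lam α (R := R) (hK hz₀)).comp
    (fun z : ℂ => (z, x))
  exact this.mono fun z hz => ⟨hmin hz, hR z hz⟩

theorem continuous_mf (hE : 0 < E.im) : Continuous (mf lam α E) := by
  rw [← continuousOn_univ]
  exact continuousOn_mf.comp (f := fun x : ℝ => (E, x)) (by fun_prop) fun x _ => hE

theorem cp_mf (lam α : ℝ) (hE : 0 < E.im) : CP (mf lam α E) := ⟨continuous_mf hE, mf_periodic⟩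

theorem integral_shift {F : Type*} [NormedAddCommGroup F] [NormedSpace ℝ F] {f : ℝ → F}
    (hf : ∀ x, f (x + 1) = f x) (a : ℝ) :
    ∫ x in (0 : ℝ)..1, f (x + a) = ∫ x in (0 : ℝ)..1, f x := by
  rw [intervalIntegral.integral_comp_add_right (fun x => f x)]
  have := Function.Periodic.intervalIntegral_add_eq (f := f) (T := 1) hf (0 + a) 0
  rw [show (1 : ℝ) + a = 0 + a + 1 by ring, this, zero_add]

theorem integral_reflect {F : Type*} [NormedAddCommGroup F] [NormedSpace ℝ F] {f : ℝ → F}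
    (hf : ∀ x, f (x + 1) = f x) (a : ℝ) :
    ∫ x in (0 : ℝ)..1, f (a - x) = ∫ x in (0 : ℝ)..1, f x := by
  rw [intervalIntegral.integral_comp_sub_left (fun x => f x)]
  have := Function.Periodic.intervalIntegral_add_eq (f := f) (T := 1) hf (a - 1) 0
  rw [show a - 0 = a - 1 + 1 by ring, this, zero_add]

/-- Solutions of the Riccati equation give eigen-directions of the transfer matrices. -/
theorem An_mulVec {M : ℝ → ℂ} {z : ℂ} (h0 : ∀ x, M x ≠ 0)
    (hr : ∀ x, M (x + α) = E - pot lam (z + x) - (M x)⁻¹) (n : ℕ) (x : ℝ) :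
    (An lam α E n (z + x)).mulVec ![M x, 1] =
      (∏ j ∈ range n, M (x + j * α)) • ![M (x + n * α), 1] := by
  induction n with
  | zero => simp [An_zero]
  | succ n ih =>
    rw [An_succ, ← Matrix.mulVec_mulVec, ih, Matrix.mulVec_smul, prod_range_succ, mul_smul]
    congr 1
    have h1 := hr (x + n * α)
    have h2 := h0 (x + n * α)
    push_cast at h1
    rw [← add_assoc] at h1
    rw [show x + ((n + 1 : ℕ) : ℝ) * α = x + n * α + α by push_cast; ring, h1]
    ext i
    fin_cases i
    · simp [tm, mulVec, dotProduct, Fin.sum_univ_two]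
      field_simp
      ring
    · simp [tm, mulVec, dotProduct, Fin.sum_univ_two]

/-- The transfer matrices are controlled by two independent solutions of the Riccati equation. -/
theorem norm_An_le_of_riccati {M M' : ℝ → ℂ} {z : ℂ} (h0 : ∀ x, M x ≠ 0) (h0' : ∀ x, M' x ≠ 0)
    (hr : ∀ x, M (x + α) = E - pot lam (z + x) - (M x)⁻¹)
    (hr' : ∀ x, M' (x + α) = E - pot lam (z + x) - (M' x)⁻¹) {B δ T : ℝ} (hB : 1 ≤ B) (hδ : 0 < δ)
    (hM : ∀ x, ‖M x‖ ≤ B) (hM' : ∀ x, ‖M' x‖ ≤ B) {n : ℕ} {x : ℝ} (hd : δ ≤ ‖M x - M' x‖)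
    (hT : ‖∏ j ∈ range n, M (x + j * α)‖ ≤ T)
    (hT' : ‖∏ j ∈ range n, M' (x + j * α)‖ ≤ T) :
    ‖An lam α E n (z + x)‖ ≤ 2 * (2 * (B ^ 2 * T) / δ) := by
  have e1 := An_mulVec h0 hr n x
  have e2 := An_mulVec h0' hr' n x
  set S := ∏ j ∈ range n, M (x + j * α)
  set S' := ∏ j ∈ range n, M' (x + j * α)
  have hT0 : 0 ≤ T := (norm_nonneg _).trans hT
  have hb : ∀ a b c d : ℂ, ‖a‖ ≤ B → ‖b‖ ≤ B → ‖c‖ ≤ B → ‖d‖ ≤ B →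
      ‖a * b * S - c * d * S'‖ ≤ 2 * (B ^ 2 * T) := by
    intro a b c d ha hb hc hd
    have h1 : ‖a * b * S‖ ≤ B * B * T := by rw [norm_mul, norm_mul]; gcongr
    have h2 : ‖c * d * S'‖ ≤ B * B * T := by rw [norm_mul, norm_mul]; gcongr
    refine (norm_sub_le _ _).trans ?_
    nlinarith
  have h1 : ‖(1 : ℂ)‖ ≤ B := by simpa using hB
  have f1 : ∀ i, An lam α E n (z + x) i 0 * M x + An lam α E n (z + x) i 1 =
      S * (![M (x + n * α), 1] : Fin 2 → ℂ) i := by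
    intro i
    have := congrFun e1 i
    simpa [mulVec, dotProduct, Fin.sum_univ_two] using this
  have f2 : ∀ i, An lam α E n (z + x) i 0 * M' x + An lam α E n (z + x) i 1 =
      S' * (![M' (x + n * α), 1] : Fin 2 → ℂ) i := by
    intro i
    have := congrFun e2 i
    simpa [mulVec, dotProduct, Fin.sum_univ_two] using this
  have hv : ∀ i, ‖(![M (x + n * α), 1] : Fin 2 → ℂ) i‖ ≤ B := by
    intro i; fin_cases i
    · exact hM _
    · exact h1
  have hv' : ∀ i, ‖(![M' (x + n * α), 1] : Fin 2 → ℂ) i‖ ≤ B := by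
    intro i; fin_cases i
    · exact hM' _
    · exact h1
  refine norm_le_of_entry_le fun i j => ?_
  rw [le_div_iff₀ hδ]
  refine (mul_le_mul_of_nonneg_left hd (norm_nonneg _)).trans ?_
  rw [← norm_mul]
  obtain rfl | rfl : j = 0 ∨ j = 1 := by fin_cases j <;> simp
  · have := hb _ _ _ _ h1 (hv i) h1 (hv' i)
    refine le_of_eq_of_le (congrArg _ ?_) this
    linear_combination f1 i - f2 i
  · have := hb _ _ _ _ (by rw [norm_neg]; exact hM' x) (hv i) (by rw [norm_neg]; exact hM x) (hv' i)
    refine le_of_eq_of_le (congrArg _ ?_) this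
    linear_combination -M' x * f1 i + M x * f2 i

theorem CP.prod_growth (hα : Irrational α) {M : ℝ → ℂ} (hM : CP M) (h0 : ∀ x, M x ≠ 0)
    {κ : ℝ} (hκ : 0 < κ) : ∃ C, 0 < C ∧ ∀ (n : ℕ) (x : ℝ),
      ‖∏ j ∈ range n, M (x + j * α)‖ ≤
        C * exp (n * ((∫ x in (0 : ℝ)..1, log ‖M x‖) + κ)) ∧
      exp (n * ((∫ x in (0 : ℝ)..1, log ‖M x‖) - κ)) ≤
        C * ‖∏ j ∈ range n, M (x + j * α)‖ := by
  have hf : CP (fun x => ((log ‖M x‖ : ℝ) : ℂ)) :=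
    ⟨continuous_ofReal.comp (hM.cont.norm.log fun x => norm_ne_zero_iff.2 (h0 x)),
      fun x => by simp only [hM.per]⟩
  obtain ⟨C, hC, h⟩ := hf.ergodic hα hκ
  refine ⟨exp C, exp_pos _, fun n x => ?_⟩
  have hx := h n x
  rw [intervalIntegral.integral_ofReal, ← Complex.ofReal_sum, ← Complex.ofReal_natCast,
    ← Complex.ofReal_mul, ← ofReal_sub, norm_real, norm_eq_abs, abs_le] at hx
  have hp : ‖∏ j ∈ range n, M (x + j * α)‖ =
      exp (∑ j ∈ range n, log ‖M (x + j * α)‖) := by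
    rw [Real.exp_sum, norm_prod]
    exact prod_congr rfl fun j _ => (exp_log (norm_pos_iff.2 (h0 _))).symm
  rw [hp, ← exp_add, ← exp_add]
  constructor <;> apply exp_le_exp.2 <;> linarith [hx.1, hx.2]

/-- The `m`-function of the other half line. -/
def mp (lam α : ℝ) (E : ℂ) (x : ℝ) : ℂ := (mf lam α E (α - x))⁻¹

/-- The Wronskian of the two half line solutions. -/
def Dl (lam α : ℝ) (E : ℂ) (x : ℝ) : ℂ := mf lam α E x - mp lam α E x

theorem mp_ne_zero (lam α : ℝ) (hE : 0 < E.im) (x : ℝ) : mp lam α E x ≠ 0 :=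
    inv_ne_zero (mf_ne_zero _ _ hE _)

theorem mp_eq (hE : 0 < E.im) (x : ℝ) :
    mp lam α E x = E - pot lam (x - α : ℝ) - mf lam α E (2 * α - x) := by
  have h := mf_riccati (lam := lam) (α := α) hE (α - x)
  rw [show α - x + α = 2 * α - x by ring, show ((α - x : ℝ) : ℂ) = -((x - α : ℝ) : ℂ) by
    push_cast; ring, pot_neg] at h
  rw [mp, h]; ring

theorem mp_riccati (hE : 0 < E.im) (x : ℝ) :
    mp lam α E (x + α) = E - pot lam x - (mp lam α E x)⁻¹ := by
  rw [mp_eq hE, mp, inv_inv]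
  simp only [add_sub_cancel_right]
  congr 2; ring

theorem mp_im (hE : 0 < E.im) (x : ℝ) :
    (mp lam α E x).im = E.im - (mf lam α E (2 * α - x)).im := by
  rw [mp_eq hE, sub_im, sub_im, pot_ofReal_im, sub_zero]

theorem cp_mp (hE : 0 < E.im) : CP (mp lam α E) := by
  refine ⟨Continuous.inv₀ ((continuous_mf hE).comp (by fun_prop)) fun x => mf_ne_zero _ _ hE _,
    fun x => ?_⟩
  rw [mp, mp, ← mf_periodic]; congr 2; ring

theorem Dl_im (hE : 0 < E.im) (x : ℝ) :
    (Dl lam α E x).im = (mf lam α E x).im + (mf lam α E (2 * α - x)).im - E.im := by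
  rw [Dl, sub_im, mp_im hE]; ring

theorem Dl_im_ge (hE : 0 < E.im) (x : ℝ) : E.im ≤ (Dl lam α E x).im := by
  rw [Dl_im hE]; linarith [mf_im lam α hE x,
    mf_im lam α hE (2 * α - x)]

theorem norm_Dl_ge (hE : 0 < E.im) (x : ℝ) : E.im ≤ ‖Dl lam α E x‖ :=
  (Dl_im_ge hE x).trans ((le_abs_self _).trans (abs_im_le_norm _))

theorem Dl_ne_zero (lam α : ℝ) (hE : 0 < E.im) (x : ℝ) : Dl lam α E x ≠ 0 :=
  norm_pos_iff.1 (hE.trans_le (norm_Dl_ge hE x))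

theorem cp_Dl (lam α : ℝ) (hE : 0 < E.im) : CP (Dl lam α E) := (cp_mf _ _ hE).sub (cp_mp hE)

theorem Dl_shift (hE : 0 < E.im) (x : ℝ) :
    Dl lam α E (x + α) = Dl lam α E x / (mf lam α E x * mp lam α E x) := by
  have h1 := mf_ne_zero lam α hE x
  have h2 := mp_ne_zero lam α hE x
  rw [Dl, Dl, mf_riccati hE, mp_riccati hE]
  field_simp
  ring

/-- The complexified Lyapunov exponent. -/
def w (lam α : ℝ) (E : ℂ) : ℂ := ∫ x in (0 : ℝ)..1, Complex.log (mf lam α E x)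

theorem mf_mem_slitPlane (hE : 0 < E.im) (x : ℝ) : mf lam α E x ∈ Complex.slitPlane := by
  rw [Complex.mem_slitPlane_iff]
  exact Or.inr (hE.trans_le (mf_im _ _ hE x)).ne'

theorem continuous_deriv_mf (hE : 0 < E.im) :
    Continuous (fun x => deriv (fun E => mf lam α E x) E) := by
  rw [continuous_iff_continuousAt]
  intro x
  refine (continuousOn_deriv_param isOpen_uhp (F := fun E x => mf lam α E x) (a := x - 1)
    (b := x + 1) (continuousOn_mf.mono fun p hp => hp.1) (fun y _ => differentiableOn_mf _ _ y)
    hE).continuousAt (Icc_mem_nhds (by linarith) (by linarith))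

theorem deriv_mf_shift (hE : 0 < E.im) (x : ℝ) :
    deriv (fun E => mf lam α E (x + α)) E =
      1 + deriv (fun E => mf lam α E x) E / mf lam α E x ^ 2 := by
  have hd := ((differentiableOn_mf lam α x).differentiableAt
    (isOpen_uhp.mem_nhds hE)).hasDerivAt
  have h : (fun E => mf lam α E (x + α)) =ᶠ[𝓝 E] fun E => E - pot lam x - (mf lam α E x)⁻¹ := by
    filter_upwards [isOpen_uhp.mem_nhds hE] with z hz using mf_riccati hz x
  rw [h.deriv_eq, (((hasDerivAt_id' E).sub_const (pot lam x)).fun_sub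
    (hd.fun_inv (mf_ne_zero _ _ hE x))).deriv]
  ring

theorem integral_deriv_mf_div (hE : 0 < E.im) :
    ∫ x in (0 : ℝ)..1, deriv (fun E => mf lam α E x) E / mf lam α E x =
      ∫ x in (0 : ℝ)..1, (Dl lam α E x)⁻¹ := by
  have hDc := continuous_deriv_mf (lam := lam) (α := α) hE
  have hDp : ∀ x, deriv (fun E => mf lam α E (x + 1)) E = deriv (fun E => mf lam α E x) E := by
    intro x; simp only [mf_periodic]
  have hm := cp_mf lam α hE
  have hΔ := cp_Dl lam α hE
  have hm0 := mf_ne_zero lam α hE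
  have hp0 := mp_ne_zero lam α hE
  have hΔ0 := Dl_ne_zero lam α hE
  set D := fun x => deriv (fun E => mf lam α E x) E with hD
  set Q := fun x => D x / Dl lam α E x with hQ
  have hQc : Continuous Q := hDc.div hΔ.cont hΔ0
  have hQp : ∀ x, Q (x + 1) = Q x := fun x => by simp only [hQ, hD, hDp, hΔ.per]
  have hi : Continuous fun x => (Dl lam α E x)⁻¹ := hΔ.cont.inv₀ hΔ0
  have hj : Continuous fun x => D x / mf lam α E x := hDc.div hm.cont hm0
  have key : ∀ x, D x / mf lam α E x = (Dl lam α E (x + α))⁻¹ - (Q (x + α) - Q x) := by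
    intro x
    have h1 := hm0 x
    have h2 := hp0 x
    have h3 := hΔ0 x
    simp only [hQ, hD, deriv_mf_shift hE, Dl_shift hE]
    field_simp
    rw [Dl]; ring
  have e1 := integral_shift (f := fun x => (Dl lam α E x)⁻¹) (fun x => by simp only [hΔ.per]) α
  have e2 := integral_shift hQp α
  calc ∫ x in (0 : ℝ)..1, D x / mf lam α E x
      = ∫ x in (0 : ℝ)..1, ((Dl lam α E (x + α))⁻¹ - (Q (x + α) - Q x)) := by simp only [key]
    _ = _ := by
      have c1 : Continuous fun x => (Dl lam α E (x + α))⁻¹ := hi.comp (by fun_prop)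
      have c2 : Continuous fun x => Q (x + α) := hQc.comp (by fun_prop)
      have c3 : Continuous fun x => Q (x + α) - Q x := c2.sub hQc
      rw [integral_sub (c1.intervalIntegrable _ _)
        (c3.intervalIntegrable _ _), integral_sub
        (c2.intervalIntegrable _ _) (hQc.intervalIntegrable _ _), e1, e2]
      ring

theorem hasDerivAt_w (hE : 0 < E.im) :
    HasDerivAt (w lam α) (∫ x in (0 : ℝ)..1, (Dl lam α E x)⁻¹) E := by
  have := hasDerivAt_integral_param isOpen_uhp (F := fun E x => Complex.log (mf lam α E x))
    zero_le_one (ContinuousOn.clog (continuousOn_mf.mono fun p hp => hp.1) fun p hp =>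
      mf_mem_slitPlane hp.1 _) (fun x _ => (differentiableOn_mf _ _ x).clog fun z hz =>
      mf_mem_slitPlane hz x) hE
  rw [← integral_deriv_mf_div hE]
  refine this.congr_deriv (integral_congr fun x _ => ?_)
  have hd := ((differentiableOn_mf lam α x).differentiableAt
    (isOpen_uhp.mem_nhds hE)).hasDerivAt
  exact (hd.clog (mf_mem_slitPlane hE x)).deriv

theorem w_re (hE : 0 < E.im) :
    (w lam α E).re = ∫ x in (0 : ℝ)..1, log ‖mf lam α E x‖ := by
  have hc : Continuous fun x => Complex.log (mf lam α E x) :=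
    (continuous_mf hE).clog (mf_mem_slitPlane hE)
  have := Complex.reCLM.intervalIntegral_comp_comm (hc.intervalIntegrable (μ := volume) 0 1)
  simp only [Complex.reCLM_apply, Complex.log_re] at this
  exact this.symm

theorem mf_im_gt (lam α : ℝ) (hE : 0 < E.im) (x : ℝ) : E.im < (mf lam α E x).im := by
  have h := mf_riccati' lam α hE x
  have h1 : 0 < (-(mf lam α E (x - α))⁻¹).im := by
    rw [im_neg_inv]
    exact div_pos (hE.trans_le (mf_im _ _ hE _)) (normSq_pos.2 (mf_ne_zero _ _ hE _))
  rw [h, sub_eq_add_neg, add_im, sub_im, pot_ofReal_im]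
  linarith

theorem two_w_re (hE : 0 < E.im) :
    2 * (w lam α E).re = ∫ x in (0 : ℝ)..1,
      log ((mf lam α E x).im / ((mf lam α E x).im - E.im)) := by
  have hm := cp_mf lam α hE
  have hgt := mf_im_gt lam α hE
  have hpos : ∀ x, 0 < (mf lam α E x).im := fun x => hE.trans (hgt x)
  have c1 : Continuous fun x => log (mf lam α E x).im :=
    (continuous_im.comp hm.cont).log fun x => (hpos x).ne'
  have c2 : Continuous fun x => log ((mf lam α E x).im - E.im) :=
    ((continuous_im.comp hm.cont).sub continuous_const).log fun x =>
      (sub_pos.2 (hgt x)).ne'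
  have key : ∀ x, 2 * log ‖mf lam α E x‖ = log (mf lam α E x).im -
      log ((mf lam α E (x + α)).im - E.im) := by
    intro x
    have h1 : (mf lam α E (x + α)).im - E.im = (mf lam α E x).im / ‖mf lam α E x‖ ^ 2 := by
      rw [mf_riccati hE, sub_eq_add_neg _ (mf lam α E x)⁻¹, add_im, sub_im,
        pot_ofReal_im, im_neg_inv, normSq_eq_norm_sq]
      ring
    rw [h1, Real.log_div (hpos x).ne' (by have := mf_ne_zero lam α hE x; positivity),
      Real.log_pow]
    push_cast; ring
  rw [w_re hE, ← integral_const_mul]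
  simp only [key]
  have c3 : Continuous fun x => log ((mf lam α E (x + α)).im - E.im) :=
    c2.comp (continuous_id.add continuous_const)
  rw [integral_sub (c1.intervalIntegrable _ _) (c3.intervalIntegrable _ _),
    integral_shift (f := fun x => log ((mf lam α E x).im - E.im))
      (fun x => by simp only [hm.per]) α,
    ← integral_sub (c1.intervalIntegrable _ _) (c2.intervalIntegrable _ _)]
  congr 1
  funext x
  rw [Real.log_div (hpos x).ne' (sub_pos.2 (hgt x)).ne']

theorem w_re_pos (hE : 0 < E.im) : 0 < (w lam α E).re := by
  have hm := cp_mf lam α hE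
  have hgt := mf_im_gt lam α hE
  have c : Continuous fun x => log ((mf lam α E x).im / ((mf lam α E x).im - E.im)) := by
    have c1 := continuous_im.comp hm.cont
    refine (c1.div (c1.sub continuous_const) fun x => (sub_pos.2 (hgt x)).ne').log fun x => ?_
    exact (div_pos (hE.trans (hgt x)) (sub_pos.2 (hgt x))).ne'
  have : 0 < 2 * (w lam α E).re := by
    rw [two_w_re hE]
    refine intervalIntegral.intervalIntegral_pos_of_pos (c.intervalIntegrable _ _) (fun x => ?_)
      zero_lt_one
    apply log_pos
    rw [one_lt_div (sub_pos.2 (hgt x))]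
    linarith
  linarith

theorem prod_mf_mul_prod_mp (lam α : ℝ) (hE : 0 < E.im) (n : ℕ) (x : ℝ) :
    (∏ j ∈ range n, mf lam α E (x + j * α)) *
      (∏ j ∈ range n, mp lam α E (x + j * α)) * Dl lam α E (x + n * α) =
      Dl lam α E x := by
  induction n with
  | zero => simp
  | succ n ih =>
    have h1 := mf_ne_zero lam α hE (x + n * α)
    have h2 := mp_ne_zero lam α hE (x + n * α)
    rw [← ih, prod_range_succ, prod_range_succ,
      show x + ((n + 1 : ℕ) : ℝ) * α = x + n * α + α by push_cast; ring, Dl_shift hE]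
    generalize mf lam α E (x + n * α) = a at *
    generalize mp lam α E (x + n * α) = b at *
    generalize (∏ j ∈ range n, mf lam α E (x + j * α)) = S
    generalize (∏ j ∈ range n, mp lam α E (x + j * α)) = S'
    generalize Dl lam α E (x + n * α) = d
    field_simp

/-- The Lyapunov exponent off the real axis. -/
theorem Lyap_eq (hα : Irrational α) (hE : 0 < E.im) :
    Lyap lam α E 0 = (w lam α E).re := by
  have hm := cp_mf lam α hE
  have hp := cp_mp (lam := lam) (α := α) hE
  obtain ⟨B₁, hB₁, hb₁⟩ := hm.norm_bdd
  obtain ⟨B₂, hB₂, hb₂⟩ := hp.norm_bdd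
  obtain ⟨B₃, hB₃, hb₃⟩ := (cp_Dl lam α hE).norm_bdd
  have hpos := w_re_pos (lam := lam) (α := α) hE
  apply le_antisymm
  · refine le_of_forall_pos_le_add fun κ hκ => ?_
    set κ' := min κ ((w lam α E).re) with hκ'
    have hκ'0 : 0 < κ' := lt_min hκ hpos
    obtain ⟨C, hC, h⟩ := hm.prod_growth hα (mf_ne_zero _ _ hE) hκ'0
    rw [← w_re hE] at h
    set T : ℕ → ℝ := fun n => max C (B₃ / E.im * C) * exp (n * ((w lam α E).re + κ)) with hT
    have key : ∀ (n : ℕ) (x : ℝ), ‖An lam α E n x‖ ≤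
        2 * (2 * ((max 1 (max B₁ B₂)) ^ 2 * T n) / E.im) := by
      intro n x
      rw [← zero_add (x : ℂ)]
      refine norm_An_le_of_riccati (mf_ne_zero _ _ hE) (mp_ne_zero _ _ hE)
        (by simpa using mf_riccati hE) (by simpa using mp_riccati hE)
        (le_max_left _ _) hE (fun x => (hb₁ x).trans ((le_max_left _ _).trans (le_max_right _ _)))
        (fun x => (hb₂ x).trans ((le_max_right _ _).trans (le_max_right _ _)))
        (norm_Dl_ge hE x) ?_ ?_
      · refine (h n x).1.trans ?_
        simp only [hT]
        have := min_le_left κ ((w lam α E).re)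
        gcongr
        exact le_max_left _ _
      · have h1 := prod_mf_mul_prod_mp lam α hE n x
        have h2 := (h n x).2
        set S := ∏ j ∈ range n, mf lam α E (x + j * α)
        set S' := ∏ j ∈ range n, mp lam α E (x + j * α)
        have h3 : ‖S‖ * ‖S'‖ * E.im ≤ B₃ := by
          calc _ ≤ ‖S‖ * ‖S'‖ * ‖Dl lam α E (x + n * α)‖ := by gcongr; exact norm_Dl_ge hE _
            _ = ‖Dl lam α E x‖ := by rw [← norm_mul, ← norm_mul, h1]
            _ ≤ B₃ := hb₃ x
        have h4 : 1 ≤ C * ‖S‖ := by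
          refine le_trans ?_ h2
          rw [Real.one_le_exp_iff]
          have := min_le_right κ ((w lam α E).re)
          have : 0 ≤ (w lam α E).re - κ' := by linarith
          positivity
        calc ‖S'‖ ≤ ‖S'‖ * (C * ‖S‖) := le_mul_of_one_le_right (norm_nonneg _) h4
          _ = C * (‖S‖ * ‖S'‖ * E.im) / E.im := by field_simp
          _ ≤ C * B₃ / E.im := by gcongr
          _ = B₃ / E.im * C * 1 := by ring
          _ ≤ T n := by
            simp only [hT]
            gcongr
            · exact le_max_right _ _
            · rw [Real.one_le_exp_iff]; positivity
    refine Lyap_le_of_growth (C := 2 * (2 * ((max 1 (max B₁ B₂)) ^ 2 * max C (B₃ / E.im * C)) /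
      E.im)) le_rfl fun n x hx => ?_
    have hx0 : x.im = 0 := abs_nonpos_iff.1 hx
    have hxr : x = (x.re : ℂ) := Complex.ext rfl (by simpa using hx0)
    rw [hxr]
    refine (key n x.re).trans (le_of_eq ?_)
    simp only [hT]; rw [mul_comm (n : ℝ)]; ring
  · by_contra! hlt
    obtain ⟨c, hc1, hc2⟩ := exists_between hlt
    obtain ⟨δ, hδ, C, hC, h⟩ := exists_growth le_rfl hc1
    set κ := ((w lam α E).re - c) / 2 with hκ
    have hκ0 : 0 < κ := by rw [hκ]; linarith
    obtain ⟨C', hC', h'⟩ := hm.prod_growth hα (mf_ne_zero _ _ hE) hκ0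
    rw [← w_re hE] at h'
    have key : ∀ n : ℕ, exp (n * κ) ≤ C' * (C * (B₁ + 1)) := by
      intro n
      have h1 := h E (by simpa using hδ) n 0 (by simp)
      have h2 := (h' n 0).2
      have h3 : ‖∏ j ∈ range n, mf lam α E (0 + j * α)‖ ≤
          ‖An lam α E n 0‖ * (B₁ + 1) := by
        have h4 := congrFun (An_mulVec (lam := lam) (α := α) (z := 0) (mf_ne_zero _ _ hE)
          (by simpa using mf_riccati hE) n 0) 1
        simp only [mulVec, dotProduct, Fin.sum_univ_two, Pi.smul_apply, smul_eq_mul,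
          Matrix.cons_val_zero, Matrix.cons_val_one, mul_one, Complex.ofReal_zero, add_zero] at h4
        rw [← h4]
        refine (norm_add_le _ _).trans ?_
        rw [norm_mul, mul_add, mul_one]
        gcongr
        · exact norm_entry_le _ _ _
        · exact hb₁ _
        · exact norm_entry_le _ _ _
      have h5 : exp (n * κ) * exp (c * n) =
          exp (n * ((w lam α E).re - κ)) := by
        rw [← exp_add]; congr 1; rw [hκ]; ring
      have h6 : exp (n * κ) * exp (c * n) ≤
          C' * (C * (B₁ + 1)) * exp (c * n) := by
        rw [h5]
        calc _ ≤ _ := h2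
          _ ≤ C' * (C * exp (c * n) * (B₁ + 1)) := by
            gcongr
            refine h3.trans ?_
            gcongr
          _ = _ := by ring
      exact le_of_mul_le_mul_right h6 (exp_pos _)
    have ht : Tendsto (fun n : ℕ => exp (n * κ)) atTop atTop :=
      Real.tendsto_exp_atTop.comp (tendsto_natCast_atTop_atTop.atTop_mul_const hκ0)
    obtain ⟨n, hn⟩ := (ht.eventually_gt_atTop (C' * (C * (B₁ + 1)))).exists
    linarith [key n]

theorem w_small (hα : Irrational α) {a b : ℝ} (hJ : ∀ t ∈ Icc a b, Lyap lam α (t : ℝ) 0 = 0)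
    {κ : ℝ} (hκ : 0 < κ) :
    ∃ η₀ > 0, ∀ t ∈ Icc a b, ∀ η : ℝ, 0 < η → η < η₀ → (w lam α (t + η * I)).re ≤ κ := by
  set U : Set ℂ := {E | ∃ δ > 0, ∀ E' : ℂ, ‖E' - E‖ < δ → Lyap lam α E' 0 ≤ κ} with hU
  have hUo : IsOpen U := by
    rw [Metric.isOpen_iff]
    rintro E ⟨δ, hδ, h⟩
    refine ⟨δ / 2, half_pos hδ, fun E' hE' => ⟨δ / 2, half_pos hδ, fun E'' hE'' => h _ ?_⟩⟩
    rw [mem_ball_iff_norm] at hE'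
    calc _ = ‖(E'' - E') + (E' - E)‖ := by ring_nf
      _ ≤ _ := norm_add_le _ _
      _ < δ := by linarith
  have hK : IsCompact ((fun t : ℝ => (t : ℂ)) '' Icc a b) :=
    isCompact_Icc.image continuous_ofReal
  obtain ⟨δ, hδ, h⟩ := hK.exists_thickening_subset_open hUo (by
    rintro _ ⟨t, ht, rfl⟩
    exact Lyap_usc le_rfl (by rw [hJ t ht]; exact hκ))
  refine ⟨δ, hδ, fun t ht η h0 h1 => ?_⟩
  have him : 0 < ((t : ℂ) + η * I).im := by simpa using h0
  rw [← Lyap_eq hα him]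
  obtain ⟨δ', hδ', h'⟩ := h (show (t : ℂ) + η * I ∈ _ from Metric.mem_thickening_iff.2
      ⟨(t : ℂ), ⟨t, ht, rfl⟩, by
    simpa [dist_eq_norm, abs_of_pos h0] using h1⟩)
  exact h' _ (by simpa using hδ')

theorem w_bounded (hα : Irrational α) (hE : 0 < E.im) {R : ℝ} (hR : ‖E‖ ≤ R) :
    (w lam α E).re ≤ log (Kb lam 0 R) := by
  rw [← Lyap_eq hα hE]
  have h1 := one_le_Kb (lam := lam) (ε := 0) ((norm_nonneg _).trans hR)
  refine Lyap_le_of_growth (C := 1) le_rfl fun n x hx => ?_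
  refine (norm_An_le hx hR n).trans (le_of_eq ?_)
  rw [one_mul, mul_comm, exp_nat_mul, exp_log (by linarith)]

/-- Near an interval of vanishing Lyapunov exponent, the exponent is at most linear in `Im E`. -/
theorem w_slope (hα : Irrational α) {a b ρ : ℝ} (hρ : 0 < ρ)
    (hJ : ∀ t ∈ Icc a b, Lyap lam α (t : ℝ) 0 = 0) :
    ∃ K > 0, ∀ t ∈ Icc (a + ρ) (b - ρ), ∀ η : ℝ, 0 < η → η < ρ →
      (w lam α (t + η * I)).re ≤ K * η := by
  set R := max |a| |b| + ρ + 1 with hRdef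
  have hR0 : 0 ≤ R := by positivity
  have hM1 := Real.log_nonneg (one_le_Kb (lam := lam) (ε := 0) hR0)
  set M := log (Kb lam 0 R) + 1 with hM
  have hM0 : 0 < M := by linarith
  refine ⟨2 * M / ρ, by positivity, fun t ht η h0 h1 => ?_⟩
  have key : ∀ κ > 0, ∀ᶠ δ : ℝ in 𝓝[>] 0,
      (w lam α (t + η * I + δ * I)).re ≤ 2 * M / ρ * η + κ := by
    intro κ hκ
    obtain ⟨η₀, hη₀, hs⟩ := w_small hα hJ hκ
    filter_upwards [Ioo_mem_nhdsGT (lt_min one_pos hη₀)] with δ hδ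
    have hδ1 := hδ.2.trans_le (min_le_left _ _)
    have hδ2 := hδ.2.trans_le (min_le_right _ _)
    set B : ℂ → ℂ := fun z => (M / ρ ^ 2 : ℝ) * ((z - t) ^ 2 - 2 * I * ρ * (z - t)) + (κ : ℝ)
      with hB
    have hBre : ∀ z : ℂ, (B z).re = M / ρ ^ 2 * ((z.re - t) ^ 2 - z.im ^ 2 + 2 * ρ * z.im) + κ := by
      intro z
      simp only [hB, add_re, ofReal_re, sub_re, sq,
        mul_re, mul_im, sub_im, ofReal_im, I_re,
        I_im, Complex.re_ofNat, Complex.im_ofNat]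
      ring
    set f : ℂ → ℂ := fun z => Complex.exp (w lam α (z + δ * I) - B z) with hf
    set U : Set ℂ := {z | ‖z - t‖ < ρ} ∩ {z | 0 < z.im} with hUdef
    have hUo : IsOpen U := (isOpen_lt (by fun_prop) continuous_const).inter isOpen_uhp
    have hcl : closure U ⊆ {z | ‖z - t‖ ≤ ρ} ∩ {z | 0 ≤ z.im} := by
      refine closure_minimal (fun z hz => ⟨le_of_lt (α := ℝ) hz.1,
        le_of_lt (α := ℝ) hz.2⟩) ?_
      exact (isClosed_le (by fun_prop) continuous_const).inter
        (isClosed_le continuous_const continuous_im)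
    have hfd : ∀ z : ℂ, 0 ≤ z.im → DifferentiableAt ℂ f z := by
      intro z hz
      have hp : 0 < (z + δ * I).im := by simpa using by linarith [hδ.1]
      have hw : DifferentiableAt ℂ (fun z => w lam α (z + δ * I)) z :=
        (hasDerivAt_w hp).differentiableAt.comp (f := fun z => z + δ * I) z (by fun_prop)
      exact (hw.sub (by simp only [hB]; fun_prop)).cexp
    have hbd : Bornology.IsBounded U := by
      refine (isBounded_ball (x := (t : ℂ)) (r := ρ)).subset fun z hz => ?_
      rw [mem_ball_iff_norm]; exact hz.1
    have hfr : ∀ z ∈ frontier U, ‖f z‖ ≤ 1 := by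
      intro z hz
      rw [frontier, hUo.interior_eq] at hz
      obtain ⟨hz1, hz2⟩ := hcl hz.1
      simp only [mem_ofPred_eq] at hz1 hz2
      have hp : 0 < (z + δ * I).im := by simpa using by linarith [hδ.1]
      rw [hf, Complex.norm_exp, Real.exp_le_one_iff, sub_re, hBre]
      have hn2 : ‖z - t‖ ^ 2 = (z.re - t) ^ 2 + z.im ^ 2 := by
        rw [← normSq_eq_norm_sq, normSq_apply]; simp; ring
      by_cases hz0 : z.im = 0
      · have hre : |z.re - t| ≤ ρ := by
          have := Complex.abs_re_le_norm (z - t)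
          simp only [sub_re, ofReal_re] at this
          linarith
        rw [abs_le] at hre
        have := hs z.re ⟨by linarith [ht.1], by linarith [ht.2]⟩ δ hδ.1 hδ2
        have hze : (z.re : ℂ) = z := Complex.ext rfl (by simp [hz0])
        rw [hze] at this
        rw [hz0]
        have : 0 ≤ M / ρ ^ 2 * ((z.re - t) ^ 2 - 0 ^ 2 + 2 * ρ * 0) := by
          have : 0 ≤ (z.re - t) ^ 2 - 0 ^ 2 + 2 * ρ * 0 := by nlinarith [sq_nonneg (z.re - t)]
          positivity
        linarith
      · have hzpos : 0 < z.im := lt_of_le_of_ne hz2 (Ne.symm hz0)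
        have hnorm : ‖z - t‖ = ρ := by
          refine le_antisymm hz1 ?_
          by_contra! hlt
          exact hz.2 ⟨hlt, hzpos⟩
        have hwb : (w lam α (z + δ * I)).re ≤ M - 1 := by
          rw [hM, add_sub_cancel_right]
          refine w_bounded hα hp ?_
          have h1 : ‖z‖ ≤ ‖z - t‖ + |t| := by
            have := norm_add_le (z - t) (t : ℂ)
            simpa using this
          have h2 : ‖z + δ * I‖ ≤ ‖z‖ + δ := by
            refine (norm_add_le _ _).trans ?_
            simp [abs_of_pos hδ.1]
          have h3 : |t| ≤ max |a| |b| :=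
            abs_le_max_abs_abs (by linarith [ht.1]) (by linarith [ht.2])
          rw [hRdef]; linarith
        rw [hnorm] at hn2
        have him : z.im ≤ ρ := by
          have := abs_im_le_norm (z - t)
          simp only [sub_im, ofReal_im, sub_zero] at this
          linarith [le_abs_self z.im]
        have h3 : M / ρ ^ 2 * ρ ^ 2 ≤ M / ρ ^ 2 * ((z.re - t) ^ 2 - z.im ^ 2 + 2 * ρ * z.im) := by
          gcongr
          nlinarith
        rw [div_mul_cancel₀ _ (by positivity)] at h3
        linarith
    have hzU : t + η * I ∈ closure U := by
      apply subset_closure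
      refine ⟨?_, by simpa using h0⟩
      simpa [abs_of_pos h0] using h1
    have := norm_le_of_forall_mem_frontier_norm_le hbd ⟨fun z hz =>
      (hfd z (le_of_lt hz.2)).differentiableWithinAt, fun z hz =>
      (hfd z (hcl hz).2).continuousAt.continuousWithinAt⟩ hfr hzU
    rw [hf, Complex.norm_exp, Real.exp_le_one_iff, sub_re, hBre] at this
    simp only [add_re, ofReal_re, mul_re, I_re, mul_zero,
      ofReal_im, I_im, mul_one, sub_self, add_zero, add_im,
      mul_im, zero_add] at this
    have e : M / ρ ^ 2 * (0 ^ 2 - η ^ 2 + 2 * ρ * η) ≤ 2 * M / ρ * η := by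
      have : 2 * M / ρ * η = M / ρ ^ 2 * (2 * ρ * η) := by field_simp
      rw [this]
      gcongr
      nlinarith [sq_nonneg η]
    linarith
  have hp : 0 < ((t : ℂ) + η * I).im := by simpa using h0
  have hc : Tendsto (fun δ : ℝ => (w lam α (t + η * I + δ * I)).re) (𝓝[>] 0)
      (𝓝 (w lam α (t + η * I)).re) := by
    have h1 : Tendsto (fun δ : ℝ => (t : ℂ) + η * I + δ * I) (𝓝[>] 0)
        (𝓝 (t + η * I)) := by
      have : Continuous fun δ : ℝ => (t : ℂ) + η * I + δ * I := by fun_prop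
      simpa using (this.tendsto 0).mono_left nhdsWithin_le_nhds
    exact (continuous_re.tendsto _).comp
      ((hasDerivAt_w (lam := lam) (α := α) hp).continuousAt.tendsto.comp h1)
  exact le_of_forall_pos_le_add fun κ hκ => le_of_tendsto hc (key κ hκ)

/-- The Cayley transform of the upper half plane onto the unit disc. -/
def cay (z : ℂ) : ℂ := (z - I) / (z + I)

theorem one_add_im_le_norm {z : ℂ} : 1 + z.im ≤ ‖z + I‖ := by
  have := abs_im_le_norm (z + I)
  simp only [add_im, I_im] at this
  linarith [le_abs_self (z.im + 1)]

theorem add_I_ne_zero {z : ℂ} (hz : 0 < z.im) : z + I ≠ 0 := by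
  rw [← norm_pos_iff]; linarith [one_add_im_le_norm (z := z)]

theorem normSq_add_I (z : ℂ) : ‖z + I‖ ^ 2 = z.re ^ 2 + (z.im + 1) ^ 2 := by
  rw [← normSq_eq_norm_sq, normSq_apply]; simp; ring

theorem normSq_sub_I (z : ℂ) : ‖z - I‖ ^ 2 = z.re ^ 2 + (z.im - 1) ^ 2 := by
  rw [← normSq_eq_norm_sq, normSq_apply]; simp; ring

theorem norm_cay_lt {z : ℂ} (hz : 0 < z.im) : ‖cay z‖ < 1 := by
  rw [cay, norm_div, div_lt_one (norm_pos_iff.2 (add_I_ne_zero hz))]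
  refine lt_of_pow_lt_pow_left₀ 2 (norm_nonneg _) ?_
  rw [normSq_add_I, normSq_sub_I]; nlinarith

theorem cay_sub {z u : ℂ} (hz : 0 < z.im) (hu : 0 < u.im) :
    cay z - cay u = 2 * I * (z - u) / ((z + I) * (u + I)) := by
  have h1 := add_I_ne_zero hz
  have h2 := add_I_ne_zero hu
  rw [cay, cay]; field_simp; ring

theorem norm_cay_sub_le {z u : ℂ} (hz : 0 < z.im) (hu : 0 < u.im) :
    ‖cay z - cay u‖ ≤ 2 * ‖z - u‖ := by
  rw [cay_sub hz hu, norm_div, norm_mul, norm_mul, norm_mul, norm_I, Complex.norm_ofNat,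
    mul_one]
  apply div_le_self (by positivity)
  nlinarith [one_add_im_le_norm (z := z), one_add_im_le_norm (z := u)]

theorem norm_cay_sub_sq_le {z u : ℂ} (hz : 0 < z.im) (hu : 0 < u.im) :
    ‖cay z - cay u‖ ^ 2 ≤ 2 * (1 / z.im + 1 / u.im) -
      8 * ((z.im + u.im) / ‖z - conj u‖ ^ 2) := by
  rw [cay_sub hz hu, norm_div, norm_mul, norm_mul, norm_mul, norm_I, Complex.norm_ofNat,
    mul_one, div_pow, mul_pow, mul_pow]
  have hp := one_add_im_le_norm (z := z)
  have hq := one_add_im_le_norm (z := u)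
  have hD : ‖z - conj u‖ ^ 2 = ‖z - u‖ ^ 2 + 4 * z.im * u.im := by
    rw [← normSq_eq_norm_sq, ← normSq_eq_norm_sq, normSq_apply,
      normSq_apply]
    simp; ring
  have hD2 : ‖z - conj u‖ ^ 2 ≤ 2 * (‖z + I‖ ^ 2 + ‖u + I‖ ^ 2) := by
    rw [normSq_add_I, normSq_add_I, ← normSq_eq_norm_sq, normSq_apply]
    simp
    nlinarith [sq_nonneg (z.re + u.re), sq_nonneg (z.im - u.im)]
  have hDpos : 0 < ‖z - conj u‖ ^ 2 := by
    rw [hD]; nlinarith [mul_pos hz hu, sq_nonneg ‖z - u‖]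
  have hN : ‖z - u‖ ^ 2 = ‖z - conj u‖ ^ 2 - 4 * z.im * u.im := by linarith
  have hN0 := sq_nonneg ‖z - u‖
  set N := ‖z - u‖ ^ 2
  set D := ‖z - conj u‖ ^ 2
  set p := ‖z + I‖ ^ 2 with hpd
  set q := ‖u + I‖ ^ 2 with hqd
  set a := z.im
  set b := u.im
  have hpa : 4 * a ≤ p := by rw [hpd]; nlinarith [sq_nonneg (a - 1)]
  have hqb : 4 * b ≤ q := by rw [hqd]; nlinarith [sq_nonneg (b - 1)]
  have h1 : D * (a * b) ≤ (a + b) * (p * q) / 2 := by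
    have e1 : 4 * b * (a * p) ≤ q * (a * p) := by gcongr
    have e2 : 4 * a * (b * q) ≤ p * (b * q) := by gcongr
    have e3 : D * (a * b) ≤ 2 * (p + q) * (a * b) := by gcongr
    nlinarith
  have e : 2 * (1 / a + 1 / b) - 8 * ((a + b) / D) = 2 * N * (a + b) / (a * b * D) := by
    rw [hN]; field_simp; ring
  have hp0 : 0 < p := by linarith [show 0 < a from hz]
  have hq0 : 0 < q := by linarith [show 0 < b from hu]
  rw [e, div_le_div_iff₀ (mul_pos hp0 hq0) (mul_pos (mul_pos hz hu) hDpos)]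
  have := mul_le_mul_of_nonneg_left h1 hN0
  nlinarith

/-- Both `m`-functions, glued to a function with values in the upper half plane. -/
def Mo (lam α : ℝ) (E : ℂ) (x : ℝ) : ℂ :=
  if 0 < E.im then mf lam α E x else conj (mp lam α (conj E) x)

theorem Mo_pos (hE : 0 < E.im) (x : ℝ) : Mo lam α E x = mf lam α E x := by rw [Mo, if_pos hE]

theorem Mo_neg (hE : E.im < 0) (x : ℝ) :
    Mo lam α E x = conj (mp lam α (conj E) x) := by
  rw [Mo, if_neg hE.not_gt]

theorem conj_im_pos (hE : E.im < 0) : 0 < (conj E).im := by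
  rw [conj_im]; linarith

theorem Mo_im (hE : E.im ≠ 0) (x : ℝ) : 0 < (Mo lam α E x).im := by
  rcases lt_or_gt_of_ne hE with h | h
  · have h' := conj_im_pos h
    rw [Mo_neg h, conj_im, mp_im h']
    linarith [mf_im_gt lam α h' (2 * α - x)]
  · rw [Mo_pos h]; exact h.trans (mf_im_gt _ _ h x)

theorem Mo_periodic (hE : E.im ≠ 0) (x : ℝ) : Mo lam α E (x + 1) = Mo lam α E x := by
  rcases lt_or_gt_of_ne hE with h | h
  · rw [Mo_neg h, Mo_neg h, (cp_mp (conj_im_pos h)).per]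
  · rw [Mo_pos h, Mo_pos h, mf_periodic]

theorem conj_pot (x : ℝ) : conj (pot lam x) = pot lam x := by
  rw [pot_ofReal, conj_ofReal]

theorem Mo_riccati (hE : E.im ≠ 0) (x : ℝ) :
    Mo lam α E (x + α) = E - pot lam x - (Mo lam α E x)⁻¹ := by
  rcases lt_or_gt_of_ne hE with h | h
  · rw [Mo_neg h, Mo_neg h, mp_riccati (conj_im_pos h)]
    simp [conj_pot]
  · rw [Mo_pos h, Mo_pos h, mf_riccati h]

theorem continuous_Mo (hE : E.im ≠ 0) : Continuous (Mo lam α E) := by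
  rcases lt_or_gt_of_ne hE with h | h
  · rw [show Mo lam α E = fun x => _ from funext fun x => Mo_neg h x]
    exact continuous_conj.comp (cp_mp (conj_im_pos h)).cont
  · rw [show Mo lam α E = fun x => _ from funext fun x => Mo_pos h x]
    exact continuous_mf h

theorem differentiableAt_mp (hE : 0 < E.im) (x : ℝ) :
    DifferentiableAt ℂ (fun E => mp lam α E x) E :=
  ((differentiableOn_mf _ _ (α - x)).differentiableAt (isOpen_uhp.mem_nhds hE)).inv
  (mf_ne_zero _ _ hE _)

theorem differentiableAt_Mo (hE : E.im ≠ 0) (x : ℝ) :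
    DifferentiableAt ℂ (fun E => Mo lam α E x) E := by
  rcases lt_or_gt_of_ne hE with h | h
  · have := (differentiableAt_mp (lam := lam) (α := α) (conj_im_pos h) x).conj_conj
    rw [conj_conj] at this
    refine this.congr_of_eventuallyEq ?_
    filter_upwards [(isOpen_lt continuous_im continuous_const).mem_nhds h] with z hz
    rw [Mo_neg hz]; rfl
  · refine ((differentiableOn_mf lam α x).differentiableAt
      (isOpen_uhp.mem_nhds h)).congr_of_eventuallyEq ?_
    filter_upwards [isOpen_uhp.mem_nhds h] with z hz
    rw [Mo_pos hz]

theorem continuousOn_mp : ContinuousOn (fun p : ℂ × ℝ => mp lam α p.1 p.2) {p | 0 < p.1.im} :=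
  (continuousOn_mf.comp (f := fun p : ℂ × ℝ => (p.1, α - p.2)) (by fun_prop)
    fun p hp => hp).inv₀ fun p hp => mf_ne_zero _ _ hp _

theorem continuous_Mo_line {η : ℝ} (hη : η ≠ 0) :
    Continuous fun p : ℝ × ℝ => Mo lam α (p.1 + η * I) p.2 := by
  have hi : ∀ t : ℝ, ((t : ℂ) + η * I).im = η := fun t => by simp
  rcases lt_or_gt_of_ne hη with h | h
  · have e : (fun p : ℝ × ℝ => Mo lam α (p.1 + η * I) p.2) = fun p : ℝ × ℝ =>
        conj (mp lam α (conj (p.1 + η * I)) p.2) := by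
      funext p; exact Mo_neg (by rw [hi]; exact h) _
    rw [e]
    refine continuous_conj.comp ?_
    refine continuousOn_mp.comp_continuous (f := fun p : ℝ × ℝ =>
      (conj ((p.1 : ℂ) + η * I), p.2)) (by fun_prop) fun p => ?_
    exact conj_im_pos (by rw [hi]; exact h)
  · have e : (fun p : ℝ × ℝ => Mo lam α (p.1 + η * I) p.2) = fun p : ℝ × ℝ =>
        mf lam α (p.1 + η * I) p.2 := by
      funext p; exact Mo_pos (by rw [hi]; exact h) _
    rw [e]
    refine continuousOn_mf.comp_continuous (f := fun p : ℝ × ℝ =>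
      ((p.1 : ℂ) + η * I, p.2)) (by fun_prop) fun p => ?_
    show 0 < ((p.1 : ℂ) + η * I).im
    rw [hi]; exact h

/-- The bounded holomorphic function (off the real axis) attached to the `m`-functions. -/
def ff (lam α : ℝ) (E : ℂ) (x : ℝ) : ℂ := cay (Mo lam α E x)

theorem norm_ff_lt (hE : E.im ≠ 0) (x : ℝ) : ‖ff lam α E x‖ < 1 := norm_cay_lt (Mo_im hE x)

theorem differentiableAt_ff (hE : E.im ≠ 0) (x : ℝ) :
    DifferentiableAt ℂ (fun E => ff lam α E x) E := by
  have := differentiableAt_Mo (lam := lam) (α := α) hE x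
  unfold ff cay
  exact (this.sub_const _).div (this.add_const _) (add_I_ne_zero (Mo_im hE x))

theorem continuous_ff (hE : E.im ≠ 0) : Continuous (ff lam α E) := by
  have := continuous_Mo (lam := lam) (α := α) hE
  unfold ff cay
  exact (this.sub continuous_const).div (this.add continuous_const) fun x =>
    add_I_ne_zero (Mo_im hE x)

theorem continuous_ff_line (lam α : ℝ) {η : ℝ} (hη : η ≠ 0) :
    Continuous fun p : ℝ × ℝ => ff lam α (p.1 + η * I) p.2 := by
  have := continuous_Mo_line (lam := lam) (α := α) hη
  unfold ff cay
  exact (this.sub continuous_const).div (this.add continuous_const) fun p =>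
    add_I_ne_zero (Mo_im (by simpa using hη) _)

/-- The jump of `ff` across the real axis is controlled in mean square. -/
theorem integral_jump_le (hE : 0 < E.im) :
    ∫ x in (0 : ℝ)..1, ‖ff lam α E x - ff lam α (conj E) x‖ ^ 2 ≤
      16 * ((w lam α E).re / E.im + (deriv (w lam α) E).im) + 8 * E.im ^ 2 := by
  set η := E.im with hη
  have hE' : (conj E).im < 0 := by rw [conj_im]; linarith
  have hgt := mf_im_gt lam α hE
  have hm := cp_mf lam α hE
  have hmi : Continuous fun x => (mf lam α E x).im := continuous_im.comp hm.cont
  set a : ℝ → ℝ := fun x => (mf lam α E x).im - η / 2 with ha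
  have ha0 : ∀ x, η / 2 < a x := fun x => by
    simp only [ha]; linarith [hgt x]
  have hac : Continuous a := hmi.sub continuous_const
  have hap : ∀ x, a (x + 1) = a x := fun x => by simp only [ha, hm.per]
  have h1a : Continuous fun x => 1 / a x := continuous_const.div hac fun x => by
    linarith [ha0 x]
  have hmain : ∀ x, ‖ff lam α E x - ff lam α (conj E) x‖ ^ 2 ≤
      2 * (2 * (1 / a x + 1 / a (2 * α - x)) - 8 * ((Dl lam α E x).im / ‖Dl lam α E x‖ ^ 2)) +
        8 * η ^ 2 := by
    intro x
    set z := mf lam α E x - (η / 2 : ℝ) * I with hz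
    set u := conj (mp lam α E x) + (η / 2 : ℝ) * I with hu
    have hzi : z.im = a x := by simp [hz, ha]
    have hui : u.im = a (2 * α - x) := by
      simp only [hu, ha, add_im, conj_im, mp_im hE, mul_im,
        ofReal_re, I_im, ofReal_im, I_re]
      ring
    have hz0 : 0 < z.im := by rw [hzi]; linarith [ha0 x]
    have hu0 : 0 < u.im := by rw [hui]; linarith [ha0 (2 * α - x)]
    have hzu : z - conj u = Dl lam α E x := by
      simp only [hz, hu, Dl, map_add, map_mul, conj_conj, conj_ofReal, Complex.conj_I]
      ring
    have hs := norm_cay_sub_sq_le hz0 hu0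
    have hDi : z.im + u.im = (Dl lam α E x).im := by
      rw [← hzu]; simp
    rw [hzu, hDi, hzi, hui] at hs
    have hn : ‖(η / 2 : ℝ) * I‖ = η / 2 := by
      rw [norm_mul, norm_I, mul_one, norm_real, norm_of_nonneg (by positivity)]
    have t1 : ‖ff lam α E x - cay z‖ ≤ η := by
      rw [ff, Mo_pos hE]
      refine (norm_cay_sub_le (hE.trans (hgt x)) hz0).trans ?_
      rw [hz, sub_sub_cancel, hn]; linarith
    have t2 : ‖cay u - ff lam α (conj E) x‖ ≤ η := by
      have h3 := Mo_im (lam := lam) (α := α) hE'.ne x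
      rw [ff]
      refine (norm_cay_sub_le hu0 h3).trans ?_
      rw [Mo_neg hE', conj_conj, hu, add_sub_cancel_left, hn]; linarith
    have t3 : ‖ff lam α E x - ff lam α (conj E) x‖ ≤ ‖cay z - cay u‖ + 2 * η := by
      calc _ = ‖(ff lam α E x - cay z) + (cay z - cay u) +
            (cay u - ff lam α (conj E) x)‖ := by ring_nf
        _ ≤ ‖ff lam α E x - cay z‖ + ‖cay z - cay u‖ +
            ‖cay u - ff lam α (conj E) x‖ := norm_add₃_le
        _ ≤ _ := by linarith
    calc _ ≤ (‖cay z - cay u‖ + 2 * η) ^ 2 := by gcongr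
      _ ≤ 2 * ‖cay z - cay u‖ ^ 2 + 8 * η ^ 2 := by
        nlinarith [sq_nonneg (‖cay z - cay u‖ - 2 * η)]
      _ ≤ _ := by linarith
  have hint : ∫ x in (0 : ℝ)..1, 1 / a x ≤ 2 * (w lam α E).re / η := by
    rw [two_w_re hE, le_div_iff₀ hE, ← intervalIntegral.integral_mul_const]
    refine integral_mono_on zero_le_one
      ((h1a.mul continuous_const).intervalIntegrable _ _) (Continuous.intervalIntegrable ?_ _ _)
      fun x _ => ?_
    · refine (hmi.div (hmi.sub continuous_const) fun x => (sub_pos.2 (hgt x)).ne').log fun x => ?_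
      exact (div_pos (hE.trans (hgt x)) (sub_pos.2 (hgt x))).ne'
    · have h1 := ha0 x
      have h3 : 0 < a x := by linarith
      have h4 : |η / 2 / a x| < 1 := by
        rw [abs_of_pos (by positivity), div_lt_one h3]; exact h1
      have h5 := le_hasSum (Real.hasSum_log_sub_log_of_abs_lt_one h4) 0 fun k _ => by positivity
      have e1 : 1 + η / 2 / a x = (mf lam α E x).im / a x := by
        rw [eq_div_iff h3.ne', add_mul, div_mul_cancel₀ _ h3.ne']; simp only [ha]; ring
      have e2 : 1 - η / 2 / a x = ((mf lam α E x).im - η) / a x := by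
        rw [eq_div_iff h3.ne', sub_mul, div_mul_cancel₀ _ h3.ne']; simp only [ha]; ring
      have p1 : 0 < (mf lam α E x).im := hE.trans (hgt x)
      have p2 : 0 < (mf lam α E x).im - η := sub_pos.2 (hgt x)
      rw [e1, e2, ← Real.log_div (by positivity) (by positivity),
        div_div_div_cancel_right₀ h3.ne'] at h5
      refine le_trans (le_of_eq ?_) h5
      simp; ring
  have hD := cp_Dl lam α hE
  have hDc : Continuous fun x => (Dl lam α E x)⁻¹ :=
    hD.cont.inv₀ fun x => Dl_ne_zero _ _ hE x
  have hDim : ∀ x, (Dl lam α E x).im / ‖Dl lam α E x‖ ^ 2 = -((Dl lam α E x)⁻¹).im := fun x => by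
    rw [Complex.inv_im, normSq_eq_norm_sq]; ring
  have hw : ∫ x in (0 : ℝ)..1, ((Dl lam α E x)⁻¹).im = (deriv (w lam α) E).im := by
    rw [(hasDerivAt_w hE).deriv]
    exact Complex.imCLM.intervalIntegral_comp_comm (hDc.intervalIntegrable _ _)
  have hr : ∫ x in (0 : ℝ)..1, 1 / a (2 * α - x) = ∫ x in (0 : ℝ)..1, 1 / a x :=
    integral_reflect (f := fun x => 1 / a x) (fun x => by simp only [hap]) _
  have h1b : Continuous fun x => 1 / a (2 * α - x) :=
    h1a.comp (f := fun x => 2 * α - x) (by fun_prop)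
  have hDi : Continuous fun x => ((Dl lam α E x)⁻¹).im := continuous_im.comp hDc
  have hfc : Continuous fun x => ‖ff lam α E x - ff lam α (conj E) x‖ ^ 2 :=
    ((continuous_ff hE.ne').sub (continuous_ff hE'.ne)).norm.pow 2
  have c1 : Continuous fun x => 2 * (2 * (1 / a x + 1 / a (2 * α - x)) +
      8 * ((Dl lam α E x)⁻¹).im) + 8 * η ^ 2 := by
    have h1 := h1a.add h1b
    have h2 := hDi.const_mul (8 : ℝ)
    exact (((h1.const_mul 2).add h2).const_mul 2).add continuous_const
  calc _ ≤ ∫ x in (0 : ℝ)..1, (2 * (2 * (1 / a x + 1 / a (2 * α - x)) +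
      8 * ((Dl lam α E x)⁻¹).im) + 8 * η ^ 2) := by
        refine integral_mono_on zero_le_one (hfc.intervalIntegrable _ _)
          (c1.intervalIntegrable _ _) fun x _ => (hmain x).trans (le_of_eq ?_)
        rw [hDim]; ring
    _ = 2 * (2 * ((∫ x in (0 : ℝ)..1, 1 / a x) + ∫ x in (0 : ℝ)..1, 1 / a x) +
      8 * (deriv (w lam α) E).im) + 8 * η ^ 2 := by
        rw [← hw]
        conv_rhs => enter [1, 2, 1, 2, 2]; rw [← hr]
        have h1 : Continuous fun x => 2 * (1 / a x + 1 / a (2 * α - x)) := (h1a.add h1b).const_mul 2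
        have h2 : Continuous fun x => 8 * ((Dl lam α E x)⁻¹).im := hDi.const_mul (8 : ℝ)
        have h3 : Continuous fun x => 2 * (2 * (1 / a x + 1 / a (2 * α - x)) +
          8 * ((Dl lam α E x)⁻¹).im) := (h1.add h2).const_mul 2
        rw [integral_add (h3.intervalIntegrable _ _)
            (continuous_const.intervalIntegrable _ _), integral_const_mul,
          integral_add (h1.intervalIntegrable _ _)
            (h2.intervalIntegrable _ _), integral_const_mul,
          integral_const_mul,
          integral_add (h1a.intervalIntegrable _ _) (h1b.intervalIntegrable _ _)]
        simp
    _ ≤ _ := by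
        have : 2 * (w lam α E).re / η = 2 * ((w lam α E).re / η) := by ring
        linarith

/-- The mean over an energy interval of the Kotani quantity controlling the jump. -/
def kG (lam α t₁ t₂ η : ℝ) : ℝ := ∫ t in t₁..t₂, ((w lam α (t + η * I)).re / η +
  (deriv (w lam α) (t + η * I)).im)

theorem differentiableOn_w : DifferentiableOn ℂ (w lam α) {z | 0 < z.im} := fun z hz =>
  (hasDerivAt_w (E := z) hz).differentiableAt.differentiableWithinAt

theorem continuous_w_line (lam α : ℝ) {η : ℝ} (hη : 0 < η) :
    Continuous (fun t : ℝ => w lam α (t + η * I)) ∧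
      Continuous (fun t : ℝ => deriv (w lam α) (t + η * I)) := by
  have h : ∀ t : ℝ, (t : ℂ) + η * I ∈ {z : ℂ | 0 < z.im} := fun t => by simpa using hη
  exact ⟨differentiableOn_w.continuousOn.comp_continuous (by fun_prop) h,
    (differentiableOn_w.deriv isOpen_uhp).continuousOn.comp_continuous (by fun_prop) h⟩

theorem exists_kG_lt {t₁ t₂ K ρ : ℝ} (ht : t₁ ≤ t₂) (hρ : 0 < ρ)
    (hK : ∀ t ∈ Icc t₁ t₂, ∀ η : ℝ, 0 < η → η < ρ → (w lam α (t + η * I)).re ≤ K * η)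
    {κ η₁ : ℝ} (hκ : 0 < κ) (hη₁ : 0 < η₁) :
    ∃ η, 0 < η ∧ η < η₁ ∧ kG lam α t₁ t₂ η < κ := by
  by_contra! hcon
  set W : ℂ → ℂ := fun ζ => ∫ t in t₁..t₂, w lam α (ζ + t) with hW
  have hWd : ∀ ζ ∈ {z : ℂ | 0 < z.im}, HasDerivAt W
      (∫ t in t₁..t₂, deriv (fun z => w lam α (z + (t : ℝ))) ζ) ζ := fun ζ hζ => by
    refine hasDerivAt_integral_param (F := fun ζ (t : ℝ) => w lam α (ζ + t)) isOpen_uhp ht ?_ ?_ hζ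
    · refine differentiableOn_w.continuousOn.comp (f := fun p : ℂ × ℝ => p.1 + p.2) (by fun_prop) ?_
      intro p hp
      have : 0 < p.1.im := hp.1
      simpa using this
    · intro t _
      refine differentiableOn_w.comp (f := fun z : ℂ => z + t) (by fun_prop) fun z hz => ?_
      have : 0 < z.im := hz
      simpa using this
  have hline : ∀ η : ℝ, 0 < η → HasDerivAt (fun y : ℝ => (W (y * I)).re)
      (-(∫ t in t₁..t₂, (deriv (w lam α) (t + η * I)).im)) η := fun η hη => by
    have h1 := hWd (η * I) (by simpa using hη)
    have h2 : HasDerivAt (fun y : ℝ => (y : ℂ) * I) I η := by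
      simpa using (Complex.ofRealCLM.hasDerivAt (x := η)).mul_const I
    have h3 := h1.comp η h2
    have h4 := Complex.reCLM.hasFDerivAt.comp_hasDerivAt η h3
    refine h4.congr_deriv ?_
    simp only [deriv_comp_add_const, Complex.reCLM_apply, mul_re, I_re,
      I_im, mul_zero, mul_one, zero_sub]
    have h5 := Complex.imCLM.intervalIntegral_comp_comm
      ((continuous_w_line lam α hη).2.intervalIntegrable (μ := volume) t₁ t₂)
    simp only [Complex.imCLM_apply] at h5
    rw [h5]
    exact congrArg (fun z : ℂ => -z.im) (integral_congr fun t _ => by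
      simp only [add_comm])
  have hre : ∀ η : ℝ, 0 < η → (W (η * I)).re =
      ∫ t in t₁..t₂, (w lam α (t + η * I)).re := fun η hη => by
    have h5 := Complex.reCLM.intervalIntegral_comp_comm
      ((continuous_w_line lam α hη).1.intervalIntegrable (μ := volume) t₁ t₂)
    simp only [Complex.reCLM_apply] at h5
    rw [h5]
    exact congrArg Complex.re (integral_congr fun t _ => by
      simp only [add_comm])
  have hG : ∀ η : ℝ, 0 < η → kG lam α t₁ t₂ η = (W (η * I)).re / η +
      ∫ t in t₁..t₂, (deriv (w lam α) (t + η * I)).im := fun η hη => by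
    obtain ⟨c1, c2⟩ := continuous_w_line lam α hη
    rw [kG, hre η hη, ← integral_div]
    exact integral_add
      ((continuous_re.comp c1).div_const η |>.intervalIntegrable _ _)
      ((continuous_im.comp c2).intervalIntegrable _ _)
  have hΨ : ∀ η : ℝ, 0 < η → HasDerivAt (fun y : ℝ => (W (y * I)).re / y + κ * log y)
      ((κ - kG lam α t₁ t₂ η) / η) η := fun η hη => by
    refine (((hline η hη).div (hasDerivAt_id η) hη.ne').add
      ((Real.hasDerivAt_log hη.ne').const_mul κ)).congr_deriv ?_
    rw [hG η hη]
    simp only [id]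
    field_simp; ring
  have hanti : AntitoneOn (fun y : ℝ => (W (y * I)).re / y + κ * log y) (Ioo 0 η₁) := by
    refine antitoneOn_of_deriv_nonpos (convex_Ioo _ _)
      (fun y hy => (hΨ y hy.1).continuousAt.continuousWithinAt)
      (fun y hy => (hΨ y (interior_subset hy).1).differentiableAt.differentiableWithinAt)
      fun y hy => ?_
    have hy' := interior_subset hy
    rw [(hΨ y hy'.1).deriv]
    exact div_nonpos_of_nonpos_of_nonneg (by linarith [hcon y hy'.1 hy'.2]) hy'.1.le
  set c := (W ((η₁ / 2 : ℝ) * I)).re / (η₁ / 2) + κ * log (η₁ / 2) with hc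
  have hlog := Real.tendsto_log_nhdsGT_zero
  have hev := (hlog.eventually (eventually_lt_atBot ((c - K * (t₂ - t₁)) / κ))).and
    (Ioo_mem_nhdsGT (lt_min (half_pos hη₁) hρ))
  obtain ⟨η, h1, h2, h3⟩ := hev.exists
  have h4 := lt_min_iff.1 h3
  have h5 := hanti (a := η) (b := η₁ / 2) ⟨h2, by linarith⟩ ⟨by linarith, by linarith⟩ h4.1.le
  simp only at h5
  rw [← hc] at h5
  have h6 : (W (η * I)).re / η ≤ K * (t₂ - t₁) := by
    rw [div_le_iff₀ h2, hre η h2]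
    calc _ ≤ ∫ t in t₁..t₂, K * η := by
          refine integral_mono_on ht
            ((continuous_re.comp (continuous_w_line _ _ h2).1).intervalIntegrable _ _)
            (by simp) fun t htt => hK t htt η h2 h4.2
      _ = _ := by simp; ring
  rw [lt_div_iff₀ hκ] at h1
  linarith

/-- The integrated jump at height `η`. -/
def kD (lam α t₁ t₂ η x : ℝ) : ℂ :=
  ∫ t in t₁..t₂, (ff lam α (t + η * I) x - ff lam α (t - η * I) x)

theorem continuous_jump {η : ℝ} (hη : 0 < η) : Continuous fun p : ℝ × ℝ =>
    ff lam α (p.1 + η * I) p.2 - ff lam α (p.1 - η * I) p.2 := by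
  have h2 := continuous_ff_line lam α (η := -η) (by linarith)
  refine (continuous_ff_line _ _ hη.ne').sub (h2.congr fun p => ?_)
  push_cast; ring_nf

theorem continuous_kD {t₁ t₂ η : ℝ} (hη : 0 < η) : Continuous (kD lam α t₁ t₂ η) := by
  have h : Continuous (uncurry fun (x t : ℝ) =>
      ff lam α (t + η * I) x - ff lam α (t - η * I) x) := by
    have h := (continuous_jump (lam := lam) (α := α) hη).comp
      (continuous_swap : Continuous (Prod.swap : ℝ × ℝ → ℝ × ℝ))
    exact h
  exact intervalIntegral.continuous_parametric_intervalIntegral_of_continuous' h _ _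

theorem integral_kD_le {t₁ t₂ η ε : ℝ} (ht : t₁ ≤ t₂) (hη : 0 < η) (hε : 0 < ε) :
    ∫ x in (0 : ℝ)..1, ‖kD lam α t₁ t₂ η x‖ ≤
      ε * (t₂ - t₁) + (16 * kG lam α t₁ t₂ η + 8 * η ^ 2 * (t₂ - t₁)) / ε := by
  set j : ℝ × ℝ → ℂ := fun p =>
    ff lam α (p.1 + η * I) p.2 - ff lam α (p.1 - η * I) p.2 with hj
  have hjc : Continuous j := continuous_jump hη
  have hjn : Continuous fun p => ‖j p‖ ^ 2 := hjc.norm.pow 2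
  obtain ⟨c1, c2⟩ := continuous_w_line lam α hη
  have c3 : Continuous fun t : ℝ => (w lam α (t + η * I)).re / η +
      (deriv (w lam α) (t + η * I)).im :=
    ((continuous_re.comp c1).div_const η).add (continuous_im.comp c2)
  have c4 : Continuous fun t : ℝ => ∫ x in (0 : ℝ)..1, ‖j (t, x)‖ ^ 2 :=
    intervalIntegral.continuous_parametric_intervalIntegral_of_continuous'
      (f := fun t x => ‖j (t, x)‖ ^ 2) hjn _ _
  have c9 : Continuous (uncurry fun x t => ε + ‖j (t, x)‖ ^ 2 / ε) :=
    (continuous_const (y := ε)).add ((hjn.comp continuous_swap).div_const ε)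
  have c5 : Continuous fun x : ℝ => ∫ t in t₁..t₂, (ε + ‖j (t, x)‖ ^ 2 / ε) :=
    intervalIntegral.continuous_parametric_intervalIntegral_of_continuous' c9 _ _
  calc _ ≤ ∫ x in (0 : ℝ)..1, ∫ t in t₁..t₂, (ε + ‖j (t, x)‖ ^ 2 / ε) := by
        refine integral_mono_on zero_le_one
          ((continuous_kD hη).norm.intervalIntegrable _ _) (c5.intervalIntegrable _ _) fun x _ => ?_
        refine (intervalIntegral.norm_integral_le_integral_norm ht).trans ?_
        have c6 : Continuous fun t : ℝ => j (t, x) := hjc.comp (by fun_prop)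
        refine integral_mono_on ht (c6.norm.intervalIntegrable _ _)
          (Continuous.intervalIntegrable (continuous_const.add ((c6.norm.pow 2).div_const ε)) _ _)
          fun t _ => ?_
        change ‖j (t, x)‖ ≤ ε + ‖j (t, x)‖ ^ 2 / ε
        rw [← sub_nonneg, show ε + ‖j (t, x)‖ ^ 2 / ε - ‖j (t, x)‖ =
          (ε ^ 2 + ‖j (t, x)‖ ^ 2 - ‖j (t, x)‖ * ε) / ε by field_simp]
        refine div_nonneg ?_ hε.le
        nlinarith [sq_nonneg (ε - ‖j (t, x)‖), sq_nonneg (ε + ‖j (t, x)‖)]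
    _ = ∫ t in t₁..t₂, ∫ x in (0 : ℝ)..1, (ε + ‖j (t, x)‖ ^ 2 / ε) := by
        refine intervalIntegral_intervalIntegral_swap ?_
        rw [uIoc_of_le ht, uIoc_of_le zero_le_one]
        exact (c9.continuousOn.integrableOn_compact (isCompact_Icc.prod isCompact_Icc)).mono_set
          (prod_mono Ioc_subset_Icc_self Ioc_subset_Icc_self)
    _ = ∫ t in t₁..t₂, (ε + (∫ x in (0 : ℝ)..1, ‖j (t, x)‖ ^ 2) / ε) := by
        congr 1; funext t
        have c6 : Continuous fun x : ℝ => ‖j (t, x)‖ ^ 2 := hjn.comp (by fun_prop)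
        rw [integral_add (by simp) ((c6.div_const ε).intervalIntegrable _ _),
          integral_div]
        simp
    _ ≤ ∫ t in t₁..t₂, (ε + (16 * ((w lam α (t + η * I)).re / η +
      (deriv (w lam α) (t + η * I)).im) + 8 * η ^ 2) / ε) := by
        refine integral_mono_on ht
          (Continuous.intervalIntegrable (by fun_prop) _ _)
          (Continuous.intervalIntegrable (continuous_const.add
            (((c3.const_mul 16).add continuous_const).div_const ε)) _ _) fun t _ => ?_
        have h := integral_jump_le (lam := lam) (α := α) (E := t + η * I) (by simpa using hη)
        have e1 : ((t : ℂ) + η * I).im = η := by simp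
        have e2 : conj ((t : ℂ) + η * I) = t - η * I := by
          simp; ring
        rw [e1, e2] at h
        gcongr
    _ = _ := by
        have c7 : Continuous fun t : ℝ => 16 * ((w lam α (t + η * I)).re / η +
          (deriv (w lam α) (t + η * I)).im) := c3.const_mul 16
        have c8 : Continuous fun t : ℝ => 16 * ((w lam α (t + η * I)).re / η +
          (deriv (w lam α) (t + η * I)).im) + 8 * η ^ 2 := c7.add continuous_const
        rw [integral_add (by simp) ((c8.div_const ε).intervalIntegrable _ _),
          integral_div, integral_add
            (c7.intervalIntegrable _ _) (by simp), integral_const_mul, ← kG]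
        simp; ring

/-- Moving a horizontal line integral of a function bounded by one. -/
theorem norm_integral_line_sub_le {f : ℂ → ℂ} {t₁ t₂ y₁ y₂ : ℝ} (hy : y₁ ≤ y₂)
    (hf : ∀ z : ℂ, z.im ∈ Icc y₁ y₂ → DifferentiableAt ℂ f z)
    (hb : ∀ z : ℂ, z.im ∈ Icc y₁ y₂ → ‖f z‖ ≤ 1) :
    ‖(∫ t in t₁..t₂, f (t + y₁ * I)) - ∫ t in t₁..t₂, f (t + y₂ * I)‖ ≤
      2 * (y₂ - y₁) := by
  have h := Complex.integral_boundary_rect_eq_zero_of_differentiableOn f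
    (t₁ + y₁ * I) (t₂ + y₂ * I) (fun z hz => by
      refine (hf z ?_).differentiableWithinAt
      rw [Complex.mem_reProdIm] at hz
      have := hz.2
      simpa [uIcc_of_le hy] using this)
  simp only [add_re, ofReal_re, mul_re, I_re, mul_zero,
    ofReal_im, I_im, mul_one, sub_self, add_zero, add_im, mul_im,
    zero_add] at h
  have hs : ∀ s : ℝ, ‖∫ y in y₁..y₂, f (s + y * I)‖ ≤ y₂ - y₁ := fun s => by
    have := norm_integral_le_of_norm_le_const (a := y₁) (b := y₂) (C := 1)
      (f := fun y : ℝ => f (s + y * I)) (fun y hy' => by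
        rw [uIoc_of_le hy] at hy'
        exact hb _ (by simpa using ⟨hy'.1.le, hy'.2⟩))
    rwa [one_mul, abs_of_nonneg (sub_nonneg.2 hy)] at this
  have e : (∫ t in t₁..t₂, f (t + y₁ * I)) - ∫ t in t₁..t₂, f (t + y₂ * I) =
      I • (∫ y in y₁..y₂, f (t₁ + y * I)) -
        I • ∫ y in y₁..y₂, f (t₂ + y * I) := by
    linear_combination h
  rw [e]
  refine (norm_sub_le _ _).trans ?_
  rw [norm_smul, norm_smul, norm_I, one_mul, one_mul]
  linarith [hs t₁, hs t₂]

theorem norm_kD_sub_le {t₁ t₂ η η' x : ℝ} (h0 : 0 < η') (hη : η' ≤ η) :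
    ‖kD lam α t₁ t₂ η x‖ ≤ ‖kD lam α t₁ t₂ η' x‖ + 4 * η := by
  have key : ∀ y : ℝ, y ≠ 0 → IntervalIntegrable (fun t : ℝ => ff lam α (t + y * I) x)
      volume t₁ t₂ := fun y hy => Continuous.intervalIntegrable
    ((continuous_ff_line lam α hy).comp (f := fun t : ℝ => (t, x)) (by fun_prop)) _ _
  have hsplit : ∀ y : ℝ, 0 < y → kD lam α t₁ t₂ y x =
      (∫ t in t₁..t₂, ff lam α (t + y * I) x) -
        ∫ t in t₁..t₂, ff lam α (t + (-y : ℝ) * I) x := fun y hy => by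
    rw [← integral_sub (key y hy.ne') (key (-y) (by linarith)), kD]
    refine integral_congr fun t _ => ?_
    simp [sub_eq_add_neg]
  have u1 := norm_integral_line_sub_le (t₁ := t₁) (t₂ := t₂) (f := fun z => ff lam α z x) hη
    (fun z hz => differentiableAt_ff (h0.trans_le hz.1).ne' x)
    (fun z hz => (norm_ff_lt (h0.trans_le hz.1).ne' x).le)
  have u2 := norm_integral_line_sub_le (t₁ := t₁) (t₂ := t₂) (f := fun z => ff lam α z x)
    (neg_le_neg hη)
    (fun z hz => differentiableAt_ff (by linarith [hz.2] : z.im < 0).ne x)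
    (fun z hz => (norm_ff_lt (by linarith [hz.2] : z.im < 0).ne x).le)
  rw [hsplit η (h0.trans_le hη), hsplit η' h0]
  set A := ∫ t in t₁..t₂, ff lam α (t + η * I) x
  set B := ∫ t in t₁..t₂, ff lam α (t + η' * I) x
  set A' := ∫ t in t₁..t₂, ff lam α (t + (-η : ℝ) * I) x
  set B' := ∫ t in t₁..t₂, ff lam α (t + (-η' : ℝ) * I) x
  have : A - A' = (B - B') - (B - A) - (A' - B') := by ring
  rw [this]
  refine (norm_sub_le _ _).trans ?_
  have := norm_sub_le (B - B') (B - A)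
  linarith

theorem norm_kD_le {t₁ t₂ K ρ : ℝ} (ht : t₁ ≤ t₂) (hρ : 0 < ρ)
    (hK : ∀ t ∈ Icc t₁ t₂, ∀ η : ℝ, 0 < η → η < ρ → (w lam α (t + η * I)).re ≤ K * η)
    {η : ℝ} (hη : 0 < η) (x : ℝ) : ‖kD lam α t₁ t₂ η x‖ ≤ 4 * η := by
  have hinf : ∀ δ > 0, ∃ η', 0 < η' ∧ η' ≤ η ∧
      ∫ x in (0 : ℝ)..1, ‖kD lam α t₁ t₂ η' x‖ ≤ δ := fun δ hδ => by
    set T := t₂ - t₁ with hT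
    have hT0 : 0 ≤ T := sub_nonneg.2 ht
    set ε := δ / (4 * (T + 1)) with hε
    have hε0 : 0 < ε := by positivity
    have hs : 0 < δ * ε / (32 * (T + 1)) := by positivity
    obtain ⟨η', h1, h2, h3⟩ := exists_kG_lt (lam := lam) (α := α) ht hρ hK
      (κ := δ * ε / 64) (by positivity) (lt_min hη (lt_min one_pos hs))
    rw [lt_min_iff, lt_min_iff] at h2
    refine ⟨η', h1, h2.1.le, (integral_kD_le ht h1 hε0).trans ?_⟩
    have h4 : ε * T ≤ δ / 4 := by
      rw [hε, div_mul_eq_mul_div, div_le_div_iff₀ (by positivity) (by norm_num)]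
      nlinarith
    have h5 : η' ^ 2 * T ≤ δ * ε / 32 := by
      have : η' ^ 2 ≤ η' := by nlinarith
      have h6 := h2.2.2
      rw [lt_div_iff₀ (by positivity)] at h6
      have : η' ^ 2 * T ≤ η' * (T + 1) := by gcongr; linarith
      linarith
    have h6 : (16 * kG lam α t₁ t₂ η' + 8 * η' ^ 2 * T) / ε ≤ δ / 2 := by
      rw [div_le_iff₀ hε0]; linarith
    linarith
  have hc : Continuous fun x => max (‖kD lam α t₁ t₂ η x‖ - 4 * η) 0 :=
    ((continuous_kD hη).norm.sub continuous_const).max continuous_const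
  have hper : kD lam α t₁ t₂ η x = kD lam α t₁ t₂ η (Int.fract x) := by
    have hp : Function.Periodic (kD lam α t₁ t₂ η) 1 := fun x => by
      refine integral_congr fun t _ => ?_
      rw [ff, ff, ff, ff, Mo_periodic (by simpa using hη.ne'), Mo_periodic (by simpa using hη.ne')]
    have := hp.int_mul (-⌊x⌋) x
    rw [← this]; congr 1; rw [Int.fract]; push_cast; ring
  rw [hper]
  by_contra! hcon
  have hpos : 0 < ∫ x in (0 : ℝ)..1, max (‖kD lam α t₁ t₂ η x‖ - 4 * η) 0 :=
    intervalIntegral.integral_pos one_pos hc.continuousOn (fun _ _ => le_max_right _ _)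
      ⟨Int.fract x, ⟨Int.fract_nonneg x, (Int.fract_lt_one x).le⟩, lt_max_of_lt_left (by linarith)⟩
  obtain ⟨η', h1, h2, h3⟩ := hinf _ (half_pos hpos)
  have h4 : ∫ x in (0 : ℝ)..1, max (‖kD lam α t₁ t₂ η x‖ - 4 * η) 0 ≤
      ∫ x in (0 : ℝ)..1, ‖kD lam α t₁ t₂ η' x‖ :=
    integral_mono_on zero_le_one (hc.intervalIntegrable _ _)
      ((continuous_kD h1).norm.intervalIntegrable _ _) fun x _ =>
        max_le (by linarith [norm_kD_sub_le (lam := lam) (α := α) (x := x) (t₁ := t₁) (t₂ := t₂) h1 h2]) (norm_nonneg _)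
  linarith

theorem tendsto_kD {a b K ρ : ℝ} (hρ : 0 < ρ)
    (hK : ∀ t ∈ Icc a b, ∀ η : ℝ, 0 < η → η < ρ → (w lam α (t + η * I)).re ≤ K * η)
    {t₁ t₂ : ℝ} (h₁ : t₁ ∈ Icc a b) (h₂ : t₂ ∈ Icc a b) (x : ℝ) :
    Tendsto (fun η : ℝ => kD lam α t₁ t₂ η x) (𝓝[>] 0) (𝓝 0) := by
  have h4 : Tendsto (fun η : ℝ => 4 * η) (𝓝[>] 0) (𝓝 0) := by
    refine Tendsto.mono_left ?_ nhdsWithin_le_nhds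
    have : Continuous fun η : ℝ => 4 * η := by fun_prop
    simpa using this.tendsto 0
  refine squeeze_zero_norm' ?_ h4
  filter_upwards [self_mem_nhdsWithin] with η hη
  rcases le_total t₁ t₂ with h | h
  · exact norm_kD_le h hρ (fun t ht => hK t ⟨h₁.1.trans ht.1, ht.2.trans h₂.2⟩) hη x
  · have := norm_kD_le (lam := lam) (α := α) h hρ
      (fun t ht => hK t ⟨h₂.1.trans ht.1, ht.2.trans h₁.2⟩) (show 0 < η from hη) x
    rw [kD, intervalIntegral.integral_symm, norm_neg]
    exact this

theorem dense_im_ne_zero : Dense {z : ℂ | z.im ≠ 0} :=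
  (dense_compl_singleton (0 : ℝ)).preimage Complex.isOpenMap_im

theorem eq_of_off_real {f g : ℂ → ℂ} {U : Set ℂ} (hU : IsOpen U) (hf : ContinuousOn f U)
    (hg : ContinuousOn g U) (h : ∀ z ∈ U, z.im ≠ 0 → f z = g z) {z : ℂ} (hz : z ∈ U) :
    f z = g z :=
  Set.EqOn.of_subset_closure (s := U ∩ {z | z.im ≠ 0}) (fun z hz => h z hz.1 hz.2) hf hg
    inter_subset_left
    (fun z hz => hU.inter_closure ⟨hz, dense_im_ne_zero z⟩) hz

theorem le_of_off_real {f : ℂ → ℝ} {C : ℝ} {U : Set ℂ} (hU : IsOpen U) (hf : ContinuousOn f U)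
    (h : ∀ z ∈ U, z.im ≠ 0 → f z ≤ C) {z : ℂ} (hz : z ∈ U) : f z ≤ C := by
  have h1 : (fun z => max (f z) C) z = (fun _ => C) z :=
    Set.EqOn.of_subset_closure (s := U ∩ {z | z.im ≠ 0}) (f := fun z => max (f z) C)
      (g := fun _ => C) (fun z hz => max_eq_right (h z hz.1 hz.2))
      ((continuous_id.max continuous_const).comp_continuousOn hf) continuousOn_const
        inter_subset_left
      (fun z hz => hU.inter_closure ⟨hz, dense_im_ne_zero z⟩) hz
  exact max_eq_right_iff.1 h1

/-- `M` extends both `m`-functions analytically through the real axis, on a ball. -/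
structure Kot (lam α E₀ r : ℝ) (M : ℂ → ℝ → ℂ) : Prop where
  cont : ContinuousOn (uncurry M) (ball (E₀ : ℂ) r ×ˢ univ)
  diff : ∀ x, DifferentiableOn ℂ (M · x) (ball (E₀ : ℂ) r)
  im_pos : ∀ E ∈ ball (E₀ : ℂ) r, ∀ x, 0 < (M E x).im
  eq_Mo : ∀ E ∈ ball (E₀ : ℂ) r, E.im ≠ 0 → ∀ x, M E x = Mo lam α E x

/-- Inverse Cayley transform. -/
def ycay (w : ℂ) : ℂ := I * (1 + w) / (1 - w)

theorem one_sub_ne_zero {w : ℂ} (h : ‖w‖ < 1) : 1 - w ≠ 0 := fun h' => by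
  rw [← sub_eq_zero.1 h'] at h; simp at h

theorem ycay_cay {z : ℂ} (hz : 0 < z.im) : ycay (cay z) = z := by
  have h1 := add_I_ne_zero hz
  have h2 := one_sub_ne_zero (norm_cay_lt hz)
  rw [ycay, div_eq_iff h2, cay]
  field_simp
  ring_nf
  

theorem ycay_im {w : ℂ} (h : ‖w‖ < 1) : 0 < (ycay w).im := by
  have h2 := one_sub_ne_zero h
  have h3 : w.re ^ 2 + w.im ^ 2 < 1 := by
    have := Complex.sq_norm w
    rw [normSq_apply] at this
    nlinarith [norm_nonneg w]
  have e : (ycay w).im = (1 - (w.re ^ 2 + w.im ^ 2)) / normSq (1 - w) := by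
    rw [ycay, Complex.div_im]; simp; ring
  rw [e]
  exact div_pos (by linarith) (normSq_pos.2 h2)

theorem exists_bounded_extension (hα : Irrational α) {E₀ a b : ℝ} (hE₀ : E₀ ∈ Ioo a b)
    (hJ : ∀ t ∈ Icc a b, Lyap lam α (t : ℝ) 0 = 0) :
    ∃ r > 0, ∃ W : ℂ → ℝ → ℂ, (∀ x, DifferentiableOn ℂ (W · x) (ball (E₀ : ℂ) r)) ∧
      ∀ E ∈ ball (E₀ : ℂ) r, E.im ≠ 0 → ∀ x, W E x = ff lam α E x := by
  set R := min (E₀ - a) (b - E₀) / 2 with hR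
  have hR0 : 0 < R := half_pos (lt_min (sub_pos.2 hE₀.1) (sub_pos.2 hE₀.2))
  have hRa : 2 * R ≤ E₀ - a := by rw [hR]; linarith [min_le_left (E₀ - a) (b - E₀)]
  have hRb : 2 * R ≤ b - E₀ := by rw [hR]; linarith [min_le_right (E₀ - a) (b - E₀)]
  obtain ⟨K, -, hK⟩ := w_slope (lam := lam) hα hR0 hJ
  have h := fun x => glue (f := fun z => ff lam α z x) (c := E₀) hR0
    (fun z _ _ hz => differentiableAt_ff hz x) (fun z _ _ hz => (norm_ff_lt hz x).le)
    (fun t₁ t₂ h1 h2 => by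
      rw [abs_lt] at h1 h2
      exact tendsto_kD hR0 hK ⟨by linarith, by linarith⟩ ⟨by linarith, by linarith⟩ x)
  exact ⟨R / 2, half_pos hR0, _, fun x => (h x).1, fun E hE hi x => (h x).2 E hE hi⟩

theorem kotani (hα : Irrational α) {E₀ a b : ℝ} (hE₀ : E₀ ∈ Ioo a b)
    (hJ : ∀ t ∈ Icc a b, Lyap lam α (t : ℝ) 0 = 0) :
    ∃ r > 0, ∃ M : ℂ → ℝ → ℂ, Kot lam α E₀ r M := by
  obtain ⟨R, hR, W, hWd, hWf⟩ := exists_bounded_extension hα hE₀ hJ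
  set U := ball (E₀ : ℂ) R with hU
  have hUo : IsOpen U := isOpen_ball
  have hle : ∀ x, ∀ z ∈ U, ‖W z x‖ ≤ 1 := fun x z hz =>
    le_of_off_real hUo (hWd x).continuousOn.norm (fun z hz hi => by
      rw [hWf z hz hi]; exact (norm_ff_lt hi x).le) hz
  have hlt : ∀ x, ∀ z ∈ U, ‖W z x‖ < 1 := fun x z hz => by
    refine (hle x z hz).lt_of_ne fun h1 => ?_
    have := Complex.norm_eqOn_of_isPreconnected_of_isMaxOn (f := (W · x)) (c := z)
      (Metric.isPreconnected_ball (x := (E₀ : ℂ)) (r := R)) hUo (hWd x) hz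
      (fun y hy => by simp only [mem_ofPred_eq, comp_apply]; rw [h1]; exact hle x y hy)
    have hmem : (E₀ : ℂ) + (R / 2 : ℝ) * I ∈ U := by
      rw [hU, mem_ball, dist_eq_norm, add_sub_cancel_left, norm_mul, norm_I,
        norm_real, mul_one, norm_of_nonneg (by positivity)]
      linarith
    have hi : ((E₀ : ℂ) + (R / 2 : ℝ) * I).im ≠ 0 := by simpa using hR.ne'
    have h2 := this hmem
    simp only [comp_apply, Function.const_apply, h1] at h2
    rw [hWf _ hmem hi] at h2
    exact (norm_ff_lt hi x).ne h2
  set V := ball (E₀ : ℂ) (R / 2) with hV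
  have hVU : V ⊆ U := Metric.ball_subset_ball (by linarith)
  have hLip : ∀ x, ∀ z ∈ V, ∀ z' ∈ V, ‖W z' x - W z x‖ ≤ 4 / R * ‖z' - z‖ := fun x z hz z' hz' => by
    refine (convex_ball (E₀ : ℂ) (R / 2)).norm_image_sub_le_of_norm_deriv_le (𝕜 := ℂ) (f := (W · x))
      (fun y hy => (hWd x).differentiableAt (hUo.mem_nhds (hVU hy))) (fun y hy => ?_) hz hz'
    have hsub : closedBall y (R / 4) ⊆ U := by
      intro u hu
      rw [hU, mem_ball]
      rw [mem_ball] at hy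
      rw [Metric.mem_closedBall] at hu
      linarith [dist_triangle u y (E₀ : ℂ)]
    refine (norm_deriv_le_of_forall_mem_sphere_norm_le (by positivity : 0 < R / 4)
      ((hWd x).diffContOnCl_ball hsub) (C := 1) fun u hu =>
        hle x u (hsub (sphere_subset_closedBall hu))).trans (le_of_eq ?_)
    field_simp
  have hcx : ∀ z ∈ V, z.im ≠ 0 → Continuous (W z) := fun z hz hi =>
    (continuous_ff (lam := lam) (α := α) hi).congr fun x => (hWf z (hVU hz) hi x).symm
  have hcx' : ∀ z ∈ V, Continuous (W z) := fun z hz => by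
    rw [Metric.continuous_iff]
    intro x ε hε
    have hd := Metric.dense_iff.1 dense_im_ne_zero
    obtain ⟨δ, hδ, hδV⟩ := isOpen_ball.mem_nhds hz |> Metric.mem_nhds_iff.1
    obtain ⟨y, hy, hyi⟩ := hd z (min δ (ε * R / 16)) (lt_min hδ (by positivity))
    rw [mem_ball, lt_min_iff] at hy
    have hyV : y ∈ V := hδV hy.1
    obtain ⟨d, hd0, hd⟩ := Metric.continuous_iff.1 (hcx y hyV hyi) x (ε / 2) (half_pos hε)
    refine ⟨d, hd0, fun x' hx' => ?_⟩
    have h1 := hLip x z hz y hyV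
    have h2 := hLip x' z hz y hyV
    have h3 : 4 / R * ‖y - z‖ < ε / 4 := by
      rw [← dist_eq_norm]
      calc _ < 4 / R * (ε * R / 16) := by gcongr; exact hy.2
        _ = _ := by field_simp; ring
    have h4 := hd x' hx'
    rw [dist_eq_norm] at h4 ⊢
    have : W z x' - W z x = (W y x' - W y x) - (W y x' - W z x') + (W y x - W z x) := by ring
    rw [this]
    have := norm_add_le (W y x' - W y x - (W y x' - W z x')) (W y x - W z x)
    have := norm_sub_le (W y x' - W y x) (W y x' - W z x')
    linarith
  have hWc : ContinuousOn (uncurry W) (V ×ˢ univ) := by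
    intro p hp
    refine ContinuousAt.continuousWithinAt ?_
    rw [Metric.continuousAt_iff]
    intro ε hε
    obtain ⟨δ, hδ, hδV⟩ := isOpen_ball.mem_nhds hp.1 |> Metric.mem_nhds_iff.1
    obtain ⟨d, hd0, hd⟩ := Metric.continuous_iff.1 (hcx' p.1 hp.1) p.2 (ε / 2) (half_pos hε)
    refine ⟨min d (min δ (ε * R / 8)), by positivity, fun {q} hq => ?_⟩
    rw [lt_min_iff, lt_min_iff] at hq
    have hq1 : dist q.1 p.1 ≤ dist q p := le_max_left _ _
    have hq2 : dist q.2 p.2 ≤ dist q p := le_max_right _ _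
    have h1 := hLip q.2 p.1 hp.1 q.1 (hδV (hq1.trans_lt hq.2.1))
    have h2 := hd q.2 (hq2.trans_lt hq.1)
    have h3 : 4 / R * ‖q.1 - p.1‖ < ε / 2 := by
      rw [← dist_eq_norm]
      calc _ < 4 / R * (ε * R / 8) := by gcongr; exact hq1.trans_lt hq.2.2
        _ = _ := by field_simp; ring
    rw [← dist_eq_norm] at h1
    show dist (W q.1 q.2) (W p.1 p.2) < ε
    exact (dist_triangle _ (W p.1 q.2) _).trans_lt (by linarith)
  refine ⟨R / 2, half_pos hR, fun E x => ycay (W E x), ?_, fun x => ?_,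
    fun E hE x => ycay_im (hlt x E (hVU hE)), fun E hE hi x => ?_⟩
  · unfold ycay
    exact (continuousOn_const.mul (continuousOn_const.add hWc)).div (continuousOn_const.sub hWc)
      fun p hp => one_sub_ne_zero (hlt p.2 p.1 (hVU hp.1))
  · unfold ycay
    have := (hWd x).mono hVU
    exact ((differentiableOn_const _).mul ((differentiableOn_const _).add this)).div
      ((differentiableOn_const _).sub this) fun p hp => one_sub_ne_zero (hlt x p (hVU hp))
  · rw [hWf E (hVU hE) hi, ff, ycay_cay (Mo_im hi x)]

namespace Kot
variable {E₀ r : ℝ} {M : ℂ → ℝ → ℂ}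

theorem periodic (h : Kot lam α E₀ r M) {E : ℂ} (hE : E ∈ ball (E₀ : ℂ) r) (x : ℝ) :
    M E (x + 1) = M E x :=
  eq_of_off_real isOpen_ball (h.diff (x + 1)).continuousOn (h.diff x).continuousOn
    (fun z hz hi => by rw [h.eq_Mo z hz hi, h.eq_Mo z hz hi, Mo_periodic hi]) hE

theorem ne_zero (h : Kot lam α E₀ r M) {E : ℂ} (hE : E ∈ ball (E₀ : ℂ) r) (x : ℝ) :
    M E x ≠ 0 := fun h0 => by simpa [h0] using h.im_pos E hE x

theorem riccati (h : Kot lam α E₀ r M) {E : ℂ} (hE : E ∈ ball (E₀ : ℂ) r) (x : ℝ) :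
    M E (x + α) = E - pot lam x - (M E x)⁻¹ :=
  eq_of_off_real (g := fun E => E - pot lam x - (M E x)⁻¹) isOpen_ball
    (h.diff (x + α)).continuousOn
    ((continuousOn_id.sub continuousOn_const).sub
      ((h.diff x).continuousOn.inv₀ fun z hz => h.ne_zero hz x))
    (fun z hz hi => by rw [h.eq_Mo z hz hi, h.eq_Mo z hz hi, Mo_riccati hi]) hE

theorem continuous (h : Kot lam α E₀ r M) {E : ℂ} (hE : E ∈ ball (E₀ : ℂ) r) :
    Continuous (M E) :=
  h.cont.comp_continuous (f := fun x : ℝ => (E, x)) (by fun_prop) fun _ => ⟨hE, mem_univ _⟩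

theorem cp (h : Kot lam α E₀ r M) {E : ℂ} (hE : E ∈ ball (E₀ : ℂ) r) : CP (M E) :=
  ⟨h.continuous hE, h.periodic hE⟩

end Kot

namespace Kot
variable {E₀ r : ℝ} {M : ℂ → ℝ → ℂ}

theorem mem_slitPlane (h : Kot lam α E₀ r M) {E : ℂ} (hE : E ∈ ball (E₀ : ℂ) r) (x : ℝ) :
    M E x ∈ Complex.slitPlane := by
  rw [Complex.mem_slitPlane_iff]
  exact Or.inr (h.im_pos E hE x).ne'

theorem differentiableOn_integral_log (h : Kot lam α E₀ r M) :
    DifferentiableOn ℂ (fun E => ∫ x in (0 : ℝ)..1, Complex.log (M E x))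
      (ball (E₀ : ℂ) r) := fun E hE => by
  refine (hasDerivAt_integral_param (F := fun E x => Complex.log (M E x)) isOpen_ball
    zero_le_one ?_ ?_ hE).differentiableAt.differentiableWithinAt
  · exact (h.cont.mono (prod_mono_right (subset_univ _))).clog
      fun p hp => h.mem_slitPlane hp.1 p.2
  · exact fun x _ => (h.diff x).clog fun z hz => h.mem_slitPlane hz x

theorem integral_log_eq (h : Kot lam α E₀ r M) {E : ℂ} (hE : E ∈ ball (E₀ : ℂ) r)
    (hi : 0 < E.im) : ∫ x in (0 : ℝ)..1, Complex.log (M E x) = w lam α E := by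
  rw [w]
  exact integral_congr fun x _ => by
    simp only [h.eq_Mo E hE hi.ne', Mo_pos hi]

theorem tendsto_vertical (t : ℝ) :
    Tendsto (fun η : ℝ => (t : ℂ) + η * I) (𝓝[>] 0) (𝓝 t) := by
  have : Continuous fun η : ℝ => (t : ℂ) + η * I := by fun_prop
  simpa using (this.tendsto 0).mono_left nhdsWithin_le_nhds

theorem integral_log_re (hα : Irrational α) (h : Kot lam α E₀ r M) {a b : ℝ}
    (hJ : ∀ t ∈ Icc a b, Lyap lam α (t : ℝ) 0 = 0) {t : ℝ} (ht : t ∈ Icc a b)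
    (htr : (t : ℂ) ∈ ball (E₀ : ℂ) r) :
    (∫ x in (0 : ℝ)..1, Complex.log (M t x)).re = 0 := by
  have hc := (h.differentiableOn_integral_log.differentiableAt
    (isOpen_ball.mem_nhds htr)).continuousAt
  have hlim := (continuous_re.continuousAt.tendsto.comp hc.tendsto).comp
    (tendsto_vertical t)
  have hev : ∀ᶠ η : ℝ in 𝓝[>] 0, (t : ℂ) + η * I ∈ ball (E₀ : ℂ) r :=
    (tendsto_vertical t).eventually (isOpen_ball.mem_nhds htr)
  have hew : ∀ᶠ η : ℝ in 𝓝[>] 0, (∫ x in (0 : ℝ)..1, Complex.log (M (t + η * I) x)).re =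
      (w lam α (t + η * I)).re := by
    filter_upwards [hev, self_mem_nhdsWithin] with η h1 h2
    have h2' : 0 < η := h2
    rw [h.integral_log_eq h1 (by simpa using h2')]
  apply le_antisymm
  · refine le_of_forall_pos_le_add fun κ hκ => ?_
    obtain ⟨η₀, h0, hs⟩ := w_small hα hJ hκ
    refine le_of_tendsto hlim ?_
    filter_upwards [hew, self_mem_nhdsWithin, Ioo_mem_nhdsGT h0] with η h1 h2 h3
    simp only [comp_apply]
    rw [h1, zero_add]; exact hs t ht η h3.1 h3.2
  · refine ge_of_tendsto hlim ?_
    filter_upwards [hew, self_mem_nhdsWithin] with η h1 h2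
    have hη : 0 < η := h2
    simp only [comp_apply]
    rw [h1]; exact (w_re_pos (by simpa using hη)).le

/-- There is an energy for which the rotation number is resonant. -/
theorem exists_resonant (hα : Irrational α) (hr : 0 < r) (h : Kot lam α E₀ r M) {a b : ℝ}
    (hE₀ : E₀ ∈ Ioo a b) (hJ : ∀ t ∈ Icc a b, Lyap lam α (t : ℝ) 0 = 0) :
    ∃ E₁ : ℝ, E₁ ∈ Icc a b ∧ (E₁ : ℂ) ∈ ball (E₀ : ℂ) r ∧ ∃ j k : ℤ,
      ∫ x in (0 : ℝ)..1, Complex.log (M E₁ x) = π * (j * α + k) * I := by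
  set ρ := min r (min (E₀ - a) (b - E₀)) with hρ
  have hρ0 : 0 < ρ := lt_min hr (lt_min (sub_pos.2 hE₀.1) (sub_pos.2 hE₀.2))
  have hρ1 : ρ ≤ r := min_le_left _ _
  have hρ2 : ρ ≤ E₀ - a := (min_le_right _ _).trans (min_le_left _ _)
  have hρ3 : ρ ≤ b - E₀ := (min_le_right _ _).trans (min_le_right _ _)
  set S := Ioo (E₀ - ρ) (E₀ + ρ) with hS
  have hSJ : S ⊆ Icc a b := fun t ht => ⟨by linarith [ht.1], by linarith [ht.2]⟩
  have hSB : ∀ t ∈ S, (t : ℂ) ∈ ball (E₀ : ℂ) r := fun t ht => by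
    rw [mem_ball, dist_eq_norm, ← ofReal_sub, norm_real, norm_eq_abs,
      abs_lt]
    exact ⟨by linarith [ht.1], by linarith [ht.2]⟩
  set W : ℂ → ℂ := fun E => ∫ x in (0 : ℝ)..1, Complex.log (M E x) with hW
  have hWd := h.differentiableOn_integral_log
  have hWre : ∀ t ∈ S, (W t).re = 0 := fun t ht => h.integral_log_re hα hJ (hSJ ht) (hSB t ht)
  have hθ : ContinuousOn (fun t : ℝ => (W t).im) S :=
    continuous_im.comp_continuousOn
      (hWd.continuousOn.comp (by fun_prop) fun t ht => hSB t ht)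
  obtain ⟨t, ht, hne⟩ : ∃ t ∈ S, (W t).im ≠ (W E₀).im := by
    by_contra! hcon
    have hE₀S : E₀ ∈ S := ⟨by linarith, by linarith⟩
    have hconst : ∀ t ∈ S, W t = W E₀ := fun t ht =>
      Complex.ext (by rw [hWre t ht, hWre E₀ hE₀S]) (hcon t ht)
    have hfr : ∃ᶠ z in 𝓝[≠] (E₀ : ℂ), W z = (fun _ => W E₀) z := by
      have ht : Tendsto (fun t : ℝ => (t : ℂ)) (𝓝[≠] E₀) (𝓝[≠] (E₀ : ℂ)) := by
        refine tendsto_nhdsWithin_of_tendsto_nhds_of_eventually_within _ ?_ ?_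
        · exact (continuous_ofReal.tendsto _).mono_left nhdsWithin_le_nhds
        · filter_upwards [self_mem_nhdsWithin] with t ht
          simpa using ht
      refine ht.frequently (Eventually.frequently ?_)
      filter_upwards [nhdsWithin_le_nhds (Ioo_mem_nhds hE₀S.1 hE₀S.2)] with t ht
      exact hconst t ht
    have hid := AnalyticOnNhd.eqOn_of_preconnected_of_frequently_eq
      (hWd.analyticOnNhd isOpen_ball) (fun z _ => analyticAt_const)
      (Metric.isPreconnected_ball) (hSB E₀ hE₀S) hfr
    have hmem : (E₀ : ℂ) + (r / 2 : ℝ) * I ∈ ball (E₀ : ℂ) r := by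
      rw [mem_ball, dist_eq_norm, add_sub_cancel_left, norm_mul, norm_I,
        norm_real, mul_one, norm_of_nonneg (by positivity)]
      linarith
    have hi : 0 < ((E₀ : ℂ) + (r / 2 : ℝ) * I).im := by simpa using hr
    have h1 := congrArg Complex.re (hid hmem)
    simp only [hW] at h1
    rw [h.integral_log_eq hmem hi, h.integral_log_re hα hJ (hSJ hE₀S) (hSB E₀ hE₀S)] at h1
    exact (w_re_pos hi).ne' h1
  have hdense : Dense (AddSubgroup.closure {π * α, π} : Set ℝ) := by
    rw [dense_addSubgroupClosure_pair_iff, mul_div_cancel_left₀ _ Real.pi_ne_zero]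
    exact hα
  have hsub : uIcc t E₀ ⊆ S := by
    rw [hS]
    exact (convex_Ioo _ _).ordConnected.uIcc_subset ht ⟨by linarith, by linarith⟩
  have hivt := intermediate_value_uIcc (hθ.mono hsub)
  obtain ⟨y, hy, hym⟩ := hdense.exists_mem_open isOpen_Ioo
    (nonempty_Ioo.2 (min_lt_max.2 hne) :
      (Ioo (min (W t).im (W E₀).im) (max (W t).im (W E₀).im)).Nonempty)
  obtain ⟨E₁, hE₁, hE₁y⟩ := hivt (Ioo_subset_Icc_self hym)
  obtain ⟨j, k, hjk⟩ := AddSubgroup.mem_closure_pair.1 hy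
  refine ⟨E₁, hSJ (hsub hE₁), hSB _ (hsub hE₁), j, k, Complex.ext ?_ ?_⟩
  · change (W E₁).re = _
    rw [hWre _ (hsub hE₁)]; simp
  · change (W E₁).im = _
    have : (W E₁).im = y := hE₁y
    rw [this, ← hjk]; simp; ring

end Kot

theorem prod_lower_of_step {M : ℝ → ℂ} {N : ℕ} (hN : 0 < N) {c d : ℝ} (hc : 0 ≤ c) (hd : 0 < d)
    (hd1 : d ≤ 1) (hM : ∀ x, d ≤ ‖M x‖)
    (hstep : ∀ x, exp (c * N) ≤ ‖∏ j ∈ range N, M (x + j * α)‖) (n : ℕ) (x : ℝ) :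
    exp (c * n) ≤ exp (c * N) / d ^ N * ‖∏ j ∈ range n, M (x + j * α)‖ := by
  have hq : ∀ (q : ℕ) (x : ℝ),
      exp (c * (N * q : ℕ)) ≤ ‖∏ j ∈ range (N * q), M (x + j * α)‖ := by
    intro q
    induction q with
    | zero => simp
    | succ q ih =>
      intro x
      rw [mul_add, mul_one, Finset.prod_range_add, norm_mul]
      have h1 := hstep (x + (N * q : ℕ) * α)
      have h2 := ih x
      push_cast at h1 h2 ⊢
      rw [mul_add, exp_add]
      refine mul_le_mul h2 (h1.trans (le_of_eq ?_)) (exp_pos _).le (norm_nonneg _)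
      congr 1; refine prod_congr rfl fun j _ => ?_
      congr 1; ring
  have hr : ∀ (r : ℕ), r ≤ N → ∀ x, d ^ N ≤ ‖∏ j ∈ range r, M (x + j * α)‖ := by
    intro r hr x
    rw [norm_prod]
    calc d ^ N ≤ d ^ r := pow_le_pow_of_le_one hd.le hd1 hr
      _ = ∏ j ∈ range r, d := by simp
      _ ≤ _ := Finset.prod_le_prod (fun _ _ => hd.le) fun _ _ => hM _
  have e : N * (n / N) + n % N = n := Nat.div_add_mod n N
  rw [div_mul_eq_mul_div, le_div_iff₀ (pow_pos hd N)]
  have h1 := hq (n / N) x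
  have h2 := hr (n % N) (Nat.mod_lt n hN).le (x + (N * (n / N) : ℕ) * α)
  have h3 : ‖∏ j ∈ range n, M (x + j * α)‖ =
      ‖∏ j ∈ range (N * (n / N)), M (x + j * α)‖ *
      ‖∏ j ∈ range (n % N), M (x + (N * (n / N) : ℕ) * α + j * α)‖ := by
    conv_lhs => rw [← e, Finset.prod_range_add, norm_mul]
    congr 2; refine prod_congr rfl fun j _ => ?_
    congr 1; push_cast; ring
  rw [h3, ← mul_assoc]
  refine mul_le_mul ?_ h2 (pow_pos hd N).le (by positivity)
  have h4 : c * n ≤ c * N + c * (N * (n / N) : ℕ) := by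
    rw [← mul_add]; refine mul_le_mul_of_nonneg_left ?_ hc
    have := (Nat.mod_lt n hN).le
    have : n ≤ N + N * (n / N) := by omega
    exact_mod_cast this
  calc exp (c * n) ≤ exp (c * N + c * (N * (n / N) : ℕ)) := exp_le_exp.2 h4
    _ = exp (c * N) * exp (c * (N * (n / N) : ℕ)) := exp_add _ _
    _ ≤ _ := by gcongr

theorem prod_mf_lower_local (hα : Irrational α) (hE : 0 < E.im) {c : ℝ} (hc : 0 ≤ c)
    (hcw : c < (w lam α E).re) : ∃ C, ∀ᶠ E' in 𝓝 E, 0 < E'.im ∧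
      ∀ (n : ℕ) (x : ℝ), exp (c * n) ≤
        C * ‖∏ j ∈ range n, mf lam α E' (x + j * α)‖ := by
  have hm := cp_mf lam α hE
  obtain ⟨C₀, hC₀, hg⟩ := hm.prod_growth hα (mf_ne_zero _ _ hE)
    (κ := ((w lam α E).re - c) / 2) (by linarith)
  rw [← w_re hE] at hg
  obtain ⟨N, hN⟩ := exists_nat_gt (log C₀ / (((w lam α E).re - c) / 2))
  have hκ : 0 < ((w lam α E).re - c) / 2 := by linarith
  have hN' : log C₀ < (N + 1 : ℕ) * (((w lam α E).re - c) / 2) := by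
    rw [div_lt_iff₀ hκ] at hN; push_cast; nlinarith
  have hstep : ∀ x : ℝ, exp (c * (N + 1 : ℕ)) <
      ‖∏ j ∈ range (N + 1), mf lam α E (x + j * α)‖ := by
    intro x
    have h1 := (hg (N + 1) x).2
    have h2 : C₀ * exp (c * (N + 1 : ℕ)) <
        exp ((N + 1 : ℕ) * ((w lam α E).re - ((w lam α E).re - c) / 2)) := by
      conv_lhs => rw [← exp_log hC₀]
      rw [← exp_add]
      refine Real.exp_lt_exp.2 ?_
      linarith
    exact lt_of_mul_lt_mul_left (h2.trans_le h1) hC₀.le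
  have hev : ∀ᶠ E' in 𝓝 E, ∀ x ∈ Icc (0 : ℝ) 1, exp (c * (N + 1 : ℕ)) <
      ‖∏ j ∈ range (N + 1), mf lam α E' (x + j * α)‖ := by
    refine isCompact_Icc.eventually_forall_of_forall_eventually fun x _ => ?_
    have hc : ContinuousAt (fun p : ℂ × ℝ =>
        ‖∏ j ∈ range (N + 1), mf lam α p.1 (p.2 + j * α)‖) (E, x) := by
      refine ContinuousAt.norm (tendsto_finsetProd _ fun j _ => ?_)
      have h1 : ContinuousAt (fun p : ℂ × ℝ => mf lam α p.1 p.2) (E, x + j * α) :=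
        continuousOn_mf.continuousAt ((isOpen_lt continuous_const (by fun_prop)).mem_nhds hE)
      exact ContinuousAt.comp (f := fun p : ℂ × ℝ => (p.1, p.2 + (j : ℝ) * α)) (x := (E, x)) h1
        (by fun_prop)
    exact hc.eventually (lt_mem_nhds (hstep x))
  have hev2 : ∀ᶠ E' in 𝓝 E, E.im / 2 < E'.im :=
    continuous_im.continuousAt.eventually (lt_mem_nhds (by linarith))
  refine ⟨exp (c * (N + 1 : ℕ)) / (min (E.im / 2) 1) ^ (N + 1), ?_⟩
  filter_upwards [hev, hev2] with E' h1 h2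
  have hE' : 0 < E'.im := by linarith
  refine ⟨hE', prod_lower_of_step N.succ_pos hc (lt_min (by linarith) one_pos) (min_le_right _ _)
    (fun x => (min_le_left _ _).trans (h2.le.trans ?_)) fun x => ?_⟩
  · exact (mf_im _ _ hE' x).trans ((le_abs_self _).trans (abs_im_le_norm _))
  · have h3 := h1 (Int.fract x) ⟨Int.fract_nonneg x, (Int.fract_lt_one x).le⟩
    refine h3.le.trans (le_of_eq ?_)
    congr 1; refine prod_congr rfl fun j _ => ?_
    rw [← (cp_mf lam α hE').sub_int (x + j * α) ⌊x⌋, Int.fract]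
    congr 1; ring

theorem prod_mf_lower (hα : Irrational α) {K : Set ℂ} (hK : IsCompact K) {c : ℝ} (hc : 0 ≤ c)
    (hKE : ∀ E ∈ K, 0 < E.im ∧ c < (w lam α E).re) : ∃ C, 0 < C ∧ ∀ E ∈ K,
      ∀ (n : ℕ) (x : ℝ), exp (c * n) ≤
        C * ‖∏ j ∈ range n, mf lam α E (x + j * α)‖ := by
  refine hK.induction_on (p := fun K => ∃ C, 0 < C ∧ ∀ E ∈ K, ∀ (n : ℕ) (x : ℝ),
    exp (c * n) ≤ C * ‖∏ j ∈ range n, mf lam α E (x + j * α)‖) ⟨1, one_pos, by simp⟩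
    (fun s t hst ⟨C, hC, h⟩ => ⟨C, hC, fun E hE => h E (hst hE)⟩)
    (fun s t ⟨C, hC, h⟩ ⟨D, hD, h'⟩ => ⟨max C D, lt_max_of_lt_left hC, ?_⟩) fun E hE => ?_
  · rintro E (hE | hE) n x
    · exact (h E hE n x).trans (mul_le_mul_of_nonneg_right (le_max_left _ _) (norm_nonneg _))
    · exact (h' E hE n x).trans (mul_le_mul_of_nonneg_right (le_max_right _ _) (norm_nonneg _))
  · obtain ⟨C, hC⟩ := prod_mf_lower_local hα (hKE E hE).1 hc (hKE E hE).2
    refine ⟨_, mem_nhdsWithin_of_mem_nhds hC, max C 1, lt_max_of_lt_right one_pos, ?_⟩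
    intro E' hE' n x
    exact (hE'.2 n x).trans (mul_le_mul_of_nonneg_right (le_max_left _ _) (norm_nonneg _))

/-- The Green function of the almost Mathieu operator with one end at the origin. -/
def gg (lam α : ℝ) (E : ℂ) : ℤ → ℝ → ℂ
  | .ofNat n, x => (Dl lam α E (x + α))⁻¹ * ∏ j ∈ range n, mp lam α E (x + (j + 1) * α)
  | .negSucc p, x => (Dl lam α E (x + α))⁻¹ *
      (∏ j ∈ range (p + 1), mf lam α E (x - j * α))⁻¹

theorem gg_zero (x : ℝ) : gg lam α E 0 x = (Dl lam α E (x + α))⁻¹ := by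
  change gg lam α E (.ofNat 0) x = _
  simp [gg]

theorem gg_succ (lam α : ℝ) (n : ℕ) (x : ℝ) :
    gg lam α E (n + 1) x = gg lam α E n x * mp lam α E (x + (n + 1) * α) := by
  change gg lam α E (.ofNat (n + 1)) x = gg lam α E (.ofNat n) x * _
  simp only [gg, prod_range_succ]; ring

theorem gg_neg (lam α : ℝ) (hE : 0 < E.im) (n : ℕ) (x : ℝ) :
    gg lam α E (-n) x = gg lam α E (-n - 1) x * mf lam α E (x - n * α) := by
  have h : (-n - 1 : ℤ) = .negSucc n := by rw [Int.negSucc_eq]; ring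
  have hm := mf_ne_zero lam α hE
  rw [h]
  cases n with
  | zero => 
    have := hm x
    simp [gg]; field_simp
  | succ n =>
    have h' : (-((n + 1 : ℕ) : ℤ)) = .negSucc n := rfl
    rw [h']
    simp only [gg, prod_range_succ _ (n + 1)]
    have := hm (x - ((n + 1 : ℕ) : ℝ) * α)
    rw [mul_inv, mul_assoc, mul_assoc, inv_mul_cancel₀ this, mul_one]

theorem gg_eq (hE : 0 < E.im) (n : ℤ) (x : ℝ) :
    (E - pot lam (x + n * α : ℝ)) * gg lam α E n x - gg lam α E (n + 1) x - gg lam α E (n - 1) x =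
      if n = 0 then 1 else 0 := by
  have hm := mf_ne_zero lam α hE
  have hp := mp_ne_zero lam α hE
  have hD := Dl_ne_zero lam α hE
  have rm := fun y => mf_riccati (lam := lam) (α := α) hE y
  have rp := fun y => mp_riccati (lam := lam) (α := α) hE y
  have key1 : ∀ y : ℝ, (E - pot lam y) = mf lam α E (y + α) + (mf lam α E y)⁻¹ := fun y => by
    rw [rm]; ring
  have key2 : ∀ y : ℝ, (E - pot lam y) = mp lam α E (y + α) + (mp lam α E y)⁻¹ := fun y => by
    rw [rp]; ring
  rcases eq_or_ne n 0 with rfl | hn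
  · have h1 := gg_succ lam α (E := E) 0 x
    have h2 := gg_neg lam α hE 0 x
    simp only [Nat.cast_zero, neg_zero, zero_sub, zero_add, zero_mul, sub_zero, one_mul]
      at h1 h2
    simp only [zero_add, zero_sub, Int.cast_zero, zero_mul, add_zero, if_pos]
    have h3 : gg lam α E (-1) x = gg lam α E 0 x * (mf lam α E x)⁻¹ := by
      rw [h2, mul_assoc, mul_inv_cancel₀ (hm x), mul_one]
    rw [h1, h3, key1 x, gg_zero]
    have h4 := hD (x + α)
    have h5 : mf lam α E (x + α) = Dl lam α E (x + α) + mp lam α E (x + α) := by rw [Dl]; ring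
    rw [h5]
    calc _ = Dl lam α E (x + α) * (Dl lam α E (x + α))⁻¹ := by ring
      _ = 1 := mul_inv_cancel₀ h4
  rw [if_neg hn]
  obtain ⟨p, rfl | rfl⟩ := n.eq_nat_or_neg
  · rcases p with _ | p
    · simp at hn
    have h1 := gg_succ lam α (E := E) (p + 1) x
    have h2 := gg_succ lam α (E := E) p x
    have e : ((p + 1 : ℕ) : ℤ) - 1 = p := by push_cast; ring
    have e2 : x + (((p + 1 : ℕ) : ℤ) : ℝ) * α + α = x + (((p + 1 : ℕ) : ℝ) + 1) * α := by
      push_cast; ring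
    rw [e, h1, key2, e2]
    have h6 : gg lam α E ((p + 1 : ℕ) : ℤ) x =
      gg lam α E p x * mp lam α E (x + (((p + 1 : ℕ) : ℤ) : ℝ) * α) := by
      have := h2; push_cast at this ⊢; exact this
    rw [h6]
    have := hp (x + (((p + 1 : ℕ) : ℤ) : ℝ) * α)
    generalize mp lam α E (x + (((p + 1 : ℕ) : ℤ) : ℝ) * α) = z at this ⊢
    field_simp
    ring
  · rcases p with _ | p
    · simp at hn
    have h1 := gg_neg lam α hE (p + 1) x
    have h2 := gg_neg lam α hE p x
    have e : -((p + 1 : ℕ) : ℤ) + 1 = -p := by push_cast; ring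
    have e2 : (-(p : ℤ) - 1) = -((p + 1 : ℕ) : ℤ) := by push_cast; ring
    rw [e, h2, e2, h1]
    have := hm (x - ((p + 1 : ℕ) : ℝ) * α)
    have e3 : x + ((-((p + 1 : ℕ) : ℤ) : ℤ) : ℝ) * α = x - ((p + 1 : ℕ) : ℝ) * α := by
      push_cast; ring
    rw [e3, key1, show x - ((p + 1 : ℕ) : ℝ) * α + α = x - p * α by
      push_cast; ring]
    generalize mf lam α E (x - ((p + 1 : ℕ) : ℝ) * α) = z at this ⊢
    field_simp
    ring

theorem gg_neg_one (hE : 0 < E.im) (x : ℝ) :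
    gg lam α E (-1) x = mf lam α E x / Dl lam α E x - 1 := by
  have h2 := gg_neg lam α hE 0 x
  simp only [Nat.cast_zero, neg_zero, zero_sub, zero_mul, sub_zero, gg_zero, Dl_shift hE] at h2
  have h1 := mf_ne_zero lam α hE x
  have h3 := mp_ne_zero lam α hE x
  have h4 := Dl_ne_zero lam α hE x
  rw [inv_div] at h2
  have : gg lam α E (-1) x = mp lam α E x / Dl lam α E x := by
    refine (mul_left_inj' h1).1 ?_
    rw [← h2]; ring
  rw [this, eq_sub_iff_add_eq, div_add_one h4, div_left_inj' h4, Dl]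
  ring

theorem cp_gg (lam α : ℝ) (hE : 0 < E.im) (n : ℤ) : CP (gg lam α E n) := by
  have hm := mf_ne_zero lam α hE
  have hD := Dl_ne_zero lam α hE
  have cm := cp_mf lam α hE
  have cp := cp_mp (lam := lam) (α := α) hE
  have cD := cp_Dl lam α hE
  have c0 : CP fun x => (Dl lam α E (x + α))⁻¹ :=
    ⟨(cD.shift α).cont.inv₀ fun x => hD _, fun x => by rw [(cD.shift α).per]⟩
  rcases n with n | p
  · refine c0.mul ⟨continuous_finsetProd _ fun j _ => cp.cont.comp (by fun_prop), fun x =>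
      prod_congr rfl fun j _ => ?_⟩
    rw [add_right_comm, cp.per]
  · refine c0.mul ⟨(continuous_finsetProd _ fun j _ => cm.cont.comp (by fun_prop)).inv₀ fun x =>
      Finset.prod_ne_zero_iff.2 fun j _ => hm _, fun x =>
      congrArg _ (prod_congr rfl fun j _ => ?_)⟩
    rw [add_sub_right_comm, cm.per]

theorem gg_bound (hα : Irrational α) {K : Set ℂ} (hK : IsCompact K) {c : ℝ} (hc : 0 ≤ c)
    (hKE : ∀ E ∈ K, 0 < E.im ∧ c < (w lam α E).re) : ∃ C, 0 < C ∧ ∀ E ∈ K,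
      ∀ (n : ℤ) (x : ℝ), ‖gg lam α E n x‖ ≤ C * exp (-(c * |(n : ℝ)|)) := by
  obtain ⟨C, hC, h⟩ := prod_mf_lower hα hK hc hKE
  obtain ⟨η, hη, hηK⟩ : ∃ η > 0, ∀ E ∈ K, η ≤ E.im := by
    rcases K.eq_empty_or_nonempty with rfl | hne
    · exact ⟨1, one_pos, by simp⟩
    obtain ⟨E₀, hE₀, hmin⟩ := hK.exists_isMinOn hne continuous_im.continuousOn
    exact ⟨E₀.im, (hKE E₀ hE₀).1, fun E hE => hmin hE⟩
  refine ⟨η⁻¹ * C, by positivity, fun E hEK n x => ?_⟩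
  have hE := (hKE E hEK).1
  have hD : ∀ y, ‖(Dl lam α E y)⁻¹‖ ≤ η⁻¹ := fun y =>
    norm_inv_le_of_im hη ((hηK E hEK).trans (Dl_im_ge hE y))
  have hm := mf_ne_zero lam α hE
  have hP : ∀ (n : ℕ) (y : ℝ), ‖(∏ j ∈ range n, mf lam α E (y + j * α))⁻¹‖ ≤
      C * exp (-(c * n)) := by
    intro n y
    rw [norm_inv, Real.exp_neg, ← div_eq_mul_inv, inv_eq_one_div,
      div_le_div_iff₀ (norm_pos_iff.2 (Finset.prod_ne_zero_iff.2 fun j _ => hm _))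
      (exp_pos _), one_mul]
    exact h E hEK n y
  rcases n with n | p
  · have h1 := prod_mf_mul_prod_mp lam α hE n (x + α)
    have h2 : gg lam α E (.ofNat n) x = (Dl lam α E (x + α + n * α))⁻¹ *
        (∏ j ∈ range n, mf lam α E (x + α + j * α))⁻¹ := by
      have h3 : ∏ j ∈ range n, mf lam α E (x + α + j * α) ≠ 0 :=
        Finset.prod_ne_zero_iff.2 fun j _ => hm _
      have h4 := Dl_ne_zero lam α hE (x + α)
      have h5 := Dl_ne_zero lam α hE (x + α + n * α)
      have h6 : ∏ j ∈ range n, mp lam α E (x + (j + 1) * α) =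
          ∏ j ∈ range n, mp lam α E (x + α + j * α) :=
        prod_congr rfl fun j _ => by congr 1; ring
      simp only [gg]
      rw [h6]
      generalize (∏ j ∈ range n, mf lam α E (x + α + j * α)) = a at *
      generalize (∏ j ∈ range n, mp lam α E (x + α + j * α)) = b at *
      generalize Dl lam α E (x + α + n * α) = d at *
      rw [← h1] at h4 ⊢
      have : b ≠ 0 := by rintro rfl; simp at h4
      field_simp
    rw [h2, norm_mul, mul_assoc]
    have := hP n (x + α)
    refine mul_le_mul (hD _) (this.trans (le_of_eq ?_)) (norm_nonneg _) (by positivity)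
    simp
  · simp only [gg]
    have h2 := hP (p + 1) (x - p * α)
    rw [← Finset.prod_range_reflect] at h2
    rw [norm_mul, mul_assoc]
    refine mul_le_mul (hD _) ?_ (norm_nonneg _) (by positivity)
    have e1 : ∏ j ∈ range (p + 1), mf lam α E (x - p * α + (p + 1 - 1 - j : ℕ) * α) =
        ∏ j ∈ range (p + 1), mf lam α E (x - j * α) := by
      refine prod_congr rfl fun j hj => ?_
      have : j ≤ p := by simpa [Nat.lt_succ_iff] using hj
      congr 1
      rw [show p + 1 - 1 - j = p - j by omega, Nat.cast_sub this]; ring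
    have e2 : |((Int.negSucc p : ℤ) : ℝ)| = (p + 1 : ℕ) := by
      rw [Int.cast_negSucc, abs_neg, abs_of_nonneg (by positivity)]
    rw [e2, ← e1]
    exact h2

theorem im_tsum_hop {ι : Type*} (σ : Equiv.Perm ι) {d : ι → ℂ} (hd : Summable fun p => ‖d p‖ ^ 2)
    {c : ι → ℂ} {C : ℝ} (hc : ∀ p, ‖c p‖ ≤ C) :
    ∃ r : ℝ, HasSum (fun p => star (d p) * (c p * d (σ p) + star (c (σ.symm p)) * d (σ.symm p)))
      (r : ℂ) := by
  have hs : Summable fun p => star (d p) * (c p * d (σ p)) := by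
    refine Summable.of_norm_bounded (g := fun p => C * (‖d p‖ ^ 2 + ‖d (σ p)‖ ^ 2))
      ((hd.add ((σ.summable_iff (f := fun p => ‖d p‖ ^ 2)).2 hd)).mul_left C) fun p => ?_
    rw [norm_mul, norm_mul, norm_star]
    have h1 : ‖d p‖ * ‖d (σ p)‖ ≤ ‖d p‖ ^ 2 + ‖d (σ p)‖ ^ 2 := by
      nlinarith [sq_nonneg (‖d p‖ - ‖d (σ p)‖), sq_nonneg (‖d p‖), sq_nonneg (‖d (σ p)‖)]
    calc ‖d p‖ * (‖c p‖ * ‖d (σ p)‖) = ‖c p‖ * (‖d p‖ * ‖d (σ p)‖) := by ring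
      _ ≤ C * (‖d p‖ ^ 2 + ‖d (σ p)‖ ^ 2) := mul_le_mul (hc p) h1 (by positivity)
        ((norm_nonneg _).trans (hc p))
  obtain ⟨S, hS⟩ := hs
  have h2 := (σ.symm.hasSum_iff.2 hS).star
  refine ⟨2 * S.re, ?_⟩
  have e : ((2 * S.re : ℝ) : ℂ) = S + star S := by
    rw [Complex.star_def, Complex.add_conj]
  rw [e]
  convert hS.add h2 using 1
  ext p
  simp only [comp_apply, Equiv.apply_symm_apply, star_mul', star_star]
  ring

theorem eq_zero_of_hop {ι : Type*} (σ τ : Equiv.Perm ι) {d : ι → ℂ}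
    (hd : Summable fun p => ‖d p‖ ^ 2) {c c' : ι → ℂ} {C : ℝ} (hc : ∀ p, ‖c p‖ ≤ C)
    (hc' : ∀ p, ‖c' p‖ ≤ C) (hE : 0 < E.im)
    (h : ∀ p, E * d p = (c p * d (σ p) + star (c (σ.symm p)) * d (σ.symm p)) +
      (c' p * d (τ p) + star (c' (τ.symm p)) * d (τ.symm p))) (p : ι) : d p = 0 := by
  obtain ⟨r, hr⟩ := im_tsum_hop σ hd hc
  obtain ⟨r', hr'⟩ := im_tsum_hop τ hd hc'
  have h1 := hr.add hr'
  have h2 : HasSum (fun p => E * ((‖d p‖ ^ 2 : ℝ) : ℂ)) (E * ((∑' p, ‖d p‖ ^ 2 : ℝ) : ℂ)) :=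
    (Complex.hasSum_ofReal.2 hd.hasSum).mul_left E
  have h3 : ∀ p, E * ((‖d p‖ ^ 2 : ℝ) : ℂ) = star (d p) * (c p * d (σ p) +
      star (c (σ.symm p)) * d (σ.symm p)) + star (d p) * (c' p * d (τ p) +
      star (c' (τ.symm p)) * d (τ.symm p)) := by
    intro p
    rw [← mul_add, ← h p]
    have := Complex.conj_mul' (d p)
    rw [Complex.star_def, Complex.ofReal_pow, ← this]; ring
  have h4 := (funext h3 ▸ h2).unique h1
  have h5 := congrArg Complex.im h4
  rw [Complex.im_mul_ofReal, add_im, ofReal_im, ofReal_im, add_zero] at h5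
  have h6 := (mul_eq_zero.1 h5).resolve_left hE.ne'
  have h7 := hd.le_tsum p (fun q _ => by positivity)
  rw [h6] at h7
  simpa using h7

theorem pot_eq_ee (x : ℂ) : pot lam x = lam * (ee x + ee (-x)) := by
  rw [pot, cos, ee, ee]
  rw [show 2 * π * x * I = 2 * π * I * x by ring,
    show -(2 * π * x) * I = 2 * π * I * -x by ring]
  ring

theorem fc_const_one (k : ℤ) : fc (fun _ => 1) k = if k = 0 then 1 else 0 := by
  split_ifs with h
  · rw [h, fc_zero]; simp
  · have := integral_ee (k := -k) (by simpa using h)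
    simp only [fc, mul_one]
    convert this using 2
    ext x; congr 1; push_cast; ring

theorem fc_gg_eq (hE : 0 < E.im) (n k : ℤ) :
    E * fc (gg lam α E n) k = (fc (gg lam α E (n + 1)) k + fc (gg lam α E (n - 1)) k) +
      (lam * ee (n * α) * fc (gg lam α E n) (k - 1) +
        lam * ee (-(n * α)) * fc (gg lam α E n) (k + 1)) +
      if n = 0 ∧ k = 0 then 1 else 0 := by
  have h := fun n => cp_gg lam α hE n
  have h1 : ∀ x, E * gg lam α E n x = (gg lam α E (n + 1) x + gg lam α E (n - 1) x) +
      ((lam * ee (n * α)) * (ee ((1 : ℤ) * x) * gg lam α E n x) +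
        (lam * ee (-(n * α))) * (ee ((-1 : ℤ) * x) * gg lam α E n x)) +
      (if n = 0 then 1 else 0) * 1 := by
    intro x
    have := gg_eq (lam := lam) (α := α) hE n x
    rw [mul_one, ← this, pot_eq_ee]
    push_cast
    rw [neg_add, ee_add, ee_add]
    simp only [one_mul, neg_one_mul]
    ring
  have h2 : fc (fun x => E * gg lam α E n x) k = _ := congrArg (fun f => fc f k) (funext h1)
  rw [fc_const_mul, CP.fc_add (((h (n + 1)).add (h (n - 1))).add
      (((CP.const _).mul ((CP.char 1).mul (h n))).add
        ((CP.const _).mul ((CP.char (-1)).mul (h n)))))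
      ((CP.const _).mul (CP.const _)), fc_const_mul, fc_const_one] at h2
  rw [h2, CP.fc_add ((h (n + 1)).add (h (n - 1)))
      (((CP.const _).mul ((CP.char 1).mul (h n))).add
        ((CP.const _).mul ((CP.char (-1)).mul (h n)))),
    CP.fc_add (h (n + 1)) (h (n - 1)), CP.fc_add ((CP.const _).mul ((CP.char 1).mul (h n)))
      ((CP.const _).mul ((CP.char (-1)).mul (h n))), fc_const_mul, fc_const_mul, fc_ee_mul,
    fc_ee_mul, sub_neg_eq_add]
  congr 1
  by_cases h1 : n = 0 <;> by_cases h2 : k = 0 <;> simp [h1, h2]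

theorem summable_fc_gg (hα : Irrational α) (hE : 0 < E.im) :
    Summable fun p : ℤ × ℤ => ‖fc (gg lam α E p.1) p.2‖ ^ 2 := by
  have hw := w_re_pos (lam := lam) (α := α) hE
  obtain ⟨C, hC, h⟩ := gg_bound (lam := lam) hα (isCompact_singleton (x := E))
    (c := (w lam α E).re / 2) (by linarith)
    (fun E' hE' => by rw [mem_singleton_iff.1 hE']; exact ⟨hE, by linarith⟩)
  have hcp := fun n => cp_gg lam α hE n
  rw [summable_prod_of_nonneg (fun _ => by positivity)]
  refine ⟨fun n => (hcp n).parseval.summable, ?_⟩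
  simp only [fun n => (hcp n).parseval.tsum_eq]
  have hgeo : Summable fun n : ℤ => C ^ 2 * exp (-((w lam α E).re * |(n : ℝ)|)) := by
    refine Summable.mul_left _ ?_
    have h0 : Summable fun n : ℕ => exp (-((w lam α E).re * n)) := by
      have := Real.summable_exp_nat_mul_iff.2 (neg_lt_zero.2 hw)
      refine this.congr fun n => by congr 1; ring
    refine Summable.of_nat_of_neg ?_ ?_
    · exact h0.congr fun n => by simp
    · exact h0.congr fun n => by simp
  refine hgeo.of_nonneg_of_le (fun n => intervalIntegral.integral_nonneg zero_le_one fun x _ =>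
    by positivity) fun n => ?_
  have : ∀ x, ‖gg lam α E n x‖ ^ 2 ≤ C ^ 2 * exp (-((w lam α E).re * |(n : ℝ)|)) := by
    intro x
    have := pow_le_pow_left₀ (norm_nonneg _) (h E rfl n x) 2
    rw [mul_pow, ← exp_nat_mul] at this
    refine this.trans (le_of_eq ?_)
    congr 2; push_cast; ring
  have hc := (hcp n).cont
  calc _ ≤ ∫ x in (0 : ℝ)..1, C ^ 2 * exp (-((w lam α E).re * |(n : ℝ)|)) :=
        integral_mono_on zero_le_one
          (Continuous.intervalIntegrable (by fun_prop) _ _) (by simp) fun x _ => this x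
    _ = _ := by simp

theorem star_ee_real (x : ℝ) : star (ee x) = ee (-x) := by
  rw [Complex.star_def, ee_conj_real]

theorem fc_gg_dual (hα : Irrational α) (hlam : 0 < lam) (hE : 0 < E.im) (n k : ℤ) :
    fc (gg lam α E n) k = ee (n * k * α) * (lam⁻¹ * fc (gg lam⁻¹ α (E / lam) k) (-n)) := by
  have hl : (lam : ℂ) ≠ 0 := by exact_mod_cast hlam.ne'
  have hE' : 0 < (E / lam).im := by
    rw [div_ofReal_im]; exact div_pos hE hlam
  set a : ℤ × ℤ → ℂ := fun p => fc (gg lam α E p.1) p.2 with ha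
  set b : ℤ × ℤ → ℂ := fun p =>
    ee (p.1 * p.2 * α) * (lam⁻¹ * fc (gg lam⁻¹ α (E / lam) p.2) (-p.1)) with hb
  have hb2 : Summable fun p => ‖b p‖ ^ 2 := by
    have h1 := summable_fc_gg (lam := lam⁻¹) hα hE'
    have h2 := ((((Equiv.prodComm ℤ ℤ).trans
      ((Equiv.refl ℤ).prodCongr (Equiv.neg ℤ))).summable_iff (f := fun p : ℤ × ℤ =>
        ‖fc (gg lam⁻¹ α (E / lam) p.1) p.2‖ ^ 2)).2 h1).mul_left (lam⁻¹ ^ 2)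
    refine h2.congr fun p => ?_
    have : ‖ee (p.1 * p.2 * α)‖ = 1 := by
      have := norm_ee_real (p.1 * p.2 * α); push_cast at this; exact this
    simp only [hb, norm_mul, this, one_mul, mul_pow]
    simp
  have ha2 : Summable fun p => ‖a p‖ ^ 2 := summable_fc_gg hα hE
  have hd : Summable fun p => ‖a p - b p‖ ^ 2 := by
    refine ((ha2.add hb2).mul_left 2).of_nonneg_of_le (fun _ => by positivity) fun p => ?_
    have := norm_sub_le (a p) (b p)
    nlinarith [sq_nonneg (‖a p‖ - ‖b p‖), norm_nonneg (a p - b p), norm_nonneg (a p),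
      norm_nonneg (b p)]
  have hae : ∀ n k, E * a (n, k) = (a (n + 1, k) + a (n - 1, k)) +
      (lam * ee (n * α) * a (n, k - 1) + lam * ee (-(n * α)) * a (n, k + 1)) +
      if n = 0 ∧ k = 0 then 1 else 0 := fun n k => fc_gg_eq hE n k
  have hbe : ∀ n k, E * b (n, k) = (b (n + 1, k) + b (n - 1, k)) +
      (lam * ee (n * α) * b (n, k - 1) + lam * ee (-(n * α)) * b (n, k + 1)) +
      if n = 0 ∧ k = 0 then 1 else 0 := by
    intro n k
    have h1 := fc_gg_eq (lam := lam⁻¹) (α := α) hE' k (-n)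
    have e1 : ee ((n + 1 : ℤ) * k * α) = ee (n * k * α) * ee (k * α) := by
      rw [← ee_add]; congr 1; push_cast; ring
    have e2 : ee ((n - 1 : ℤ) * k * α) = ee (n * k * α) * ee (-(k * α)) := by
      rw [← ee_add]; congr 1; push_cast; ring
    have e3 : ee (n * (k - 1 : ℤ) * α) * ee (n * α) = ee (n * k * α) := by
      rw [← ee_add]; congr 1; push_cast; ring
    have e4 : ee (n * (k + 1 : ℤ) * α) * ee (-(n * α)) = ee (n * k * α) := by
      rw [← ee_add]; congr 1; push_cast; ring
    have e5 : (if n = 0 ∧ k = 0 then (1 : ℂ) else 0) =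
        ee (n * k * α) * (if k = 0 ∧ -n = 0 then 1 else 0) := by
      by_cases h1 : n = 0 <;> by_cases h2 : k = 0 <;> simp [h1, h2, ee_zero]
    simp only [hb]
    rw [e1, e2, e5, show -(n + 1) = -n - 1 by ring, show -(n - 1) = -n + 1 by ring]
    push_cast at h1
    generalize (if k = 0 ∧ -n = 0 then (1 : ℂ) else 0) = z at h1 ⊢
    generalize fc (gg lam⁻¹ α (E / lam) k) (-n) = f at h1 ⊢
    generalize fc (gg lam⁻¹ α (E / lam) k) (-n - 1) = f1 at h1 ⊢
    generalize fc (gg lam⁻¹ α (E / lam) k) (-n + 1) = f2 at h1 ⊢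
    generalize fc (gg lam⁻¹ α (E / lam) (k - 1)) (-n) = f3 at h1 ⊢
    generalize fc (gg lam⁻¹ α (E / lam) (k + 1)) (-n) = f4 at h1 ⊢
    push_cast at h1 ⊢ e3 e4
    have h2 : E * ((lam : ℂ)⁻¹ * f) = E / lam * f := by ring
    have h3 : ∀ u v w t : ℂ, u * v = w → lam * v * (u * ((lam : ℂ)⁻¹ * t)) = w * t := by
      rintro u v w t rfl; field_simp
    rw [h3 _ _ _ f3 e3, h3 _ _ _ f4 e4, mul_left_comm E, h2, h1]
    ring
  let σ : Equiv.Perm (ℤ × ℤ) := (Equiv.addRight 1).prodCongr (Equiv.refl ℤ)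
  let τ : Equiv.Perm (ℤ × ℤ) := (Equiv.refl ℤ).prodCongr (Equiv.addRight 1)
  have key := eq_zero_of_hop σ τ hd (c := fun _ => 1) (c' := fun p => lam * ee (-(p.1 * α)))
    (C := max 1 lam) (fun _ => by simp) (fun p => by
      have := norm_ee_real (-(p.1 * α)); push_cast at this
      rw [norm_mul, this, mul_one, norm_real, norm_eq_abs, abs_of_pos hlam]
      exact le_max_right _ _) hE (by
    rintro ⟨n, k⟩
    have h1 := hae n k
    have h2 := hbe n k
    have e : star (lam * ee (-(n * α))) = lam * ee (n * α) := by
      have := star_ee_real (-(n * α))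
      push_cast at this
      rw [neg_neg] at this
      rw [star_mul', this]
      simp
    simp only [σ, τ, Equiv.prodCongr_apply, Equiv.prodCongr_symm, Prod.map_apply,
      Equiv.coe_addRight, Equiv.refl_apply, Equiv.refl_symm, Equiv.addRight_symm, star_one, one_mul,
      ← sub_eq_add_neg, e]
    rw [mul_sub, h1, h2]; ring) (n, k)
  exact sub_eq_zero.1 key

theorem fc_decay (hα : Irrational α) (hlam : 0 < lam) {K : Set ℂ} (hK : IsCompact K) {c : ℝ}
    (hc : 0 ≤ c) (hKE : ∀ E ∈ K, 0 < E.im ∧ c < (w lam⁻¹ α (E / lam)).re) :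
    ∃ C, 0 < C ∧ ∀ E ∈ K, ∀ k : ℤ,
      ‖fc (fun x => (Dl lam α E x)⁻¹) k‖ ≤ C * exp (-(c * |(k : ℝ)|)) ∧
      ‖fc (fun x => mf lam α E x / Dl lam α E x) k‖ ≤ C * exp (-(c * |(k : ℝ)|)) := by
  have hl : (lam : ℂ) ≠ 0 := by exact_mod_cast hlam.ne'
  obtain ⟨C, hC, h⟩ := gg_bound (lam := lam⁻¹) hα (K := (fun E => E / lam) '' K)
    (hK.image (continuous_id.div_const _)) hc (by
      rintro _ ⟨E, hE, rfl⟩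
      refine ⟨?_, (hKE E hE).2⟩
      simp only
      rw [div_ofReal_im]; exact div_pos (hKE E hE).1 hlam)
  have hli : 0 < lam⁻¹ := inv_pos.2 hlam
  refine ⟨lam⁻¹ * C + 1, by positivity, fun E hEK k => ?_⟩
  have hE := (hKE E hEK).1
  have hCe : ∀ k : ℤ, lam⁻¹ * C * exp (-(c * |(k : ℝ)|)) ≤
      (lam⁻¹ * C + 1) * exp (-(c * |(k : ℝ)|)) := fun k =>
    mul_le_mul_of_nonneg_right (by linarith) (exp_pos _).le
  have ha : ∀ n k : ℤ, ‖fc (gg lam α E n) k‖ ≤ lam⁻¹ * C * exp (-(c * |(k : ℝ)|)) := by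
    intro n k
    have h1 : ‖ee (n * k * α)‖ = 1 := by
      have := norm_ee_real (n * k * α); push_cast at this; exact this
    rw [fc_gg_dual hα hlam hE, norm_mul, h1, one_mul, norm_mul, norm_real,
      norm_eq_abs, abs_of_pos hli, mul_assoc]
    exact mul_le_mul_of_nonneg_left (fc_norm_le (fun x => h _ ⟨E, hEK, rfl⟩ k x) _) hli.le
  constructor
  · refine le_trans ?_ (hCe k)
    refine le_trans (le_of_eq ?_) (ha 0 k)
    have h1 : gg lam α E 0 = fun x => (fun x => (Dl lam α E x)⁻¹) (x + α) :=
      funext fun x => gg_zero x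
    have h2 : CP fun x => (Dl lam α E x)⁻¹ :=
      ⟨(cp_Dl _ _ hE).cont.inv₀ (Dl_ne_zero _ _ hE), fun x => by rw [(cp_Dl _ _ hE).per]⟩
    have h3 : ‖ee (k * α)‖ = 1 := by
      have := norm_ee_real (k * α); push_cast at this; exact this
    rw [h1, h2.fc_shift, norm_mul, h3, one_mul]
  · have h1 : fc (fun x => mf lam α E x / Dl lam α E x) k =
        fc (gg lam α E (-1)) k + if k = 0 then 1 else 0 := by
      rw [← fc_const_one, ← (cp_gg _ _ hE (-1)).fc_add (CP.const 1)]
      congr 1; ext x; rw [gg_neg_one hE]; ring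
    rw [h1]
    refine (norm_add_le _ _).trans ?_
    have h2 := ha (-1) k
    split_ifs with hk
    · subst hk; simp at h2 ⊢; linarith
    · simpa using h2.trans (hCe k)

theorem le_of_exp_growth {a b C : ℝ} (h : ∀ n : ℕ, exp (a * n) ≤ C * exp (b * n)) :
    a ≤ b := by
  by_contra! hlt
  have hC : 0 < C := by have := h 0; simp at this; linarith
  obtain ⟨n, hn⟩ := exists_nat_gt (log C / (a - b))
  rw [div_lt_iff₀ (by linarith)] at hn
  have := h n
  rw [← exp_log hC, ← exp_add, exp_le_exp] at this
  nlinarith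

/-- The matrix `tⁿ Aₙ(x)` as a function of `t = e(x)`. -/
def Gn (lam α : ℝ) (E : ℂ) : ℕ → ℂ → Matrix (Fin 2) (Fin 2) ℂ
  | 0, _ => 1
  | n + 1, t => !![E * t - lam * (t ^ 2 * ee (n * α) + ee (-(n * α))), -t; t, 0] * Gn lam α E n t

theorem Gn_ee (n : ℕ) (x : ℂ) : Gn lam α E n (ee x) = ee x ^ n • An lam α E n x := by
  induction n with
  | zero => simp [Gn, An]
  | succ n ih =>
    rw [Gn, ih, An_succ, pow_succ (ee x) n, mul_smul_comm, mul_smul, ← smul_mul_assoc (ee x)]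
    congr 2
    have h1 : ee x ^ 2 * ee (n * α) = ee x * ee (x + n * α) := by rw [ee_add]; ring
    have h2 : ee (-(n * α)) = ee x * ee (-(x + n * α)) := by rw [← ee_add]; congr 1; ring
    rw [h1, h2, tm, pot_eq_ee]
    ext i j; fin_cases i <;> fin_cases j <;> simp; ring

theorem differentiable_Gn (lam α : ℝ) (n : ℕ) (i j : Fin 2) :
    Differentiable ℂ fun t => Gn lam α E n t i j := by
  induction n generalizing i j with
  | zero => simp only [Gn]; fun_prop
  | succ n ih =>
    have h0 := ih 0 j
    have h1 := ih 1 j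
    simp only [Gn, Matrix.mul_apply, Fin.sum_univ_two]
    fin_cases i <;> simp <;> fun_prop

theorem norm_Gn_zero (hlam : 0 ≤ lam) (n : ℕ) : ‖Gn lam α E n 0 0 0‖ = lam ^ n := by
  induction n with
  | zero => simp [Gn]
  | succ n ih =>
    have h : ‖ee (-(n * α))‖ = 1 := by
      have := norm_ee_real (-(n * α)); push_cast at this; exact this
    simp [Gn, Matrix.mul_apply, Fin.sum_univ_two, ih, h, abs_of_nonneg hlam, pow_succ']

theorem exists_ee_eq {t : ℂ} (ht : t ≠ 0) : ∃ x, ee x = t ∧ ‖t‖ = exp (-(2 * π * x.im)) := by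
  refine ⟨Complex.log t / (2 * π * I), ?_⟩
  have h : ee (Complex.log t / (2 * π * I)) = t := by
    rw [ee, mul_div_cancel₀ _ Complex.two_pi_I_ne_zero, Complex.exp_log ht]
  refine ⟨h, ?_⟩
  conv_lhs => rw [← h, norm_ee]

theorem norm_Gn_le {y M : ℝ} {n : ℕ} (h : ∀ x : ℂ, x.im = y → ‖An lam α E n x‖ ≤ M) {t : ℂ}
    (ht : ‖t‖ ≤ exp (-(2 * π * y))) (i j : Fin 2) :
    ‖Gn lam α E n t i j‖ ≤ exp (-(2 * π * y)) ^ n * M := by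
  have hr := exp_pos (-(2 * π * y))
  refine norm_le_of_forall_mem_frontier_norm_le (U := ball 0
    (exp (-(2 * π * y)))) isBounded_ball
    (differentiable_Gn _ _ n i j).diffContOnCl (fun z hz => ?_) (z := t) ?_
  · rw [frontier_ball _ hr.ne', mem_sphere_zero_iff_norm] at hz
    obtain ⟨x, rfl, hx⟩ := exists_ee_eq (t := z) (norm_pos_iff.1 (hz ▸ hr))
    have hxy : x.im = y := by
      rw [hx] at hz
      have h1 := Real.exp_injective hz
      have h2 := pi_pos
      have h3 : 2 * π * (x.im - y) = 0 := by linarith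
      have := (mul_eq_zero.1 h3).resolve_left (by positivity)
      linarith
    rw [Gn_ee, Matrix.smul_apply, norm_smul, norm_pow, hz]
    exact mul_le_mul_of_nonneg_left ((norm_entry_le _ i j).trans (h x hxy)) (by positivity)
  · rw [closure_ball _ hr.ne']; simpa using ht

theorem herman (hlam : 0 ≤ lam) {y M : ℝ} {n : ℕ}
    (h : ∀ x : ℂ, x.im = y → ‖An lam α E n x‖ ≤ M) :
    lam ^ n * exp (2 * π * y) ^ n ≤ M := by
  have := norm_Gn_le h (t := 0) (by simpa using (exp_pos _).le) 0 0
  rw [norm_Gn_zero hlam, Real.exp_neg, inv_pow, inv_mul_eq_div, le_div_iff₀ (by positivity)] at this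
  exact this

theorem log_add_le_Lyap (hlam : 0 < lam) {ε : ℝ} (hε : 0 ≤ ε) :
    log lam + 2 * π * ε ≤ Lyap lam α E ε := by
  refine le_of_forall_gt_imp_ge_of_dense fun c hc => ?_
  obtain ⟨δ, hδ, C, -, hC⟩ := exists_growth hε hc
  refine le_of_exp_growth (C := C) fun n => ?_
  have h := herman (lam := lam) (α := α) (E := E) hlam.le (y := ε) (n := n) fun x hx =>
    hC E (by simpa using hδ) n x (by rw [hx, abs_of_nonneg hε])
  refine le_trans (le_of_eq ?_) h
  rw [add_mul, exp_add, mul_comm (log lam), mul_comm (2 * π * ε),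
    exp_nat_mul, exp_nat_mul, exp_log hlam]

theorem norm_An_le_slope {y y' M : ℝ} {n : ℕ} (h : ∀ x : ℂ, x.im = y → ‖An lam α E n x‖ ≤ M)
    (hy : y ≤ y') {x : ℂ} (hx : x.im = y') :
    ‖An lam α E n x‖ ≤ 2 * (exp (2 * π * (y' - y) * n) * M) := by
  refine norm_le_of_entry_le fun i j => ?_
  have hn : ‖ee x‖ = exp (-(2 * π * y')) := by rw [norm_ee, ← hx]
  have h1 := norm_Gn_le h (t := ee x) (by
    rw [hn, exp_le_exp]; nlinarith [pi_pos]) i j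
  rw [Gn_ee, Matrix.smul_apply, norm_smul, norm_pow, hn] at h1
  have h2 : exp (2 * π * (y' - y) * n) =
      exp (2 * π * y') ^ n * exp (-(2 * π * y)) ^ n := by
    rw [← exp_nat_mul, ← exp_nat_mul, ← exp_add]; congr 1; ring
  rw [h2, mul_assoc]
  refine le_trans (le_of_eq ?_) (mul_le_mul_of_nonneg_left h1 (by positivity))
  rw [← mul_assoc, ← mul_pow, ← exp_add, add_neg_cancel, Real.exp_zero, one_pow, one_mul]

theorem An_transpose (lam α : ℝ) (n : ℕ) (x : ℂ) : (An lam α E n x).transpose =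
    !![1, 0; 0, -1] * An lam α E n (-x - (n - 1) * α) * !![1, 0; 0, -1] := by
  have hD : (!![1, 0; 0, -1] : Matrix (Fin 2) (Fin 2) ℂ) * !![1, 0; 0, -1] = 1 := by
    ext i j; fin_cases i <;> fin_cases j <;> simp [Matrix.mul_apply]
  induction n generalizing x with
  | zero => simp [An, hD]
  | succ n ih =>
    have h1 : (tm lam E x).transpose = !![1, 0; 0, -1] * tm lam E (-x) * !![1, 0; 0, -1] := by
      rw [tm, tm, pot_neg]
      ext i j; fin_cases i <;> fin_cases j <;> simp [Matrix.mul_apply, Fin.sum_univ_two]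
    rw [An_succ', Matrix.transpose_mul, ih, h1, An_succ]
    have e1 : -x - (((n + 1 : ℕ) : ℂ) - 1) * α + n * α = -x := by push_cast; ring
    have e2 : -(x + α) - ((n : ℂ) - 1) * α = -x - (((n + 1 : ℕ) : ℂ) - 1) * α := by push_cast; ring
    rw [e1, e2]
    generalize An lam α E n (-x - (((n + 1 : ℕ) : ℂ) - 1) * α) = X
    generalize tm lam E (-x) = T
    calc _ = !![1, 0; 0, -1] * T * (!![1, 0; 0, -1] * !![1, 0; 0, -1]) * X * !![1, 0; 0, -1] := by
          simp only [mul_assoc]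
      _ = _ := by rw [hD]; simp only [mul_assoc, one_mul]

theorem norm_An_reflect (lam α : ℝ) (n : ℕ) (x : ℂ) :
    ‖An lam α E n x‖ ≤ 2 * ‖An lam α E n (-x - (n - 1) * α)‖ := by
  refine norm_le_of_entry_le fun i j => ?_
  have h := congrFun (congrFun (An_transpose lam α (E := E) n x) j) i
  rw [Matrix.transpose_apply] at h
  rw [h]
  generalize An lam α E n (-x - (n - 1) * α) = X
  have := norm_entry_le X j i
  have e : ∀ a b, ‖(!![1, 0; 0, -1] * X * !![1, 0; 0, -1] : Matrix (Fin 2) (Fin 2) ℂ) a b‖ =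
      ‖X a b‖ := by
    intro a b
    rw [Matrix.eta_fin_two X]
    fin_cases a <;> fin_cases b <;> simp
  rw [e]; exact this

theorem strip_max {F : ℂ → ℂ} {ε : ℝ} (hε : 0 < ε) (hF : DiffContOnCl ℂ F {z | |z.im| < ε})
    {B M : ℝ}
    (hB : ∀ z, |z.im| < ε → ‖F z‖ ≤ B) (h : ∀ z, |z.im| = ε → ‖F z‖ ≤ M) {z : ℂ}
    (hz : |z.im| ≤ ε) : ‖F z‖ ≤ M := by
  have e : {z : ℂ | |z.im| < ε} = Complex.im ⁻¹' Ioo (-ε) ε := by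
    ext z; simp [abs_lt]
  rw [e] at hF
  refine PhragmenLindelof.horizontal_strip (a := -ε) (b := ε) hF ⟨0, ?_, 0, ?_⟩ (fun z hz => h z ?_)
    (fun z hz => h z ?_) (neg_le_of_abs_le hz) (le_of_abs_le hz)
  · have := pi_pos; rw [sub_neg_eq_add]; positivity
  · refine Asymptotics.IsBigO.of_bound B ?_
    refine eventually_inf_principal.2 (.of_forall fun z hz => ?_)
    simp only [zero_mul, Real.exp_zero, norm_one, mul_one]
    exact hB z (by rw [abs_lt]; exact hz)
  · rw [hz, abs_neg, abs_of_pos hε]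
  · rw [hz, abs_of_pos hε]

theorem three_lines_mid {F : ℂ → ℂ} {ε : ℝ} (hε : 0 < ε) (hF : DiffContOnCl ℂ F {z | |z.im| < ε})
    {a b B : ℝ} (ha : 0 < a) (hb : 0 < b) (hB : ∀ z, |z.im| < ε → ‖F z‖ ≤ B)
    (h1 : ∀ z, z.im = ε → ‖F z‖ ≤ a) (h2 : ∀ z, z.im = -ε → ‖F z‖ ≤ b) (x : ℝ) :
    ‖F x‖ ≤ √(a * b) := by
  set s := log (b / a) / (2 * ε) with hs
  have hn : ∀ z : ℂ, ‖Complex.exp (-(s * I * z))‖ = exp (s * z.im) := by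
    intro z; rw [Complex.norm_exp]; simp
  have hsε : s * ε = log (b / a) / 2 := by rw [hs]; field_simp
  have ex : exp (s * ε) = √(b / a) := by
    rw [hsε, Real.exp_half, exp_log (div_pos hb ha)]
  have := strip_max (F := fun z => Complex.exp (-(s * I * z)) * F z) hε
    (DiffContOnCl.smul (f := F) (c := fun z => Complex.exp (-(s * I * z)))
      (Differentiable.diffContOnCl (by fun_prop)) hF) (B := exp (|s| * ε) * B)
    (M := √(a * b)) (fun z hz => ?_) (fun z hz => ?_) (z := (x : ℂ)) (by simpa using hε.le)
  · rw [norm_mul, hn] at this; simpa using this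
  · rw [norm_mul, hn]
    refine mul_le_mul (exp_le_exp.2 ?_) (hB z hz) (norm_nonneg _) (exp_pos _).le
    calc s * z.im ≤ |s * z.im| := le_abs_self _
      _ = |s| * |z.im| := abs_mul _ _
      _ ≤ _ := mul_le_mul_of_nonneg_left hz.le (abs_nonneg _)
  · rw [norm_mul, hn]
    rcases (abs_eq hε.le).1 hz with h | h
    · rw [h, ex]
      calc √(b / a) * ‖F z‖ ≤ √(b / a) * a := mul_le_mul_of_nonneg_left (h1 z h) (Real.sqrt_nonneg _)
        _ = √(a * b) := by
          rw [← Real.sqrt_sq ha.le, ← Real.sqrt_mul' _ (by positivity), Real.sqrt_sq ha.le]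
          congr 1; field_simp
    · rw [h, mul_neg, Real.exp_neg, ex, ← Real.sqrt_inv, inv_div]
      calc √(a / b) * ‖F z‖ ≤ √(a / b) * b := mul_le_mul_of_nonneg_left (h2 z h) (Real.sqrt_nonneg _)
        _ = √(a * b) := by
          rw [← Real.sqrt_sq hb.le, ← Real.sqrt_mul' _ (by positivity), Real.sqrt_sq hb.le]
          congr 1; field_simp

theorem exists_vecMulVec {P : Matrix (Fin 2) (Fin 2) ℂ} (hP : P.det = 0) :
    ∃ u v : Fin 2 → ℂ, P = Matrix.vecMulVec u v := by
  rw [Matrix.det_fin_two] at hP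
  by_cases h : P 0 0 = 0 ∧ P 1 0 = 0
  · refine ⟨fun i => P i 1, ![0, 1], ?_⟩
    ext i j; fin_cases i <;> fin_cases j <;> simp [Matrix.vecMulVec_apply, h.1, h.2]
  · by_cases h0 : P 0 0 = 0
    · have h1 : P 1 0 ≠ 0 := fun h1 => h ⟨h0, h1⟩
      have h2 : P 0 1 = 0 := by simpa [h0, h1] using hP
      refine ⟨fun i => P i 0, ![1, P 1 1 / P 1 0], ?_⟩
      ext i j; fin_cases i <;> fin_cases j <;> simp [Matrix.vecMulVec_apply, h0, h2]
      field_simp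
    · refine ⟨fun i => P i 0, ![1, P 0 1 / P 0 0], ?_⟩
      ext i j; fin_cases i <;> fin_cases j <;> simp [Matrix.vecMulVec_apply] <;> field_simp
      linear_combination hP

theorem norm_vecMulVec (u v : Fin 2 → ℂ) :
    ‖Matrix.vecMulVec u v‖ = max ‖u 0‖ ‖u 1‖ * (‖v 0‖ + ‖v 1‖) := by
  rw [norm_two, max_mul_of_nonneg _ _ (by positivity)]
  simp [Matrix.vecMulVec_apply, mul_add]

theorem norm_mul_norm_of_rank_one {A P Q : Matrix (Fin 2) (Fin 2) ℂ} (hP : P.det = 0)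
    (hQ : P * Q = Q) : ‖P‖ * ‖A * Q‖ = ‖A * P‖ * ‖Q‖ := by
  obtain ⟨u, v, rfl⟩ := exists_vecMulVec hP
  rw [Matrix.vecMulVec_mul] at hQ
  rw [← hQ, Matrix.mul_vecMulVec, Matrix.mul_vecMulVec]
  simp only [norm_vecMulVec]
  ring

theorem norm_adjugate_le (X : Matrix (Fin 2) (Fin 2) ℂ) : ‖X.adjugate‖ ≤ 2 * ‖X‖ := by
  refine norm_le_of_entry_le fun i j => ?_
  rw [Matrix.adjugate_fin_two]
  have := norm_entry_le X
  fin_cases i <;> fin_cases j <;> simpa using this _ _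

/-- An analytic invariant splitting of the cocycle over the strip of half-width `h`. -/
structure Spl (lam α : ℝ) (E : ℂ) (h : ℝ) (P : ℂ → Matrix (Fin 2) (Fin 2) ℂ) : Prop where
  diff : ∀ i j, DifferentiableOn ℂ (fun x => P x i j) {x | |x.im| < h}
  per : ∀ x, |x.im| < h → P (x + 1) = P x
  inv : ∀ x, |x.im| < h → tm lam E x * P x = P (x + α) * tm lam E x
  tr : ∀ x, |x.im| < h → P x 0 0 + P x 1 1 = 1
  det : ∀ x, |x.im| < h → (P x).det = 0

section Splitting
variable {h : ℝ} {P : ℂ → Matrix (Fin 2) (Fin 2) ℂ}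

theorem Spl.norm_pos (hP : Spl lam α E h P) {x : ℂ} (hx : |x.im| < h) : 0 < ‖P x‖ := by
  rw [norm_pos_iff]
  intro h0
  have := hP.tr x hx
  simp [h0] at this

theorem Spl.adj (hP : Spl lam α E h P) {x : ℂ} (hx : |x.im| < h) : (P x).adjugate = 1 - P x := by
  rw [Matrix.adjugate_fin_two]
  have := hP.tr x hx
  ext i j; fin_cases i <;> fin_cases j <;> simp
  · linear_combination this
  · linear_combination this

theorem Spl.idem (hP : Spl lam α E h P) {x : ℂ} (hx : |x.im| < h) : P x * P x = P x := by
  have h1 := Matrix.mul_adjugate (P x)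
  rw [hP.adj hx, hP.det x hx, zero_smul, mul_sub, mul_one, sub_eq_zero] at h1
  exact h1.symm

theorem Spl.inv_An (hP : Spl lam α E h P) (n : ℕ) {x : ℂ} (hx : |x.im| < h) :
    An lam α E n x * P x = P (x + n * α) * An lam α E n x := by
  induction n with
  | zero => simp [An_zero]
  | succ n ih =>
    have h1 := hP.inv (x + n * α) (by simpa using hx)
    rw [An_succ, mul_assoc, ih, ← mul_assoc, h1, mul_assoc]
    congr 2; push_cast; ring

theorem Spl.norm_An_mul (hP : Spl lam α E h P) (n : ℕ) {x : ℂ} (hx : |x.im| < h) :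
    ‖An lam α E n x * P x‖ = ‖P x‖ * ∏ j ∈ range n,
      (‖tm lam E (x + j * α) * P (x + j * α)‖ / ‖P (x + j * α)‖) := by
  induction n with
  | zero => simp [An_zero]
  | succ n ih =>
    have hx' : |(x + n * α).im| < h := by simpa using hx
    have h1 : P (x + n * α) * (An lam α E n x * P x) = An lam α E n x * P x := by
      rw [hP.inv_An n hx, ← mul_assoc, hP.idem hx']
    have h2 := norm_mul_norm_of_rank_one (A := tm lam E (x + n * α)) (hP.det _ hx') h1
    rw [prod_range_succ, ← mul_assoc, ← ih, An_succ, mul_assoc, mul_div_assoc',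
      eq_div_iff (hP.norm_pos hx').ne', mul_comm, h2, mul_comm]

theorem Spl.An_mul_one_sub (hP : Spl lam α E h P) (n : ℕ) {x : ℂ} (hx : |x.im| < h) :
    An lam α E n x * (1 - P x) =
      ((An lam α E n x).adjugate * P (x + n * α)).adjugate := by
  have hA := Matrix.mul_adjugate (An lam α E n x)
  have hA' := Matrix.adjugate_mul (An lam α E n x)
  rw [det_An, one_smul] at hA hA'
  have h1 : (An lam α E n x).adjugate * P (x + n * α) = P x * (An lam α E n x).adjugate := by
    calc _ = (An lam α E n x).adjugate * (P (x + n * α) * An lam α E n x)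
          * (An lam α E n x).adjugate := by rw [mul_assoc, mul_assoc, hA, mul_one]
      _ = _ := by rw [← hP.inv_An n hx, ← mul_assoc, hA', one_mul]
  rw [h1, Matrix.adjugate_mul_distrib, hP.adj hx,
    Matrix.adjugate_adjugate _ (by simp)]
  simp

theorem Spl.norm_mul_norm (hP : Spl lam α E h P) (n : ℕ) {x : ℂ} (hx : |x.im| < h) :
    ‖An lam α E n x * P x‖ * ‖(An lam α E n x).adjugate * P (x + n * α)‖ =
      ‖P x‖ * ‖P (x + n * α)‖ := by
  have hx' : |(x + n * α).im| < h := by simpa using hx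
  have hA' := Matrix.adjugate_mul (An lam α E n x)
  rw [det_An, one_smul] at hA'
  have h1 : P (x + n * α) * (An lam α E n x * P x) = An lam α E n x * P x := by
    rw [hP.inv_An n hx, ← mul_assoc, hP.idem hx']
  have h2 := norm_mul_norm_of_rank_one (A := (An lam α E n x).adjugate) (hP.det _ hx') h1
  rw [← mul_assoc, hA', one_mul] at h2
  linarith

theorem Spl.continuousOn (hP : Spl lam α E h P) : ContinuousOn P {x | |x.im| < h} := by
  have : ContinuousOn (fun x i j => P x i j) {x | |x.im| < h} :=
    continuousOn_pi.2 fun i => continuousOn_pi.2 fun j => (hP.diff i j).continuousOn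
  exact this

theorem Spl.bound (hP : Spl lam α E h P) {ε : ℝ} (hε : ε < h) :
    ∃ B, 1 ≤ B ∧ ∀ x : ℂ, |x.im| ≤ ε → ‖P x‖ ≤ B := by
  have hK : IsCompact (Icc (0 : ℝ) 1 ×ℂ Icc (-ε) ε) := isCompact_Icc.reProdIm isCompact_Icc
  obtain ⟨B, hB⟩ := hK.exists_bound_of_continuousOn (f := P) (hP.continuousOn.mono fun x hx => by
    rw [Complex.mem_reProdIm] at hx
    exact (abs_le.2 hx.2).trans_lt hε)
  have hper : ∀ (n : ℕ) (x : ℂ), |x.im| < h → P (x + n) = P x := by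
    intro n x hx
    induction n with
    | zero => simp
    | succ n ih =>
      have := hP.per (x + n) (by simpa using hx)
      rw [← ih, ← this]; congr 1; push_cast; ring
  have hperz : ∀ (n : ℤ) (x : ℂ), |x.im| < h → P (x + n) = P x := by
    intro n x hx
    obtain ⟨m, rfl | rfl⟩ := n.eq_nat_or_neg
    · simpa using hper m x hx
    · have := hper m (x + ((-(m : ℤ) : ℤ) : ℂ)) (by simpa using hx)
      rw [← this]; congr 1; push_cast; ring
  refine ⟨max 1 B, le_max_left _ _, fun x hx => le_trans ?_ (le_max_right _ _)⟩
  have := hperz (-⌊x.re⌋) x (hx.trans_lt hε)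
  rw [← this]
  refine hB _ ?_
  rw [Complex.mem_reProdIm]
  refine ⟨?_, abs_le.1 (by simpa using hx)⟩
  simp only [add_re, Complex.intCast_re, Complex.neg_re, Int.cast_neg]
  constructor <;> linarith [Int.floor_le x.re, Int.lt_floor_add_one x.re]

theorem Spl.line_growth (hα : Irrational α) (hP : Spl lam α E h P) {y : ℝ} (hy : |y| < h) :
    ∃ u : ℝ, ∀ κ > 0, ∃ C, 0 < C ∧ ∀ (n : ℕ) (x : ℂ), x.im = y →
      ‖An lam α E n x * P x‖ ≤ C * exp (n * (u + κ)) ∧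
      ‖An lam α E n x * (1 - P x)‖ ≤ C * exp (n * (-u + κ)) ∧
      exp (n * (u - κ)) ≤ C * ‖An lam α E n x * P x‖ ∧
      exp (n * (-u - κ)) ≤ C * ‖An lam α E n x * (1 - P x)‖ := by
  set N : ℝ → ℂ := fun t => ((‖tm lam E (t + y * I) * P (t + y * I)‖ /
    ‖P (t + y * I)‖ : ℝ) : ℂ) with hN
  have him : ∀ t : ℝ, ((t : ℂ) + y * I).im = y := by intro t; simp
  have hs : ∀ t : ℝ, |((t : ℂ) + y * I).im| < h := fun t => by rw [him]; exact hy
  have hpos : ∀ t : ℝ, 0 < ‖P (t + y * I)‖ := fun t => hP.norm_pos (hs t)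
  have hcP : Continuous fun t : ℝ => P (t + y * I) := by
    rw [← continuousOn_univ]
    exact hP.continuousOn.comp (by fun_prop) fun t _ => hs t
  have hctm : Continuous fun t : ℝ => tm lam E (t + y * I) := by
    refine continuous_matrix fun i j => ?_
    have := (continuous_pot (lam := lam)).comp (f := fun t : ℝ => (t + y * I : ℂ))
      (by fun_prop)
    simp only [Function.comp_def] at this
    fin_cases i <;> fin_cases j <;> simp [tm] <;> fun_prop
  have hcp : CP N := by
    refine ⟨continuous_ofReal.comp ((hctm.mul hcP).norm.div hcP.norm fun t => (hpos t).ne'),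
      fun t => ?_⟩
    have e : ((t + 1 : ℝ) : ℂ) + y * I = t + y * I + 1 := by push_cast; ring
    simp only [hN, e]
    rw [hP.per _ (hs t), tm_periodic]
  have hN0 : ∀ t, N t ≠ 0 := by
    intro t
    simp only [hN, ne_eq, Complex.ofReal_eq_zero]
    refine (div_pos ?_ (hpos t)).ne'
    rw [norm_pos_iff]
    intro h0
    have h1 := Matrix.adjugate_mul (tm lam E (t + y * I))
    rw [det_tm, one_smul] at h1
    have : P (t + y * I) = 0 := by
      rw [← one_mul (P _), ← h1, mul_assoc, h0, mul_zero]
    simpa [this] using hpos t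
  obtain ⟨B, hB1, hB⟩ := hP.bound hy
  have hB0 : 0 < B := by linarith
  set u := ∫ x in (0 : ℝ)..1, log ‖N x‖
  refine ⟨u, fun κ hκ => ?_⟩
  obtain ⟨C, hC, hgr⟩ := hcp.prod_growth hα hN0 hκ
  obtain ⟨b, hb, hPb⟩ : ∃ b, 0 < b ∧ ∀ x : ℂ, x.im = y → b ≤ ‖P x‖ := by
    refine ⟨1 / 2, by norm_num, fun x hx => ?_⟩
    have h1 := hP.tr x (by rw [hx]; exact hy)
    have h2 : (1 : ℝ) ≤ ‖P x 0 0‖ + ‖P x 1 1‖ := by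
      calc (1 : ℝ) = ‖P x 0 0 + P x 1 1‖ := by rw [h1, norm_one]
        _ ≤ _ := norm_add_le _ _
    linarith [norm_entry_le (P x) 0 0, norm_entry_le (P x) 1 1]
  have key : ∀ (n : ℕ) (x : ℂ), x.im = y →
      ‖An lam α E n x * P x‖ ≤ B * C * exp (n * (u + κ)) ∧
      b * exp (n * (u - κ)) ≤ C * ‖An lam α E n x * P x‖ := by
    intro n x hx
    have hx' : |x.im| < h := by rw [hx]; exact hy
    have e : x = x.re + y * I := by rw [← hx, Complex.re_add_im]
    have h1 := hP.norm_An_mul n hx'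
    have h2 : ∏ j ∈ range n,
      (‖tm lam E (x + j * α) * P (x + j * α)‖ / ‖P (x + j * α)‖) =
        ‖∏ j ∈ range n, N (x.re + j * α)‖ := by
      rw [norm_prod]
      refine prod_congr rfl fun j _ => ?_
      have : ((x.re + j * α : ℝ) : ℂ) + y * I = x + j * α := by
        conv_rhs => rw [e]
        push_cast; ring
      simp only [hN, this, norm_real, norm_div, norm_norm]
    rw [h2] at h1
    obtain ⟨h3, h4⟩ := hgr n x.re
    rw [h1]
    constructor
    · calc _ ≤ B * (C * exp (n * (u + κ))) :=
            mul_le_mul (hB x (by rw [hx])) h3 (norm_nonneg _) hB0.le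
        _ = _ := by ring
    · calc _ ≤ ‖P x‖ * (C * ‖∏ j ∈ range n, N (x.re + j * α)‖) :=
            mul_le_mul (hPb x hx) h4 (exp_pos _).le (norm_nonneg _)
        _ = _ := by ring
  have hB' : ∀ x : ℂ, x.im = y → ‖P x‖ ≤ B := fun x hx => hB x (by rw [hx])
  have key2 : ∀ (n : ℕ) (x : ℂ), x.im = y →
      ‖An lam α E n x * (1 - P x)‖ ≤ 2 * (B * B * C / b) * exp (n * (-u + κ)) := by
    intro n x hx
    have hx' : |x.im| < h := by rw [hx]; exact hy
    have hx2 : (x + n * α).im = y := by simpa using hx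
    rw [hP.An_mul_one_sub n hx', mul_assoc 2]
    refine (norm_adjugate_le _).trans (mul_le_mul_of_nonneg_left ?_ zero_le_two)
    have h1 := hP.norm_mul_norm n hx'
    have h2 := (key n x hx).2
    set p := ‖An lam α E n x * P x‖
    have hp : 0 < p := by
      have := mul_pos hb (exp_pos (n * (u - κ)))
      exact pos_of_mul_pos_right (this.trans_le h2) hC.le
    have h3 : ‖(An lam α E n x).adjugate * P (x + n * α)‖ ≤ B * B / p := by
      rw [le_div_iff₀ hp, mul_comm, h1]
      exact mul_le_mul (hB' x hx) (hB' _ hx2) (norm_nonneg _) hB0.le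
    refine h3.trans ?_
    have h4 : exp (n * (-u + κ)) = (exp (n * (u - κ)))⁻¹ := by
      rw [← Real.exp_neg]; congr 1; ring
    rw [h4, ← div_eq_mul_inv, div_div, div_le_div_iff₀ hp (by positivity)]
    calc B * B * (b * exp (n * (u - κ))) ≤ B * B * (C * p) :=
          mul_le_mul_of_nonneg_left h2 (by positivity)
      _ = _ := by ring
  have key3 : ∀ (n : ℕ) (x : ℂ), x.im = y →
      exp (n * (-u - κ)) ≤ 2 * (B * C / (b * b)) * ‖An lam α E n x * (1 - P x)‖ := by
    intro n x hx
    have hx' : |x.im| < h := by rw [hx]; exact hy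
    have hx2 : (x + n * α).im = y := by simpa using hx
    have h1 := hP.norm_mul_norm n hx'
    have h2 := (key n x hx).1
    have h3 : ‖(An lam α E n x).adjugate * P (x + n * α)‖ ≤ 2 * ‖An lam α E n x * (1 - P x)‖ := by
      have := norm_adjugate_le (An lam α E n x * (1 - P x))
      rwa [hP.An_mul_one_sub n hx', Matrix.adjugate_adjugate _ (by simp), Fintype.card_fin,
        Nat.sub_self, pow_zero, one_smul, ← hP.An_mul_one_sub n hx'] at this
    have h4 : b * b ≤ B * C * exp (n * (u + κ)) * (2 * ‖An lam α E n x * (1 - P x)‖) := by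
      calc b * b ≤ ‖P x‖ * ‖P (x + n * α)‖ := mul_le_mul (hPb x hx) (hPb _ hx2) hb.le (norm_nonneg _)
        _ = _ := h1.symm
        _ ≤ _ := mul_le_mul h2 h3 (norm_nonneg _) (by positivity)
    have h5 : exp (n * (-u - κ)) = (exp (n * (u + κ)))⁻¹ := by
      rw [← Real.exp_neg]; congr 1; ring
    rw [h5, ← one_div, div_le_iff₀ (exp_pos _), mul_div_assoc', div_mul_eq_mul_div,
      div_mul_eq_mul_div, le_div_iff₀ (by positivity)]
    linarith
  set c1 := B * C with hc1
  set c2 := 2 * (B * B * C / b) with hc2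
  set c3 := C / b with hc3
  set c4 := 2 * (B * C / (b * b)) with hc4
  have p1 : 0 < c1 := by positivity
  have p2 : 0 < c2 := by positivity
  have p3 : 0 < c3 := by positivity
  have p4 : 0 < c4 := by positivity
  have key5 : ∀ (n : ℕ) (x : ℂ), x.im = y →
      exp (n * (u - κ)) ≤ c3 * ‖An lam α E n x * P x‖ := by
    intro n x hx
    rw [hc3, div_mul_eq_mul_div, le_div_iff₀ hb, mul_comm]
    exact (key n x hx).2
  refine ⟨c1 + c2 + c3 + c4, by positivity, fun n x hx => ⟨(key n x hx).1.trans ?_,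
    (key2 n x hx).trans ?_, (key5 n x hx).trans ?_, (key3 n x hx).trans ?_⟩⟩
  all_goals exact mul_le_mul_of_nonneg_right (by linarith) (by positivity)

theorem differentiable_An (n : ℕ) (i j : Fin 2) :
    Differentiable ℂ fun x => An lam α E n x i j := by
  induction n generalizing i j with
  | zero => simp only [An]; fun_prop
  | succ n ih =>
    have h0 := ih 0 j
    have h1 := ih 1 j
    simp only [An_succ, Matrix.mul_apply, Fin.sum_univ_two]
    fin_cases i <;> simp [tm, pot] <;> fun_prop

/-- The growth rate is constant across a strip carrying an analytic invariant splitting. -/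
theorem Spl.Lyap_le (hα : Irrational α) (hP : Spl lam α E h P) {ε : ℝ} (hε : 0 < ε) (hεh : ε < h)
    (hL : 0 < Lyap lam α E 0) : Lyap lam α E ε ≤ Lyap lam α E 0 := by
  obtain ⟨u0, h0⟩ := hP.line_growth hα (y := 0) (by simpa using hε.trans hεh)
  obtain ⟨u1, h1⟩ := hP.line_growth hα (y := ε) (by rwa [abs_of_pos hε])
  obtain ⟨u2, h2⟩ := hP.line_growth hα (y := -ε) (by rwa [abs_neg, abs_of_pos hε])
  obtain ⟨B, hB1, hB⟩ := hP.bound hεh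
  have hB0 : 0 < B := by linarith
  have habs : ∀ (u y κ C : ℝ), |y| ≤ ε → 0 < κ → 0 < C → (∀ (n : ℕ) (x : ℂ), x.im = y →
      ‖An lam α E n x * P x‖ ≤ C * exp (n * (u + κ)) ∧
      ‖An lam α E n x * (1 - P x)‖ ≤ C * exp (n * (-u + κ)) ∧
      exp (n * (u - κ)) ≤ C * ‖An lam α E n x * P x‖ ∧
      exp (n * (-u - κ)) ≤ C * ‖An lam α E n x * (1 - P x)‖) → ∀ (n : ℕ) (x : ℂ), x.im = y →
      ‖An lam α E n x‖ ≤ 2 * C * exp (n * (|u| + κ)) ∧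
      exp (n * (|u| - κ)) ≤ C * (1 + B) * ‖An lam α E n x‖ := by
    intro u y κ C hy hκ hC hh n x hx
    obtain ⟨a1, a2, a3, a4⟩ := hh n x hx
    have hBx := hB x (by rw [hx]; exact hy)
    constructor
    · have e : An lam α E n x = An lam α E n x * P x + An lam α E n x * (1 - P x) := by
        rw [mul_sub, mul_one]; abel
      have b1 : exp (n * (u + κ)) ≤ exp (n * (|u| + κ)) :=
        exp_le_exp.2 (mul_le_mul_of_nonneg_left (by linarith [le_abs_self u]) n.cast_nonneg)
      have b2 : exp (n * (-u + κ)) ≤ exp (n * (|u| + κ)) :=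
        exp_le_exp.2 (mul_le_mul_of_nonneg_left (by linarith [neg_le_abs u]) n.cast_nonneg)
      calc ‖An lam α E n x‖ ≤ ‖An lam α E n x * P x‖ + ‖An lam α E n x * (1 - P x)‖ := by
            conv_lhs => rw [e]
            exact norm_add_le _ _
        _ ≤ C * exp (n * (|u| + κ)) + C * exp (n * (|u| + κ)) :=
            add_le_add (a1.trans (mul_le_mul_of_nonneg_left b1 hC.le))
              (a2.trans (mul_le_mul_of_nonneg_left b2 hC.le))
        _ = _ := by ring
    · have b1 : ‖An lam α E n x * P x‖ ≤ (1 + B) * ‖An lam α E n x‖ :=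
        (norm_mul_le _ _).trans (by nlinarith [norm_nonneg (An lam α E n x)])
      have b2 : ‖An lam α E n x * (1 - P x)‖ ≤ (1 + B) * ‖An lam α E n x‖ := by
        rw [mul_sub, mul_one]
        refine (norm_sub_le _ _).trans ?_
        have := norm_mul_le (An lam α E n x) (P x)
        nlinarith [norm_nonneg (An lam α E n x)]
      rw [mul_assoc]
      rcases abs_choice u with h | h <;> rw [h]
      · exact a3.trans (mul_le_mul_of_nonneg_left b1 hC.le)
      · exact a4.trans (mul_le_mul_of_nonneg_left b2 hC.le)
  have hopen : IsOpen {z : ℂ | |z.im| < ε} :=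
    isOpen_lt (by fun_prop) continuous_const
  have hcl : closure {z : ℂ | |z.im| < ε} ⊆ {z | |z.im| ≤ ε} :=
    closure_minimal (fun z hz => le_of_lt (show |z.im| < ε from hz))
      (isClosed_le (by fun_prop) continuous_const)
  have hle : ∀ (n : ℕ) (κ u1' u2' C : ℝ) (Q : ℂ → Matrix (Fin 2) (Fin 2) ℂ), 0 < C →
      (∀ i j, DifferentiableOn ℂ (fun x => Q x i j) {x | |x.im| < h}) →
      (∃ B, ∀ z : ℂ, |z.im| ≤ ε → ‖Q z‖ ≤ B) →
      (∀ x : ℂ, x.im = ε → ‖An lam α E n x * Q x‖ ≤ C * exp (n * (u1' + κ))) →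
      (∀ x : ℂ, x.im = -ε → ‖An lam α E n x * Q x‖ ≤ C * exp (n * (u2' + κ))) →
      ∀ x : ℝ, ‖An lam α E n x * Q x‖ ≤ 2 * (C * exp (n * ((u1' + u2') / 2 + κ))) := by
    intro n κ u1' u2' C Q hC hQ ⟨B, hB⟩ q1 q2 x
    refine norm_le_of_entry_le fun i j => ?_
    have hd : DifferentiableOn ℂ (fun x => (An lam α E n x * Q x) i j) {x | |x.im| < h} := by
      simp only [Matrix.mul_apply, Fin.sum_univ_two]
      have hA := differentiable_An (lam := lam) (α := α) (E := E) n
      exact ((hA i 0).differentiableOn.mul (hQ 0 j)).add ((hA i 1).differentiableOn.mul (hQ 1 j))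
    have hdc : DiffContOnCl ℂ (fun x => (An lam α E n x * Q x) i j) {x | |x.im| < ε} :=
      ⟨hd.mono fun x hx => lt_trans (show |x.im| < ε from hx) hεh, hd.continuousOn.mono fun x hx =>
        lt_of_le_of_lt (hcl hx) hεh⟩
    refine (three_lines_mid hε hdc (a := C * exp (n * (u1' + κ)))
      (b := C * exp (n * (u2' + κ))) (B := Kb lam ε ‖E‖ ^ n * B) (by positivity)
      (by positivity) (fun z hz => ?_) (fun z hz => (norm_entry_le _ i j).trans (q1 z hz))
      (fun z hz => (norm_entry_le _ i j).trans (q2 z hz)) x).trans (le_of_eq ?_)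
    · refine (norm_entry_le _ i j).trans ((norm_mul_le _ _).trans ?_)
      exact mul_le_mul (norm_An_le hz.le le_rfl n) (hB z hz.le) (norm_nonneg _)
        (pow_nonneg (zero_le_one.trans (one_le_Kb (norm_nonneg _))) _)
    · rw [Real.sqrt_eq_iff_mul_self_eq (by positivity) (by positivity)]
      rw [mul_mul_mul_comm, mul_mul_mul_comm C _ C, ← exp_add, ← exp_add]
      congr 2; ring
  have hQ' : ∀ i j, DifferentiableOn ℂ (fun x => (1 - P x) i j) {x | |x.im| < h} := by
    intro i j
    simp only [Matrix.sub_apply]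
    exact (differentiableOn_const _).sub (hP.diff i j)
  have hB2 : ∃ B, ∀ z : ℂ, |z.im| ≤ ε → ‖1 - P z‖ ≤ B :=
    ⟨‖(1 : Matrix (Fin 2) (Fin 2) ℂ)‖ + B, fun z hz => (norm_sub_le _ _).trans
      (add_le_add le_rfl (hB z hz))⟩
  have two : ∀ a b : ℝ, (∀ κ > 0, a - κ ≤ b + κ) → a ≤ b := fun a b h =>
    le_of_forall_pos_le_add fun κ hκ => by linarith [h (κ / 2) (by positivity)]
  have hu : u0 = (u1 + u2) / 2 := by
    refine le_antisymm (two _ _ fun κ hκ => ?_) (neg_le_neg_iff.1 (two _ _ fun κ hκ => ?_)) <;>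
    · obtain ⟨C0, hC0, k0⟩ := h0 κ hκ
      obtain ⟨C1, hC1, k1⟩ := h1 κ hκ
      obtain ⟨C2, hC2, k2⟩ := h2 κ hκ
      refine le_of_exp_growth (C := C0 * (2 * (C1 + C2))) fun n => ?_
      have g1 : ∀ t, C1 * exp t ≤ (C1 + C2) * exp t := fun t =>
        mul_le_mul_of_nonneg_right (by linarith) (exp_pos _).le
      have g2 : ∀ t, C2 * exp t ≤ (C1 + C2) * exp t := fun t =>
        mul_le_mul_of_nonneg_right (by linarith) (exp_pos _).le
      have l1 := hle n κ u1 u2 (C1 + C2) P (by positivity) hP.diff ⟨B, hB⟩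
        (fun x hx => (k1 n x hx).1.trans (g1 _)) (fun x hx => (k2 n x hx).1.trans (g2 _)) 0
      have l2 := hle n κ (-u1) (-u2) (C1 + C2) (fun x => 1 - P x) (by positivity) hQ' hB2
        (fun x hx => (k1 n x hx).2.1.trans (g1 _)) (fun x hx => (k2 n x hx).2.1.trans (g2 _)) 0
      rw [Complex.ofReal_zero] at l1 l2
      have e2 : (-u1 + -u2) / 2 + κ = -((u1 + u2) / 2) + κ := by ring
      rw [e2] at l2
      obtain ⟨-, -, m1, m2⟩ := k0 n 0 rfl
      have l1' := mul_le_mul_of_nonneg_left l1 hC0.le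
      have l2' := mul_le_mul_of_nonneg_left l2 hC0.le
      rw [mul_comm _ (n : ℝ), mul_comm _ (n : ℝ)]
      linarith
  have hu12 : |u1| = |u2| := by
    refine le_antisymm (two _ _ fun κ hκ => ?_) (two _ _ fun κ hκ => ?_) <;>
    · obtain ⟨C1, hC1, k1⟩ := h1 κ hκ
      obtain ⟨C2, hC2, k2⟩ := h2 κ hκ
      have H1 := habs u1 ε κ C1 (by rw [abs_of_pos hε]) hκ hC1 k1
      have H2 := habs u2 (-ε) κ C2 (by rw [abs_neg, abs_of_pos hε]) hκ hC2 k2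
      refine le_of_exp_growth (C := (C1 + C2) * (1 + B) * (2 * (2 * (C1 + C2)))) fun n => ?_
      have i1 : (ε * I : ℂ).im = ε := by simp
      have i2 : (-(ε * I) - (n - 1) * α : ℂ).im = -ε := by simp
      have i3 : (-(-(ε * I) - (n - 1) * α) - (n - 1) * α : ℂ) = ε * I := by ring
      have r1 := norm_An_reflect lam α (E := E) n (ε * I)
      have r2 := norm_An_reflect lam α (E := E) n (-(ε * I) - (n - 1) * α)
      rw [i3] at r2
      obtain ⟨a1, a2⟩ := H1 n _ i1
      obtain ⟨b1, b2⟩ := H2 n _ i2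
      generalize ‖An lam α E n (ε * I)‖ = X at *
      generalize ‖An lam α E n (-(ε * I) - (n - 1) * α)‖ = Y at *
      rw [mul_comm _ (n : ℝ), mul_comm _ (n : ℝ)]
      first
        | refine a2.trans ?_
          have q := b1.trans (mul_le_mul_of_nonneg_right (b := 2 * C2) (c := 2 * (C1 + C2))
            (by linarith) (exp_pos _).le)
          calc C1 * (1 + B) * X ≤ (C1 + C2) * (1 + B) * (2 * (2 * (C1 + C2) *
                exp (n * (|u2| + κ)))) := by
                refine mul_le_mul ?_ (by linarith) ?_ (by positivity)
                · exact mul_le_mul_of_nonneg_right (by linarith) (by positivity)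
                · by_contra! hX
                  have := a2.trans (mul_nonpos_of_nonneg_of_nonpos (by positivity) hX.le)
                  linarith [exp_pos (n * (|u1| - κ))]
            _ = _ := by ring
        | refine b2.trans ?_
          have q := a1.trans (mul_le_mul_of_nonneg_right (b := 2 * C1) (c := 2 * (C1 + C2))
            (by linarith) (exp_pos _).le)
          calc C2 * (1 + B) * Y ≤ (C1 + C2) * (1 + B) * (2 * (2 * (C1 + C2) *
                exp (n * (|u1| + κ)))) := by
                refine mul_le_mul ?_ (by linarith) ?_ (by positivity)
                · exact mul_le_mul_of_nonneg_right (by linarith) (by positivity)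
                · by_contra! hX
                  have := b2.trans (mul_nonpos_of_nonneg_of_nonpos (by positivity) hX.le)
                  linarith [exp_pos (n * (|u2| - κ))]
            _ = _ := by ring
  have hL0 : Lyap lam α E 0 ≤ |u0| := by
    refine le_of_forall_pos_le_add fun κ hκ => ?_
    obtain ⟨C0, hC0, k0⟩ := h0 κ hκ
    refine Lyap_le_of_growth (C := 2 * C0) le_rfl fun n x hx => ?_
    rw [mul_comm _ (n : ℝ)]
    exact (habs u0 0 κ C0 (by simpa using hε.le) hκ hC0 k0 n x
      (abs_nonpos_iff.1 hx)).1
  have hu1 : |u1| = |u0| := by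
    rcases abs_eq_abs.1 hu12 with h | h
    · rw [hu, h]; ring_nf
    · rw [h, neg_add_cancel, zero_div] at hu
      rw [hu, abs_zero] at hL0
      linarith
  have hup : |u0| ≤ Lyap lam α E 0 := by
    refine le_of_forall_gt_imp_ge_of_dense fun c hc => ?_
    obtain ⟨δ, hδ, C, hC, hg⟩ := exists_growth le_rfl hc
    refine le_of_forall_pos_le_add fun κ hκ => ?_
    obtain ⟨C0, hC0, k0⟩ := h0 κ hκ
    rw [← sub_le_iff_le_add]
    refine le_of_exp_growth (C := C0 * (1 + B) * C) fun n => ?_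
    have g := hg E (by simpa using hδ) n 0 (by simp)
    have := (habs u0 0 κ C0 (by simpa using hε.le) hκ hC0 k0 n 0 rfl).2
    rw [mul_comm _ (n : ℝ)]
    refine this.trans ?_
    rw [mul_assoc _ C]
    exact mul_le_mul_of_nonneg_left g (by positivity)
  refine le_trans ?_ hup
  refine le_of_forall_pos_le_add fun κ hκ => ?_
  obtain ⟨C1, hC1, k1⟩ := h1 κ hκ
  obtain ⟨C2, hC2, k2⟩ := h2 κ hκ
  refine Lyap_le_of_growth (C := 2 * (2 * (C1 + C2))) hε.le fun n x hx => ?_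
  have H1 := habs u1 ε κ C1 (by rw [abs_of_pos hε]) hκ hC1 k1 n
  have H2 := habs u2 (-ε) κ C2 (by rw [abs_neg, abs_of_pos hε]) hκ hC2 k2 n
  rw [mul_assoc]
  refine norm_le_of_entry_le fun i j => ?_
  refine strip_max hε ((differentiable_An n i j).diffContOnCl) (B := Kb lam ε ‖E‖ ^ n)
    (fun z hz => (norm_entry_le _ i j).trans (norm_An_le hz.le le_rfl n)) (fun z hz => ?_) hx
  refine (norm_entry_le _ i j).trans ?_
  rw [mul_comm _ (n : ℝ)]
  rcases (abs_eq hε.le).1 hz with h | h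
  · refine (H1 z h).1.trans ?_
    rw [hu1]
    exact mul_le_mul_of_nonneg_right (by linarith) (exp_pos _).le
  · refine (H2 z h).1.trans ?_
    rw [← hu12, hu1]
    exact mul_le_mul_of_nonneg_right (by linarith) (exp_pos _).le

end Splitting

theorem summable_exp_abs {c : ℝ} (hc : 0 < c) : Summable fun k : ℤ => exp (-(c * |(k : ℝ)|)) := by
  have h0 : Summable fun n : ℕ => exp (-(c * n)) :=
    (Real.summable_exp_nat_mul_iff.2 (neg_lt_zero.2 hc)).congr fun n => by congr 1; ring
  refine Summable.of_nat_of_neg (h0.congr fun n => ?_) (h0.congr fun n => ?_) <;> simp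

/-- A continuous periodic function whose Fourier coefficients decay like `exp(-2πh|k|)`. -/
structure Dec (f : ℝ → ℂ) (h : ℝ) : Prop where
  cp : CP f
  decay : ∃ C, ∀ k : ℤ, ‖fc f k‖ ≤ C * exp (-(2 * π * h * |(k : ℝ)|))

/-- The holomorphic extension given by the Fourier series. -/
def ext (f : ℝ → ℂ) (z : ℂ) : ℂ := ∑' k : ℤ, fc f k * ee (k * z)

theorem norm_ee_int_mul_le (k : ℤ) (z : ℂ) : ‖ee (k * z)‖ ≤ exp (2 * π * |z.im| * |(k : ℝ)|) := by
  rw [norm_ee, exp_le_exp]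
  have h1 : ((k : ℂ) * z).im = k * z.im := by simp
  have h2 : -(k * z.im) ≤ |(k : ℝ)| * |z.im| := by rw [← abs_mul]; exact neg_le_abs _
  rw [h1]
  nlinarith [pi_pos]

theorem ext_add_one (f : ℝ → ℂ) (z : ℂ) : ext f (z + 1) = ext f z := by
  simp only [ext, mul_add, mul_one, ee_add, ee_int]

theorem isOpen_strip (h : ℝ) : IsOpen {z : ℂ | |z.im| < h} :=
  isOpen_lt (by fun_prop) continuous_const

theorem isPreconnected_strip (h : ℝ) : IsPreconnected {z : ℂ | |z.im| < h} := by
  have e : {z : ℂ | |z.im| < h} = Complex.imLm ⁻¹' Ioo (-h) h := by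
    ext z; simp [abs_lt]
  rw [e]
  exact ((convex_Ioo _ _).linear_preimage Complex.imLm).isPreconnected

/-- The identity principle for a strip. -/
theorem eq_on_strip {h : ℝ} (hh : 0 < h) {F G : ℂ → ℂ} (hF : DifferentiableOn ℂ F {z | |z.im| < h})
    (hG : DifferentiableOn ℂ G {z | |z.im| < h}) (heq : ∀ x : ℝ, F x = G x) {z : ℂ}
    (hz : |z.im| < h) : F z = G z := by
  refine (hF.analyticOnNhd (isOpen_strip h)).eqOn_of_preconnected_of_frequently_eq
    (hG.analyticOnNhd (isOpen_strip h)) (isPreconnected_strip h) (z₀ := 0) (by simpa using hh) ?_ hz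
  have ht : Tendsto (fun n : ℕ => (((1 / ((n : ℝ) + 1) : ℝ)) : ℂ)) atTop (𝓝[≠] 0) := by
    refine tendsto_nhdsWithin_iff.2 ⟨?_, .of_forall fun n => ?_⟩
    · have := (continuous_ofReal.tendsto 0).comp
        (tendsto_one_div_add_atTop_nhds_zero_nat (𝕜 := ℝ))
      simpa [Function.comp_def] using this
    · simp only [mem_compl_iff, mem_singleton_iff, Complex.ofReal_eq_zero]
      positivity
  exact ht.frequently (.of_forall fun n => heq _)

namespace Dec
variable {f g : ℝ → ℂ} {h : ℝ}

theorem mono (hf : Dec f h) {h' : ℝ} (hh : h' ≤ h) : Dec f h' := by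
  obtain ⟨C, hC⟩ := hf.decay
  have hC0 : 0 ≤ C := by
    have := (norm_nonneg _).trans (hC 0)
    simpa using this
  refine ⟨hf.cp, C, fun k => (hC k).trans (mul_le_mul_of_nonneg_left ?_ hC0)⟩
  rw [exp_le_exp, neg_le_neg_iff]
  have := pi_pos
  gcongr

theorem term_le {C : ℝ} (hC : ∀ k : ℤ, ‖fc f k‖ ≤ C * exp (-(2 * π * h * |(k : ℝ)|)))
    {h' : ℝ} {z : ℂ} (hz : |z.im| ≤ h') (k : ℤ) :
    ‖fc f k * ee (k * z)‖ ≤ C * exp (-(2 * π * (h - h') * |(k : ℝ)|)) := by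
  rw [norm_mul]
  have hC0 : 0 ≤ C := by simpa using (norm_nonneg _).trans (hC 0)
  have h2 : ‖ee (k * z)‖ ≤ exp (2 * π * h' * |(k : ℝ)|) := by
    refine (norm_ee_int_mul_le k z).trans (exp_le_exp.2 ?_)
    have := pi_pos
    gcongr
  calc _ ≤ C * exp (-(2 * π * h * |(k : ℝ)|)) * exp (2 * π * h' * |(k : ℝ)|) :=
        mul_le_mul (hC k) h2 (norm_nonneg _) (by positivity)
    _ = _ := by rw [mul_assoc, ← exp_add]; congr 2; ring

theorem summable_fc (hf : Dec f h) (hh : 0 < h) : Summable (fc f) := by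
  obtain ⟨C, hC⟩ := hf.decay
  have := pi_pos
  exact Summable.of_norm_bounded ((summable_exp_abs (c := 2 * π * h) (by positivity)).mul_left C) hC

theorem ext_ofReal (hf : Dec f h) (hh : 0 < h) (x : ℝ) : ext f x = f x :=
  (hf.cp.hasSum (hf.summable_fc hh) x).tsum_eq

theorem differentiableOn_ext (hf : Dec f h) : DifferentiableOn ℂ (ext f) {z | |z.im| < h} := by
  obtain ⟨C, hC⟩ := hf.decay
  intro z hz
  obtain ⟨h', h1, h2⟩ := exists_between (show |z.im| < h from hz)
  have : DifferentiableOn ℂ (ext f) {z | |z.im| < h'} := by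
    have := pi_pos
    refine Complex.differentiableOn_tsum_of_summable_norm
      ((summable_exp_abs (c := 2 * π * (h - h')) (mul_pos (by positivity)
        (sub_pos.2 h2))).mul_left C) (fun k => ?_) (isOpen_strip h')
      fun k w hw => term_le hC (le_of_lt (show |w.im| < h' from hw)) k
    unfold ee
    fun_prop
  exact (this.differentiableAt ((isOpen_strip h').mem_nhds h1)).differentiableWithinAt

end Dec

/-- The projection onto one invariant direction along the other one. -/
def pr (α : ℝ) (b g : ℝ → ℂ) (x : ℂ) : Matrix (Fin 2) (Fin 2) ℂ :=
  !![ext b x, -ext g (x + α); ext g x, 1 - ext b x]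

theorem spl_of_dec {b g : ℝ → ℂ} {h : ℝ} (hh : 0 < h) (hb : Dec b h) (hg : Dec g h)
    (h0 : ∀ x, g x ≠ 0) (h1 : ∀ x : ℝ, (E - pot lam x) * g (x + α) = b x + b (x + α) - 1)
    (h2 : ∀ x, b x * (1 - b x) + g x * g (x + α) = 0) : Spl lam α E h (pr α b g) := by
  have hB := hb.differentiableOn_ext
  have hG := hg.differentiableOn_ext
  have shift : ∀ {F : ℂ → ℂ}, DifferentiableOn ℂ F {z | |z.im| < h} →
      DifferentiableOn ℂ (fun z => F (z + α)) {z | |z.im| < h} := fun hF =>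
    hF.comp (by fun_prop) fun z hz => by simpa using hz
  have hB' := shift hB
  have hG' := shift hG
  have hG'' := shift hG'
  have hpot : DifferentiableOn ℂ (pot lam) {z | |z.im| < h} := by
    unfold pot; exact Differentiable.differentiableOn (by fun_prop)
  have r : ∀ x : ℝ, (x : ℂ) + α = ((x + α : ℝ) : ℂ) := fun x => by push_cast; ring
  have e1 : ∀ z : ℂ, |z.im| < h → (E - pot lam z) * ext g (z + α) = ext b z + ext b (z + α) - 1 :=
    fun z hz => eq_on_strip hh (F := fun z => (E - pot lam z) * ext g (z + α))
      (G := fun z => ext b z + ext b (z + α) - 1) (by fun_prop) (by fun_prop) (fun x => by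
        simp only [r, hb.ext_ofReal hh, hg.ext_ofReal hh]; exact h1 x) hz
  have e2 : ∀ z : ℂ, |z.im| < h → ext b z * (1 - ext b z) + ext g z * ext g (z + α) = 0 :=
    fun z hz => eq_on_strip hh (F := fun z => ext b z * (1 - ext b z) + ext g z * ext g (z + α))
      (G := fun z => 0) (by fun_prop) (by fun_prop) (fun x => by
        simp only [r, hb.ext_ofReal hh, hg.ext_ofReal hh]; exact h2 x) hz
  have e3 : ∀ z : ℂ, |z.im| < h → (E - pot lam z) * (ext b (z + α) - ext b z) =
      ext g (z + α + α) - ext g z :=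
    fun z hz => eq_on_strip hh (F := fun z => (E - pot lam z) * (ext b (z + α) - ext b z))
      (G := fun z => ext g (z + α + α) - ext g z) (by fun_prop) (by fun_prop) (fun x => by
        simp only [r, hb.ext_ofReal hh, hg.ext_ofReal hh]
        have a1 := h1 x
        have a2 := h2 x
        have a3 := h2 (x + α)
        refine mul_right_cancel₀ (h0 (x + α)) ?_
        linear_combination (b (x + α) - b x) * a1 + a2 - a3) hz
  refine ⟨fun i j => ?_, fun x hx => ?_, fun x hx => ?_, fun x hx => ?_, fun x hx => ?_⟩
  · fin_cases i <;> fin_cases j <;> simp only [pr] <;> simp <;> fun_prop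
  · simp only [pr, ext_add_one, add_right_comm x 1 (α : ℂ)]
  · have a1 := e1 x hx
    have a3 := e3 x hx
    simp only [pr, tm]
    ext i j; fin_cases i <;> fin_cases j <;> simp
    · linear_combination -a3
    · linear_combination -a1
    · linear_combination -a1
  · simp [pr]
  · simp only [pr, Matrix.det_fin_two_of]
    linear_combination e2 x hx

theorem Lyap_strip_le (hα : Irrational α) (hlam : 0 < lam) (hE : 0 < E.im) {ε : ℝ} (hε : 0 < ε)
    (hεw : 2 * π * ε < (w lam⁻¹ α (E / lam)).re) : Lyap lam α E ε ≤ Lyap lam α E 0 := by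
  have hpi := pi_pos
  obtain ⟨c, hc1, hc2⟩ := exists_between hεw
  have hc0 : 0 < c := lt_trans (by positivity) hc1
  set h := c / (2 * π) with hh
  have hc : c = 2 * π * h := by rw [hh]; field_simp
  have hh0 : 0 < h := by positivity
  obtain ⟨C, -, hC⟩ := fc_decay (lam := lam) (K := {E}) hα hlam isCompact_singleton hc0.le (by
    rintro _ rfl; exact ⟨hE, hc2⟩)
  have hD := Dl_ne_zero lam α hE
  have cD := cp_Dl lam α hE
  have cg : CP fun x => (Dl lam α E x)⁻¹ :=
    ⟨cD.cont.inv₀ hD, fun x => by rw [cD.per]⟩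
  have cb : CP fun x => mf lam α E x / Dl lam α E x :=
    ⟨(cp_mf _ _ hE).cont.div cD.cont hD, fun x => by rw [cD.per, (cp_mf _ _ hE).per]⟩
  refine (spl_of_dec hh0 (b := fun x => mf lam α E x / Dl lam α E x)
    (g := fun x => (Dl lam α E x)⁻¹) ⟨cb, C, fun k => ?_⟩ ⟨cg, C, fun k => ?_⟩
    (fun x => inv_ne_zero (hD x)) (fun x => ?_) (fun x => ?_)).Lyap_le hα hε
    (by rw [hc] at hc1; exact lt_of_mul_lt_mul_left hc1 (by positivity))
    (by rw [Lyap_eq hα hE]; exact w_re_pos hE)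
  · rw [← hc]; exact (hC E rfl k).2
  · rw [← hc]; exact (hC E rfl k).1
  · have h1 := mf_ne_zero lam α hE x
    have h2 := mp_ne_zero lam α hE x
    have h3 := hD x
    have h4 := mf_riccati (lam := lam) (α := α) hE x
    have h5 := Dl_shift (lam := lam) (α := α) hE x
    have h6 : Dl lam α E x = mf lam α E x - mp lam α E x := rfl
    simp only [h4, h5]
    field_simp
    rw [h6]; ring
  · have h1 := mf_ne_zero lam α hE x
    have h2 := mp_ne_zero lam α hE x
    have h3 := hD x
    have h5 := Dl_shift (lam := lam) (α := α) hE x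
    have h6 : Dl lam α E x = mf lam α E x - mp lam α E x := rfl
    simp only [h5]
    field_simp
    rw [h6]; ring

theorem norm_le_of_two_constants {f : ℂ → ℂ} {E : ℂ} {ρ C b K σ : ℝ} {q : ℕ} (hρ : 0 < ρ)
    (hσ : 0 ≤ σ) (hC : 0 ≤ C) (hb : 0 ≤ b) (hK : 1 ≤ K) (hq : 1 ≤ q) (hKσ : K ^ q * σ ≤ 1) (n : ℕ)
    (hf : DiffContOnCl ℂ f (ball E ρ))
    (hM : ∀ z ∈ sphere E ρ, ‖f z‖ ≤ C * b ^ n * K ^ n)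
    (hm : ∀ z ∈ sphere E ρ, ρ * σ ≤ |(z - E).im| → ‖f z‖ ≤ C * b ^ n) :
    ‖f E‖ ≤ C * K ^ q * b ^ n * exp (log 2 / q * n) := by
  refine (two_constants hρ hσ hf hM hm (n / q)).trans ?_
  have hs : (2 : ℝ) ^ (n / q) ≤ exp (log 2 / q * n) := by
    rw [← exp_log (zero_lt_two' ℝ), ← exp_nat_mul, exp_log zero_lt_two,
      exp_le_exp]
    have h1 : ((n / q : ℕ) : ℝ) ≤ n / q := Nat.cast_div_le
    have h2 := log_pos one_lt_two
    calc _ ≤ (n / q : ℝ) * log 2 := mul_le_mul_of_nonneg_right h1 h2.le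
      _ = _ := by ring
  have hm : max (C * b ^ n) (C * b ^ n * K ^ n * σ ^ (n / q)) ≤ C * K ^ q * b ^ n := by
    have h0 : 0 ≤ C * b ^ n := by positivity
    have h1 : K ^ n * σ ^ (n / q) ≤ K ^ q := by
      have h2 : n ≤ q + q * (n / q) := by
        have := Nat.div_add_mod n q
        have := Nat.mod_lt n (show 0 < q by omega)
        omega
      calc K ^ n * σ ^ (n / q) ≤ K ^ (q + q * (n / q)) * σ ^ (n / q) :=
            mul_le_mul_of_nonneg_right (pow_le_pow_right₀ hK h2) (by positivity)
        _ = K ^ q * (K ^ q * σ) ^ (n / q) := by rw [mul_pow, ← pow_mul, pow_add]; ring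
        _ ≤ K ^ q * 1 := mul_le_mul_of_nonneg_left (pow_le_one₀ (by positivity) hKσ) (by positivity)
        _ = _ := mul_one _
    refine max_le ?_ ?_
    · calc C * b ^ n = C * b ^ n * 1 := (mul_one _).symm
        _ ≤ C * b ^ n * K ^ q := mul_le_mul_of_nonneg_left (one_le_pow₀ hK) h0
        _ = _ := by ring
    · calc _ = C * b ^ n * (K ^ n * σ ^ (n / q)) := by ring
        _ ≤ C * b ^ n * K ^ q := mul_le_mul_of_nonneg_left h1 h0
        _ = _ := by ring
  calc _ ≤ exp (log 2 / q * n) * (C * K ^ q * b ^ n) :=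
        mul_le_mul hs hm (le_max_of_le_left (by positivity)) (exp_pos _).le
    _ = _ := mul_comm _ _

theorem pot_conj (x : ℂ) : pot lam (conj x) = conj (pot lam x) := by
  simp only [pot, map_mul, ← Complex.cos_conj, conj_ofReal, map_ofNat]

theorem An_conj (n : ℕ) (x : ℂ) : An lam α (conj E) n (conj x) =
    (An lam α E n x).map conj := by
  induction n with
  | zero => simp [An_zero]
  | succ n ih =>
    rw [An_succ, An_succ, Matrix.map_mul, ih]
    congr 1
    have : conj x + n * α = conj (x + n * α) := by simp
    rw [this, tm, tm, pot_conj]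
    ext i j; fin_cases i <;> fin_cases j <;> simp

theorem norm_An_conj (n : ℕ) (x : ℂ) :
    ‖An lam α (conj E) n (conj x)‖ = ‖An lam α E n x‖ := by
  rw [An_conj, norm_two, norm_two]; simp

theorem Lyap_conj_le {ε : ℝ} (hε : 0 ≤ ε) : Lyap lam α (conj E) ε ≤ Lyap lam α E ε := by
  refine le_of_forall_gt_imp_ge_of_dense fun c hc => ?_
  obtain ⟨δ, hδ, C, -, hC⟩ := exists_growth hε hc
  refine Lyap_le_of_growth (C := C) hε fun n x hx => ?_
  have := norm_An_conj (lam := lam) (α := α) (E := E) n (conj x)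
  rw [conj_conj] at this
  rw [this]
  exact hC E (by simpa using hδ) n _ (by simpa using hx)

theorem Lyap_conj {ε : ℝ} (hε : 0 ≤ ε) : Lyap lam α (conj E) ε = Lyap lam α E ε := by
  refine le_antisymm (Lyap_conj_le hε) ?_
  have := Lyap_conj_le (lam := lam) (α := α) (E := conj E) hε
  rwa [conj_conj] at this

theorem exists_uniform_growth {ε c : ℝ} (hε : 0 ≤ ε) {K : Set ℂ} (hK : IsCompact K)
    (h : ∀ E ∈ K, Lyap lam α E ε < c) : ∃ C, 0 < C ∧ ∀ E ∈ K, ∀ (n : ℕ) (x : ℂ), |x.im| ≤ ε →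
      ‖An lam α E n x‖ ≤ C * exp (c * n) := by
  refine hK.induction_on (p := fun K => ∃ C, 0 < C ∧ ∀ E ∈ K, ∀ (n : ℕ) (x : ℂ), |x.im| ≤ ε →
      ‖An lam α E n x‖ ≤ C * exp (c * n)) ⟨1, one_pos, by simp⟩ ?_ ?_ ?_
  · rintro s t hst ⟨C, hC, H⟩
    exact ⟨C, hC, fun E hE => H E (hst hE)⟩
  · rintro s t ⟨C, hC, H⟩ ⟨C', hC', H'⟩
    refine ⟨C + C', by positivity, fun E hE n x hx => ?_⟩
    have := exp_pos (c * n)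
    rcases hE with hE | hE
    · exact (H E hE n x hx).trans (mul_le_mul_of_nonneg_right (by linarith) this.le)
    · exact (H' E hE n x hx).trans (mul_le_mul_of_nonneg_right (by linarith) this.le)
  · intro E hE
    obtain ⟨δ, hδ, C, hC, H⟩ := exists_growth hε (h E hE)
    exact ⟨ball E δ, mem_nhdsWithin_of_mem_nhds (Metric.ball_mem_nhds _ hδ), C, hC,
      fun E' hE' => H E' (by simpa [dist_eq_norm] using hE')⟩

theorem Lyap_slope {ε ε' : ℝ} (hε' : 0 ≤ ε') (h : ε' ≤ ε) :
    Lyap lam α E ε ≤ Lyap lam α E ε' + 2 * π * (ε - ε') := by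
  have hpi := pi_pos
  refine le_of_forall_pos_le_add fun κ hκ => ?_
  obtain ⟨δ, hδ, C, hC, H⟩ := exists_growth hε' (lt_add_of_pos_right (Lyap lam α E ε') hκ)
  have H := H E (by simpa using hδ)
  have up : ∀ (n : ℕ) (x : ℂ), 0 ≤ x.im → x.im ≤ ε → ‖An lam α E n x‖ ≤
      2 * (exp (2 * π * (ε - ε') * n) * (C * exp ((Lyap lam α E ε' + κ) * n))) := by
    intro n x h0 hx
    rcases le_total x.im ε' with h1 | h1
    · refine (H n x (by rwa [abs_of_nonneg h0])).trans ?_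
      have : 1 ≤ exp (2 * π * (ε - ε') * n) :=
        Real.one_le_exp (mul_nonneg (mul_nonneg (by positivity) (sub_nonneg.2 h)) n.cast_nonneg)
      have h3 : 0 ≤ C * exp ((Lyap lam α E ε' + κ) * n) := by positivity
      nlinarith
    · refine (norm_An_le_slope (fun z hz => H n z (by rw [hz, abs_of_nonneg hε'])) h1 rfl).trans ?_
      gcongr
  refine Lyap_le_of_growth (C := 4 * C) (hε'.trans h) fun n x hx => ?_
  have e : 2 * (2 * (exp (2 * π * (ε - ε') * n) *
      (C * exp ((Lyap lam α E ε' + κ) * n)))) =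
      4 * C * exp ((Lyap lam α E ε' + 2 * π * (ε - ε') + κ) * n) := by
    rw [show (Lyap lam α E ε' + 2 * π * (ε - ε') + κ) * n =
      2 * π * (ε - ε') * n + (Lyap lam α E ε' + κ) * n by ring, exp_add]
    ring
  rw [← e]
  rcases le_total 0 x.im with h0 | h0
  · have := up n x h0 (le_of_abs_le hx)
    have h3 := norm_nonneg (An lam α E n x)
    linarith
  · refine (norm_An_reflect _ _ n x).trans (mul_le_mul_of_nonneg_left (up n _ ?_ ?_) zero_le_two)
    · simpa using h0
    · have := neg_le_of_abs_le hx
      simp; linarith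

theorem exists_Lyap_strip_le (hα : Irrational α) (hlam : 0 < lam) (hlam1 : lam ≤ 1) {l : ℝ}
    (hl : 0 < l) : ∃ ε, 0 < ε ∧ ∀ E : ℂ, E.im ≠ 0 → Lyap lam α E ε ≤ max l (Lyap lam α E 0) := by
  have hpi := pi_pos
  suffices ∃ ε, 0 < ε ∧ ∀ E : ℂ, 0 < E.im → Lyap lam α E ε ≤ max l (Lyap lam α E 0) by
    obtain ⟨ε, hε, h⟩ := this
    refine ⟨ε, hε, fun E hE => ?_⟩
    rcases lt_or_gt_of_ne hE with h' | h'
    · have := h (conj E) (by simpa using h')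
      rwa [Lyap_conj hε.le, Lyap_conj le_rfl] at this
    · exact h E h'
  have him : ∀ E : ℂ, 0 < E.im → 0 < (E / lam).im := by
    intro E hE
    rw [div_ofReal_im]; positivity
  have hdual : ∀ E : ℂ, 0 < E.im → -log lam ≤ (w lam⁻¹ α (E / lam)).re := by
    intro E hE
    rw [← Lyap_eq hα (him E hE), ← Real.log_inv]
    simpa using log_add_le_Lyap (lam := lam⁻¹) (α := α) (E := E / lam) (by positivity) le_rfl
  rcases hlam1.lt_or_eq with h1 | rfl
  · have hlog := Real.log_neg hlam h1
    refine ⟨-log lam / (4 * π), by apply div_pos <;> linarith, fun E hE => ?_⟩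
    refine (Lyap_strip_le hα hlam hE (by apply div_pos <;> linarith)
      (lt_of_lt_of_le ?_ (hdual E hE))).trans (le_max_right _ _)
    have : 2 * π * (-log lam / (4 * π)) = -log lam / 2 := by field_simp; ring
    rw [this]; linarith
  · refine ⟨l / (2 * π), by positivity, fun E hE => ?_⟩
    set ε := l / (2 * π) with hε
    have hεl : 2 * π * ε = l := by rw [hε]; field_simp
    have hw : Lyap 1 α E 0 = (w 1 α E).re := Lyap_eq hα hE
    have hL := w_re_pos (lam := 1) (α := α) hE
    have hs := fun ε => Lyap_strip_le (lam := 1) (α := α) (E := E) (ε := ε) hα one_pos hE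
    simp only [inv_one, Complex.ofReal_one, div_one, ← hw] at hs
    rw [← hw] at hL
    rcases lt_or_ge (2 * π * ε) (Lyap 1 α E 0) with h | h
    · exact (hs ε (by positivity) h).trans (le_max_right _ _)
    · refine le_trans ?_ (le_max_left _ _)
      refine le_of_forall_pos_le_add fun κ hκ => ?_
      set κ' := min κ (Lyap 1 α E 0 / 2)
      have k1 : 0 < κ' := lt_min hκ (by linarith)
      have k2 : κ' ≤ κ := min_le_left _ _
      have k3 : κ' ≤ Lyap 1 α E 0 / 2 := min_le_right _ _
      set ε' := (Lyap 1 α E 0 - κ') / (2 * π) with hε'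
      have e' : 2 * π * ε' = Lyap 1 α E 0 - κ' := by rw [hε']; field_simp
      have p' : 0 < ε' := div_pos (by linarith) (by positivity)
      have q' : ε' ≤ ε := by
        refine le_of_mul_le_mul_left ?_ (show 0 < 2 * π by positivity)
        linarith
      have a1 := hs ε' p' (by linarith)
      have a2 := Lyap_slope (lam := 1) (α := α) (E := E) p'.le q'
      rw [mul_sub] at a2
      linarith

theorem differentiable_An_energy (n : ℕ) (x : ℂ) (i j : Fin 2) :
    Differentiable ℂ fun E => An lam α E n x i j := by
  induction n generalizing i j with
  | zero => simp only [An]; fun_prop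
  | succ n ih =>
    have h0 := ih 0 j
    have h1 := ih 1 j
    simp only [An_succ, Matrix.mul_apply, Fin.sum_univ_two]
    fin_cases i <;> simp [tm] <;> fun_prop

theorem isCompact_sphere_im (E : ℂ) (ρ c : ℝ) :
    IsCompact {z : ℂ | z ∈ sphere E ρ ∧ c ≤ |(z - E).im|} :=
  (isCompact_sphere E ρ).inter_right 
    (isClosed_le continuous_const (by fun_prop : Continuous fun z : ℂ => |(z - E).im|))

/-- At a real energy with positive growth rate, the growth rate is constant on a strip. -/
theorem exists_strip_Lyap_le (hα : Irrational α) (hlam : 0 < lam) (hlam1 : lam ≤ 1)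
    (hE : E.im = 0) (hl : 0 < Lyap lam α E 0) :
    ∃ ε, 0 < ε ∧ Lyap lam α E ε ≤ Lyap lam α E 0 := by
  obtain ⟨ε, hε, h⟩ := exists_Lyap_strip_le hα hlam hlam1 hl
  refine ⟨ε, hε, ?_⟩
  set l := Lyap lam α E 0
  suffices ∀ κ, 0 < κ → Lyap lam α E ε ≤ l + 3 * κ from
    le_of_forall_pos_le_add fun κ hκ => by linarith [this (κ / 3) (by linarith)]
  intro κ hκ
  obtain ⟨δ, hδ, hus⟩ := Lyap_usc (lam := lam) (α := α) (E := E) (c := l + κ) le_rfl (by linarith)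
  have hρ : 0 < δ / 2 := by linarith
  obtain ⟨q, hq⟩ := exists_nat_gt (log 2 / κ)
  have hlog := log_pos one_lt_two
  have hq0 : (0 : ℝ) < q := (div_pos hlog hκ).trans hq
  have hq1 : 1 ≤ q := by exact_mod_cast hq0
  have hqκ : log 2 / q ≤ κ := by
    rw [div_le_iff₀ hq0]; rw [div_lt_iff₀ hκ] at hq; linarith
  set K := Kb lam ε (‖E‖ + δ / 2)
  have hK : 1 ≤ K := one_le_Kb (by positivity)
  set σ := (K ^ q)⁻¹
  have hσ : 0 < σ := by positivity
  obtain ⟨C, hC, hG⟩ := exists_uniform_growth (lam := lam) (α := α) (c := l + 2 * κ) hε.le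
    (isCompact_sphere_im E (δ / 2) (δ / 2 * σ)) (by
      rintro z ⟨hz, him⟩
      have hz0 : z.im ≠ 0 := by
        intro h0
        simp [h0, hE] at him
        nlinarith
      have h1 := hus z (by rw [mem_sphere_iff_norm.1 hz]; linarith)
      refine (h z hz0).trans_lt (max_lt ?_ ?_) <;> linarith)
  refine Lyap_le_of_growth (C := 2 * (max C 1 * K ^ q)) hε.le fun n x hx => ?_
  have hb : 1 ≤ exp (l + 2 * κ) := Real.one_le_exp (by linarith)
  have key : ∀ i j, ‖An lam α E n x i j‖ ≤
      max C 1 * K ^ q * exp (l + 2 * κ) ^ n * exp (log 2 / q * n) := by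
    intro i j
    refine norm_le_of_two_constants (f := fun z => An lam α z n x i j) hρ hσ.le (by positivity)
      (by positivity) hK hq1 (mul_inv_cancel₀ (by positivity)).le n
      (differentiable_An_energy n x i j).diffContOnCl ?_ ?_
    · intro z hz
      have hz' : ‖z‖ ≤ ‖E‖ + δ / 2 := by
        have := norm_le_norm_add_norm_sub' z E
        rw [mem_sphere_iff_norm.1 hz] at this; exact this
      refine ((norm_entry_le _ i j).trans (norm_An_le hx hz' n)).trans ?_
      refine le_mul_of_one_le_left (by positivity) ?_
      nlinarith [le_max_right C 1, one_le_pow₀ hb (n := n)]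
    · intro z hz him
      refine ((norm_entry_le _ i j).trans (hG z ⟨hz, him⟩ n x hx)).trans ?_
      rw [← exp_nat_mul, mul_comm (n : ℝ)]
      exact mul_le_mul_of_nonneg_right (le_max_left _ _) (exp_pos _).le
  refine (norm_le_of_entry_le key).trans ?_
  have h2 : exp (l + 2 * κ) ^ n * exp (log 2 / q * n) ≤
      exp ((l + 3 * κ) * n) := by
    rw [← exp_nat_mul, ← exp_add, exp_le_exp]
    nlinarith [mul_le_mul_of_nonneg_right hqκ n.cast_nonneg]
  calc _ = 2 * (max C 1 * K ^ q) * (exp (l + 2 * κ) ^ n * exp (log 2 / q * n)) := by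
        ring
    _ ≤ _ := mul_le_mul_of_nonneg_left h2 (by positivity)

theorem fc_two_constants {F : ℂ → ℝ → ℂ} {U : Set ℂ} (hU : IsOpen U)
    (hFc : ContinuousOn (uncurry F) (U ×ˢ univ)) (hFd : ∀ x, DifferentiableOn ℂ (F · x) U)
    {ρ c C σ : ℝ} {q : ℕ} (hρ : 0 < ρ) (hEU : closedBall E ρ ⊆ U) (hσ : 0 ≤ σ) (hc : 0 ≤ c)
    (hq : 1 ≤ q) (hcq : exp c ^ q * σ ≤ 1)
    (hm : ∀ z ∈ sphere E ρ, ρ * σ ≤ |(z - E).im| → ∀ k : ℤ,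
      ‖fc (F z) k‖ ≤ C * exp (-(c * |(k : ℝ)|))) :
    ∃ C', ∀ k : ℤ, ‖fc (F E) k‖ ≤ C' * exp (-((c - log 2 / q) * |(k : ℝ)|)) := by
  obtain ⟨B, hB⟩ := ((isCompact_closedBall E ρ).prod
    (isCompact_Icc (a := (0 : ℝ)) (b := 1))).exists_bound_of_continuousOn
      (hFc.mono (prod_mono hEU (subset_univ _)))
  set A := max (max B C) 0
  refine ⟨A * exp c ^ q, fun k => ?_⟩
  have hk : |(k : ℝ)| = k.natAbs := by rw [Nat.cast_natAbs, Int.cast_abs]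
  have hd : DifferentiableOn ℂ (fun z => fc (F z) k) U := by
    intro z hz
    refine (hasDerivAt_integral_param (F := fun z x => ee (-(k * x)) * F z x) hU zero_le_one ?_ ?_
      hz).differentiableAt.differentiableWithinAt
    · refine ContinuousOn.mul (Continuous.continuousOn ?_) (hFc.mono (prod_mono subset_rfl
        (subset_univ _)))
      have := continuous_ee
      fun_prop
    · exact fun x _ => (hFd x).const_mul _
  have hexp : ∀ n : ℕ, exp (-c) ^ n * exp c ^ n = 1 := fun n => by
    rw [← mul_pow, ← exp_add]; simp
  refine (norm_le_of_two_constants (f := fun z => fc (F z) k) (C := A) (b := exp (-c))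
    (K := exp c) (n := k.natAbs) hρ hσ (le_max_right _ _)
    (exp_pos _).le (Real.one_le_exp hc) hq hcq (hd.diffContOnCl_ball hEU) ?_ ?_).trans ?_
  · intro z hz
    rw [mul_assoc, hexp, mul_one]
    refine le_trans ?_ ((le_max_left B C).trans (le_max_left _ _))
    have := norm_integral_le_of_norm_le_const (a := (0 : ℝ)) (b := 1) (C := B)
      (f := fun x => ee (-(k * x)) * F z x) (by
        intro x hx
        rw [uIoc_of_le zero_le_one] at hx
        rw [norm_mul, ee_neg, norm_inv, norm_ee_int_mul, inv_one, one_mul]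
        exact hB (z, x) ⟨sphere_subset_closedBall hz, hx.1.le, hx.2⟩)
    simpa [fc] using this
  · intro z hz him
    refine (hm z hz him k).trans ?_
    rw [← exp_nat_mul, hk, show -(c * (k.natAbs : ℝ)) = k.natAbs * -c by ring]
    exact mul_le_mul_of_nonneg_right ((le_max_right B C).trans (le_max_left _ _)) (exp_pos _).le
  · rw [← exp_nat_mul (-c), mul_assoc (A * _), ← exp_add, hk]
    refine le_of_eq ?_
    congr 2; ring

theorem CP.conj {f : ℝ → ℂ} (hf : CP f) : CP fun x => conj (f x) :=
  ⟨continuous_conj.comp hf.cont, fun x => by rw [hf.per]⟩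

/-- The difference of the two solutions of the Riccati equation. -/
def kd (M : ℂ → ℝ → ℂ) (E : ℂ) (x : ℝ) : ℂ := M E x - conj (M (conj E) x)

theorem fc_conj (f : ℝ → ℂ) (k : ℤ) :
    fc (fun x => conj (f x)) k = conj (fc f (-k)) := by
  simp only [fc]
  rw [intervalIntegral.integral_of_le zero_le_one, intervalIntegral.integral_of_le zero_le_one,
    ← integral_conj]
  refine integral_congr_ae (.of_forall fun x => ?_)
  simp [map_mul, ee_conj]

theorem conj_mem_ball {E₀ r : ℝ} (hE : E ∈ ball (E₀ : ℂ) r) :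
    conj E ∈ ball (E₀ : ℂ) r := by
  rw [mem_ball, dist_eq_norm] at hE ⊢
  rwa [← conj_ofReal, ← map_sub, norm_conj]

section
variable {E₀ r : ℝ} {M : ℂ → ℝ → ℂ}

theorem Kot.kd_im (h : Kot lam α E₀ r M) (hE : E ∈ ball (E₀ : ℂ) r) (x : ℝ) :
    0 < (kd M E x).im := by
  have h1 := h.im_pos E hE x
  have h2 := h.im_pos _ (conj_mem_ball hE) x
  simp only [kd, sub_im, conj_im]; linarith

theorem Kot.kd_ne_zero (h : Kot lam α E₀ r M) (hE : E ∈ ball (E₀ : ℂ) r) (x : ℝ) :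
    kd M E x ≠ 0 := fun h0 => by simpa [h0] using h.kd_im hE x

theorem Kot.kd_continuousOn (h : Kot lam α E₀ r M) :
    ContinuousOn (uncurry (kd M)) (ball (E₀ : ℂ) r ×ˢ univ) := by
  refine h.cont.sub (continuous_conj.comp_continuousOn (h.cont.comp
    (f := fun p : ℂ × ℝ => (conj p.1, p.2)) ?_ fun p hp => ⟨conj_mem_ball hp.1, trivial⟩))
  exact ((continuous_conj.comp continuous_fst).prodMk continuous_snd).continuousOn

theorem Kot.kd_differentiableOn (h : Kot lam α E₀ r M) (x : ℝ) :
    DifferentiableOn ℂ (kd M · x) (ball (E₀ : ℂ) r) := fun E hE => by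
  have hn : ∀ {z : ℂ}, z ∈ ball (E₀ : ℂ) r → DifferentiableAt ℂ (M · x) z := fun hz =>
    (h.diff x).differentiableAt (isOpen_ball.mem_nhds hz)
  have h2 := (hn (conj_mem_ball hE)).conj_conj
  rw [conj_conj] at h2
  exact ((hn hE).sub h2).differentiableWithinAt

theorem Kot.kd_pos (h : Kot lam α E₀ r M) (hE : E ∈ ball (E₀ : ℂ) r) (him : 0 < E.im)
    (x : ℝ) : M E x = mf lam α E x ∧ kd M E x = Dl lam α E x := by
  have h1 := (h.eq_Mo E hE him.ne' x).trans (Mo_pos him x)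
  have h2 := (h.eq_Mo _ (conj_mem_ball hE) (by simpa using him.ne') x).trans
    (Mo_neg (by simpa using him) x)
  refine ⟨h1, ?_⟩
  rw [kd, h1, h2, conj_conj, conj_conj, Dl]

theorem kd_conj (E : ℂ) (x : ℝ) :
    kd M (conj E) x = -conj (kd M E x) := by
  simp [kd]

/-- Exponential decay of the Fourier coefficients of the spectral projection at a real energy. -/
theorem Kot.fc_decay (hα : Irrational α) (hlam : 0 < lam) (h : Kot lam α E₀ r M) {E₁ : ℝ}
    {ρ c σ : ℝ} {q : ℕ} (hρ : 0 < ρ) (hEU : closedBall (E₁ : ℂ) ρ ⊆ ball (E₀ : ℂ) r)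
    (hσ : 0 < σ) (hc : 0 ≤ c) (hq : 1 ≤ q) (hcq : exp c ^ q * σ ≤ 1)
    (hm : ∀ z ∈ sphere (E₁ : ℂ) ρ, ρ * σ ≤ z.im → c < (w lam⁻¹ α (z / lam)).re) :
    (∃ C', ∀ k : ℤ, ‖fc (fun x => (kd M E₁ x)⁻¹) k‖ ≤
      C' * exp (-((c - log 2 / q) * |(k : ℝ)|))) ∧
    ∃ C', ∀ k : ℤ, ‖fc (fun x => M E₁ x / kd M E₁ x) k‖ ≤
      C' * exp (-((c - log 2 / q) * |(k : ℝ)|)) := by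
  obtain ⟨C, hC, hD⟩ := TenMartini.fc_decay (lam := lam) hα hlam
    (K := {z : ℂ | z ∈ sphere (E₁ : ℂ) ρ ∧ ρ * σ ≤ z.im})
    ((isCompact_sphere _ _).inter_right (isClosed_le continuous_const continuous_im)) hc
    fun z hz => ⟨(mul_pos hρ hσ).trans_le hz.2, hm z hz.1 hz.2⟩
  have hsub := sphere_subset_closedBall.trans hEU
  have hpos : ∀ z ∈ sphere (E₁ : ℂ) ρ, ρ * σ ≤ z.im → ∀ k : ℤ,
      ‖fc (fun x => (kd M z x)⁻¹) k‖ ≤ C * exp (-(c * |(k : ℝ)|)) ∧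
      ‖fc (fun x => M z x / kd M z x) k‖ ≤ C * exp (-(c * |(k : ℝ)|)) := by
    intro z hz him k
    have := h.kd_pos (hsub hz) ((mul_pos hρ hσ).trans_le him)
    simp only [this]
    exact hD z ⟨hz, him⟩ k
  have hcs : ∀ z ∈ sphere (E₁ : ℂ) ρ, conj z ∈ sphere (E₁ : ℂ) ρ := by
    intro z hz
    rw [mem_sphere_iff_norm] at hz ⊢
    rwa [← conj_ofReal, ← map_sub, norm_conj]
  refine ⟨fc_two_constants (F := fun E x => (kd M E x)⁻¹) (C := C) isOpen_ball
    (h.kd_continuousOn.inv₀ fun p hp => h.kd_ne_zero hp.1 p.2)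
    (fun x => (h.kd_differentiableOn x).inv fun E hE => h.kd_ne_zero hE x) hρ hEU hσ.le hc hq hcq
      ?_,
    fc_two_constants (F := fun E x => M E x / kd M E x) (C := 1 + C) isOpen_ball
    (h.cont.div h.kd_continuousOn fun p hp => h.kd_ne_zero hp.1 p.2)
    (fun x => (h.diff x).div (h.kd_differentiableOn x) fun E hE => h.kd_ne_zero hE x)
    hρ hEU hσ.le hc hq hcq ?_⟩
  · intro z hz him k
    simp only [sub_im, ofReal_im, sub_zero] at him
    rcases le_total 0 z.im with h0 | h0
    · exact (hpos z hz (by rwa [abs_of_nonneg h0] at him) k).1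
    · have h1 := (hpos _ (hcs z hz) (by rwa [abs_of_nonpos h0] at him) (-k)).1
      have h2 : ∀ x, (kd M z x)⁻¹ = (-1) * conj (kd M (conj z) x)⁻¹ := by
        intro x; rw [kd_conj, map_inv₀, map_neg, conj_conj, inv_neg]; ring
      simp only [h2]
      rw [fc_const_mul, fc_conj, norm_mul, norm_conj]
      simpa using h1
  · intro z hz him k
    simp only [sub_im, ofReal_im, sub_zero] at him
    rcases le_total 0 z.im with h0 | h0
    · refine (hpos z hz (by rwa [abs_of_nonneg h0] at him) k).2.trans ?_
      gcongr; linarith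
    · have h1 := (hpos _ (hcs z hz) (by rwa [abs_of_nonpos h0] at him) (-k)).2
      have hz' := hcs z hz
      have h2 : ∀ x, M z x / kd M z x =
          1 - conj (M (conj z) x / kd M (conj z) x) := by
        intro x
        have h3 := h.kd_ne_zero (hsub hz) x
        rw [kd_conj, map_div₀, map_neg, conj_conj]
        field_simp
        simp [kd]
      simp only [h2]
      have hcpM : CP fun x => M (conj z) x / kd M (conj z) x := by
        have hb := hsub hz'
        refine ⟨(h.continuous hb).div (h.kd_continuousOn.comp_continuous
          (f := fun x : ℝ => (conj z, x)) (by fun_prop) fun _ => ⟨hb, mem_univ _⟩)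
          (h.kd_ne_zero hb), fun x => ?_⟩
        rw [kd, kd, h.periodic hb, conj_conj, h.periodic (hsub hz)]
      have hone : ‖fc (fun _ => (1 : ℂ)) k‖ ≤ exp (-(c * |(k : ℝ)|)) := by
        rcases eq_or_ne k 0 with rfl | hk
        · simp [fc_zero]
        · have := integral_ee (neg_ne_zero.2 hk)
          push_cast at this
          simp only [fc, mul_one, ← neg_mul, this, norm_zero]
          positivity
      rw [CP.fc_sub (CP.const 1) hcpM.conj, fc_conj]
      refine (norm_sub_le _ _).trans ?_
      rw [norm_conj, add_mul, one_mul]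
      refine add_le_add hone ?_
      simpa using h1
end

section

variable {E₀ r : ℝ} {M : ℂ → ℝ → ℂ}

theorem Kot.cp_kd (h : Kot lam α E₀ r M) (hE : E ∈ ball (E₀ : ℂ) r) : CP (kd M E) :=
  ⟨h.kd_continuousOn.comp_continuous (f := fun x : ℝ => (E, x)) (by fun_prop)
    fun _ => ⟨hE, mem_univ _⟩, fun x => by
      rw [kd, kd, h.periodic hE, h.periodic (conj_mem_ball hE)]⟩

theorem Kot.dec_of_decay (h : Kot lam α E₀ r M) (hE : E ∈ ball (E₀ : ℂ) r) {c b : ℝ}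
    (hb : 2 * π * b ≤ c)
    (hd : (∃ C', ∀ k : ℤ, ‖fc (fun x => (kd M E x)⁻¹) k‖ ≤ C' * exp (-(c * |(k : ℝ)|))) ∧
      ∃ C', ∀ k : ℤ, ‖fc (fun x => M E x / kd M E x) k‖ ≤ C' * exp (-(c * |(k : ℝ)|))) :
    Dec (fun x => (kd M E x)⁻¹) b ∧ Dec (fun x => M E x / kd M E x) b := by
  have hpi := pi_pos
  have e : 2 * π * (c / (2 * π)) = c := by field_simp
  have hbc : b ≤ c / (2 * π) := by rw [le_div_iff₀ (by positivity)]; linarith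
  have hk := h.cp_kd hE
  constructor
  · refine Dec.mono (h := c / (2 * π)) ⟨⟨hk.cont.inv₀ (h.kd_ne_zero hE), fun x => ?_⟩, ?_⟩ hbc
    · simp only [Pi.inv_apply, hk.per]
    · rw [e]; exact hd.1
  · refine Dec.mono (h := c / (2 * π))
      ⟨⟨(h.continuous hE).div hk.cont (h.kd_ne_zero hE), fun x => ?_⟩, ?_⟩ hbc
    · simp only [Pi.div_apply, hk.per, h.periodic hE]
    · rw [e]; exact hd.2

theorem exists_closedBall_subset {E₁ : ℂ} {r : ℝ} (h : E ∈ ball E₁ r) :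
    ∃ ρ > 0, closedBall E ρ ⊆ ball E₁ r :=
  Metric.nhds_basis_closedBall.mem_iff.1 (isOpen_ball.mem_nhds h)

theorem Kot.dec_of_lt_one (hα : Irrational α) (hlam : 0 < lam) (h : Kot lam α E₀ r M) {E₁ b : ℝ}
    (hE : (E₁ : ℂ) ∈ ball (E₀ : ℂ) r) (hb : 0 ≤ b) (hbl : 2 * π * b < -log lam) :
    Dec (fun x => (kd M E₁ x)⁻¹) b ∧ Dec (fun x => M E₁ x / kd M E₁ x) b := by
  have hpi := pi_pos
  obtain ⟨ρ, hρ, hsub⟩ := exists_closedBall_subset hE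
  set c := (2 * π * b + -log lam) / 2 with hc
  have hbp : 0 ≤ 2 * π * b := by positivity
  have hlog := log_pos one_lt_two
  obtain ⟨q, hq⟩ := exists_nat_gt (log 2 / (c - 2 * π * b))
  have hq0 : (0 : ℝ) < q := (div_pos hlog (by linarith)).trans hq
  rw [div_lt_iff₀ (by linarith)] at hq
  have hqκ : log 2 / q ≤ c - 2 * π * b := by
    rw [div_le_iff₀ hq0]; linarith
  refine h.dec_of_decay hE (c := c - log 2 / q) (by linarith) (h.fc_decay hα hlam hρ hsub
    (σ := (exp c ^ q)⁻¹) (by positivity) (by linarith) (by exact_mod_cast hq0)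
    (mul_inv_cancel₀ (by positivity)).le fun z hz him => ?_)
  have hz0 : 0 < z.im := lt_of_lt_of_le (by positivity) him
  have hz1 : 0 < (z / lam).im := by rw [div_ofReal_im]; positivity
  rw [← Lyap_eq hα hz1]
  have := log_add_le_Lyap (lam := lam⁻¹) (α := α) (E := z / lam) (ε := 0) (by positivity) le_rfl
  rw [Real.log_inv] at this
  linarith

theorem Kot.exists_dec (hα : Irrational α) (h : Kot 1 α E₀ r M) {E₁ : ℝ}
    (hE : (E₁ : ℂ) ∈ ball (E₀ : ℂ) r) : ∃ b, 0 < b ∧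
    Dec (fun x => (kd M E₁ x)⁻¹) b ∧ Dec (fun x => M E₁ x / kd M E₁ x) b := by
  have hpi := pi_pos
  obtain ⟨ρ, hρ, hsub⟩ := exists_closedBall_subset hE
  have hlog := log_pos one_lt_two
  have hK : IsCompact {z : ℂ | z ∈ sphere (E₁ : ℂ) ρ ∧ ρ * (1 / 4) ≤ z.im} :=
    (isCompact_sphere _ _).inter_right (isClosed_le continuous_const continuous_im)
  have hpos : ∀ z : ℂ, ρ * (1 / 4) ≤ z.im → 0 < z.im :=
    fun z hz => lt_of_lt_of_le (by positivity) hz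
  obtain ⟨z₀, hz₀, hmin⟩ := hK.exists_isMinOn (f := fun z => (w 1 α z).re)
    ⟨E₁ + ρ * I, by simp [hρ.le], by simp; linarith⟩
    (continuous_re.comp_continuousOn fun z hz =>
      (hasDerivAt_w (hpos z hz.2)).continuousAt.continuousWithinAt)
  have h0 := w_re_pos (lam := 1) (α := α) (hpos z₀ hz₀.2)
  set c := min ((w 1 α z₀).re / 2) (log 2)
  have hc : 0 < c := lt_min (by linarith) hlog
  have hc1 : c ≤ (w 1 α z₀).re / 2 := min_le_left _ _
  have hc2 : c ≤ log 2 := min_le_right _ _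
  set q := ⌊log 2 / c⌋₊ + 1 with hqd
  have hq : log 2 / c < q := by rw [hqd]; push_cast; exact Nat.lt_floor_add_one _
  have hq2 : (q : ℝ) ≤ log 2 / c + 1 := by
    rw [hqd]; push_cast
    linarith [Nat.floor_le (div_pos hlog hc).le]
  have hq0 : (0 : ℝ) < q := (div_pos hlog hc).trans hq
  have hqc : (q : ℝ) * c ≤ 2 * log 2 := by
    have := mul_le_mul_of_nonneg_right hq2 hc.le
    rw [add_mul, div_mul_cancel₀ _ hc.ne'] at this; linarith
  rw [div_lt_iff₀ hc] at hq
  have hqκ : log 2 / q < c := by rw [div_lt_iff₀ hq0]; linarith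
  refine ⟨(c - log 2 / q) / (2 * π), div_pos (by linarith) (by positivity),
    h.dec_of_decay hE (c := c - log 2 / q) (by field_simp; rfl) (h.fc_decay hα one_pos hρ hsub
    (σ := 1 / 4) (by positivity) hc.le (by omega) ?_ fun z hz him => ?_)⟩
  · have : exp c ^ q ≤ 4 := by
      rw [← exp_nat_mul]
      calc _ ≤ exp (2 * log 2) := exp_le_exp.2 hqc
        _ = 4 := by rw [two_mul, exp_add, exp_log two_pos]; norm_num
    linarith
  · have := hmin (show z ∈ _ from ⟨hz, him⟩)
    simp only [mem_ofPred_eq] at this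
    simp only [inv_one, Complex.ofReal_one, div_one]
    linarith

end

/-- A lower bound for the trace modulo constants, by its leading Fourier coefficient. -/
theorem pow_le_of_norm_trace_sub_le (hlam : 0 ≤ lam) {n : ℕ} (hn : n ≠ 0) {c : ℂ} {B : ℝ}
    (h : ∀ x : ℝ, ‖An lam α E n x 0 0 + An lam α E n x 1 1 - c‖ ≤ B) : lam ^ n ≤ B := by
  have h0 := norm_Gn_zero (α := α) (E := E) hlam n
  have h1 : Gn lam α E n 0 1 1 = 0 := by
    obtain ⟨n, rfl⟩ := Nat.exists_eq_succ_of_ne_zero hn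
    simp [Gn, Matrix.mul_apply, Fin.sum_univ_two]
  have hd := ((differentiable_Gn lam α (E := E) n 0 0).add
    (differentiable_Gn lam α (E := E) n 1 1)).sub ((differentiable_id.pow n).const_mul c)
  have := norm_le_of_forall_mem_frontier_norm_le (U := ball 0 1)
    isBounded_ball hd.diffContOnCl (C := B) (fun z hz => ?_) 
    (subset_closure (Metric.mem_ball_self one_pos))
  · simpa [h1, hn, h0] using this
  · rw [frontier_ball _ one_ne_zero, mem_sphere_zero_iff_norm] at hz
    obtain ⟨x, rfl, hx⟩ := exists_ee_eq (t := z) (norm_pos_iff.1 (by rw [hz]; exact one_pos))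
    have hx0 : x.im = 0 := by
      rw [hz, eq_comm, Real.exp_eq_one_iff] at hx
      simpa [Real.pi_ne_zero] using hx
    have hxr : x = (x.re : ℂ) := Complex.ext rfl (by simp [hx0])
    have := h x.re
    rw [← hxr] at this
    simp only [Pi.add_apply, Pi.sub_apply, Gn_ee, Matrix.smul_apply, smul_eq_mul, Pi.pow_apply, id]
    rw [mul_comm c, ← mul_add, ← mul_sub, norm_mul, norm_pow, hz, one_pow, one_mul]
    exact this

theorem fc_deriv {G G' : ℝ → ℂ} (hG : CP G) (hG' : CP G') (hd : ∀ x, HasDerivAt G (G' x) x)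
    (k : ℤ) :
    fc G' k = 2 * π * I * k * fc G k := by
  have he : ∀ x : ℝ, HasDerivAt (fun x : ℝ => ee (-(k * x)))
      (-(2 * π * I * k) * ee (-(k * x))) x := by
    intro x
    have := (((((hasDerivAt_id (x : ℂ)).const_mul (k : ℂ)).neg).const_mul
      (2 * π * I)).cexp).comp_ofReal
    refine this.congr_deriv ?_
    simp [ee]; ring
  have hc : Continuous fun x : ℝ => ee (-(k * x)) := continuous_ee.comp (by fun_prop)
  have := intervalIntegral.integral_deriv_mul_eq_sub (a := 0) (b := 1)
    (fun x _ => he x) (fun x _ => hd x)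
    ((hc.const_mul _).intervalIntegrable _ _) (hG'.cont.intervalIntegrable _ _)
  rw [integral_add (((hc.const_mul _).fun_mul hG.cont).intervalIntegrable _ _)
    ((hc.fun_mul hG'.cont).intervalIntegrable _ _)] at this
  simp only [mul_assoc (-(2 * π * I * k)), integral_const_mul] at this
  have h1 : G 1 = G 0 := by simpa using hG.per 0
  have h2 : ee (-k) = 1 := by have := ee_int (-k); push_cast at this; exact this
  have h3 : -(2 * π * I * k) * fc G k + fc G' k = 0 := by
    refine this.trans ?_
    simp [h1, h2, ee_zero]
  linear_combination h3

theorem CP.lipschitz {Q Q' : ℝ → ℂ} (hQ' : CP Q') (hd : ∀ x, HasDerivAt Q (Q' x) x) :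
    ∃ K, 0 < K ∧ ∀ x y, ‖Q x - Q y‖ ≤ K * |x - y| := by
  obtain ⟨K, hK, h⟩ := hQ'.norm_bdd
  exact ⟨K, hK, fun x y => convex_univ.norm_image_sub_le_of_norm_hasDerivWithin_le
    (fun x _ => (hd x).hasDerivWithinAt) (fun x _ => h x) (mem_univ y) (mem_univ x)⟩

theorem Dec.exists_deriv {f : ℝ → ℂ} {b : ℝ} (hf : Dec f b) (hb : 0 < b) :
    ∃ f', CP f' ∧ ∀ x, HasDerivAt f (f' x) x := by
  have hst : ∀ x : ℝ, (x : ℂ) ∈ {z : ℂ | |z.im| < b} := fun x => by simpa using hb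
  refine ⟨fun x => deriv (ext f) x, ⟨?_, fun x => ?_⟩, fun x => ?_⟩
  · exact (hf.differentiableOn_ext.deriv (isOpen_strip b)).continuousOn.comp_continuous
      continuous_ofReal hst
  · have : (fun z => ext f (z + 1)) = ext f := funext (ext_add_one f)
    conv_rhs => rw [← this]
    rw [deriv_comp_add_const (ext f)]; simp
  · have := (hf.differentiableOn_ext.differentiableAt
      ((isOpen_strip b).mem_nhds (hst x))).hasDerivAt.comp_ofReal
    simpa only [hf.ext_ofReal hb] using this

/-- A solution of the Riccati equation in the upper half plane with analytic Green functions. -/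
structure Sol (lam α t b : ℝ) (m : ℝ → ℂ) : Prop where
  cp : CP m
  pos : ∀ x, 0 < (m x).im
  ric : ∀ x : ℝ, m (x + α) = t - pot lam x - (m x)⁻¹
  dec_inv : Dec (fun x => (m x - conj (m x))⁻¹) b
  dec_div : Dec (fun x => m x / (m x - conj (m x))) b

namespace Sol
variable {t b : ℝ} {m : ℝ → ℂ}

theorem ne_zero (h : Sol lam α t b m) (x : ℝ) : m x ≠ 0 := fun h0 => by
  have := h.pos x; simp [h0] at this

theorem sub_conj_ne_zero (h : Sol lam α t b m) (x : ℝ) : m x - conj (m x) ≠ 0 := fun h0 => by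
  have h1 := h.pos x
  have := congrArg Complex.im h0
  simp at this; linarith

theorem ric_conj (h : Sol lam α t b m) (x : ℝ) :
    conj (m (x + α)) = t - pot lam x - (conj (m x))⁻¹ := by
  rw [h.ric]; simp [conj_pot]

theorem sub_conj_shift (h : Sol lam α t b m) (x : ℝ) :
    m (x + α) - conj (m (x + α)) =
      (m x - conj (m x)) / (m x * conj (m x)) := by
  have h1 := h.ne_zero x
  have h2 : conj (m x) ≠ 0 := by simpa using h1
  rw [h.ric_conj, h.ric]; field_simp; ring

theorem exists_reduction (h : Sol lam α t b m) (hb : 0 < b) : ∃ Q G : ℝ → ℂ, CP Q ∧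
    (∃ K, 0 < K ∧ ∀ x y, ‖Q x - Q y‖ ≤ K * |x - y|) ∧
    (∃ K, 0 < K ∧ ∀ x y, ‖m x - m y‖ ≤ K * |x - y|) ∧ Dec G b ∧ fc G 0 = 0 ∧
    ∀ x, m x = Complex.exp ((∫ x in (0 : ℝ)..1, Complex.log (m x)) + G x + Q (x + α) - Q x) := by
  obtain ⟨γ', hγ', hγd⟩ := h.dec_inv.exists_deriv hb
  obtain ⟨β', hβ', hβd⟩ := h.dec_div.exists_deriv hb
  set D : ℝ → ℂ := fun x => m x - conj (m x) with hD
  have hD0 : ∀ x, D x ≠ 0 := h.sub_conj_ne_zero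
  have hDc : CP D := h.cp.sub h.cp.conj
  obtain ⟨m', hm', hmd⟩ : ∃ m', CP m' ∧ ∀ x, HasDerivAt m (m' x) x := by
    refine ⟨_, (hβ'.sub (h.cp.mul hγ')).mul hDc, fun x => ?_⟩
    have e : m = fun x => (m x / D x) / (D x)⁻¹ := by
      ext x; have := hD0 x; field_simp
    rw [e]
    refine ((hβd x).fun_div (hγd x) (inv_ne_zero (hD0 x))).congr_deriv ?_
    have := hD0 x
    change _ = _ * D x
    rw [show m x - conj (m x) = D x from rfl]
    field_simp
  set θ := ∫ x in (0 : ℝ)..1, Complex.log (m x) with hθ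
  set r : ℝ → ℂ := fun x => -(m' x * (D x)⁻¹) with hr
  have hrc : CP r := by
    have := (CP.const 0).sub (hm'.mul h.dec_inv.cp)
    simpa only [zero_sub] using this
  set μ := ∫ x in (0 : ℝ)..1, r x with hμ
  set Q : ℝ → ℂ := fun x => (∫ y in (0 : ℝ)..x, r y) - μ * x with hQ
  have hQd : ∀ x, HasDerivAt Q (r x - μ) x := by
    intro x
    have h1 := (intervalIntegral.integral_hasDerivAt_right
      (a := 0) (hrc.cont.intervalIntegrable _ _)
      (hrc.cont.stronglyMeasurableAtFilter _ _) hrc.cont.continuousAt : HasDerivAt _ (r x) x)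
    have h2 := ((hasDerivAt_id (x : ℂ)).const_mul μ).comp_ofReal
    simpa using h1.fun_sub h2
  have hQc : CP Q := by
    refine ⟨continuous_iff_continuousAt.2 fun x => (hQd x).continuousAt, fun x => ?_⟩
    have h1 : ∫ y in (0 : ℝ)..(x + 1), r y = (∫ y in (0 : ℝ)..x, r y) + μ := by
      rw [← integral_add_adjacent_intervals (hrc.cont.intervalIntegrable 0 x)
        (hrc.cont.intervalIntegrable x (x + 1)), hrc.periodic.intervalIntegral_add_eq x 0, zero_add]
    simp only [hQ, h1]; push_cast; ring
  have hls : ∀ x, m x ∈ Complex.slitPlane := fun x => Or.inr (h.pos x).ne'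
  have hlc : CP fun x => Complex.log (m x) := ⟨h.cp.cont.clog hls, fun x => by simp only [h.cp.per]⟩
  set G : ℝ → ℂ := fun x => Complex.log (m x) + Q x - Q (x + α) - θ with hG
  have hGc : CP G := ((hlc.add hQc).sub (hQc.shift α)).sub (CP.const θ)
  set q : ℝ → ℂ := fun x => -(2 * π * I * lam) *
    (ee ((1 : ℤ) * x) * (D (x + α))⁻¹ - ee ((-1 : ℤ) * x) * (D (x + α))⁻¹) with hq
  have hqc : CP q := (CP.const _).mul (((CP.char 1).mul (h.dec_inv.cp.shift α)).sub
    ((CP.char (-1)).mul (h.dec_inv.cp.shift α)))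
  have hpd : ∀ x : ℝ, HasDerivAt (fun x : ℝ => pot lam x)
      (2 * π * I * lam * (ee x - ee (-x))) x := by
    intro x
    have h1 := ((hasDerivAt_id (x : ℂ)).const_mul (2 * π * I)).cexp
    have h2 := ((hasDerivAt_id (x : ℂ)).neg.const_mul (2 * π * I)).cexp
    have := ((h1.add h2).const_mul (lam : ℂ)).comp_ofReal
    simp only [pot_eq_ee]
    refine this.congr_deriv ?_
    simp [ee]; ring
  have hGd : ∀ x, HasDerivAt G (q x) x := by
    intro x
    have hr' : m' (x + α) = -(2 * π * I * lam * (ee x - ee (-x))) + m' x / m x ^ 2 := by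
      have h1 := (hmd (x + α)).comp_add_const x α
      have h2 := ((hpd x).const_sub (t : ℂ)).fun_sub ((hmd x).fun_inv (h.ne_zero x))
      simp only [← h.ric] at h2
      rw [h1.unique h2]; ring
    have h3 := (((hmd x).clog_real (hls x)).add (hQd x)).sub ((hQd (x + α)).comp_add_const x α)
    refine (h3.sub_const θ).congr_deriv ?_
    have hs : D (x + α) = D x / (m x * conj (m x)) := h.sub_conj_shift x
    have h4 := h.ne_zero x
    have h5 := hD0 x
    have h6 : conj (m x) = m x - D x := by simp [hD]
    have h7 : m x - D x ≠ 0 := by rw [← h6]; simpa using h4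
    simp only [hr, hq, hr', hs, h6]
    push_cast
    simp only [one_mul, neg_mul]
    generalize D x = d at *
    generalize m x = mx at *
    field_simp
    ring
  refine ⟨Q, G, hQc, CP.lipschitz (hrc.sub (CP.const μ)) hQd, CP.lipschitz hm' hmd,
    ⟨hGc, ?_⟩, ?_, fun x => ?_⟩
  · obtain ⟨C, hC⟩ := h.dec_inv.decay
    have hC0 : 0 ≤ C := by simpa using (norm_nonneg _).trans (hC 0)
    set c := 2 * π * I * lam with hc
    have hs : ∀ k : ℤ, ‖fc (fun x => (D (x + α))⁻¹) k‖ ≤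
        C * exp (-(2 * π * b * |(k : ℝ)|)) := fun k => by
      have e := h.dec_inv.cp.fc_shift α k
      simp only [hD]
      rw [e, norm_mul, norm_ee_int_mul, one_mul]; exact hC k
    have hpi := pi_pos
    have hs' : ∀ k j : ℤ, |(j : ℝ)| = 1 → ‖fc (fun x => (D (x + α))⁻¹) (k - j)‖ ≤
        C * (exp (2 * π * b) * exp (-(2 * π * b * |(k : ℝ)|))) := fun k j hj => by
      refine (hs _).trans (mul_le_mul_of_nonneg_left ?_ hC0)
      rw [← exp_add, exp_le_exp]
      have h1 := abs_sub_abs_le_abs_sub (k : ℝ) j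
      rw [hj] at h1
      have : 0 < 2 * π * b := by positivity
      push_cast
      nlinarith
    refine ⟨max ‖fc G 0‖ (‖c‖ * (2 * (C * exp (2 * π * b)))), fun k => ?_⟩
    rcases eq_or_ne k 0 with rfl | hk
    · simp
    refine le_trans ?_ (mul_le_mul_of_nonneg_right (le_max_right _ _) (exp_pos _).le)
    have h1 := fc_deriv hGc hqc hGd k
    have h2 : fc q k = -c * (fc (fun x => (D (x + α))⁻¹) (k - 1) -
        fc (fun x => (D (x + α))⁻¹) (k - (-1))) := by
      have hγs := h.dec_inv.cp.shift α
      have e1 := ((CP.char 1).mul hγs).fc_sub ((CP.char (-1)).mul hγs) k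
      simp only [fc_ee_mul] at e1
      rw [← e1, ← fc_const_mul]
    have h3 : ‖fc G k‖ ≤ ‖fc q k‖ := by
      rw [h1, norm_mul]
      refine le_mul_of_one_le_left (norm_nonneg _) ?_
      have : (1 : ℝ) ≤ |(k : ℝ)| := by exact_mod_cast Int.one_le_abs hk
      simp [abs_of_pos hpi]
      nlinarith [Real.pi_gt_three]
    refine h3.trans ?_
    rw [h2, norm_mul, norm_neg, mul_assoc]
    refine mul_le_mul_of_nonneg_left ((norm_sub_le _ _).trans ?_) (norm_nonneg _)
    linarith [hs' k 1 (by simp), hs' k (-1) (by simp)]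
  · have e1 := ((hlc.add hQc).sub (hQc.shift α)).fc_sub (CP.const θ) 0
    rw [(hlc.add hQc).fc_sub (hQc.shift α), hlc.fc_add hQc, hQc.fc_shift] at e1
    refine e1.trans ?_
    simp [fc_zero, ee_zero, hθ]
  · simp only [hG]
    rw [show θ + (Complex.log (m x) + Q x - Q (x + α) - θ) + Q (x + α) - Q x =
      Complex.log (m x) by ring,
      Complex.exp_log (h.ne_zero x)]

end Sol

section

variable {t b : ℝ} {m : ℝ → ℂ}

theorem Kot.sol {E₀ r : ℝ} {M : ℂ → ℝ → ℂ} (h : Kot lam α E₀ r M)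
    (hE : (t : ℂ) ∈ ball (E₀ : ℂ) r) (h1 : Dec (fun x => (kd M t x)⁻¹) b)
    (h2 : Dec (fun x => M t x / kd M t x) b) : Sol lam α t b (M t) := by
  simp only [kd, conj_ofReal] at h1 h2
  exact ⟨h.cp hE, h.im_pos _ hE, h.riccati hE, h1, h2⟩

theorem mul_comm_of_recurrence {a c d : ℤ → ℂ} (ha : ∀ n, a (n + 1) = d n * a n - a (n - 1))
    (hc : ∀ n, c (n + 1) = d n * c n - c (n - 1)) (ha0 : Tendsto a atTop (𝓝 0))
    (hc0 : Tendsto c atTop (𝓝 0)) : ∃ p q, (p ≠ 0 ∨ q ≠ 0) ∧ ∀ n, p * a n + q * c n = 0 := by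
  have hW : ∀ n, a (n + 1) * c n - a n * c (n + 1) = a 1 * c 0 - a 0 * c 1 := by
    have hs : ∀ n, a (n + 1) * c n - a n * c (n + 1) = a n * c (n - 1) - a (n - 1) * c n :=
        fun n => by
      rw [ha, hc]; ring
    intro n
    induction n using Int.induction_on with
    | zero => simp
    | succ k ih => rw [hs]; simpa using ih
    | pred k ih => rw [hs] at ih; simpa using ih
  have hW0 : a 1 * c 0 - a 0 * c 1 = 0 := by
    have hsh : Tendsto (fun n : ℤ => n + 1) atTop atTop :=
      tendsto_atTop_add_const_right _ _ tendsto_id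
    have := ((ha0.comp hsh).mul hc0).sub (ha0.mul (hc0.comp hsh))
    simp only [Function.comp_def, hW, mul_zero, sub_zero] at this
    exact tendsto_nhds_unique tendsto_const_nhds this
  have key : ∀ p q : ℂ, p * a 0 + q * c 0 = 0 → p * a 1 + q * c 1 = 0 → ∀ n,
      p * a n + q * c n = 0 := by
    intro p q h0 h1
    have hr : ∀ n, p * a (n + 1) + q * c (n + 1) = d n * (p * a n + q * c n) -
        (p * a (n - 1) + q * c (n - 1)) := fun n => by rw [ha, hc]; ring
    have : ∀ n, p * a n + q * c n = 0 ∧ p * a (n + 1) + q * c (n + 1) = 0 := by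
      intro n
      induction n using Int.induction_on with
      | zero => exact ⟨h0, by simpa using h1⟩
      | succ k ih => exact ⟨ih.2, by rw [hr]; simp [ih]⟩
      | pred k ih =>
        have := hr (-k)
        rw [ih.1, ih.2] at this
        exact ⟨by linear_combination this, by simpa using ih.1⟩
    exact fun n => (this n).1
  by_cases h0 : c 0 = 0 ∧ a 0 = 0
  · by_cases h1 : c 1 = 0 ∧ a 1 = 0
    · exact ⟨1, 0, by simp, key _ _ (by simp [h0]) (by simp [h1])⟩
    · exact ⟨c 1, -a 1, by rw [neg_ne_zero]; tauto, key _ _ (by simp [h0]) (by ring)⟩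
  · exact ⟨c 0, -a 0, by rw [neg_ne_zero]; tauto, key _ _ (by ring) (by linear_combination hW0)⟩

theorem CP.tendsto_fc {f : ℝ → ℂ} (hf : CP f) : Tendsto (fc f) cofinite (𝓝 0) := by
  have := hf.parseval.summable.tendsto_cofinite_zero
  rw [tendsto_zero_iff_norm_tendsto_zero]
  simpa [Real.sqrt_sq] using this.sqrt

/-- Two periodic solutions of the same quasiperiodic equation are proportional. -/
theorem mul_comm_of_equation (hlam : lam ≠ 0) {f g : ℝ → ℂ} (hf : CP f) (hg : CP g) {X : ℂ}
    (hfe : ∀ x : ℝ, X * f (x + α) + X⁻¹ * f (x - α) + pot lam x * f x = t * f x)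
    (hge : ∀ x : ℝ, X * g (x + α) + X⁻¹ * g (x - α) + pot lam x * g x = t * g x) (x y : ℝ) :
    f x * g y = f y * g x := by
  have hrec : ∀ {f : ℝ → ℂ}, CP f →
      (∀ x : ℝ, X * f (x + α) + X⁻¹ * f (x - α) + pot lam x * f x = t * f x) → ∀ n : ℤ,
      fc f (n + 1) = (t - X * ee (n * α) - X⁻¹ * ee (-(n * α))) / lam * fc f n - fc f (n - 1) := by
    intro f hf h n
    have e : (fun x => (t : ℂ) * f x) = fun x => (X * f (x + α) + X⁻¹ * f (x + -α)) +
        lam * (ee ((1 : ℤ) * x) * f x + ee ((-1 : ℤ) * x) * f x) := by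
      ext x; rw [← h, pot_eq_ee]; push_cast; simp only [one_mul, neg_mul, ← sub_eq_add_neg]; ring
    have e1 := congrArg (fun f => fc f n) e
    have c1 := (CP.const X).mul (hf.shift α)
    have c2 := (CP.const X⁻¹).mul (hf.shift (-α))
    have c3 := (CP.char 1).mul hf
    have c4 := (CP.char (-1)).mul hf
    simp only [(c1.add c2).fc_add ((CP.const lam).mul (c3.add c4)), c1.fc_add c2, fc_const_mul,
      c3.fc_add c4, fc_ee_mul, hf.fc_shift] at e1
    have hl : (lam : ℂ) ≠ 0 := by exact_mod_cast hlam
    push_cast at e1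
    rw [sub_neg_eq_add, mul_neg] at e1
    field_simp
    linear_combination -e1
  have hcof : ∀ {f : ℝ → ℂ}, CP f → Tendsto (fc f) atTop (𝓝 0) := fun hf =>
    hf.tendsto_fc.mono_left (by rw [Int.cofinite_eq]; exact le_sup_right)
  obtain ⟨p, q, hpq, h⟩ := mul_comm_of_recurrence (hrec hf hfe) (hrec hg hge) (hcof hf) (hcof hg)
  have h0 : ∀ x, p * f x + q * g x = 0 := by
    refine (((CP.const p).mul hf).add ((CP.const q).mul hg)).eq_zero fun k => ?_
    rw [((CP.const p).mul hf).fc_add ((CP.const q).mul hg), fc_const_mul, fc_const_mul, h]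
  rcases hpq with hp | hq
  · exact mul_left_cancel₀ hp (by linear_combination g y * h0 x - g x * h0 y)
  · exact mul_left_cancel₀ hq (by linear_combination f x * h0 y - f y * h0 x)

end

theorem Dec.exists_cohomologous {G : ℝ → ℂ} {b s c : ℝ} (hG : Dec G b) (hb : 0 < b)
    (h0 : fc G 0 = 0)
    (hs : s < 2 * π * b) (hc : 0 < c)
    (hd : ∀ k : ℤ, k ≠ 0 → c * exp (-(s * |(k : ℝ)|)) ≤ ‖ee (k * α) - 1‖) :
    ∃ ψ, CP ψ ∧ ∀ x, ψ (x + α) - ψ x = G x := by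
  obtain ⟨C, hC⟩ := hG.decay
  set a : ℤ → ℂ := fun k => fc G k / (ee (k * α) - 1) with ha
  have hka : ∀ k, a k * (ee (k * α) - 1) = fc G k := fun k => by
    rcases eq_or_ne k 0 with rfl | hk
    · simp [ha, h0]
    · have h1 := hd k hk
      refine div_mul_cancel₀ _ (norm_pos_iff.1 (lt_of_lt_of_le (by positivity) h1))
  have hb' : ∀ k, ‖a k‖ ≤ C / c * exp (-((2 * π * b - s) * |(k : ℝ)|)) := fun k => by
    rcases eq_or_ne k 0 with rfl | hk
    · have := (norm_nonneg _).trans (hC 0)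
      simp only [Int.cast_zero, abs_zero, mul_zero, neg_zero, Real.exp_zero, mul_one] at this ⊢
      simp only [ha, h0, zero_div, norm_zero]; positivity
    · rw [ha, norm_div, div_le_iff₀ (lt_of_lt_of_le (by positivity) (hd k hk))]
      have hC0 : 0 ≤ C := by
        have := (norm_nonneg _).trans (hC 0)
        simpa using this
      calc _ ≤ _ := hC k
        _ = C / c * exp (-((2 * π * b - s) * |(k : ℝ)|)) * (c * exp (-(s * |(k : ℝ)|))) := by
          rw [show -(2 * π * b * |(k : ℝ)|) = -((2 * π * b - s) * |(k : ℝ)|) +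
            -(s * |(k : ℝ)|) by ring,
            exp_add]
          field_simp
        _ ≤ _ := by gcongr; exact hd k hk
  have hsum : Summable fun k : ℤ => C / c * exp (-((2 * π * b - s) * |(k : ℝ)|)) :=
    (summable_exp_abs (sub_pos.2 hs)).mul_left _
  have hle : ∀ (k : ℤ) (x : ℝ), ‖a k * ee (k * x)‖ ≤ C / c * exp (-((2 * π * b - s) * |(k : ℝ)|)) :=
    fun k x => by rw [norm_mul, norm_ee_int_mul, mul_one]; exact hb' k
  have hsx : ∀ x : ℝ, Summable fun k : ℤ => a k * ee (k * x) :=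
    fun x => .of_norm_bounded hsum fun k => hle k x
  refine ⟨fun x => ∑' k : ℤ, a k * ee (k * x),
    ⟨continuous_tsum (fun k => (CP.char k).cont.const_mul _ |>.congr
    fun _ => rfl) hsum hle, fun x => ?_⟩, fun x => ?_⟩
  · exact tsum_congr fun k => by rw [(CP.char k).per x]
  · rw [← (hsx _).tsum_sub (hsx _), ← (hG.cp.hasSum (hG.summable_fc hb) x).tsum_eq]
    refine tsum_congr fun k => ?_
    rw [← hka]; push_cast; rw [mul_add, ee_add]; ring

theorem Sol.not_diophantine {t b s c : ℝ} {m : ℝ → ℂ} (hlam : 0 < lam) (h : Sol lam α t b m)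
    (hb : 0 < b)
    {j k : ℤ} (hres : ∫ x in (0 : ℝ)..1, Complex.log (m x) = π * (j * α + k) * I)
    (hs : s < 2 * π * b) (hc : 0 < c) :
    ¬ ∀ k : ℤ, k ≠ 0 → c * exp (-(s * |(k : ℝ)|)) ≤ ‖ee (k * α) - 1‖ := by
  intro hd
  obtain ⟨Q, G, hQ, -, -, hG, hG0, hm⟩ := h.exists_reduction hb
  obtain ⟨ψ, hψ, hψG⟩ := hG.exists_cohomologous hb hG0 hs hc hd
  rw [hres] at hm
  set X := Complex.exp (π * (j * α + k) * I) with hX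
  have hX0 : X ≠ 0 := Complex.exp_ne_zero _
  have hXc : conj X = X * ee (-(j * α)) := by
    rw [hX, ← Complex.exp_conj, ee, ← Complex.exp_add, Complex.exp_eq_exp_iff_exists_int]
    refine ⟨-k, ?_⟩
    simp only [map_mul, map_add, conj_ofReal, Complex.conj_I, map_intCast]
    push_cast; ring
  set f : ℝ → ℂ := fun x => Complex.exp (ψ (x + α) + Q (x + α)) with hf
  have hf0 : ∀ x, f x ≠ 0 := fun x => Complex.exp_ne_zero _
  have hfc : CP f := by
    have := (hψ.shift α).add (hQ.shift α)
    exact ⟨this.cont.cexp, fun x => by simp only [hf, this.per x]⟩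
  have hmf : ∀ x, m x = X * f x / f (x - α) := by
    intro x
    rw [hm, hX, hf, ← Complex.exp_add, ← Complex.exp_sub, sub_add_cancel, ← hψG]; ring_nf
  have hfe : ∀ x : ℝ, X * f (x + α) + X⁻¹ * f (x - α) + pot lam x * f x = t * f x := by
    intro x
    have h1 := h.ric x
    rw [hmf, hmf, add_sub_cancel_right] at h1
    have h2 := hf0 x; have h3 := hf0 (x - α)
    field_simp at h1 ⊢
    linear_combination h1
  have hge : ∀ x : ℝ, X * (ee ((-j : ℤ) * (x + α : ℝ)) * conj (f (x + α))) +
      X⁻¹ * (ee ((-j : ℤ) * (x - α : ℝ)) * conj (f (x - α))) +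
      pot lam x * (ee ((-j : ℤ) * x) * conj (f x)) =
      t * (ee ((-j : ℤ) * x) * conj (f x)) := by
    intro x
    have h1 := congrArg conj (hfe x)
    simp only [map_add, map_mul, map_inv₀, conj_ofReal, conj_pot, hXc, ee_neg, mul_inv,
      inv_inv] at h1
    push_cast
    rw [show -(j : ℂ) * (x + α) = -j * x +
      -(j * α) by ring, show -(j : ℂ) * (x - α) = -j * x + (j * α) by ring,
      ee_add, ee_add, ee_neg (j * α)]
    linear_combination ee (-j * x) * h1
  have hcomm := mul_comm_of_equation hlam.ne' hfc ((CP.char (-j)).mul hfc.conj) hfe hge α 0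
  have h1 : conj (m α) = m α := by
    rw [hmf]
    simp only [map_div₀, map_mul, hXc, sub_self]
    have h2 := hf0 0
    have h3 : conj (f 0) ≠ 0 := by simpa using h2
    push_cast at hcomm
    rw [mul_zero, ee_zero, neg_mul, one_mul] at hcomm
    field_simp
    linear_combination -hcomm
  have h2 := h.pos α
  rw [Complex.conj_eq_iff_im] at h1
  linarith

theorem le_norm_ee_sub_one {x d : ℝ} (h : ∀ n : ℤ, d ≤ |x - n|) : 4 * d ≤ ‖ee x - 1‖ := by
  have e : ee x = Complex.exp (I * (2 * π * (x - round x) : ℝ)) := by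
    rw [← sub_add_cancel (x : ℂ) (round x : ℤ), ee_add, ee_int, mul_one, ee]
    congr 1; push_cast; ring
  rw [e, Complex.norm_exp_I_mul_ofReal_sub_one]
  set y := x - round x with hy
  have h1 : |y| ≤ 1 / 2 := abs_sub_round x
  have h2 := h (round x)
  rw [← hy] at h2
  have h3 : 2 / π * (π * |y|) ≤ Real.sin (π * |y|) :=
    Real.mul_le_sin (by positivity) (by nlinarith [pi_pos])
  have h4 : |Real.sin (π * y)| = Real.sin (π * |y|) := by
    rcases abs_cases y with ⟨h5, -⟩ | ⟨h5, -⟩ <;> rw [h5] at h3 ⊢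
    · exact abs_of_nonneg (le_trans (mul_nonneg (by positivity)
        (mul_nonneg pi_pos.le (h5 ▸ abs_nonneg y))) h3)
    · rw [mul_neg, Real.sin_neg]
      exact abs_of_nonpos (by
        have : 0 ≤ Real.sin (π * -y) := le_trans
          (mul_nonneg (by positivity) (mul_nonneg pi_pos.le (h5 ▸ abs_nonneg y))) h3
        rw [mul_neg, Real.sin_neg] at this; linarith)
  rw [norm_eq_abs, show 2 * π * y / 2 = π * y by ring, abs_mul, h4, abs_two]
  have : 2 / π * (π * |y|) = 2 * |y| := by field_simp
  linarith

theorem norm_ee_sub_one_le (x : ℝ) : ‖ee x - 1‖ ≤ 2 * π * |x| := by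
  have := Real.norm_exp_I_mul_ofReal_sub_one_le (x := 2 * π * x)
  rw [norm_eq_abs, abs_mul, abs_of_pos two_pi_pos] at this
  convert this using 3
  rw [ee]; push_cast; ring_nf

/-- `p / q` approximates `α` exponentially well. -/
structure Approx (α s : ℝ) (q : ℕ) (p : ℤ) : Prop where
  pos : 0 < q
  coprime : IsCoprime (q : ℤ) p
  dist_le : |q * α - p| ≤ exp (-(s * q))
  small : q * exp (-(s * q)) ≤ 1 / 2

namespace Approx
variable {s : ℝ} {q : ℕ} {p : ℤ}

theorem le_norm (h : Approx α s q p) {k : ℤ} (hk : k ≠ 0) (hkq : |(k : ℝ)| < q) :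
    2 / q ≤ ‖ee (k * α) - 1‖ := by
  have hq : (0 : ℝ) < q := by exact_mod_cast h.pos
  have := le_norm_ee_sub_one (x := k * α) (d := 1 / (2 * q)) fun n => by
    have h1 : k * p - n * q ≠ 0 := fun h0 => by
      have h2 : (q : ℤ) ∣ k := h.coprime.dvd_of_dvd_mul_right ⟨n, by linarith⟩
      have h3 := Int.le_of_dvd (abs_pos.2 hk) ((dvd_abs _ _).2 h2)
      have h4 : |k| < q := by exact_mod_cast hkq
      omega
    have h2 : (1 : ℝ) ≤ |(k * p - n * q : ℤ)| := by exact_mod_cast Int.one_le_abs h1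
    push_cast at h2
    have h3 : (k * p - n * q : ℝ) = q * (k * α - n) - k * (q * α - p) := by ring
    have h4 : |(k : ℝ) * (q * α - p)| ≤ 1 / 2 := by
      rw [abs_mul]
      calc _ ≤ (q : ℝ) * exp (-(s * q)) := by gcongr; exact h.dist_le
        _ ≤ _ := h.small
    have h5 := abs_sub ((q : ℝ) * (k * α - n)) (k * (q * α - p))
    rw [← h3, abs_mul (q : ℝ), abs_of_pos hq] at h5
    rw [div_le_iff₀ (by positivity)]
    linarith
  push_cast at this
  convert this using 1
  field_simp; norm_num

theorem norm_geom_sum_le (h : Approx α s q p) {k : ℤ} (hk : k ≠ 0) (hkq : |(k : ℝ)| < q) :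
    ‖∑ j ∈ range q, ee (k * α) ^ j‖ ≤ π * |(k : ℝ)| * (q * exp (-(s * q))) := by
  have hq : (0 : ℝ) < q := by exact_mod_cast h.pos
  have h1 := geom_sum_mul (ee (k * α)) q
  have h2 : ee (k * α) ^ q = ee (k * (q * α - p) : ℝ) := by
    rw [← ee_nat_mul]; push_cast
    rw [show (k : ℂ) * (q * α - p) = q * (k * α) +
      (-(k * p) : ℤ) by push_cast; ring, ee_add, ee_int, mul_one]
  have h3 := norm_ee_sub_one_le (k * (q * α - p))
  rw [← h2, ← h1, norm_mul, abs_mul] at h3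
  have h4 := h.le_norm hk hkq
  have h5 : ‖∑ j ∈ range q, ee (k * α) ^ j‖ * (2 / q) ≤ 2 * π * (|(k : ℝ)| * exp (-(s * q))) :=
    (mul_le_mul_of_nonneg_left h4 (norm_nonneg _)).trans (h3.trans (by gcongr; exact h.dist_le))
  rw [mul_div_assoc', div_le_iff₀ hq] at h5
  linarith

end Approx

theorem Dec.exists_birkhoff {G : ℝ → ℂ} {b s : ℝ} (hG : Dec G b) (hb : 0 < b) (h0 : fc G 0 = 0)
    (hs0 : 0 < s)
    (hs : s < 2 * π * b) : ∃ C, 0 < C ∧ ∀ q p, Approx α s q p → ∀ x,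
      ‖∑ j ∈ range q, G (x + j * α)‖ ≤ C * (q * exp (-(s * q))) := by
  obtain ⟨C, hC⟩ := hG.decay
  have hC0 : 0 ≤ C := by
    have := (norm_nonneg _).trans (hC 0)
    simpa using this
  set κ := 2 * π * b - s with hκ
  have hκ0 : 0 < κ := sub_pos.2 hs
  have hsum := summable_exp_abs (half_pos hκ0)
  set B := C * (2 * π / κ + 1) with hB
  refine ⟨B * ∑' k : ℤ, exp (-(κ / 2 * |(k : ℝ)|)) + 1, by positivity, fun q p h x => ?_⟩
  have hterm : ∀ k : ℤ, ‖fc G k * ee (k * x) * ∑ j ∈ range q, ee (k * α) ^ j‖ ≤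
      B * (q * exp (-(s * q))) * exp (-(κ / 2 * |(k : ℝ)|)) := by
    intro k
    rw [norm_mul, norm_mul, norm_ee_int_mul, mul_one]
    rcases eq_or_ne k 0 with rfl | hk
    · rw [h0, norm_zero, zero_mul]; positivity
    have e1 : exp (-(2 * π * b * |(k : ℝ)|)) = exp (-(s * |(k : ℝ)|)) *
        (exp (-(κ / 2 * |(k : ℝ)|)) * exp (-(κ / 2 * |(k : ℝ)|))) := by
      rw [← exp_add, ← exp_add, hκ]; ring_nf
    have e2 : exp (-(s * |(k : ℝ)|)) ≤ 1 := Real.exp_le_one_iff.2 (by simp; positivity)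
    have e3 : exp (-(κ / 2 * |(k : ℝ)|)) ≤ 1 := Real.exp_le_one_iff.2 (by simp; positivity)
    have hkey : exp (-(2 * π * b * |(k : ℝ)|)) * ‖∑ j ∈ range q, ee (k * α) ^ j‖ ≤
        (2 * π / κ + 1) * (q * exp (-(s * q))) * exp (-(κ / 2 * |(k : ℝ)|)) := by
      rcases lt_or_ge |(k : ℝ)| q with hkq | hkq
      · have h1 := h.norm_geom_sum_le hk hkq
        have h2 : κ / 2 * |(k : ℝ)| * exp (-(κ / 2 * |(k : ℝ)|)) ≤ 1 := by
          have := Real.add_one_le_exp (κ / 2 * |(k : ℝ)|)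
          rw [Real.exp_neg, ← div_eq_mul_inv, div_le_one (exp_pos _)]; linarith
        have h3 : |(k : ℝ)| * exp (-(κ / 2 * |(k : ℝ)|)) ≤ 2 / κ := by
          rw [le_div_iff₀ hκ0]; linarith
        calc _ ≤ (1 * (exp (-(κ / 2 * |(k : ℝ)|)) * exp (-(κ / 2 * |(k : ℝ)|)))) *
              (π * |(k : ℝ)| * (q * exp (-(s * q)))) := by rw [e1]; gcongr
          _ = π * (q * exp (-(s * q))) * exp (-(κ / 2 * |(k : ℝ)|)) *
              (|(k : ℝ)| * exp (-(κ / 2 * |(k : ℝ)|))) := by ring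
          _ ≤ π * (q * exp (-(s * q))) * exp (-(κ / 2 * |(k : ℝ)|)) * (2 / κ) := by gcongr
          _ = (2 * π / κ) * (q * exp (-(s * q))) * exp (-(κ / 2 * |(k : ℝ)|)) := by ring
          _ ≤ _ := by gcongr; linarith
      · have h1 : ‖∑ j ∈ range q, ee (k * α) ^ j‖ ≤ q := by
          refine (norm_sum_le _ _).trans ?_
          simp [norm_ee_int_mul]
        calc _ ≤ (exp (-(s * q)) * (1 * exp (-(κ / 2 * |(k : ℝ)|)))) * q := by
              rw [e1]; gcongr
          _ = 1 * (q * exp (-(s * q))) * exp (-(κ / 2 * |(k : ℝ)|)) := by ring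
          _ ≤ _ := by
            gcongr
            have : 0 < 2 * π / κ := by positivity
            linarith
    calc _ ≤ C * exp (-(2 * π * b * |(k : ℝ)|)) * ‖∑ j ∈ range q, ee (k * α) ^ j‖ := by
          gcongr; exact hC k
      _ ≤ _ := by
        rw [mul_assoc, hB, mul_assoc C, mul_assoc C]; gcongr
  have hS : HasSum (fun k : ℤ => fc G k * ee (k * x) * ∑ j ∈ range q, ee (k * α) ^ j)
      (∑ j ∈ range q, G (x + j * α)) := by
    simp only [mul_sum]
    refine hasSum_sum fun j _ => ?_
    refine (hG.cp.hasSum (hG.summable_fc hb) (x + j * α)).congr_fun ?_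
    intro k
    rw [← ee_nat_mul, mul_assoc, ← ee_add]; push_cast; ring_nf
  have := tsum_of_norm_bounded ((hsum.mul_left _).hasSum) hterm
  rw [hS.tsum_eq, tsum_mul_left] at this
  refine this.trans ?_
  have : 0 ≤ (q : ℝ) * exp (-(s * q)) := by positivity
  nlinarith

namespace Sol
variable {t b s : ℝ} {m : ℝ → ℂ}

theorem exists_prod (h : Sol lam α t b m) (hb : 0 < b) {j k : ℤ}
    (hres : ∫ x in (0 : ℝ)..1, Complex.log (m x) = π * (j * α + k) * I)
    (hs0 : 0 < s) (hs : s < 2 * π * b) : ∃ C, 0 < C ∧ ∀ q p, Approx α s q p →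
      (∀ x, ‖m (x + q * α) - m x‖ ≤ C * (q * exp (-(s * q)))) ∧
      ∃ ς : ℂ, ς ^ 2 = 1 ∧ ∀ x, ∃ η, ∏ j ∈ range q, m (x + j * α) = ς * Complex.exp η ∧
        ‖η‖ ≤ C * (q * exp (-(s * q))) := by
  obtain ⟨Q, G, hQ, ⟨K, hK, hQl⟩, ⟨K', hK', hml⟩, hG, hG0, hm⟩ := h.exists_reduction hb
  obtain ⟨C, hC, hCb⟩ := hG.exists_birkhoff (α := α) hb hG0 hs0 hs
  rw [hres] at hm
  refine ⟨π * |(j : ℝ)| + C + K + K', by positivity, fun q p ha => ?_⟩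
  have hq1 : (1 : ℝ) ≤ q := by exact_mod_cast ha.pos
  have hle : |q * α - p| ≤ q * exp (-(s * q)) :=
    ha.dist_le.trans (le_mul_of_one_le_left (exp_pos _).le hq1)
  set δ := (q : ℝ) * exp (-(s * q))
  have hδ : 0 ≤ δ := by positivity
  have hlip : ∀ {F : ℝ → ℂ} {K : ℝ}, 0 < K → CP F → (∀ x y, ‖F x - F y‖ ≤ K * |x - y|) → ∀ x,
      ‖F (x + q * α) - F x‖ ≤ K * δ := by
    intro F K hK hF hl x
    rw [← hF.sub_int _ p]
    refine (hl _ _).trans ?_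
    rw [show x + q * α - p - x = q * α - p by ring]; gcongr
  refine ⟨fun x => (hlip hK' h.cp hml x).trans ?_, Complex.exp (π * (j * p + k * q) * I), ?_,
    fun x => ⟨π * j * (q * α - p : ℝ) * I + ∑ j ∈ range q, G (x + j * α) +
      (Q (x + q * α) - Q x), ?_, ?_⟩⟩
  · gcongr
    have : 0 ≤ π * |(j : ℝ)| := by positivity
    linarith
  · rw [← Complex.exp_nat_mul, Complex.exp_eq_one_iff]
    exact ⟨j * p + k * q, by push_cast; ring⟩
  · have : ∀ n : ℕ, ∏ i ∈ range n, m (x + i * α) = Complex.exp (n * (π * (j * α + k) * I) +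
        ∑ i ∈ range n, G (x + i * α) + (Q (x + n * α) - Q x)) := by
      intro n
      induction n with
      | zero => simp
      | succ n ih =>
        rw [prod_range_succ, ih, hm, ← Complex.exp_add, Finset.sum_range_succ]
        rw [show x + n * α + α = x + (n + 1 : ℕ) * α by push_cast; ring]
        congr 1; push_cast; ring
    rw [this, ← Complex.exp_add]; congr 1; push_cast; ring
  · refine (norm_add₃_le).trans ?_
    have h1 := hCb q p ha x
    have h2 := hlip hK hQ hQl x
    have h3 : ‖(π * j * (q * α - p : ℝ) * I : ℂ)‖ ≤ π * |(j : ℝ)| * δ := by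
      rw [norm_mul, norm_mul, norm_mul, norm_I, mul_one, norm_real, norm_real,
        Complex.norm_intCast, norm_eq_abs, norm_eq_abs, abs_of_pos pi_pos]
      gcongr
    nlinarith [mul_nonneg hK'.le hδ]

theorem trace_identity (h : Sol lam α t b m) {ς : ℂ} (hς : ς ^ 2 = 1) (n : ℕ) (x : ℝ) {σ P : ℂ}
    (hσ : σ = (m (x + n * α) - conj (m x)) / (m x - conj (m x)))
    (hP : P = ∏ j ∈ range n, m (x + j * α)) :
    ‖An lam α t n x 0 0 + An lam α t n x 1 1 - 2 * ς‖ ≤ ‖P * (1 - σ)‖ ^ 2 + ‖P * σ - ς‖ ^ 2 := by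
  have hD := h.sub_conj_ne_zero x
  have hne := h.ne_zero
  have e1 := An_mulVec (z := 0) (E := t) hne (fun x => by rw [h.ric, zero_add]) n x
  have e2 := An_mulVec (z := 0) (E := t) (M := fun x => conj (m x))
    (fun x => by simpa using hne x) (fun x => by rw [h.ric_conj, zero_add]) n x
  have hdet := det_An (lam := lam) (α := α) (E := t) n x
  have hςc : conj ς = ς := by
    rcases sq_eq_one_iff.1 hς with h | h <;> simp [h]
  rw [← map_prod, ← hP] at e2
  rw [← hP] at e1
  rw [zero_add] at e1 e2
  rw [Matrix.det_fin_two] at hdet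
  have a1 := congrFun e1 0; have a2 := congrFun e1 1
  have a3 := congrFun e2 0; have a4 := congrFun e2 1
  simp [mulVec, dotProduct, Fin.sum_univ_two] at a1 a2 a3 a4
  set A := An lam α t n x
  have hσc : conj σ = (conj (m (x + n * α)) - m x) / (conj (m x) - m x) := by
    rw [hσ]; simp
  set Pc := conj P
  set σc := conj σ
  set u := m x
  set uc := conj u
  set v := m (x + n * α)
  set vc := conj v
  have hσ' : σ * (u - uc) = v - uc := by rw [hσ, div_mul_cancel₀ _ hD]
  have hσc' : σc * (u - uc) = u - vc := by
    have : uc - u ≠ 0 := fun h0 => hD (by linear_combination -h0)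
    rw [hσc]; field_simp; ring
  have hP2 : P * Pc * (v - vc) = u - uc := by
    linear_combination (u - uc) * hdet - a1 * (A 1 0 * uc + A 1 1) + a3 * (A 1 0 * u + A 1 1)
      - P * v * a4 + Pc * vc * a2
  have hT : A 0 0 + A 1 1 = P * σ + Pc * σc := by
    apply mul_right_cancel₀ hD
    linear_combination a1 - a3 + u * a4 - uc * a2 - P * hσ' - Pc * hσc'
  have h1 : P * Pc * (σ + σc - 1) = 1 := by
    apply mul_right_cancel₀ hD
    linear_combination P * Pc * (hσ' + hσc') + hP2
  have key : A 0 0 + A 1 1 - 2 * ς = ς *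
      ((P * (1 - σ)) * (Pc * (1 - σc)) - (P * σ - ς) * (Pc * σc - ς)) := by
    rw [hT]
    linear_combination (P * σ + Pc * σc + ς * (-1 : ℂ)) * (-hς) + ς * h1
  have n1 : ‖ς‖ = 1 := by
    rcases sq_eq_one_iff.1 hς with h | h <;> simp [h]
  rw [key, norm_mul, n1, one_mul]
  have n2 : Pc * (1 - σc) = conj (P * (1 - σ)) := by simp [Pc, σc]
  have n3 : Pc * σc - ς = conj (P * σ - ς) := by simp [Pc, σc, hςc]
  refine (norm_sub_le _ _).trans ?_
  rw [norm_mul, norm_mul (P * σ - ς), n2, n3, norm_conj, norm_conj, sq, sq]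

theorem exists_pow_le (h : Sol lam α t b m) (hlam : 0 ≤ lam) (hb : 0 < b) {j k : ℤ}
    (hres : ∫ x in (0 : ℝ)..1, Complex.log (m x) = π * (j * α + k) * I)
    (hs0 : 0 < s) (hs : s < 2 * π * b) : ∃ C, 0 < C ∧ ∀ q p, Approx α s q p →
      lam ^ q ≤ C * (q * exp (-(s * q))) ^ 2 := by
  obtain ⟨C, hC, hCb⟩ := h.exists_prod hb hres hs0 hs
  obtain ⟨D, hD, hDb⟩ := h.dec_inv.cp.norm_bdd
  set R := exp C
  have hR : 0 < R := exp_pos C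
  refine ⟨(R * (D * C)) ^ 2 + (R * (D * C) + C * R) ^ 2, by positivity, fun q p ha => ?_⟩
  obtain ⟨hv, ς, hς, hprod⟩ := hCb q p ha
  have hδ2 := ha.small
  set δ := (q : ℝ) * exp (-(s * q)) with hδ
  have hδ0 : 0 ≤ δ := by positivity
  refine pow_le_of_norm_trace_sub_le (α := α) (E := t) hlam ha.pos.ne' (c := 2 * ς) fun x => ?_
  refine (h.trace_identity hς q x rfl rfl).trans ?_
  obtain ⟨η, hη, hηb⟩ := hprod x
  rw [hη]
  have n1 : ‖ς‖ = 1 := by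
    rcases sq_eq_one_iff.1 hς with h | h <;> simp [h]
  have hηC : ‖η‖ ≤ C := hηb.trans (by nlinarith)
  have hP : ‖ς * Complex.exp η‖ ≤ R := by
    rw [norm_mul, n1, one_mul]
    exact (Complex.norm_exp_le_exp_norm _).trans (exp_le_exp.2 hηC)
  have hσ : ‖1 - (m (x + q * α) - conj (m x)) / (m x - conj (m x))‖ ≤ D * C * δ := by
    have h0 := h.sub_conj_ne_zero x
    rw [show 1 - (m (x + q * α) - conj (m x)) / (m x - conj (m x)) =
      (m x - conj (m x))⁻¹ * -(m (x + q * α) -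
        m x) by field_simp; ring, norm_mul, norm_neg, mul_assoc]
    gcongr
    · exact hDb x
    · exact hv x
  set σ := (m (x + q * α) - conj (m x)) / (m x - conj (m x))
  have hPς : ‖ς * Complex.exp η - ς‖ ≤ C * R * δ := by
    rw [← mul_sub_one, norm_mul, n1, one_mul]
    have := Complex.norm_exp_sub_sum_le_norm_mul_exp η 1
    simp at this
    refine this.trans ?_
    calc _ ≤ (C * δ) * R := by gcongr; exact exp_le_exp.2 hηC
      _ = _ := by ring
  have h1 : ‖ς * Complex.exp η * (1 - σ)‖ ≤ R * (D * C) * δ := by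
    rw [norm_mul, mul_assoc R]; gcongr
  have h2 : ‖ς * Complex.exp η * σ - ς‖ ≤ (R * (D * C) + C * R) * δ := by
    rw [show ς * Complex.exp η * σ - ς = (ς * Complex.exp η - ς) - ς * Complex.exp η *
      (1 - σ) by ring]
    refine (norm_sub_le _ _).trans ?_
    linarith
  rw [add_mul, ← mul_pow, ← mul_pow]
  gcongr

end Sol

theorem tendsto_pow_mul_exp {a : ℝ} (ha : 0 < a) (k : ℕ) :
    Tendsto (fun q : ℕ => (q : ℝ) ^ k * exp (-(a * q))) atTop (𝓝 0) := by
  have h : |exp (-a)| < 1 := by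
    rw [abs_of_pos (exp_pos _)]; exact Real.exp_lt_one_iff.2 (by linarith)
  refine (tendsto_pow_const_mul_const_pow_of_abs_lt_one k h).congr fun q => ?_
  rw [← exp_nat_mul]; ring_nf

theorem exists_approx_of_not_diophantine (hα : Irrational α) {s : ℝ} (hs : 0 < s)
    (h : ∀ c, 0 < c → ¬ ∀ k : ℤ, k ≠ 0 → c * exp (-(s * |(k : ℝ)|)) ≤ ‖ee (k * α) - 1‖) (N : ℕ) :
    ∃ q p, N ≤ q ∧ Approx α s q p := by
  obtain ⟨N₁, hN₁⟩ := eventually_atTop.1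
    ((tendsto_pow_mul_exp hs 1).eventually_le_const (by norm_num : (0 : ℝ) < 1 / 2))
  obtain ⟨c, hc0, hc1, hc⟩ : ∃ c : ℝ, 0 < c ∧ c ≤ 1 ∧ ∀ q ∈ Finset.Icc 1 (N + N₁),
      c * 2 < ‖ee ((q : ℤ) * α) - 1‖ := by
    have h1 : ∀ᶠ c : ℝ in 𝓝 0, ∀ q ∈ Finset.Icc 1 (N + N₁), c * 2 < ‖ee ((q : ℤ) * α) - 1‖ := by
      rw [Filter.eventually_all_finset]
      intro q hq
      have h2 : 0 < ‖ee ((q : ℤ) * α) - 1‖ := norm_pos_iff.2 (sub_ne_zero.2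
        (ee_ne_one hα (by have := (Finset.mem_Icc.1 hq).1; omega)))
      exact (continuous_id.mul continuous_const).tendsto' 0 0 (by simp) |>.eventually_lt_const h2
    have h2 : ∀ᶠ c : ℝ in 𝓝[>] 0, 0 < c := eventually_mem_nhdsWithin
    have h3 : ∀ᶠ c : ℝ in 𝓝[>] 0, c ≤ 1 :=
      (eventually_le_nhds (by norm_num : (0 : ℝ) < 1)).filter_mono nhdsWithin_le_nhds
    exact (h2.and (h3.and (h1.filter_mono nhdsWithin_le_nhds))).exists
  obtain ⟨k, hk0, hk⟩ : ∃ k : ℤ, k ≠ 0 ∧ ‖ee (k * α) - 1‖ < c * exp (-(s * |(k : ℝ)|)) := by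
    have := h c hc0; push Not at this; exact this
  set P := round (k * α) with hP
  have hd : 4 * |k * α - P| ≤ ‖ee (k * α) - 1‖ := by
    have := le_norm_ee_sub_one (x := k * α) (d := |k * α - P|) fun n => round_le _ _
    push_cast at this; exact this
  have hg : 0 < Int.gcd k P := Int.gcd_pos_of_ne_zero_left _ hk0
  obtain ⟨k', P', hco, hk', hP'⟩ := Int.exists_gcd_one hg
  set g := Int.gcd k P
  have hg1 : (1 : ℝ) ≤ g := by exact_mod_cast hg
  have hk'0 : k' ≠ 0 := fun h0 => hk0 (by rw [hk', h0, zero_mul])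
  have hkk : |(k' : ℝ)| ≤ |(k : ℝ)| := by
    have : (k : ℝ) = k' * g := by exact_mod_cast hk'
    rw [this, abs_mul, Nat.abs_cast]; exact le_mul_of_one_le_right (abs_nonneg _) hg1
  have hdist : |k' * α - P'| ≤ c / 4 * exp (-(s * |(k' : ℝ)|)) := by
    have e : (k : ℝ) * α - P = g * (k' * α - P') := by
      have h1 : (k : ℝ) = k' * g := by exact_mod_cast hk'
      have h2 : (P : ℝ) = P' * g := by exact_mod_cast hP'
      rw [h1, h2]; ring
    have h1 : |k' * α - P'| ≤ |k * α - P| := by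
      rw [e, abs_mul, Nat.abs_cast]; exact le_mul_of_one_le_left (abs_nonneg _) hg1
    have h2 : exp (-(s * |(k : ℝ)|)) ≤ exp (-(s * |(k' : ℝ)|)) := by gcongr
    nlinarith
  obtain ⟨q, hq⟩ := k'.eq_nat_or_neg
  have hqa : |(k' : ℝ)| = q := by rcases hq with rfl | rfl <;> simp
  obtain ⟨p, hp, hpco⟩ : ∃ p : ℤ, |(q : ℝ) * α - p| = |k' * α - P'| ∧ IsCoprime (q : ℤ) p := by
    have hco := Int.isCoprime_iff_gcd_eq_one.2 hco
    rcases hq with rfl | rfl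
    · exact ⟨P', by simp, hco⟩
    · refine ⟨-P', ?_, by simpa using hco.neg_left.neg_right⟩
      rw [← abs_neg]; push_cast; ring_nf
  rw [hqa] at hdist
  have hq0 : 0 < q := by rcases hq with rfl | rfl <;> (simp at hk'0; omega)
  rw [← hp] at hdist
  have hqN : N + N₁ < q := by
    by_contra hle
    have h1 := hc q (Finset.mem_Icc.2 ⟨hq0, not_lt.1 hle⟩)
    have h2 := norm_ee_sub_one_le (q * α - p)
    have h3 : ee ((q * α - p : ℝ)) = ee ((q : ℤ) * α) := by
      push_cast; rw [sub_eq_add_neg, ee_add, ← Int.cast_neg, ee_int, mul_one]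
    rw [h3] at h2
    have h4 : exp (-(s * q)) ≤ 1 := Real.exp_le_one_iff.2 (by simp; positivity)
    have h5 : c / 4 * exp (-(s * q)) ≤ c / 4 := mul_le_of_le_one_right (by positivity) h4
    have := Real.pi_lt_four
    have h6 := hdist.trans h5
    have h7 := mul_le_mul_of_nonneg_right this.le (abs_nonneg (q * α - p))
    linarith
  refine ⟨q, p, by omega, hq0, hpco, hdist.trans ?_, ?_⟩
  · exact mul_le_of_le_one_left (exp_pos _).le (by linarith)
  · have := hN₁ q (by omega)
    rwa [pow_one] at this

theorem Sol.false_of_resonant {t b s : ℝ} {m : ℝ → ℂ} (hα : Irrational α) (hlam : 0 < lam)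
    (h : Sol lam α t b m)
    (hb : 0 < b) {j k : ℤ}
    (hres : ∫ x in (0 : ℝ)..1, Complex.log (m x) = π * (j * α + k) * I)
    (hs0 : 0 < s) (hs : s < 2 * π * b) (hsl : -log lam < 2 * s) : False := by
  obtain ⟨C, hC, hCb⟩ := h.exists_pow_le hlam.le hb hres hs0 hs
  have hlim := (tendsto_pow_mul_exp (show 0 < 2 * s + log lam by linarith) 2).const_mul C
  rw [mul_zero] at hlim
  obtain ⟨N, hN⟩ := eventually_atTop.1 (hlim.eventually_lt_const one_pos)
  obtain ⟨q, p, hq, ha⟩ := exists_approx_of_not_diophantine hα hs0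
    (fun c hc => h.not_diophantine hlam hb hres hs hc) N
  have h1 := hCb q p ha
  have h2 := hN q hq
  have e1 : lam ^ q = exp (log lam * q) := by rw [mul_comm, exp_nat_mul, exp_log hlam]
  have e2 : C * (q * exp (-(s * q))) ^ 2 =
      C * (q ^ 2 * exp (-((2 * s + log lam) * q))) * exp (log lam * q) := by
    rw [mul_pow, ← exp_nat_mul, mul_assoc C, mul_assoc (_ ^ 2), ← exp_add]; push_cast; ring_nf
  rw [e2, e1] at h1
  nlinarith [exp_pos (log lam * q)]

/-- The Lyapunov exponent of the subcritical or critical operator vanishes on no interval. -/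
theorem exists_Lyap_ne_zero (hα : Irrational α) (hlam : 0 < lam) (hlam1 : lam ≤ 1)
    {a b : ℝ} (hab : a < b) :
    ∃ t ∈ Icc a b, Lyap lam α (t : ℝ) 0 ≠ 0 := by
  by_contra! hJ
  have hE₀ : (a + b) / 2 ∈ Ioo a b := ⟨by linarith, by linarith⟩
  obtain ⟨r, hr, M, hM⟩ := kotani hα hE₀ hJ
  obtain ⟨t, -, ht, j, k, hres⟩ := hM.exists_resonant hα hr hE₀ hJ
  rcases hlam1.lt_or_eq with h1 | rfl
  · have hl : log lam < 0 := Real.log_neg hlam h1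
    obtain ⟨d1, d2⟩ := hM.dec_of_lt_one hα hlam ht (b := -log lam * (3 / 4) / (2 * π))
      (by apply div_nonneg <;> [linarith; positivity]) (by
        rw [mul_div_cancel₀ _ two_pi_pos.ne']; linarith)
    refine (hM.sol ht d1 d2).false_of_resonant hα hlam (div_pos (by linarith) two_pi_pos) hres
      (s := -log lam * (5 / 8)) (by linarith) ?_ (by linarith)
    rw [mul_div_cancel₀ _ two_pi_pos.ne']; linarith
  · obtain ⟨b, hb, d1, d2⟩ := hM.exists_dec hα ht
    exact (hM.sol ht d1 d2).false_of_resonant hα one_pos hb hres (s := π * b) (by positivity)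
      (by nlinarith [mul_pos pi_pos hb]) (by rw [Real.log_one, neg_zero]; positivity)

theorem norm_le_of_strip {f : ℂ → ℂ} (hf : Differentiable ℂ f) {S B ε : ℝ} (hS : 0 < S) (hB : 1 ≤ B)
    (hε : 0 < ε)
    (h0 : ∀ x : ℝ, ‖f x‖ ≤ S) (h1 : ∀ z : ℂ, |z.im| ≤ ε → ‖f z‖ ≤ S * exp B)
    {z : ℂ} (hz : |z.im| ≤ ε / B) :
    ‖f z‖ ≤ S * exp 1 := by
  have hBp : 0 < B := by linarith
  obtain ⟨c, hc, hzc⟩ : ∃ c : ℝ, |c| = 1 ∧ z.im = c * |z.im| := by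
    rcases abs_cases z.im with ⟨h, -⟩ | ⟨h, -⟩
    · exact ⟨1, by simp, by rw [h, one_mul]⟩
    · exact ⟨-1, by simp, by rw [h]; ring⟩
  set T : ℂ → ℂ := fun w => z.re + c * ε * w * I with hT
  have hTim : ∀ w, (T w).im = c * ε * w.re := fun w => by simp [hT]
  have hstrip : ∀ w ∈ Complex.HadamardThreeLines.verticalClosedStrip 0 1, |(T w).im| ≤ ε := by
    intro w hw
    have h2 : w.re ∈ Icc (0 : ℝ) 1 := hw
    rw [hTim, abs_mul, abs_mul, hc, one_mul, abs_of_pos hε, abs_of_nonneg h2.1]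
    exact mul_le_of_le_one_right hε.le h2.2
  set w : ℂ := |z.im| / ε - (0 : ℝ) * I with hw
  have hwre : w.re = |z.im| / ε := by
    rw [hw, ← Complex.ofReal_div]; simp
  have hTw : T w = z := by
    apply Complex.ext
    · simp [hT, hw, ← Complex.ofReal_div]
    · rw [hTim, hwre, mul_assoc, mul_div_cancel₀ _ hε.ne', ← hzc]
  have hwI : w.re ≤ 1 / B := by
    rw [hwre, div_le_iff₀ hε]; rw [div_mul_eq_mul_div, one_mul]; exact hz
  have hw1 : w.re ≤ 1 := hwI.trans ((div_le_one hBp).2 hB)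
  have hw0 : 0 ≤ w.re := by rw [hwre]; positivity
  have hTd : Differentiable ℂ T := by simp only [hT]; fun_prop
  have := Complex.HadamardThreeLines.norm_le_interp_of_mem_verticalClosedStrip₀₁' (fun w => f (T w))
    (z := w)
    (a := S) (b := S * exp B) ⟨hw0, hw1⟩ (hf.comp hTd).diffContOnCl
    ⟨S * exp B, by rintro _ ⟨w, hw, rfl⟩; exact h1 _ (hstrip w hw)⟩
    (fun w hw => by
      have h2 : w.re = 0 := hw
      have h3 : T w = ((T w).re : ℝ) := by
        apply Complex.ext <;> simp [hTim, h2]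
      change ‖f (T w)‖ ≤ S
      rw [h3]; exact h0 _)
    (fun w hw => h1 _ (hstrip w (by
      have h2 : w.re = 1 := hw
      change w.re ∈ Icc (0 : ℝ) 1
      rw [h2]; simp)))
  simp only [hTw] at this
  refine this.trans ?_
  rw [Real.mul_rpow hS.le (exp_pos _).le, ← mul_assoc, ← Real.rpow_add hS, sub_add_cancel,
    Real.rpow_one,
    ← Real.exp_mul]
  gcongr
  rw [le_div_iff₀ hBp] at hwI; linarith

theorem norm_sub_le_of_strip {f : ℂ → ℂ} (hf : Differentiable ℂ f) {S B ε : ℝ} (hS : 0 < S)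
    (hB : 1 ≤ B) (hε : 0 < ε)
    (h0 : ∀ x : ℝ, ‖f x‖ ≤ S) (h1 : ∀ z : ℂ, |z.im| ≤ ε → ‖f z‖ ≤ S * exp B) (x y : ℝ) :
    ‖f x - f y‖ ≤ S * exp 1 * B / ε * |x - y| := by
  have hBp : 0 < B := by linarith
  have hconv : Convex ℝ {z : ℂ | z.im = 0} := by
    intro a ha b hb s t _ _ _
    have ha : a.im = 0 := ha
    have hb : b.im = 0 := hb
    change (s • a + t • b).im = 0
    simp [ha, hb]
  have := hconv.norm_image_sub_le_of_norm_deriv_le (𝕜 := ℂ) (f := f) (C := S * exp 1 * B / ε)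
    (fun z _ => hf z) (fun z hz => ?_) (ofReal_im y) (ofReal_im x)
  · rwa [← ofReal_sub, norm_real, norm_eq_abs] at this
  · have := norm_deriv_le_of_forall_mem_sphere_norm_le (c := z) (R := ε / B) (C := S * exp 1)
      (by positivity) hf.diffContOnCl fun w hw => norm_le_of_strip hf hS hB hε h0 h1 (by
        have h2 := abs_im_le_norm (w - z)
        rw [sub_im, (show z.im = 0 from hz), sub_zero] at h2
        rw [mem_sphere_iff_norm] at hw
        linarith)
    rwa [div_div_eq_mul_div] at this

theorem exists_dense_orbit (hα : Irrational α) (N : ℕ) : ∃ q : ℕ, N < q ∧ ∀ x y : ℝ, ∀ j₀ : ℤ,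
    ∃ j ∈ range q, ∃ n : ℤ, |x + (j₀ + j : ℤ) * α - y - n| ≤ 2 / q := by
  obtain ⟨M, hM0, hM⟩ : ∃ M : ℕ, 0 < M ∧ ∀ q ∈ Finset.Icc 1 N,
      1 / ((M : ℝ) + 1) < |q * α - round (q * α)| := by
    refine ((eventually_gt_atTop 0).and ((Filter.eventually_all_finset _).2 fun q hq => ?_)).exists
    refine tendsto_one_div_add_atTop_nhds_zero_nat.eventually_lt_const
      (abs_pos.2 (sub_ne_zero.2 ?_))
    have : Irrational (q * α) := hα.natCast_mul (by have := (Finset.mem_Icc.1 hq).1; omega)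
    exact this.ne_int _
  obtain ⟨r, hr, hrM⟩ := Real.exists_rat_abs_sub_le_and_den_le α hM0
  have hd0 : (0 : ℝ) < r.den := by exact_mod_cast r.den_pos
  have hrd : |r.den * α - r.num| ≤ 1 / ((M : ℝ) + 1) := by
    have e : (r.den : ℝ) * α - r.num = r.den * (α - r) := by
      rw [mul_sub]; congr 1
      exact_mod_cast (Rat.den_mul_eq_num r).symm
    rw [e, abs_mul, abs_of_pos hd0]
    calc _ ≤ (r.den : ℝ) * (1 / ((M + 1) * r.den)) := by gcongr
      _ = _ := by field_simp
  have hN : N < r.den := by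
    by_contra h
    have h1 := hM r.den (Finset.mem_Icc.2 ⟨r.den_pos, not_lt.1 h⟩)
    exact absurd (h1.trans_le ((round_le _ r.num).trans hrd)) (lt_irrefl _)
  refine ⟨r.den, hN, fun x y j₀ => ?_⟩
  set q := r.den
  set i := round (q * (y - x - j₀ * α)) with hi
  have hco : IsCoprime r.num (q : ℤ) := by
    rw [Int.isCoprime_iff_gcd_eq_one]; exact r.reduced
  obtain ⟨u, v, huv⟩ := hco
  have hq0 : (0 : ℤ) < q := by exact_mod_cast r.den_pos
  have hmod := Int.emod_add_mul_ediv (i * u) q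
  obtain ⟨j, hj⟩ := Int.eq_ofNat_of_zero_le (Int.emod_nonneg (i * u) hq0.ne')
  have hjq : j < q := by
    have := Int.emod_lt_of_pos (i * u) hq0
    rw [hj] at this; exact_mod_cast this
  rw [hj] at hmod
  refine ⟨j, Finset.mem_range.2 hjq, -(i * v + (i * u / q) * r.num), ?_⟩
  have key : (j : ℤ) * r.num = i + q * -(i * v + (i * u / q) * r.num) := by
    linear_combination r.num * hmod + i * huv
  have key' : (j : ℝ) * r.num = i + q * ((-(i * v + (i * u / q) * r.num) : ℤ) : ℝ) :=
    by exact_mod_cast key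
  generalize (-(i * v + (i * u / q) * r.num)) = n at key'
  have h1 : |(q : ℝ) * (y - x - j₀ * α) - i| ≤ 1 / 2 := abs_sub_round _
  have h2 : |(j : ℝ) * (q * α - r.num)| ≤ 1 := by
    rw [abs_mul, Nat.abs_cast]
    have hM1 : |(q : ℝ) * α - r.num| ≤ 1 / q := hrd.trans (by
      have : (r.den : ℝ) ≤ M := by exact_mod_cast hrM
      gcongr; linarith)
    calc _ ≤ (q : ℝ) * (1 / q) := by gcongr
      _ = 1 := by field_simp
  have e : (q : ℝ) * (x + (j₀ + j : ℤ) * α - y - n) = j * (q * α - r.num) -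
      (q * (y - x - j₀ * α) - i) := by
    push_cast; linear_combination key'
  rw [le_div_iff₀ hd0, mul_comm, ← abs_of_pos hd0, ← abs_mul, e]
  exact (abs_sub _ _).trans (by linarith)

theorem cp_An (n : ℕ) (i j : Fin 2) : CP fun x : ℝ => An lam α E n x i j :=
  ⟨(differentiable_An n i j).continuous.comp continuous_ofReal, fun x => by
    push_cast; rw [An_periodic]⟩

theorem CP.exists_max {f : ℝ → ℂ} (hf : CP f) : ∃ y, ∀ x, ‖f x‖ ≤ ‖f y‖ := by
  obtain ⟨y, -, hy⟩ := isCompact_Icc.exists_isMaxOn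
    (s := Icc (0 : ℝ) 1) ⟨0, by simp⟩ hf.cont.norm.continuousOn
  refine ⟨y, fun x => ?_⟩
  rw [← hf.sub_int x ⌊x⌋]
  exact hy ⟨Int.fract_nonneg x, (Int.fract_lt_one x).le⟩

theorem exists_entry_ge (E : ℂ) {n : ℕ} (hn : 2 ≤ n) : ∃ N, N ≤ n ∧ n ≤ N + 2 ∧ ∃ x : ℝ,
    exp (n * Lyap lam α E 0) / 4 ≤ ‖An lam α E N x 0 0‖ := by
  by_contra! h
  obtain ⟨n, rfl⟩ : ∃ k, n = k + 2 := ⟨n - 2, by omega⟩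
  set L := exp ((n + 2 : ℕ) * Lyap lam α E 0)
  have h1 : sN lam α E 0 (n + 2) ≤ L / 2 := by
    refine sN_le le_rfl fun z hz => ?_
    obtain ⟨x, rfl⟩ : ∃ x : ℝ, z = x :=
      ⟨z.re, Complex.ext rfl (by simpa using hz)⟩
    have e10 : ∀ n (x : ℂ), An lam α E (n + 1) x 1 0 = An lam α E n x 0 0 := fun n x => by
      simp [An_succ, tm, Matrix.mul_apply]
    have e01 : ∀ n (x : ℂ), An lam α E (n + 1) x 0 1 = -An lam α E n (x + α) 0 0 := fun n x => by
      simp [An_succ', tm, Matrix.mul_apply]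
    have e11 : ∀ n (x : ℂ), An lam α E (n + 1) x 1 1 = -An lam α E n (x + α) 1 0 := fun n x => by
      simp [An_succ', tm, Matrix.mul_apply]
    have h2 : L / 2 = 2 * (L / 4) := by ring
    rw [h2]
    refine norm_le_of_entry_le fun i j => ?_
    have a0 := h (n + 2) le_rfl (by omega) x
    have a1 := h (n + 1) (by omega) (by omega) x
    have a2 := h (n + 1) (by omega) (by omega) (x + α)
    have a3 := h n (by omega) (by omega) (x + α)
    push_cast at a2 a3
    fin_cases i <;> fin_cases j <;> simp only [Fin.mk_zero, Fin.mk_one, Fin.isValue]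
    · exact a0.le
    · rw [e01, norm_neg]; exact a2.le
    · rw [e10]; exact a1.le
    · rw [e11, e10, norm_neg]; exact a3.le
  have h2 := exp_Lyap_le_sN lam α (E := E) le_rfl (n + 2)
  have := exp_pos ((n + 2 : ℕ) * Lyap lam α E 0)
  linarith

theorem exists_large (hα : Irrational α) {ε κ : ℝ} (hε : 0 < ε)
    (hL : Lyap lam α E ε ≤ Lyap lam α E 0)
    (hκ : 0 < κ) (hκε : κ ≤ ε / 100) : ∃ C, 1 ≤ C ∧
      (∀ (n : ℕ) (x : ℝ), ‖An lam α E n x‖ ≤ C * exp ((Lyap lam α E 0 + κ) * n)) ∧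
      ∀ N₀, ∃ q : ℕ, N₀ < q ∧ ∃ N, N ≤ 4 * q ∧ 4 * q ≤ N + 2 ∧ ∀ (x : ℝ) (j₀ : ℤ), ∃ j ∈ range q,
        exp (Lyap lam α E 0 * (4 * q)) / 8 ≤ ‖An lam α E N (x + (j₀ + j : ℤ) * α : ℝ) 0 0‖ := by
  set l := Lyap lam α E 0 with hl
  have hl0 : 0 ≤ l := Lyap_nonneg le_rfl
  obtain ⟨δ, hδ, C₀, hC₀, hg⟩ := exists_growth (c := l + κ) hε.le (hL.trans_lt (by linarith))
  set C := max C₀ 1 with hC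
  have hC1 : 1 ≤ C := le_max_right _ _
  have hgC : ∀ (n : ℕ) (z : ℂ), |z.im| ≤ ε → ‖An lam α E n z‖ ≤ C * exp ((l + κ) * n) :=
      fun n z hz =>
    (hg E (by simpa using hδ) n z hz).trans (by gcongr; exact le_max_left _ _)
  refine ⟨C, hC1, fun n x => hgC n x (by simpa using hε.le), fun N₀ => ?_⟩
  have he : exp 1 < 2.72 := Real.exp_one_lt_d9.trans (by norm_num)
  have hlog : 1 ≤ log (4 * C) := by
    rw [Real.le_log_iff_exp_le (by positivity)]; linarith
  obtain ⟨N₁, hN₁⟩ := exists_nat_ge (4 * (2 * 2.72 * log (4 * C)) / ε)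
  obtain ⟨q, hq, hd⟩ := exists_dense_orbit hα (N₀ + N₁ + 1)
  obtain ⟨N, hN1, hN2, y₁, hy₁⟩ := exists_entry_ge (lam := lam) (α := α) E (n := 4 * q) (by omega)
  refine ⟨q, by omega, N, hN1, hN2, fun x j₀ => ?_⟩
  have hq0 : (0 : ℝ) < q := by exact_mod_cast (by omega : 0 < q)
  obtain ⟨y, hy⟩ := (cp_An (lam := lam) (α := α) (E := E) N 0 0).exists_max
  set f : ℂ → ℂ := fun z => An lam α E N z 0 0 with hf
  set S := ‖f y‖ with hS
  have hS4 : exp (l * (4 * q)) / 4 ≤ S := by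
    refine le_trans (le_of_eq ?_) (hy₁.trans (hy y₁)); rw [← hl]; push_cast; ring_nf
  have hS0 : 0 < S := lt_of_lt_of_le (by positivity) hS4
  set B := 4 * q * κ + log (4 * C) with hB
  have hB1 : 1 ≤ B := hlog.trans (le_add_of_nonneg_left (by positivity))
  have hstrip : ∀ z : ℂ, |z.im| ≤ ε → ‖f z‖ ≤ S * exp B := by
    intro z hz
    refine (norm_entry_le _ _ _).trans ((hgC N z hz).trans ?_)
    have hN : (N : ℝ) ≤ 4 * q := by exact_mod_cast hN1
    calc _ ≤ C * exp ((l + κ) * (4 * q)) := by gcongr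
      _ = exp (l * (4 * q)) / 4 * exp B := by
        rw [hB, exp_add, exp_log (by positivity), show (l + κ) * (4 * q) = l * (4 * q) + 4 * q *
          κ by ring,
          exp_add]; ring
      _ ≤ _ := by gcongr
  obtain ⟨j, hj, n, hn⟩ := hd x y j₀
  refine ⟨j, hj, ?_⟩
  have hlip := norm_sub_le_of_strip (differentiable_An N 0 0) hS0 hB1 hε hy hstrip
    (x + (j₀ + j : ℤ) * α - n) y
  have e1 : f ((x + (j₀ + j : ℤ) * α - n : ℝ)) = f ((x + (j₀ + j : ℤ) * α : ℝ)) :=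
    (cp_An N 0 0).sub_int _ n
  rw [sub_right_comm] at hn
  change ‖f _ - f y‖ ≤ _ at hlip
  rw [e1] at hlip
  have h1 : exp 1 * B / ε * (2 / q) ≤ 1 / 2 := by
    rw [div_mul_div_comm, div_le_iff₀ (by positivity)]
    have h2 : 4 * (2 * 2.72 * log (4 * C)) ≤ q * ε := by
      have h3 : (N₁ : ℝ) ≤ q := by exact_mod_cast (by omega : N₁ ≤ q)
      have := hN₁.trans h3
      rwa [div_le_iff₀ hε] at this
    have h3 : q * κ ≤ q * ε / 100 := by rw [mul_div_assoc]; gcongr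
    have h4 : exp 1 * B ≤ 2.72 * B := by gcongr
    rw [hB] at h4 ⊢
    nlinarith
  have h2 : ‖f ((x + (j₀ + j : ℤ) * α : ℝ)) - f y‖ ≤ S * (1 / 2) := by
    refine hlip.trans ?_
    calc _ ≤ S * exp 1 * B / ε * (2 / q) := by gcongr
      _ = S * (exp 1 * B / ε * (2 / q)) := by ring
      _ ≤ _ := by gcongr
  have h3 := norm_sub_norm_le (f y) (f ((x + (j₀ + j : ℤ) * α : ℝ)))
  rw [norm_sub_rev] at h3
  change _ ≤ ‖f _‖
  rw [← hS] at h3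
  linarith

theorem wronskian_left {x : ℂ} {ψ φ : ℤ → ℂ}
    (h : ∀ n : ℤ, φ n = ψ (n + 1) + ψ (n - 1) + (pot lam (x + n * α) - E) * ψ n) (n : ℕ) :
    An lam α E n x 1 0 * ψ n - An lam α E n x 0 0 * ψ (n - 1) =
      -ψ (-1) + ∑ k ∈ range n, An lam α E k x 0 0 * φ k := by
  induction n with
  | zero => simp [An]
  | succ n ih =>
    have e0 : An lam α E (n + 1) x 0 0 =
        (E - pot lam (x + n * α)) * An lam α E n x 0 0 - An lam α E n x 1 0 := by
      rw [An_succ]; simp [tm, Matrix.mul_apply, Fin.sum_univ_two]; ring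
    have e1 : An lam α E (n + 1) x 1 0 = An lam α E n x 0 0 := by
      rw [An_succ]; simp [tm, Matrix.mul_apply, Fin.sum_univ_two]
    rw [Finset.sum_range_succ, ← add_assoc, ← ih, e0, e1, h n]
    push_cast
    rw [add_sub_cancel_right]
    ring

theorem box_identity {x : ℂ} {ψ φ : ℤ → ℂ} (p r : ℕ)
    (h : ∀ n : ℤ, φ n = ψ (n + 1) + ψ (n - 1) + (pot lam (x + n * α) - E) * ψ n) :
    An lam α E (p + r) x 0 0 * ψ p =
      An lam α E r (-x - (p + r - 1) * α) 1 0 *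
        (ψ (-1) - ∑ k ∈ range p, An lam α E k x 0 0 * φ k) +
      An lam α E p x 0 0 * (ψ (p + r) -
        ∑ k ∈ range r, An lam α E k (-x - (p + r - 1) * α) 0 0 * φ (p + r - 1 - k)) := by
  have hL := wronskian_left h p
  have hR := wronskian_left (lam := lam) (α := α) (E := E) (x := -x - (p + r - 1) * α)
    (ψ := fun k => ψ (p + r - 1 - k)) (φ := fun k => φ (p + r - 1 - k)) (fun n => by
      have e : pot lam (-x - (p + r - 1) * α + n * α) =
          pot lam (x + ((p + r - 1 - n : ℤ) : ℂ) * α) := by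
        rw [← pot_neg]; congr 1; push_cast; ring
      rw [e]
      simp only [h]
      rw [show (p + r - 1 - (n + 1) : ℤ) = p + r - 1 - n - 1 by ring,
        show (p + r - 1 - (n - 1) : ℤ) = p + r - 1 - n + 1 by ring]
      ring) r
  have hT := An_transpose lam α (E := E) r (x + p * α)
  rw [show -(x + p * α) - (r - 1) * α = -x - (p + r - 1) * α by ring] at hT
  have h0 := congrFun (congrFun hT 0) 0
  have h1 := congrFun (congrFun hT 1) 0
  have hN : An lam α E (p + r) x 0 0 = An lam α E r (x + p * α) 0 0 * An lam α E p x 0 0 +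
      An lam α E r (x + p * α) 0 1 * An lam α E p x 1 0 := by
    rw [add_comm, An_add, Matrix.mul_apply, Fin.sum_univ_two]
  simp only [Matrix.transpose_apply] at h0 h1
  rw [hN, h0, h1]
  generalize An lam α E r (-x - (p + r - 1) * α) = Z at hR ⊢
  simp only [show (p + r - 1 - r : ℤ) = p - 1 by ring, show (p + r - 1 - (r - 1) : ℤ) = p by ring,
    show (p + r - 1 - -1 : ℤ) = p + r by ring] at hR
  rw [Matrix.eta_fin_two Z, Matrix.mul_fin_two, Matrix.mul_fin_two]
  simp only [Matrix.of_apply, Matrix.cons_val', Matrix.cons_val_zero, Matrix.cons_val_one,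
    Matrix.cons_val_fin_one]
  linear_combination (-Z 1 0) * hL - An lam α E p x 0 0 * hR

theorem tsum_le_of_window {f g : ℤ → ℝ} {η D : ℝ} (T : Finset ℤ) (hf : Summable f) (hg : Summable g)
    (hf0 : ∀ n, 0 ≤ f n) (hη : η * T.card ≤ 1 / 2)
    (h : ∀ n, f n ≤ η * ∑ j ∈ T, f (n + j) + D * ∑ j ∈ T, g (n + j)) :
    ∑' n, f n ≤ 2 * D * T.card * ∑' n, g n := by
  have key : ∀ {u : ℤ → ℝ}, Summable u → HasSum (fun n => ∑ j ∈ T, u (n + j))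
      (T.card * ∑' n, u n) := by
    intro u hu
    have := hasSum_sum (s := T) (f := fun j n => u (n + j)) (a := fun _ => ∑' n, u n)
      fun j _ => (Equiv.addRight j).hasSum_iff.2 hu.hasSum
    simpa using this
  have := hasSum_le h hf.hasSum (((key hf).mul_left η).add ((key hg).mul_left D))
  have h0 : 0 ≤ ∑' n, f n := tsum_nonneg hf0
  nlinarith

theorem sum_range_le_sum {F : ℤ → ℝ} (hF : ∀ j, 0 ≤ F j) {T : Finset ℤ} {n : ℕ} {e : ℕ → ℤ}
    (he : Function.Injective e) (hT : ∀ k < n, e k ∈ T) :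
    ∑ k ∈ range n, F (e k) ≤ ∑ j ∈ T, F j := by
  rw [← Finset.sum_image (f := F) (g := e) fun a _ b _ h => he h]
  refine Finset.sum_le_sum_of_subset_of_nonneg (fun j hj => ?_) fun j _ _ => hF j
  obtain ⟨k, hk, rfl⟩ := Finset.mem_image.1 hj
  exact hT k (Finset.mem_range.1 hk)

theorem box_bound {x : ℝ} {ψ φ : ℤ → ℂ} {p r q : ℕ} {A : ℝ} (hp : p < 3 * q) (hr : r ≤ 3 * q)
    (hA : ∀ k ≤ 3 * q, ∀ y : ℝ, ‖An lam α E k y‖ ≤ A)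
    (h : ∀ n : ℤ, φ n = ψ (n + 1) + ψ (n - 1) + (pot lam ((x + n * α : ℝ) : ℂ) - E) * ψ n) :
    ‖An lam α E (p + r) x 0 0‖ * ‖ψ p‖ ≤
      2 * A * ∑ j ∈ Finset.Icc (-(4 * q) : ℤ) (4 * q), ‖ψ (p + j)‖ +
      2 * A ^ 2 * ∑ j ∈ Finset.Icc (-(4 * q) : ℤ) (4 * q), ‖φ (p + j)‖ := by
  set T := Finset.Icc (-(4 * q) : ℤ) (4 * q) with hT
  have hA0 : 0 ≤ A := (norm_nonneg _).trans (hA 0 (by omega) 0)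
  have hid := box_identity (lam := lam) (α := α) (E := E) (x := (x : ℂ)) (ψ := ψ) (φ := φ) p r
    fun n => by
    rw [h n]; push_cast; rfl
  have hx : (-(x : ℂ) - (p + r - 1) * α) = ((-x - (p + r - 1) * α : ℝ) : ℂ) := by push_cast; rfl
  rw [hx] at hid
  have hent : ∀ k ≤ 3 * q, ∀ (y : ℝ) (i j : Fin 2), ‖An lam α E k y i j‖ ≤ A := fun k hk y i j =>
    (norm_entry_le _ i j).trans (hA k hk y)
  have hsum : ∀ (n : ℕ) (y : ℝ) (e : ℕ → ℤ), n ≤ 3 * q → Function.Injective e →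
      (∀ k < n, e k - p ∈ T) → ‖∑ k ∈ range n, An lam α E k y 0 0 * φ (e k)‖ ≤
        A * ∑ j ∈ T, ‖φ (p + j)‖ := by
    intro n y e hn he hm
    have h1 := sum_range_le_sum (F := fun j => ‖φ (p + j)‖) (fun _ => norm_nonneg _)
      (e := fun k => e k - p) (fun a b hab => he (sub_left_injective hab)) hm
    simp only [add_sub_cancel] at h1
    refine (norm_sum_le _ _).trans ?_
    refine le_trans ?_ (mul_le_mul_of_nonneg_left h1 hA0)
    rw [mul_sum]
    refine Finset.sum_le_sum fun k hk => ?_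
    rw [norm_mul]
    gcongr
    exact hent k (by have := Finset.mem_range.1 hk; omega) y 0 0
  have hψ : ∀ m : ℤ, m - p ∈ T → ‖ψ m‖ ≤ ∑ j ∈ T, ‖ψ (p + j)‖ := fun m hm => by
    have := Finset.single_le_sum (f := fun j => ‖ψ (p + j)‖) (fun _ _ => norm_nonneg _) hm
    simpa using this
  have s1 := hsum p x (fun k => (k : ℤ)) hp.le Nat.cast_injective fun k hk => by
    rw [hT, Finset.mem_Icc]; omega
  have s2 := hsum r (-x - (p + r - 1) * α) (fun k => (p + r - 1 - k : ℤ)) hr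
    (fun a b hab => by simpa using hab) fun k hk => by rw [hT, Finset.mem_Icc]; omega
  have s3 := hψ (-1) (by rw [hT, Finset.mem_Icc]; omega)
  have s4 := hψ (p + r) (by rw [hT, Finset.mem_Icc]; omega)
  rw [← norm_mul, hid]
  refine (norm_add_le _ _).trans ?_
  rw [norm_mul, norm_mul]
  have e1 := hent r hr (-x - (p + r - 1) * α) 1 0
  have e2 := hent p hp.le x 0 0
  have b1 := mul_le_mul e1 ((norm_sub_le _ _).trans (add_le_add s3 s1)) (norm_nonneg _) hA0
  have b2 := mul_le_mul e2 ((norm_sub_le _ _).trans (add_le_add s4 s2)) (norm_nonneg _) hA0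
  exact (add_le_add b1 b2).trans (le_of_eq (by ring))

theorem exists_tsum_le (hα : Irrational α) (hlam : 0 < lam) (hlam1 : lam ≤ 1) (hE : E.im = 0)
    (hl : 0 < Lyap lam α E 0) : ∃ C, ∀ (x : ℝ) (ψ φ : ℤ → ℂ),
      (∀ n : ℤ, φ n = ψ (n + 1) + ψ (n - 1) + (pot lam ((x + n * α : ℝ) : ℂ) - E) * ψ n) →
      Summable (fun n => ‖ψ n‖ ^ 2) → Summable (fun n => ‖φ n‖ ^ 2) →
      ∑' n, ‖ψ n‖ ^ 2 ≤ C * ∑' n, ‖φ n‖ ^ 2 := by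
  obtain ⟨ε, hε, hL⟩ := exists_strip_Lyap_le hα hlam hlam1 hE hl
  set l := Lyap lam α E 0 with hl'
  set κ := min (l / 8) (ε / 100) with hκ'
  have hκ : 0 < κ := lt_min (by positivity) (by positivity)
  have hκl : κ ≤ l / 8 := min_le_left _ _
  obtain ⟨C, hC1, hC, hlarge⟩ := exists_large hα hε hL hκ (min_le_right _ _)
  obtain ⟨N₀, hN₀⟩ := eventually_atTop.1 ((tendsto_pow_mul_exp hl 2).eventually
    (ge_mem_nhds (show (0 : ℝ) < 1 / (2 * 512 * 81 * C ^ 2) by positivity)))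
  obtain ⟨q, hq, N, hN1, hN2, hN⟩ := hlarge (N₀ + 2)
  have hsmall := hN₀ q (by omega)
  rw [← hl'] at hC hN
  set A := C * exp ((l + κ) * (3 * q)) with hA
  set S := exp (l * (4 * q)) / 8 with hS
  have hS0 : 0 < S := by positivity
  have hA0 : 0 < A := by positivity
  set T := Finset.Icc (-(4 * q) : ℤ) (4 * q) with hT
  have hT1 : (T.card : ℝ) = 8 * q + 1 := by
    rw [hT, Int.card_Icc]
    have : ((4 * q + 1 - -(4 * q) : ℤ).toNat) = 8 * q + 1 := by omega
    rw [this]; push_cast; ring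
  set θ := A / S with hθ
  have hθ0 : 0 < θ := by positivity
  have hθ2 : θ ^ 2 ≤ 64 * C ^ 2 * exp (-(l * q)) := by
    have e1 : θ = 8 * C * exp ((l + κ) * (3 * q) - l * (4 * q)) := by
      rw [hθ, hA, hS, Real.exp_sub]; field_simp
    rw [e1, mul_pow, mul_pow, ← exp_nat_mul]
    norm_num
    gcongr
    nlinarith [(Nat.cast_nonneg q : (0 : ℝ) ≤ q)]
  have hη : (8 * θ ^ 2 * T.card) * T.card ≤ 1 / 2 := by
    have hq1 : (1 : ℝ) ≤ q := by exact_mod_cast (by omega : 1 ≤ q)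
    have h1 : (T.card : ℝ) ≤ 9 * q := by rw [hT1]; linarith
    have hCp : 0 < C := by linarith
    rw [le_div_iff₀ (by positivity)] at hsmall
    calc (8 * θ ^ 2 * T.card) * T.card ≤
        (8 * (64 * C ^ 2 * exp (-(l * q))) * (9 * q)) * (9 * q) := by gcongr
      _ = (q : ℝ) ^ 2 * exp (-(l * q)) * (2 * 512 * 81 * C ^ 2) / 2 := by ring
      _ ≤ 1 / 2 := by gcongr
  refine ⟨2 * (8 * θ ^ 2 * A ^ 2 * T.card) * T.card, fun x ψ φ h hψ hφ => ?_⟩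
  refine tsum_le_of_window T hψ hφ (fun n => by positivity) hη fun n => ?_
  obtain ⟨j, hj, hlow⟩ := hN x (n - (2 * q - 1))
  have hjq := Finset.mem_range.1 hj
  set p := 2 * q - 1 - j with hp
  obtain ⟨r, hr⟩ : ∃ r, N = p + r := ⟨N - p, by omega⟩
  have hnp : ((n - (2 * q - 1) : ℤ) + j : ℤ) = n - p := by omega
  rw [hnp, hr] at hlow
  have hb := box_bound (lam := lam) (α := α) (E := E) (x := x + ((n - p : ℤ) : ℝ) * α)
    (ψ := fun k => ψ (n - p + k)) (φ := fun k => φ (n - p + k)) (p := p) (r := r) (q := q) (A := A)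
    (by omega) (by omega) (fun k hk y => (hC k y).trans (by
      rw [hA]
      have : (k : ℝ) ≤ 3 * q := by exact_mod_cast hk
      gcongr)) fun k => by
      simp only [h]
      rw [add_assoc (n - p : ℤ) k 1, add_sub_assoc (n - p : ℤ) k 1]
      congr 4
      push_cast; ring
  rw [← hT] at hb
  have e1 : ∀ j : ℤ, n - p + (p + j) = n + j := fun j => by ring
  simp only [e1, sub_add_cancel] at hb
  have h2 : ‖ψ n‖ ≤ 2 * θ * ∑ j ∈ T, ‖ψ (n + j)‖ + 2 * θ * A * ∑ j ∈ T, ‖φ (n + j)‖ := by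
    have h3 := (mul_le_mul_of_nonneg_right hlow (norm_nonneg (ψ n))).trans hb
    rw [mul_comm, ← le_div_iff₀ hS0] at h3
    refine h3.trans (le_of_eq ?_)
    rw [hθ]; field_simp
  have cs1 := sq_sum_le_card_mul_sum_sq (s := T) (f := fun j => ‖ψ (n + j)‖)
  have cs2 := sq_sum_le_card_mul_sum_sq (s := T) (f := fun j => ‖φ (n + j)‖)
  calc ‖ψ n‖ ^ 2 ≤ (2 * θ * ∑ j ∈ T, ‖ψ (n + j)‖ + 2 * θ * A * ∑ j ∈ T, ‖φ (n + j)‖) ^ 2 := by gcongr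
    _ ≤ 8 * θ ^ 2 * (∑ j ∈ T, ‖ψ (n + j)‖) ^ 2 + 8 * θ ^ 2 * A ^ 2 * (∑ j ∈ T, ‖φ (n + j)‖) ^ 2 := by
        generalize ∑ j ∈ T, ‖ψ (n + j)‖ = a
        generalize ∑ j ∈ T, ‖φ (n + j)‖ = b
        nlinarith [mul_nonneg (sq_nonneg θ) (sq_nonneg (a - A * b))]
    _ ≤ 8 * θ ^ 2 * (T.card * ∑ j ∈ T, ‖ψ (n + j)‖ ^ 2) +
        8 * θ ^ 2 * A ^ 2 * (T.card * ∑ j ∈ T, ‖φ (n + j)‖ ^ 2) := by gcongr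
    _ = _ := by ring

theorem isUnit_of_bounded_below {V : Type*} [NormedAddCommGroup V] [InnerProductSpace ℂ V]
    [CompleteSpace V]
    {T : V →L[ℂ] V} (hT : IsSelfAdjoint T) {C : ℝ} (hC : ∀ v, ‖v‖ ≤ C * ‖T v‖) : IsUnit T := by
  rw [ContinuousLinearMap.isUnit_iff_bijective,
    ContinuousLinearMap.bijective_iff_dense_range_and_antilipschitz]
  have hb : ∀ v, ‖v‖ ≤ (max C 0).toNNReal * ‖T v‖ := fun v => by
    rw [Real.coe_toNNReal _ (le_max_right _ _)]
    exact (hC v).trans (by gcongr; exact le_max_left _ _)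
  refine ⟨?_, _, T.antilipschitz_of_bound hb⟩
  rw [Submodule.topologicalClosure_eq_top_iff, ContinuousLinearMap.orthogonal_range,
    ← ContinuousLinearMap.star_eq_adjoint, hT.star_eq]
  refine (Submodule.eq_bot_iff _).2 fun v hv => ?_
  have h0 : T v = 0 := hv
  have := hb v
  rw [h0, norm_zero, mul_zero] at this
  exact norm_le_zero_iff.1 this

theorem exists_spectral_splitting {A : Type*} [CStarAlgebra A] {T : A} (hT : IsSelfAdjoint T)
    {δ : ℝ} (hδ : 0 < δ)
    (h : ∀ x ∈ spectrum ℝ T, |x| < δ → x = 0) : ∃ P Q : A, T * P = 0 ∧ P + Q * T = 1 := by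
  have hc : ∀ f : ℝ → ℝ, ContinuousOn f {0}ᶜ → ContinuousOn f (spectrum ℝ T) := by
    intro f hf x hx
    by_cases hx0 : x = 0
    · subst hx0
      have : 𝓝[spectrum ℝ T] (0 : ℝ) ≤ pure 0 := by
        rw [Filter.le_pure_iff, mem_nhdsWithin]
        exact ⟨ball 0 δ, isOpen_ball, Metric.mem_ball_self hδ, fun y hy =>
          h y hy.2 (by simpa using hy.1)⟩
      exact (tendsto_pure_nhds f 0).mono_left this
    · exact (hf.continuousAt (isOpen_compl_singleton.mem_nhds hx0)).continuousWithinAt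
  have hp := hc (fun x => if x = 0 then 1 else 0)
    (continuousOn_const (c := 0) |>.congr fun x hx => if_neg hx)
  have hq := hc (fun x => x⁻¹) (continuousOn_inv₀ (G₀ := ℝ))
  refine ⟨cfc (fun x : ℝ => if x = 0 then 1 else 0) T, cfc (fun x : ℝ => x⁻¹) T, ?_, ?_⟩
  · nth_rewrite 1 [← cfc_id' ℝ T]
    rw [← cfc_mul (fun x : ℝ => x) _ T continuousOn_id hp, ← cfc_zero ℝ T]
    exact cfc_congr fun x _ => by by_cases hx : x = 0 <;> simp [hx]
  · nth_rewrite 3 [← cfc_id' ℝ T]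
    rw [← cfc_mul _ (fun x : ℝ => x) T hq continuousOn_id,
      ← cfc_add T _ (fun x => x⁻¹ * x) hp (hq.mul continuousOn_id),
      ← cfc_one ℝ T]
    exact cfc_congr fun x _ => by by_cases hx : x = 0 <;> simp [hx]

/-- The Hilbert space of square summable two-sided sequences. -/
abbrev Ell2 := lp (fun _ : ℤ => ℂ) 2

/-- The almost Mathieu operator with phase `ω`. -/
def IsAMO (lam α ω : ℝ) (H : Ell2 →L[ℂ] Ell2) : Prop :=
  ∀ (ψ : Ell2) (n : ℤ), H ψ n = ψ (n + 1) + ψ (n - 1) + pot lam ((ω + n * α : ℝ) : ℂ) * ψ n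

theorem Ell2.hasSum_norm_sq (ψ : Ell2) : HasSum (fun n => ‖ψ n‖ ^ 2) (‖ψ‖ ^ 2) := by
  have := lp.hasSum_norm (p := 2) (by norm_num) ψ
  simpa using this

theorem Ell2.tendsto_zero (ψ : Ell2) : Tendsto (fun n => ψ n) cofinite (𝓝 0) := by
  have := (Ell2.hasSum_norm_sq ψ).summable.tendsto_cofinite_zero.sqrt
  rw [Real.sqrt_zero] at this
  refine tendsto_zero_iff_norm_tendsto_zero.2 (this.congr fun n => ?_)
  rw [Real.sqrt_sq (norm_nonneg _)]

theorem Ell2.norm_le {ψ χ : Ell2} {c : ℝ} (hc : 0 ≤ c) (e : ℤ ≃ ℤ)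
    (h : ∀ n, ‖χ n‖ ≤ c * ‖ψ (e n)‖) :
    ‖χ‖ ≤ c * ‖ψ‖ := by
  refine le_of_sq_le_sq ?_ (by positivity)
  rw [mul_pow]
  refine hasSum_le (fun n => ?_) (Ell2.hasSum_norm_sq χ)
    ((e.hasSum_iff.2 (Ell2.hasSum_norm_sq ψ)).mul_left (c ^ 2))
  simp only [comp_apply, ← mul_pow]
  gcongr
  exact h n

theorem Ell2.exists_shift (ψ : Ell2) (k : ℤ) : ∃ φ : Ell2, (∀ n, φ n = ψ (n - k)) ∧ ‖φ‖ = ‖ψ‖ := by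
  have hs := (Equiv.subRight k).hasSum_iff.2 (Ell2.hasSum_norm_sq ψ)
  refine ⟨⟨fun n => ψ (n - k), memℓp_gen ?_⟩, fun n => rfl, ?_⟩
  · simpa [Function.comp_def] using hs.summable
  · refine le_antisymm ?_ ?_
    · simpa using Ell2.norm_le (c := 1) zero_le_one (Equiv.subRight k)
        (χ := ⟨fun n => ψ (n - k), _⟩)
        (ψ := ψ) fun n => by simp
    · simpa using Ell2.norm_le (c := 1) zero_le_one (Equiv.addRight k)
        (ψ := ⟨fun n => ψ (n - k), _⟩)
        (χ := ψ) fun n => by simp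

theorem IsAMO.isSelfAdjoint {ω : ℝ} {H : Ell2 →L[ℂ] Ell2} (hH : IsAMO lam α ω H) :
    IsSelfAdjoint H := by
  rw [ContinuousLinearMap.isSelfAdjoint_iff_isSymmetric]
  intro ψ φ
  obtain ⟨ψp, hψp, -⟩ := Ell2.exists_shift ψ 1
  obtain ⟨φp, hφp, -⟩ := Ell2.exists_shift φ 1
  have h1 := lp.hasSum_inner (𝕜 := ℂ) ψ φp
  have h2 := lp.hasSum_inner (𝕜 := ℂ) ψp φ
  have h3 := (lp.hasSum_inner (𝕜 := ℂ) (H ψ) φ).sub (lp.hasSum_inner (𝕜 := ℂ) ψ (H φ))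
  have h1' := (Equiv.addRight (1 : ℤ)).hasSum_iff.2 h1
  have h2' := (Equiv.addRight (1 : ℤ)).hasSum_iff.2 h2
  have h4 := ((h1'.sub h1).add (h2.sub h2'))
  have h5 := h3.unique (h4.congr_fun fun n => by
    simp only [comp_apply, RCLike.inner_apply, hH ψ n, hH φ n, hψp, hφp, map_add, map_mul, conj_pot,
      Equiv.coe_addRight, add_sub_cancel_right]
    ring)
  rw [sub_self, sub_self, add_zero] at h5
  exact sub_eq_zero.1 h5

theorem mem_spectrum_iff {A : Type*} [Ring A] [Algebra ℂ A] {T : A} {z : ℂ} :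
    z ∈ spectrum ℂ T ↔ ¬IsUnit (T - algebraMap ℂ A z) := by
  rw [spectrum.mem_iff, ← IsUnit.neg_iff, neg_sub]

theorem norm_pot_sub_le (x y : ℝ) (n : ℤ) : ‖pot lam x - pot lam y‖ ≤ 4 * π * |lam| * |x - y - n| := by
  rw [pot_ofReal, pot_ofReal, ← ofReal_sub, norm_real, norm_eq_abs, ← mul_sub, abs_mul,
    abs_mul, abs_two, ← Real.cos_add_int_mul_two_pi (2 * π * y) n]
  have := Real.abs_cos_sub_cos_le (2 * π * x) (2 * π * y + n * (2 * π))
  rw [show 2 * π * x - (2 * π * y + n * (2 * π)) = 2 * π * (x - y - n) by ring, abs_mul,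
    abs_of_pos (by positivity : 0 < 2 * π)] at this
  calc _ ≤ 2 * |lam| * (2 * π * |x - y - n|) := by gcongr
    _ = _ := by ring

theorem IsAMO.eigenvector_unique {ω : ℝ} {H : Ell2 →L[ℂ] Ell2} (hH : IsAMO lam α ω H)
    {z : ℂ} {ψ χ : Ell2}
    (hψ : H ψ = z • ψ) (hχ : H χ = z • χ) (h0 : ψ ≠ 0) : ∃ c : ℂ, χ = c • ψ := by
  have hrec : ∀ f : Ell2, H f = z • f → ∀ n : ℤ, f (n + 1) = (z - pot lam ((ω + n * α : ℝ) : ℂ)) *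
      f n - f (n - 1) := by
    intro f hf n
    have := hH f n
    rw [hf, lp.coeFn_smul, Pi.smul_apply, smul_eq_mul] at this
    linear_combination -this
  have ht : ∀ f : Ell2, Tendsto (fun n => f n) atTop (𝓝 0) := fun f =>
    (Ell2.tendsto_zero f).mono_left (by rw [Int.cofinite_eq]; exact le_sup_right)
  obtain ⟨p, q, hpq, h⟩ := mul_comm_of_recurrence (hrec ψ hψ) (hrec χ hχ) (ht ψ) (ht χ)
  have hq : q ≠ 0 := by
    rintro rfl
    have hp : p ≠ 0 := by simpa using hpq
    refine h0 (lp.ext (funext fun n => ?_))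
    have := h n
    simpa [hp] using this
  refine ⟨-p / q, lp.ext (funext fun n => ?_)⟩
  rw [lp.coeFn_smul, Pi.smul_apply, smul_eq_mul]
  field_simp
  linear_combination h n

theorem IsAMO.exists_mem_spectrum (hα : Irrational α)
    {ω : ℝ} {H : Ell2 →L[ℂ] Ell2} (hH : IsAMO lam α ω H)
    {E₀ : ℝ} (hE₀ : (E₀ : ℂ) ∈ spectrum ℂ H) {δ : ℝ} (hδ : 0 < δ) :
    ∃ x : ℝ, |x - E₀| < δ ∧ x ≠ E₀ ∧ (x : ℂ) ∈ spectrum ℂ H := by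
  by_contra! hno
  set T : Ell2 →L[ℂ] Ell2 := H - algebraMap ℂ _ (E₀ : ℂ) with hT
  have hTv : ∀ f, T f = H f - (E₀ : ℂ) • f := fun f => by
    rw [hT, _root_.sub_apply, ContinuousLinearMap.algebraMap_apply]
  have hTs : IsSelfAdjoint T := hH.isSelfAdjoint.sub (IsSelfAdjoint.algebraMap _ (conj_ofReal E₀))
  obtain ⟨P, Q, hTP, hPQ⟩ := exists_spectral_splitting hTs hδ fun x hx hxδ => by
    by_contra hx0
    refine hno (x + E₀) (by simpa using hxδ) (by simpa using hx0) ?_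
    rw [← spectrum.algebraMap_mem_iff ℂ, mem_spectrum_iff] at hx
    rw [mem_spectrum_iff]
    convert hx using 2
    rw [hT, Complex.ofReal_add, map_add, Complex.coe_algebraMap]
    abel
  have hsplit : ∀ f, P f + Q (T f) = f := fun f => congrArg (fun S : Ell2 →L[ℂ] Ell2 => S f) hPQ
  have hker : ∀ f, H (P f) = (E₀ : ℂ) • P f := fun f => by
    have : T (P f) = 0 := congrArg (fun S : Ell2 →L[ℂ] Ell2 => S f) hTP
    rw [hTv] at this
    exact sub_eq_zero.1 this
  obtain ⟨χ, hχ⟩ : ∃ χ, P χ ≠ 0 := by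
    by_contra! hP
    refine mem_spectrum_iff.1 hE₀ (isUnit_of_bounded_below hTs (C := ‖Q‖) fun v => ?_)
    have := hsplit v
    rw [hP, zero_add] at this
    conv_lhs => rw [← this]
    exact Q.le_opNorm _
  set ψ := P χ with hψ
  have hψE := hker χ
  rw [← hψ] at hψE
  obtain ⟨n₀, hn₀⟩ : ∃ n, ψ n ≠ 0 := by
    by_contra! h
    exact hχ (lp.ext (funext h))
  have hn : 0 < ‖ψ n₀‖ := norm_pos_iff.2 hn₀
  have hψ0 : 0 < ‖ψ‖ := norm_pos_iff.2 hχ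
  have htend : Tendsto (fun k : ℤ => ‖ψ (n₀ - k)‖) atTop (𝓝 0) := by
    have h1 := (Ell2.tendsto_zero ψ).norm
    rw [norm_zero] at h1
    refine h1.comp ?_
    rw [Int.cofinite_eq]
    refine Tendsto.mono_right ?_ le_sup_left
    exact tendsto_atBot_add_const_left _ n₀ tendsto_neg_atTop_atBot
  obtain ⟨K, hK⟩ := eventually_atTop.1 (htend.eventually
    (gt_mem_nhds (show 0 < ‖ψ n₀‖ / 8 by positivity)))
  set R := ‖Q‖ * (4 * π * |lam|) with hR
  have hR0 : 0 ≤ R := by positivity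
  obtain ⟨M, hM⟩ := exists_nat_ge (max (4 * R) (16 * R * ‖ψ‖ / ‖ψ n₀‖))
  obtain ⟨q, hq, hd⟩ := exists_dense_orbit hα M
  obtain ⟨j, -, m, hm⟩ := hd 0 0 K
  rw [zero_add, sub_zero] at hm
  have hq0 : (0 : ℝ) < q := by exact_mod_cast (by omega : 0 < q)
  have hMq : (M : ℝ) ≤ q := by exact_mod_cast hq.le
  have hk := hK (K + j) (by omega)
  generalize (K + j : ℤ) = k at hm hk
  obtain ⟨φ, hφ, hφn⟩ := Ell2.exists_shift ψ k
  obtain ⟨c, hc⟩ := hH.eigenvector_unique hψE (hker φ) hχ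
  have hTφ : ‖T φ‖ ≤ (4 * π * |lam| * |k * α - m|) * ‖ψ‖ := by
    refine Ell2.norm_le (by positivity) (Equiv.subRight k) fun n => ?_
    have h1 := hH ψ (n - k)
    have h2 := hH φ n
    rw [hψE, lp.coeFn_smul, Pi.smul_apply, smul_eq_mul] at h1
    rw [hφ, hφ, hφ, show n + 1 - k = n - k + 1 by ring, show n - 1 - k = n - k - 1 by ring] at h2
    have h3 : T φ n = (pot lam ((ω + n * α : ℝ) : ℂ) - pot lam ((ω + (n - k : ℤ) * α : ℝ) : ℂ)) *
        ψ (n - k) := by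
      rw [hTv, lp.coeFn_sub, Pi.sub_apply, lp.coeFn_smul, Pi.smul_apply, smul_eq_mul, h2, hφ]
      linear_combination -h1
    rw [h3, norm_mul]
    refine mul_le_mul_of_nonneg_right ((norm_pot_sub_le _ _ m).trans (le_of_eq ?_)) (norm_nonneg _)
    push_cast
    congr 2; ring
  have hdiff : ‖φ - c • ψ‖ ≤ R * (2 / q) * ‖ψ‖ := by
    rw [← hc, sub_eq_of_eq_add' (hsplit φ).symm]
    refine (Q.le_opNorm _).trans ?_
    calc _ ≤ ‖Q‖ * ((4 * π * |lam| * (2 / q)) * ‖ψ‖) := by gcongr; exact hTφ.trans (by gcongr)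
      _ = _ := by rw [hR]; ring
  have hR1 : R * (2 / q) ≤ 1 / 2 := by
    have := (le_max_left _ _).trans (hM.trans hMq)
    rw [mul_div_assoc', div_le_iff₀ hq0]; linarith
  have hR2 : R * (2 / q) * ‖ψ‖ ≤ ‖ψ n₀‖ / 8 := by
    have := (le_max_right _ _).trans (hM.trans hMq)
    rw [div_le_iff₀ hn] at this
    rw [mul_div_assoc', div_mul_eq_mul_div, div_le_iff₀ hq0]; linarith
  have hc1 : 1 / 2 ≤ ‖c‖ := by
    have h1 := norm_sub_norm_le φ (c • ψ)
    rw [hφn, norm_smul] at h1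
    have h2 := mul_le_mul_of_nonneg_right hR1 hψ0.le
    refine le_of_mul_le_mul_right ?_ hψ0
    linarith
  have hc2 : ‖c‖ * ‖ψ n₀‖ ≤ ‖ψ n₀‖ / 4 := by
    have h1 := (lp.norm_apply_le_norm (p := 2) (by norm_num) (φ - c • ψ) n₀).trans (hdiff.trans hR2)
    rw [lp.coeFn_sub, Pi.sub_apply, lp.coeFn_smul, Pi.smul_apply, smul_eq_mul, hφ] at h1
    have h2 := norm_sub_norm_le (c * ψ n₀) (ψ (n₀ - k))
    rw [norm_sub_rev, norm_mul] at h2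
    linarith
  nlinarith

theorem sum_sq_le_of_cutoff {d g h : ℤ → ℂ} {B C : ℝ} (hg : ∀ k, ‖g k‖ ≤ B)
    (hrec : ∀ k, h k = g (k + 1) + g (k - 1) + d k * g k)
    (hC : ∀ u v : ℤ → ℂ, (∀ k, v k = u (k + 1) + u (k - 1) + d k * u k) →
      Summable (fun k => ‖u k‖ ^ 2) →
      Summable (fun k => ‖v k‖ ^ 2) → ∑' k, ‖u k‖ ^ 2 ≤ C * ∑' k, ‖v k‖ ^ 2) (N : ℕ) :
    ∑ k ∈ range N, ‖g k‖ ^ 2 ≤ |C| * (2 * ∑ k ∈ range N, ‖h k‖ ^ 2 + 32 * B ^ 2) := by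
  set I := Finset.Ico (0 : ℤ) N with hI
  set Z : Finset ℤ := {-1, 0, (N : ℤ) - 1, (N : ℤ)} with hZ
  have hB0 : 0 ≤ B := (norm_nonneg _).trans (hg 0)
  have hIsum : ∀ F : ℤ → ℝ, ∑ k ∈ I, F k = ∑ k ∈ range N, F k := fun F => by
    refine (Finset.sum_nbij (fun k : ℕ => (k : ℤ)) (fun k hk => ?_)
      (fun a _ b _ h => by simpa using h)
      (fun k hk => ?_) fun k _ => rfl).symm
    · rw [hI, Finset.mem_Ico]; have := Finset.mem_range.1 hk; omega
    · rw [Finset.mem_coe, hI, Finset.mem_Ico] at hk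
      exact ⟨k.toNat, by simpa using (by omega : k.toNat < N), by simp; omega⟩
  set u : ℤ → ℂ := fun k => if k ∈ I then g k else 0 with hu
  set v : ℤ → ℂ := fun k => u (k + 1) + u (k - 1) + d k * u k with hv
  have hone : ∀ F : ℤ → ℝ, ∀ S : Finset ℤ, HasSum (fun k => if k ∈ S then F k else 0)
      (∑ k ∈ S, F k) := fun F S => by
    have : HasSum (fun k => if k ∈ S then F k else 0) _ :=
      hasSum_sum_of_ne_finset_zero (s := S) fun k hk => if_neg hk
    rwa [Finset.sum_congr rfl fun k hk => if_pos hk] at this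
  have hus : HasSum (fun k => ‖u k‖ ^ 2) (∑ k ∈ I, ‖g k‖ ^ 2) := by
    refine (hone (fun k => ‖g k‖ ^ 2) I).congr_fun fun k => ?_
    by_cases hk : k ∈ I <;> simp [hu, hk]
  have hm := ((hone (fun k => ‖h k‖ ^ 2) I).mul_left 2).add (hone (fun _ => 8 * B ^ 2) Z)
  have hle : ∀ k, ‖v k‖ ^ 2 ≤ 2 * (if k ∈ I then ‖h k‖ ^ 2 else 0) +
      (if k ∈ Z then 8 * B ^ 2 else 0) := by
    intro k
    have hsq : ∀ a b c : ℂ, ‖a‖ ≤ B → ‖b‖ ≤ B → ‖c + (a + b)‖ ^ 2 ≤ 2 * ‖c‖ ^ 2 + 8 * B ^ 2 := by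
      intro a b c ha hb
      have h1 : ‖c + (a + b)‖ ≤ ‖c‖ + 2 * B := (norm_add_le _ _).trans (by
        have := norm_add_le a b
        linarith)
      calc _ ≤ (‖c‖ + 2 * B) ^ 2 := by gcongr
        _ ≤ _ := by nlinarith [sq_nonneg (‖c‖ - 2 * B)]
    have huB : ∀ k, ‖u k‖ ≤ B := fun k => by
      by_cases hk : k ∈ I
      · simpa [hu, hk] using hg k
      · simpa [hu, hk] using hB0
    by_cases hk : k ∈ I
    · by_cases hkZ : k ∈ Z
      · have e : v k = h k + ((u (k + 1) - g (k + 1)) + (u (k - 1) - g (k - 1))) := by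
          simp only [hv]; rw [hrec, show u k = g k from if_pos hk]; ring
        have hd : ∀ k, ‖u k - g k‖ ≤ B := fun k => by
          by_cases hk : k ∈ I
          · simpa [hu, hk] using hB0
          · simpa [hu, hk] using hg k
        rw [if_pos hk, if_pos hkZ, e]
        exact hsq _ _ _ (hd _) (hd _)
      · have hp : k + 1 ∈ I ∧ k - 1 ∈ I := by
          simp only [hI, hZ, Finset.mem_Ico, Finset.mem_insert, Finset.mem_singleton,
            not_or] at hk hkZ ⊢
          omega
        have e : v k = h k := by
          simp only [hv, hu]; rw [hrec, if_pos hk, if_pos hp.1, if_pos hp.2]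
        rw [if_pos hk, e]
        have : 0 ≤ (if k ∈ Z then 8 * B ^ 2 else 0 : ℝ) := by split_ifs; positivity
        nlinarith [sq_nonneg ‖h k‖]
    · have h0 : u k = 0 := if_neg hk
      by_cases hkZ : k ∈ Z
      · have := hsq _ _ 0 (huB (k + 1)) (huB (k - 1))
        rw [if_neg hk, if_pos hkZ]
        simpa [hv, h0] using this
      · have hp : k + 1 ∉ I ∧ k - 1 ∉ I := by
          simp only [hI, hZ, Finset.mem_Ico, Finset.mem_insert, Finset.mem_singleton,
            not_or] at hk hkZ ⊢
          omega
        rw [if_neg hk, if_neg hkZ]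
        simp [hv, hu, hk, hp.1, hp.2]
  have hvs : Summable fun k => ‖v k‖ ^ 2 :=
    Summable.of_nonneg_of_le (fun _ => by positivity) hle hm.summable
  have h1 := hC u v (fun _ => rfl) hus.summable hvs
  rw [hus.tsum_eq, hIsum] at h1
  have h2 := hasSum_le hle hvs.hasSum hm
  rw [hIsum] at h2
  have h3 : ∑ k ∈ Z, 8 * B ^ 2 ≤ 32 * B ^ 2 := by
    rw [Finset.sum_const, nsmul_eq_mul]
    have : (Z.card : ℝ) ≤ 4 := by exact_mod_cast Finset.card_le_four
    nlinarith [sq_nonneg B]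
  refine h1.trans ((mul_le_mul_of_nonneg_right (le_abs_self C)
    (tsum_nonneg fun _ => by positivity)).trans ?_)
  gcongr
  exact h2.trans (by linarith)

theorem CP.tendsto_average (hα : Irrational α) {f : ℝ → ℂ} (hf : CP f) :
    Tendsto (fun N : ℕ => (∑ k ∈ range N, ‖f (-(k * α))‖ ^ 2) / N) atTop (𝓝 (∑' k, ‖fc f k‖ ^ 2)) := by
  have hF : CP fun x => ((‖f x‖ ^ 2 : ℝ) : ℂ) :=
    ⟨by have := hf.cont; fun_prop, fun x => by rw [hf.per]⟩
  rw [hf.parseval.tsum_eq, Metric.tendsto_atTop]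
  intro κ hκ
  obtain ⟨C, hC0, hC⟩ := hF.ergodic hα.neg (half_pos hκ)
  obtain ⟨M, hM⟩ := exists_nat_gt (2 * C / κ)
  refine ⟨M + 1, fun N hN => ?_⟩
  have hN0 : (0 : ℝ) < N := by exact_mod_cast (by omega : 0 < N)
  have h1 := hC N 0
  rw [intervalIntegral.integral_ofReal, ← Complex.ofReal_sum, ← Complex.ofReal_natCast,
    ← Complex.ofReal_mul,
    ← ofReal_sub, norm_real, norm_eq_abs] at h1
  simp only [zero_add, mul_neg] at h1
  rw [Real.dist_eq, div_sub' hN0.ne', abs_div, abs_of_pos hN0, div_lt_iff₀ hN0]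
  have : (M : ℝ) ≤ N := by exact_mod_cast (by omega : M ≤ N)
  rw [div_lt_iff₀ hκ] at hM
  nlinarith

/-- The trigonometric series with coefficients `f`. -/
def trig (f : ℤ → ℂ) (x : ℝ) : ℂ := ∑' n : ℤ, f n * ee (n * x)

theorem hasSum_trig {f : ℤ → ℂ} {S : Finset ℤ} (hf : ∀ n ∉ S, f n = 0) (x : ℝ) :
    HasSum (fun n => f n * ee (n * x)) (trig f x) := by
  have : HasSum (fun n => f n * ee (n * x)) _ :=
    hasSum_sum_of_ne_finset_zero (s := S) fun n hn => by rw [hf n hn, zero_mul]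
  exact this.summable.hasSum

theorem trig_eq_sum {f : ℤ → ℂ} {S : Finset ℤ} (hf : ∀ n ∉ S, f n = 0) :
    trig f = fun x : ℝ => ∑ n ∈ S, f n * ee (n * x) :=
  funext fun _ => tsum_eq_sum fun n hn => by rw [hf n hn, zero_mul]

theorem cp_trig {f : ℤ → ℂ} {S : Finset ℤ} (hf : ∀ n ∉ S, f n = 0) : CP (trig f) := by
  rw [trig_eq_sum hf]
  refine ⟨continuous_finsetSum _ fun n _ => continuous_const.mul (CP.char n).cont, fun x => ?_⟩
  exact Finset.sum_congr rfl fun n _ => congrArg (f n * ·) ((CP.char n).per x)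

theorem fc_trig {f : ℤ → ℂ} {S : Finset ℤ} (hf : ∀ n ∉ S, f n = 0) (k : ℤ) : fc (trig f) k = f k := by
  rw [trig_eq_sum hf, fc]
  simp only [mul_sum]
  have hi : ∀ n ∈ S, IntervalIntegrable (fun x : ℝ => ee (-(k * x)) * (f n * ee (n * x))) volume 0
      1 :=
    fun n _ => Continuous.intervalIntegrable (by have := continuous_ee; fun_prop) _ _
  rw [intervalIntegral.integral_finsetSum hi]
  have h1 : ∀ n : ℤ, ∫ x in (0 : ℝ)..1, ee (-(k * x)) * (f n * ee (n * x)) =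
      if n = k then f n else 0 := by
    intro n
    have e : ∀ x : ℝ, ee (-(k * x)) * (f n * ee (n * x)) = f n * ee ((n - k : ℤ) * x) := fun x => by
      rw [mul_left_comm, ← ee_add]; congr 2; push_cast; ring
    simp only [e]
    rw [integral_const_mul]
    split_ifs with h
    · subst h; simp [ee_zero]
    · rw [integral_ee (sub_ne_zero.2 h), mul_zero]
  simp only [h1, Finset.sum_ite_eq']
  split_ifs with h
  · rfl
  · exact (hf k h).symm

theorem trig_dual {f φ : ℤ → ℂ} {S S' : Finset ℤ} (hf : ∀ n ∉ S, f n = 0) (hφ' : ∀ n ∉ S', φ n = 0)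
    {ω : ℝ}
    (hφ : ∀ n : ℤ, φ n = f (n + 1) + f (n - 1) + (pot lam ((ω + n * α : ℝ) : ℂ) - E) * f n)
    (x : ℝ) :
    trig φ x = (2 * cos (2 * π * x) - E) * trig f x +
      lam * (ee ω * trig f (x + α) + ee (-ω) * trig f (x - α)) := by
  have h1 := ((Equiv.addRight (1 : ℤ)).hasSum_iff.2 (hasSum_trig hf x)).mul_left (ee (-x))
  have h2 := ((Equiv.subRight (1 : ℤ)).hasSum_iff.2 (hasSum_trig hf x)).mul_left (ee x)
  have h3 := (hasSum_trig hf x).mul_left (-E)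
  have h4 := (((hasSum_trig hf (x + α)).mul_left (ee ω)).add
    ((hasSum_trig hf (x - α)).mul_left (ee (-ω)))).mul_left
    (lam : ℂ)
  have key := (hasSum_trig hφ' x).unique ((((h1.add h2).add h3).add h4).congr_fun fun n => ?_)
  · rw [key]
    have : 2 * cos (2 * π * x) = ee x + ee (-x) := by
      rw [cos, ee, ee]; ring_nf
    rw [this]; ring
  · have hc : pot lam ((ω + n * α : ℝ) : ℂ) = lam * (ee ω * ee (n * α) + ee (-ω) * ee (-(n * α))) := by
      rw [pot, ← ee_add, ← ee_add, cos, ee, ee]; push_cast; ring_nf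
    have e1 : ee (-x) * ee ((n + 1 : ℤ) * x) = ee (n * x) :=
      by rw [← ee_add]; congr 1; push_cast; ring
    have e2 : ee x * ee ((n - 1 : ℤ) * x) = ee (n * x) := by rw [← ee_add]; congr 1; push_cast; ring
    have e3 : ee (n * (x + α : ℝ)) = ee (n * x) * ee (n * α) :=
      by rw [← ee_add]; congr 1; push_cast; ring
    have e4 : ee (n * (x - α : ℝ)) = ee (n * x) * ee (-(n * α)) :=
      by rw [← ee_add]; congr 1; push_cast; ring
    simp only [comp_apply, Equiv.coe_addRight, Equiv.subRight_apply]
    rw [hφ, hc, e3, e4]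
    linear_combination (-f (n + 1)) * e1 - f (n - 1) * e2

theorem sum_sq_le_of_dual (hα : Irrational α) (hlam : 0 < lam) {f φ : ℤ → ℂ} {S S' : Finset ℤ}
    (hf : ∀ n ∉ S, f n = 0) (hφ' : ∀ n ∉ S', φ n = 0) {ω C : ℝ}
    (hφ : ∀ n : ℤ, φ n = f (n + 1) + f (n - 1) + (pot lam ((ω + n * α : ℝ) : ℂ) - E) * f n)
    (hC : ∀ u v : ℤ → ℂ,
      (∀ n : ℤ, v n = u (n + 1) + u (n - 1) + (pot lam⁻¹ ((0 + n * α : ℝ) : ℂ) - E / lam) * u n) →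
      Summable (fun n => ‖u n‖ ^ 2) → Summable (fun n => ‖v n‖ ^ 2) →
      ∑' n, ‖u n‖ ^ 2 ≤ C * ∑' n, ‖v n‖ ^ 2) :
    ∑' n, ‖f n‖ ^ 2 ≤ |C| * (2 * (lam⁻¹ ^ 2 * ∑' n, ‖φ n‖ ^ 2)) := by
  obtain ⟨B, hB0, hB⟩ := (cp_trig hf).norm_bdd
  have hnorm : ∀ k : ℤ, ‖ee (-(k * ω))‖ = 1 := fun k => by
    rw [show (-(k * ω) : ℂ) = ((-(k * ω) : ℝ) : ℂ) by push_cast; rfl, norm_ee_real]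
  have hcut := sum_sq_le_of_cutoff (d := fun k => pot lam⁻¹ ((0 + k * α : ℝ) : ℂ) - E / lam)
    (g := fun k => ee (-(k * ω)) * trig f (-(k * α)))
      (h := fun k => ee (-(k * ω)) * trig φ (-(k * α)) / lam)
    (B := B) (C := C) (fun k => by rw [norm_mul, hnorm, one_mul]; exact hB _) (fun k => by
      have hlam' : (lam : ℂ) ≠ 0 := by exact_mod_cast hlam.ne'
      have e1 : (-(k * α) + α : ℝ) = -((k - 1 : ℤ) * α) := by push_cast; ring
      have e2 : (-(k * α) - α : ℝ) = -((k + 1 : ℤ) * α) := by push_cast; ring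
      have e3 : ee (-((k + 1 : ℤ) * ω)) = ee (-(k * ω)) * ee (-ω) :=
        by rw [← ee_add]; congr 1; push_cast; ring
      have e4 : ee (-((k - 1 : ℤ) * ω)) = ee (-(k * ω)) * ee ω :=
        by rw [← ee_add]; congr 1; push_cast; ring
      have e5 : pot lam⁻¹ ((0 + k * α : ℝ) : ℂ) = (lam : ℂ)⁻¹ *
          (2 * cos (2 * π * (-(k * α) : ℝ))) := by
        rw [pot, ← Complex.cos_neg]; push_cast; ring_nf
      rw [trig_dual hf hφ' hφ, e1, e2, e3, e4, e5]
      generalize cos _ = c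
      field_simp
      ring) hC
  simp only [norm_mul, norm_div, mul_pow, div_pow, Int.cast_natCast] at hcut
  have hn : ∀ k : ℕ, ‖ee (-(k * ω))‖ = 1 := fun k => by exact_mod_cast hnorm k
  simp only [hn, one_pow, one_mul, norm_real, norm_eq_abs, sq_abs, ← Finset.sum_div] at hcut
  have t1 := (cp_trig hf).tendsto_average hα
  have t2 := (cp_trig hφ').tendsto_average hα
  simp only [fc_trig hf, fc_trig hφ'] at t1 t2
  have t3 : Tendsto (fun N : ℕ => 32 * B ^ 2 / (N : ℝ)) atTop (𝓝 0) :=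
    tendsto_const_nhds.div_atTop tendsto_natCast_atTop_atTop
  have t4 := (((t2.const_mul (lam⁻¹ ^ 2)).const_mul 2).add t3).const_mul |C|
  rw [add_zero] at t4
  refine le_of_tendsto_of_tendsto' t1 t4 fun N => ?_
  refine (div_le_div_of_nonneg_right (hcut N) (Nat.cast_nonneg N)).trans (le_of_eq ?_)
  ring

theorem IsAMO.not_mem_spectrum {ω : ℝ} {H : Ell2 →L[ℂ] Ell2} (hH : IsAMO lam α ω H) {t C : ℝ}
    (h : ∀ ψ, ‖ψ‖ ^ 2 ≤ C * ‖H ψ - (t : ℂ) • ψ‖ ^ 2) : (t : ℂ) ∉ spectrum ℂ H := by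
  rw [mem_spectrum_iff, not_not]
  refine isUnit_of_bounded_below (C := √|C|)
    (hH.isSelfAdjoint.sub (IsSelfAdjoint.algebraMap _ (conj_ofReal t))) fun ψ => ?_
  rw [_root_.sub_apply, ContinuousLinearMap.algebraMap_apply]
  refine le_of_sq_le_sq ?_ (by positivity)
  rw [mul_pow, Real.sq_sqrt (abs_nonneg C)]
  exact (h ψ).trans (by gcongr; exact le_abs_self C)

theorem IsAMO.sub_smul_apply {ω : ℝ} {H : Ell2 →L[ℂ] Ell2} (hH : IsAMO lam α ω H) (z : ℂ) (ψ : Ell2)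
    (n : ℤ) :
    (H ψ - z • ψ) n = ψ (n + 1) + ψ (n - 1) + (pot lam ((ω + n * α : ℝ) : ℂ) - z) * ψ n := by
  rw [lp.coeFn_sub, Pi.sub_apply, lp.coeFn_smul, Pi.smul_apply, smul_eq_mul, hH]
  ring

theorem IsAMO.Lyap_eq_zero (hα : Irrational α) (hlam : 0 < lam) (hlam1 : lam ≤ 1)
    {ω : ℝ} {H : Ell2 →L[ℂ] Ell2}
    (hH : IsAMO lam α ω H) {t : ℝ} (ht : (t : ℂ) ∈ spectrum ℂ H) : Lyap lam α t 0 = 0 := by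
  by_contra hne
  obtain ⟨C, hC⟩ := exists_tsum_le hα hlam hlam1 (ofReal_im t) ((Lyap_nonneg le_rfl).lt_of_ne' hne)
  refine hH.not_mem_spectrum (C := C) (fun ψ => ?_) ht
  rw [← (Ell2.hasSum_norm_sq _).tsum_eq, ← (Ell2.hasSum_norm_sq _).tsum_eq]
  exact hC ω ψ _ (hH.sub_smul_apply t ψ)
    (Ell2.hasSum_norm_sq _).summable (Ell2.hasSum_norm_sq _).summable

theorem IsAMO.Lyap_dual_eq_zero (hα : Irrational α) (hlam : 1 ≤ lam) {ω : ℝ} {H : Ell2 →L[ℂ] Ell2}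
    (hH : IsAMO lam α ω H) {t : ℝ} (ht : (t : ℂ) ∈ spectrum ℂ H) : Lyap lam⁻¹ α (t / lam : ℝ) 0 =
        0 := by
  by_contra hne
  have hlam0 : 0 < lam := by linarith
  obtain ⟨C, hC⟩ := exists_tsum_le hα (inv_pos.2 hlam0) (inv_le_one_of_one_le₀ hlam)
    (ofReal_im (t / lam)) ((Lyap_nonneg le_rfl).lt_of_ne' hne)
  have hC' := hC 0
  simp only [Complex.ofReal_div] at hC'
  refine hH.not_mem_spectrum (C := |C| * (2 * lam⁻¹ ^ 2)) (fun ψ => ?_) ht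
  have hlim := lp.hasSum_single (p := 2) (by norm_num) ψ
  have hcont : Continuous fun χ : Ell2 => |C| * (2 * lam⁻¹ ^ 2) * ‖H χ - (t : ℂ) • χ‖ ^ 2 :=
    by fun_prop
  refine le_of_tendsto_of_tendsto' (((continuous_norm.pow 2).tendsto ψ).comp hlim)
    ((hcont.tendsto ψ).comp hlim) fun s => ?_
  simp only [comp_apply]
  set χ : Ell2 := ∑ i ∈ s, lp.single 2 i (ψ i) with hχ
  have hχ0 : ∀ n ∉ s, χ n = 0 := fun n hn => by
    rw [hχ, lp.coeFn_sum, Finset.sum_apply]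
    refine Finset.sum_eq_zero fun i hi => ?_
    rw [lp.single_apply, Pi.single_eq_of_ne]
    rintro rfl; exact hn hi
  have hφ0 : ∀ n ∉ s ∪ (s.image (· - 1) ∪ s.image (· + 1)), (H χ - (t : ℂ) • χ) n = 0 :=
      fun n hn => by
    simp only [Finset.mem_union, Finset.mem_image, not_or, not_exists, not_and] at hn
    rw [hH.sub_smul_apply, hχ0 n hn.1, hχ0 (n + 1) fun h => hn.2.1 _ h (by ring),
      hχ0 (n - 1) fun h => hn.2.2 _ h (by ring)]
    ring
  have := sum_sq_le_of_dual hα hlam0 hχ0 hφ0 (hH.sub_smul_apply t χ) hC'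
  rw [(Ell2.hasSum_norm_sq _).tsum_eq, (Ell2.hasSum_norm_sq _).tsum_eq] at this
  exact this.trans (le_of_eq (by ring))

theorem IsAMO.interior_spectrum (hα : Irrational α) (hlam : 0 < lam) {ω : ℝ} {H : Ell2 →L[ℂ] Ell2}
    (hH : IsAMO lam α ω H) : interior {t : ℝ | (t : ℂ) ∈ spectrum ℂ H} = ∅ := by
  by_contra hne
  obtain ⟨t₀, ht₀⟩ := nonempty_iff_ne_empty.2 hne
  obtain ⟨δ, hδ, hball⟩ := Metric.mem_nhds_iff.1 (mem_interior_iff_mem_nhds.1 ht₀)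
  have hI : ∀ t ∈ Icc t₀ (t₀ + δ / 2), (t : ℂ) ∈ spectrum ℂ H := fun t ht =>
    hball (by rw [mem_ball, Real.dist_eq, abs_lt]; constructor <;> linarith [ht.1, ht.2])
  rcases le_total lam 1 with h1 | h1
  · obtain ⟨t, ht, hL⟩ := exists_Lyap_ne_zero hα hlam h1 (show t₀ < t₀ + δ / 2 by linarith)
    exact hL (hH.Lyap_eq_zero hα hlam h1 (hI t ht))
  · obtain ⟨t, ht, hL⟩ := exists_Lyap_ne_zero hα (inv_pos.2 hlam) (inv_le_one_of_one_le₀ h1)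
      (div_lt_div_of_pos_right (show t₀ < t₀ + δ / 2 by linarith) hlam)
    refine hL ?_
    have := hH.Lyap_dual_eq_zero hα h1 (t := t * lam) (hI _ ⟨?_, ?_⟩)
    · rwa [mul_div_cancel_right₀ _ hlam.ne'] at this
    · exact (div_le_iff₀ hlam).1 ht.1
    · exact (le_div_iff₀ hlam).1 ht.2

end

end TenMartini

/-- The Ten Martini Problem: for every `λ > 0`, irrational `α`, and `ω ∈ ℝ`, the (real)
spectrum of the almost Mathieu operator
`(Hψ)(n) = ψ(n+1) + ψ(n−1) + 2λ cos(2π(ω + nα))ψ(n)` on `ℓ²(ℤ, ℂ)` is a Cantor set: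
closed, without isolated points, and with empty interior. -/
theorem ten_martini_problem (lam α ω : ℝ) (hlam : 0 < lam) (hα : Irrational α)
    (H : lp (fun _ : ℤ => ℂ) 2 →L[ℂ] lp (fun _ : ℤ => ℂ) 2)
    (hH : ∀ (ψ : lp (fun _ : ℤ => ℂ) 2) (n : ℤ),
      (H ψ) n = ψ (n + 1) + ψ (n - 1) +
        (↑(2 * lam * Real.cos (2 * Real.pi * (ω + n * α))) : ℂ) * ψ n) :
    IsClosed {E : ℝ | (E : ℂ) ∈ spectrum ℂ H} ∧
    (∀ E : ℝ, (E : ℂ) ∈ spectrum ℂ H →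
      E ∈ closure ({x : ℝ | (x : ℂ) ∈ spectrum ℂ H} \ {E})) ∧
    interior {E : ℝ | (E : ℂ) ∈ spectrum ℂ H} = ∅ := by
  have hA : TenMartini.IsAMO lam α ω H := fun ψ n => by rw [hH, TenMartini.pot_ofReal]
  refine ⟨(spectrum.isClosed H).preimage Complex.continuous_ofReal, fun E hE => ?_,
    hA.interior_spectrum hα hlam⟩
  refine Metric.mem_closure_iff.2 fun δ hδ => ?_
  obtain ⟨x, hx, hxE, hxs⟩ := hA.exists_mem_spectrum hα hE hδ
  exact ⟨x, ⟨hxs, hxE⟩, by rwa [dist_comm, Real.dist_eq]⟩
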